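/- Under Assumptions A1–A4, for fixed t ∈ (0,1), 0 ≤ r_2 < r_1 < 1, and λ > 0, as n → ∞, E[ Ω(λ; U_{⌊nt⌋}, Ṽ_{⌊nt⌋}(r_1, r_2), S_n) e^{S_n}; τ(n) = n ] / E[e^{S_n}; τ(n) = n] converges to ⨌ Ω*(λ; u, v, −z) P_z⁺(B⁺ ∈ du) P⁻(V_∞(r_1, r_2) ∈ dv) μ_1(dz), where: ω(λ; u,v,x) := l(v)/(1 + (λ l(u_1) + l(u_2) l(v) e^{x}) κ(u_3)) for u = (u_1,u_2,u_3), Ω is the product of ω over v = (v_1,v_2), ω*(λ; u,v,x) := l(v)/(1 + (λ + l(v) e^{x}) κ(u)), Ω* is the product of ω* over (v_1,v_2); U_{⌊nt⌋} = ((1 − exp(−λ e^{−S_{⌊nt⌋}}))/(λ e^{−S_{⌊nt⌋}}), exp(−λ e^{−S_{⌊nt⌋}}), b_{⌊nt⌋}); Ṽ_{⌊nt⌋}(r) := (1 − f_{⌊nt⌋,n}(r)) e^{S_{⌊nt⌋} − S_n}; V_∞(r) := 1/(B⁻ + (1 − r)^{−1}); and μ_1(dz) = c_{11} e^{−z} u(z)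 1{z ≥ 0} dz. -/

import Mathlib

open MeasureTheory ProbabilityTheory Filter Set Topology

noncomputable section

namespace BPREpaper

variable {Ω : Type*} [MeasurableSpace Ω]

/-- The random walk `S n = X 1 + ... + X n` (increments indexed from `1`, `S 0 = 0`). -/
def walk (X : ℕ → Ω → ℝ) (n : ℕ) (ω : Ω) : ℝ := ∑ i ∈ Finset.Icc 1 n, X i ω

/-- `Mwalk X n = max (S 1, ..., S n)` for `n ≥ 1` (junk value `0` for `n = 0`). -/
def Mwalk (X : ℕ → Ω → ℝ) : ℕ → Ω → ℝ
  | 0, _ => 0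
  | n + 1, ω =>
      (Finset.Icc 1 (n + 1)).sup' (Finset.nonempty_Icc.mpr (by omega)) fun i => walk X i ω

/-- `Lwalk X n = min (S 1, ..., S n)` for `n ≥ 1` (junk value `0` for `n = 0`). -/
def Lwalk (X : ℕ → Ω → ℝ) : ℕ → Ω → ℝ
  | 0, _ => 0
  | n + 1, ω =>
      (Finset.Icc 1 (n + 1)).inf' (Finset.nonempty_Icc.mpr (by omega)) fun i => walk X i ω

/-- minimum of `S 0, S 1, ..., S n`. -/
def minWalk (X : ℕ → Ω → ℝ) (n : ℕ) (ω : Ω) : ℝ :=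
  (Finset.range (n + 1)).inf' (by simp) fun i => walk X i ω

/-- `τ(n)`: the first moment at which the minimum of `S 0, ..., S n` is attained. -/
def tauWalk (X : ℕ → Ω → ℝ) (n : ℕ) (ω : Ω) : ℕ :=
  sInf {i : ℕ | walk X i ω = minWalk X n ω}

/-- The renewal function `u(x) = 1 + ∑_{k ≥ 1} P(-S_k ≤ x, M_k < 0)` for `x ≥ 0`,
`u(x) = 0` for `x < 0`. -/
def uFun (μ : Measure Ω) (X : ℕ → Ω → ℝ) (x : ℝ) : ℝ :=
  if 0 ≤ x then
    1 + ∑' k : ℕ, (μ {ω | -walk X (k + 1) ω ≤ x ∧ Mwalk X (k + 1) ω < 0}).toReal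
  else 0

/-- The renewal function `v(x) = 1 + ∑_{k ≥ 1} P(-S_k > x, L_k ≥ 0)` for `x ≤ 0`,
`v(x) = 0` for `x > 0`. -/
def vFun (μ : Measure Ω) (X : ℕ → Ω → ℝ) (x : ℝ) : ℝ :=
  if x ≤ 0 then
    1 + ∑' k : ℕ, (μ {ω | x < -walk X (k + 1) ω ∧ 0 ≤ Lwalk X (k + 1) ω}).toReal
  else 0

/-- The event `{∀ 1 ≤ i ≤ n, x + S_i ≥ 0} = {L_n ≥ 0}` for the walk started at `x`. -/
def posSet (X : ℕ → Ω → ℝ) (x : ℝ) (n : ℕ) : Set Ω :=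
  {ω | ∀ i ∈ Finset.Icc 1 n, 0 ≤ x + walk X i ω}

/-- The event `{∀ 1 ≤ i ≤ n, x + S_i < 0} = {M_n < 0}` for the walk started at `x`. -/
def negSet (X : ℕ → Ω → ℝ) (x : ℝ) (n : ℕ) : Set Ω :=
  {ω | ∀ i ∈ Finset.Icc 1 n, x + walk X i ω < 0}

/-- A distribution on `ℝ` is non-lattice: it is not concentrated on any arithmetic
progression `a + hℤ`. -/
def NonLattice (ν : Measure ℝ) : Prop :=
  ¬ ∃ a h : ℝ, ν {x | ∃ k : ℤ, x = a + k * h} = 1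

/-- `ν` is an `α`-stable law on `ℝ`. -/
def IsStableLaw (α : ℝ) (ν : Measure ℝ) : Prop :=
  ∀ a b : ℝ, 0 < a → 0 < b → ∃ c d : ℝ, 0 < c ∧ a ^ α + b ^ α = c ^ α ∧
    ((ν.map (fun x => a * x)).prod (ν.map (fun x => b * x))).map (fun p : ℝ × ℝ => p.1 + p.2)
      = ν.map (fun x => c * x + d)

/-- Weak convergence of a sequence of laws on `ℝ`, tested against bounded continuous
functions. -/
def WeakTendsto (μs : ℕ → Measure ℝ) (ν : Measure ℝ) : Prop :=
  ∀ g : BoundedContinuousFunction ℝ ℝ,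
    Tendsto (fun n => ∫ x, g x ∂(μs n)) atTop (𝓝 (∫ x, g x ∂ν))

/-- Assumption A4: there are norming constants `c n → ∞` such that `S n / c n` converges in
distribution to an `α`-stable law concentrated neither on `[0,∞)` nor on `(-∞,0]`; the
increment distribution is non-lattice. -/
def AssumptionA4 (μ : Measure Ω) (X : ℕ → Ω → ℝ) (c : ℕ → ℝ) : Prop :=
  Tendsto c atTop atTop ∧ NonLattice (μ.map (X 1)) ∧
    ∃ (α : ℝ) (ν : Measure ℝ), IsProbabilityMeasure ν ∧ IsStableLaw α ν ∧
      0 < ν (Set.Iio 0) ∧ 0 < ν (Set.Ioi 0) ∧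
      WeakTendsto (fun n => μ.map fun ω => walk X n ω / c n) ν

/-- A family of random elements indexed by `ι` which is i.i.d. (the common distribution
being that of the element with index `i0`). -/
def IIDfam {ι : Type*} {E : Type*} [MeasurableSpace E] (μ : Measure Ω) (Q : ι → Ω → E)
    (i0 : ι) : Prop :=
  (∀ i, Measurable (Q i)) ∧ iIndepFun Q μ ∧
    ∀ i, IdentDistrib (Q i) (Q i0) μ μ

/-- An i.i.d. sequence indexed by `ℕ` (indices from `1` are the relevant ones). -/
def IIDseq {E : Type*} [MeasurableSpace E] (μ : Measure Ω) (Q : ℕ → Ω → E) : Prop :=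
  IIDfam μ Q 1

/-- `P` is the h-transform measure `P_x⁺`: for every `n` and every bounded
`F n`-measurable `g`, `E_P[g] = u(x)⁻¹ E_x[g · u(S_n); L_n ≥ 0]`. -/
def IsPplus (μ : Measure Ω) (X : ℕ → Ω → ℝ) (F : ℕ → MeasurableSpace Ω) (x : ℝ)
    (P : Measure Ω) : Prop :=
  IsProbabilityMeasure P ∧
    ∀ (n : ℕ) (g : Ω → ℝ), Measurable[F n] g → (∃ C, ∀ ω, |g ω| ≤ C) →
      ∫ ω, g ω ∂P =
        (uFun μ X x)⁻¹ * ∫ ω in posSet X x n, g ω * uFun μ X (x + walk X n ω) ∂μ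

/-- `P` is the h-transform measure `P_x⁻`: for every `n` and every bounded
`F n`-measurable `g`, `E_P[g] = v(x)⁻¹ E_x[g · v(S_n); M_n < 0]`. -/
def IsPminus (μ : Measure Ω) (X : ℕ → Ω → ℝ) (F : ℕ → MeasurableSpace Ω) (x : ℝ)
    (P : Measure Ω) : Prop :=
  IsProbabilityMeasure P ∧
    ∀ (n : ℕ) (g : Ω → ℝ), Measurable[F n] g → (∃ C, ∀ ω, |g ω| ≤ C) →
      ∫ ω, g ω ∂P =
        (vFun μ X x)⁻¹ * ∫ ω in negSet X x n, g ω * vFun μ X (x + walk X n ω) ∂μ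

/-- The filtration generated by the environment `Q 1, ..., Q n`. -/
def envFiltration {E : Type*} [MeasurableSpace E] (Q : ℕ → Ω → E) (n : ℕ) :
    MeasurableSpace Ω :=
  ⨆ i ∈ Finset.Icc 1 n, MeasurableSpace.comap (Q i) inferInstance

/-- The σ-algebra generated by the whole environment `Q 1, Q 2, ...`. -/
def envSigma {E : Type*} [MeasurableSpace E] (Q : ℕ → Ω → E) : MeasurableSpace Ω :=
  ⨆ i, MeasurableSpace.comap (Q (i + 1)) inferInstance

/-- Probability generating function of the (random) offspring law `Q n`. -/
def pgf (Q : ℕ → Ω → Measure ℕ) (n : ℕ) (ω : Ω) (s : ℝ) : ℝ :=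
  ∑' i : ℕ, (Q n ω {i}).toReal * s ^ i

/-- Mean `m(Q_n)` of the offspring law `Q n`. -/
def meanQ (Q : ℕ → Ω → Measure ℕ) (n : ℕ) (ω : Ω) : ℝ :=
  ∑' i : ℕ, (i : ℝ) * (Q n ω {i}).toReal

/-- `X_n = log f_n'(1)`, the increments of the associated random walk. -/
def Xenv (Q : ℕ → Ω → Measure ℕ) (n : ℕ) (ω : Ω) : ℝ := Real.log (meanQ Q n ω)

/-- `η_n = f_n''(1) / (2 f_n'(1)^2)`. -/
def etaEnv (Q : ℕ → Ω → Measure ℕ) (n : ℕ) (ω : Ω) : ℝ :=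
  (∑' i : ℕ, ((i : ℝ) * ((i : ℝ) - 1)) * (Q n ω {i}).toReal) / (2 * meanQ Q n ω ^ 2)

/-- The associated random walk `S_n = X_1 + ... + X_n`. -/
def Senv (Q : ℕ → Ω → Measure ℕ) : ℕ → Ω → ℝ := walk (Xenv Q)

/-- The composition `f_{j,n}(s) = f_{j+1}(f_{j+2}(⋯ f_n(s) ⋯))`, with `f_{j,n} = id` for
`n ≤ j`. -/
def pgfComp (Q : ℕ → Ω → Measure ℕ) (j : ℕ) : ℕ → Ω → ℝ → ℝ
  | 0, _, s => s
  | n + 1, ω, s => if n + 1 ≤ j then s else pgfComp Q j n ω (pgf Q (n + 1) ω s)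

/-- `b_n = ∑_{i=0}^{n-1} η_{i+1} e^{-S_i}`. -/
def bEnv (Q : ℕ → Ω → Measure ℕ) (n : ℕ) (ω : Ω) : ℝ :=
  ∑ i ∈ Finset.range n, etaEnv Q (i + 1) ω * Real.exp (-(Senv Q i ω))

/-- `B⁺ = ∑_{i=0}^∞ η_{i+1} e^{-S_i}`. -/
def Bplus (Q : ℕ → Ω → Measure ℕ) (ω : Ω) : ℝ :=
  ∑' i : ℕ, etaEnv Q (i + 1) ω * Real.exp (-(Senv Q i ω))

/-- `B⁻ = ∑_{i=1}^∞ η_i e^{S_i}`. -/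
def Bminus (Q : ℕ → Ω → Measure ℕ) (ω : Ω) : ℝ :=
  ∑' i : ℕ, etaEnv Q (i + 1) ω * Real.exp (Senv Q (i + 1) ω)

/-- `V_∞(r) = 1 / (B⁻ + (1 - r)⁻¹)`. -/
def Vinf (Q : ℕ → Ω → Measure ℕ) (r : ℝ) (ω : Ω) : ℝ := (Bminus Q ω + (1 - r)⁻¹)⁻¹

/-- All the offspring generating functions are fractional linear:
`1/(1 - f_n(s)) = e^{-X_n}/(1-s) + η_n`. -/
def FracLinear (Q : ℕ → Ω → Measure ℕ) : Prop :=
  ∀ n, 1 ≤ n → ∀ ω : Ω, ∀ s : ℝ, 0 ≤ s → s < 1 →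
    (1 - pgf Q n ω s)⁻¹ = Real.exp (-(Xenv Q n ω)) / (1 - s) + etaEnv Q n ω

/-- Assumption A1 with explicit constant `χ`. -/
def AssumptionA1With (μ : Measure Ω) (Q : ℕ → Ω → Measure ℕ) (χ : ℝ) : Prop :=
  0 < χ ∧ χ < 1 / 2 ∧ ∀ n, 1 ≤ n →
    ∀ᵐ ω ∂μ, χ ≤ pgf Q n ω 0 ∧ pgf Q n ω 0 ≤ 1 - χ ∧ χ ≤ etaEnv Q n ω

/-- Assumption A1: for some `χ ∈ (0,1/2)`, `χ ≤ f(0) ≤ 1 - χ` and `η ≥ χ` a.s. -/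
def AssumptionA1 (μ : Measure Ω) (Q : ℕ → Ω → Measure ℕ) : Prop :=
  ∃ χ : ℝ, AssumptionA1With μ Q χ

/-- Assumption A2: `X` has zero mean, finite positive variance and is non-lattice. -/
def AssumptionA2 (μ : Measure Ω) (Q : ℕ → Ω → Measure ℕ) : Prop :=
  Integrable (Xenv Q 1) μ ∧ (∫ ω, Xenv Q 1 ω ∂μ) = 0 ∧
    Integrable (fun ω => Xenv Q 1 ω ^ 2) μ ∧ 0 < ∫ ω, Xenv Q 1 ω ^ 2 ∂μ ∧
    NonLattice (μ.map (Xenv Q 1))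

/-- `ζ(a) = ∑_{y ≥ a} y² Q({y}) / m(Q)²`. -/
def zetaEnv (Q : ℕ → Ω → Measure ℕ) (a : ℕ) (ω : Ω) : ℝ :=
  (∑' y : ℕ, if a ≤ y then (y : ℝ) ^ 2 * (Q 1 ω {y}).toReal else 0) / meanQ Q 1 ω ^ 2

/-- Assumption A3: `E[(log⁺ ζ(a))^{2+ε}] < ∞` for some `ε > 0`, `a ∈ ℕ`. -/
def AssumptionA3 (μ : Measure Ω) (Q : ℕ → Ω → Measure ℕ) : Prop :=
  ∃ ε : ℝ, 0 < ε ∧ ∃ a : ℕ, 1 ≤ a ∧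
    Integrable (fun ω => Real.log (max (zetaEnv Q a ω) 1) ^ (2 + ε)) μ

/-- The extinction moment `T = min {k ≥ 0 : Z_k = 0}`. -/
def extinctTime (Z : ℕ → Ω → ℕ) (ω : Ω) : ℕ := sInf {k | Z k ω = 0}

/-- The branching property of `Z` in the environment `Q` (started from one particle):
given the environment and `Z_k`, the conditional generating function of `Z_n` is
`f_{k,n}(s)^{Z_k}`; the state `0` is absorbing. -/
def BranchingProperty (μ : Measure Ω) (Q : ℕ → Ω → Measure ℕ) (Z : ℕ → Ω → ℕ) : Prop :=
  (∀ ω, Z 0 ω = 1) ∧ (∀ n, Measurable (Z n)) ∧ (∀ n ω, Z n ω = 0 → Z (n + 1) ω = 0) ∧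
    ∀ k n : ℕ, k ≤ n → ∀ s : ℝ, 0 ≤ s → s ≤ 1 →
      (μ[fun ω => s ^ Z n ω | envSigma Q ⊔ MeasurableSpace.comap (Z k) inferInstance])
        =ᵐ[μ] fun ω => pgfComp Q k n ω s ^ Z k ω

/-- `l(y) = y 1{0 ≤ y ≤ 1} + 1{y > 1}`. -/
def lfun (y : ℝ) : ℝ := if y < 0 then 0 else if y ≤ 1 then y else 1

/-- `κ(y) = y 1{y > 0}`. -/
def kappa (y : ℝ) : ℝ := if 0 < y then y else 0

/-- `θ(α,β,λ; u, v, x)` for a triple `u = (u₁,u₂,u₃)`. -/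
def thetaFun (α β lam : ℝ) (u : ℝ × ℝ × ℝ) (v x : ℝ) : ℝ :=
  lfun v / (Real.exp (-x) * α +
    (lam * α * Real.exp (-x) * lfun u.1 + lfun u.2.1 * lfun v) * (β + α * kappa u.2.2))

/-- `θ*(α,β,λ; u, v, x)`, the special case `u = (1,1,u)`. -/
def thetaStar (α β lam u v x : ℝ) : ℝ :=
  lfun v / (α * Real.exp (-x) + (lam * α * Real.exp (-x) + lfun v) * (β + α * kappa u))

/-- `ω(λ; u, v, x)` for a triple `u = (u₁,u₂,u₃)`. -/
def omegaFun (lam : ℝ) (u : ℝ × ℝ × ℝ) (v x : ℝ) : ℝ :=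
  lfun v / (1 + (lam * lfun u.1 + lfun u.2.1 * lfun v * Real.exp x) * kappa u.2.2)

/-- `ω*(λ; u, v, x)`, the special case `u = (1,1,u)`. -/
def omegaStar (lam u v x : ℝ) : ℝ :=
  lfun v / (1 + (lam + lfun v * Real.exp x) * kappa u)

/-- The random vector `U_m = ((1 - e^{-λα e^{-S_m}})/(λα e^{-S_m}), e^{-λα e^{-S_m}}, b_m)`. -/
def Uvec {Ω : Type*} [MeasurableSpace Ω] (Q : ℕ → Ω → Measure ℕ) (α lam : ℝ) (m : ℕ)
    (ω : Ω) : ℝ × ℝ × ℝ :=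
  ((1 - Real.exp (-(lam * α * Real.exp (-(Senv Q m ω))))) /
      (lam * α * Real.exp (-(Senv Q m ω))),
    Real.exp (-(lam * α * Real.exp (-(Senv Q m ω)))), bEnv Q m ω)

/-- `Ṽ_m(r) = (1 - f_{m,n}(r)) e^{S_m - S_n}`. -/
def Vtil {Ω : Type*} [MeasurableSpace Ω] (Q : ℕ → Ω → Measure ℕ) (m n : ℕ) (r : ℝ)
    (ω : Ω) : ℝ :=
  (1 - pgfComp Q m n ω r) * Real.exp (Senv Q m ω - Senv Q n ω)

/-- The weight `n ^ (3/2)`. -/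
def wt (n : ℕ) : ℝ := (n : ℝ) * √(n : ℝ)

lemma wt_nonneg (n : ℕ) : 0 ≤ wt n := by unfold wt; positivity

lemma wt_pos {n : ℕ} (hn : 1 ≤ n) : 0 < wt n := by
  have : (0 : ℝ) < n := by exact_mod_cast hn
  unfold wt; positivity

lemma wt_mono {m n : ℕ} (h : m ≤ n) : wt m ≤ wt n := by
  unfold wt
  have : (m : ℝ) ≤ n := by exact_mod_cast h
  gcongr

lemma summable_inv_wt : Summable fun n => (wt n)⁻¹ := by
  have h := Real.summable_one_div_nat_rpow.mpr (by norm_num : (1 : ℝ) < 3 / 2)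
  refine h.congr fun n => ?_
  rcases Nat.eq_zero_or_pos n with rfl | hn
  · simp [wt]
  · have : (0 : ℝ) < n := by exact_mod_cast hn
    rw [wt, one_div, show (3 / 2 : ℝ) = 1 + 1 / 2 by norm_num, Real.rpow_add this,
      Real.rpow_one, ← Real.sqrt_eq_rpow]

lemma sqrt_le_two_mul {n j : ℕ} (h : 2 * j < n) : √(n : ℝ) ≤ 2 * √((n - j : ℕ) : ℝ) := by
  have h1 : (n : ℝ) ≤ 2 * ((n - j : ℕ) : ℝ) := by
    have : n ≤ 2 * (n - j) := by omega
    exact_mod_cast this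
  calc √(n : ℝ) ≤ √(2 ^ 2 * ((n - j : ℕ) : ℝ)) := Real.sqrt_le_sqrt (by nlinarith)
    _ = _ := by rw [Real.sqrt_mul (by norm_num), Real.sqrt_sq (by norm_num)]

lemma wt_le_four_mul {n j : ℕ} (h : 2 * j < n) : wt n ≤ 4 * wt (n - j) := by
  have h1 : (n : ℝ) ≤ 2 * ((n - j : ℕ) : ℝ) := by
    have : n ≤ 2 * (n - j) := by omega
    exact_mod_cast this
  have h2 := sqrt_le_two_mul h
  unfold wt
  calc _ ≤ (2 * ((n - j : ℕ) : ℝ)) * (2 * √((n - j : ℕ) : ℝ)) := by gcongr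
    _ = _ := by ring

lemma tendsto_sqrt_ratio (j : ℕ) :
    Tendsto (fun n : ℕ => √(n : ℝ) / √((n - j : ℕ) : ℝ)) atTop (𝓝 1) := by
  have h : Tendsto (fun n : ℕ => (n : ℝ) / ((n - j : ℕ) : ℝ)) atTop (𝓝 1) := by
    have h0 : Tendsto (fun n : ℕ => 1 + (j : ℝ) / (((n - j : ℕ)) : ℝ)) atTop (𝓝 (1 + 0)) := by
      refine tendsto_const_nhds.add (tendsto_const_nhds.div_atTop ?_)
      exact tendsto_natCast_atTop_atTop.comp (tendsto_sub_atTop_nat j)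
    rw [add_zero] at h0
    refine h0.congr' ?_
    filter_upwards [eventually_gt_atTop j] with n hn
    have : (0 : ℝ) < ((n - j : ℕ) : ℝ) := by
      have : 0 < n - j := by omega
      exact_mod_cast this
    have e : (n : ℝ) = ((n - j : ℕ) : ℝ) + j := by
      rw [Nat.cast_sub hn.le]; ring
    rw [e]; simp only [Nat.cast_sub hn.le]; rw [Nat.cast_sub hn.le] at this; field_simp
  have := h.sqrt
  rw [Real.sqrt_one] at this
  refine this.congr fun n => ?_
  rw [Real.sqrt_div (Nat.cast_nonneg _)]

lemma tendsto_wt_ratio (j : ℕ) :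
    Tendsto (fun n : ℕ => wt n / wt (n - j)) atTop (𝓝 1) := by
  have h := tendsto_sqrt_ratio j
  have := (h.mul h).mul h
  simp only [mul_one] at this
  refine this.congr fun n => ?_
  unfold wt
  have e1 : (n : ℝ) = √(n : ℝ) * √(n : ℝ) := (Real.mul_self_sqrt (Nat.cast_nonneg _)).symm
  have e2 : ((n - j : ℕ) : ℝ) = √((n - j : ℕ) : ℝ) * √((n - j : ℕ) : ℝ) :=
    (Real.mul_self_sqrt (Nat.cast_nonneg _)).symm
  conv_rhs => rw [e1, e2]
  rw [Real.sqrt_mul_self (Real.sqrt_nonneg _), Real.sqrt_mul_self (Real.sqrt_nonneg _)]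
  ring

lemma tendsto_half_conv {w a b : ℕ → ℝ} {κ c : ℝ} (hw0 : ∀ n, 0 ≤ w n)
    (hw : ∀ n j, 2 * j < n → w n ≤ c * w (n - j))
    (hr : ∀ j, Tendsto (fun n => w n / w (n - j)) atTop (𝓝 1))
    (hwp : ∀ n, 1 ≤ n → 0 < w n)
    (hb : Summable b) (hb0 : ∀ j, 0 ≤ b j)
    (ha : Tendsto (fun n => w n * a n) atTop (𝓝 κ)) :
    Tendsto (fun n => ∑ j ∈ Finset.range n, if 2 * j < n then w n * (a (n - j) * b j) else 0)
      atTop (𝓝 (κ * ∑' j, b j)) := by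
  obtain ⟨C, hC⟩ := ha.abs.bddAbove_range
  have hC' : ∀ n, |w n * a n| ≤ C := fun n => hC ⟨n, rfl⟩
  have hc0 : 0 ≤ c := by
    have h1 := hw 1 0 (by norm_num)
    have h2 := hwp 1 le_rfl
    simp only [Nat.sub_zero] at h1
    by_contra! hc
    nlinarith
  have hC0 : 0 ≤ C := (abs_nonneg _).trans (hC' 0)
  have key : Tendsto (fun n => ∑' j, if 2 * j < n then w n * (a (n - j) * b j) else 0) atTop
      (𝓝 (∑' j, κ * b j)) := by
    refine tendsto_tsum_of_dominated_convergence (bound := fun j => c * C * b j)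
      (hb.mul_left _) ?_ ?_
    · intro j
      have h1 : Tendsto (fun n => (w n / w (n - j)) * (w (n - j) * a (n - j)) * b j) atTop
          (𝓝 (1 * κ * b j)) :=
        ((hr j).mul (ha.comp (tendsto_sub_atTop_nat j))).mul_const _
      rw [one_mul] at h1
      refine h1.congr' ?_
      filter_upwards [eventually_gt_atTop (2 * j)] with n hn
      rw [if_pos hn]
      have := hwp (n - j) (by omega)
      field_simp
    · refine Eventually.of_forall fun n j => ?_
      split_ifs with h
      · rw [Real.norm_eq_abs, abs_mul, abs_mul, abs_of_nonneg (hb0 j), abs_of_nonneg (hw0 n)]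
        have h1 := hC' (n - j)
        rw [abs_mul, abs_of_nonneg (hw0 _)] at h1
        have h2 := hw n j h
        calc w n * (|a (n - j)| * b j) ≤ (c * w (n - j)) * (|a (n - j)| * b j) := by
              gcongr
              exact mul_nonneg (abs_nonneg _) (hb0 j)
          _ = c * (w (n - j) * |a (n - j)|) * b j := by ring
          _ ≤ c * C * b j := by
              gcongr
              exact hb0 j
      · simpa using mul_nonneg (mul_nonneg hc0 hC0) (hb0 j)
  rw [tsum_mul_left] at key
  refine key.congr fun n => ?_
  refine tsum_eq_sum fun j hj => ?_
  rw [if_neg]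
  simp at hj
  omega

lemma sum_inv_sqrt_le (n : ℕ) :
    ∑ j ∈ Finset.range n, (√((n - j : ℕ) : ℝ))⁻¹ ≤ 2 * √(n : ℝ) := by
  have h : ∀ n : ℕ, ∑ j ∈ Finset.range n, (√((j + 1 : ℕ) : ℝ))⁻¹ ≤ 2 * √(n : ℝ) := by
    intro n
    induction n with
    | zero => simp
    | succ n ih =>
      rw [Finset.sum_range_succ]
      have h1 : 0 < √((n + 1 : ℕ) : ℝ) := Real.sqrt_pos.mpr (by positivity)
      have h2 : (√((n + 1 : ℕ) : ℝ)) ^ 2 = n + 1 := by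
        rw [Real.sq_sqrt (by positivity)]; push_cast; ring
      have h3 : (√(n : ℝ)) ^ 2 = n := Real.sq_sqrt (by positivity)
      have h4 : 0 ≤ √(n : ℝ) := Real.sqrt_nonneg _
      have : (√((n + 1 : ℕ) : ℝ))⁻¹ ≤ 2 * √((n + 1 : ℕ) : ℝ) - 2 * √(n : ℝ) := by
        rw [inv_le_iff_one_le_mul₀ h1]
        nlinarith [sq_nonneg (√((n + 1 : ℕ) : ℝ) - √(n : ℝ))]
      linarith
  rw [← Finset.sum_range_reflect]
  refine le_trans (le_of_eq ?_) (h n)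
  refine Finset.sum_congr rfl fun j hj => ?_
  have := Finset.mem_range.mp hj
  congr 4
  omega

section Renewal

variable {a b : ℕ → ℝ} {K : ℝ}

lemma far_conv_le (hb0 : ∀ n, 0 ≤ b n) (ha0 : ∀ n, 0 ≤ a n)
    (ha : ∀ n, 1 ≤ n → a n ≤ K / √(n : ℝ)) {M : ℝ} {n : ℕ} (hn : 1 ≤ n)
    (hM : ∀ j, j < n → wt j * b j ≤ M) :
    √(n : ℝ) * ∑ j ∈ Finset.range n, (if 2 * j < n then 0 else a (n - j) * b j) ≤
      8 * K * M / √(n : ℝ) := by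
  have hn' : (0 : ℝ) < n := by exact_mod_cast hn
  have hs : 0 < √(n : ℝ) := Real.sqrt_pos.mpr hn'
  have hM0 : 0 ≤ M := le_trans (by simp [wt]) (hM 0 (by omega))
  have hK0 : 0 ≤ K := by
    have := (ha0 1).trans (ha 1 le_rfl)
    simpa using this
  have hterm : ∀ j ∈ Finset.range n, (if 2 * j < n then 0 else a (n - j) * b j) ≤
      (4 * K * M / wt n) * (√((n - j : ℕ) : ℝ))⁻¹ := by
    intro j hj
    have hjn := Finset.mem_range.mp hj
    have hwn := wt_pos hn
    split_ifs with h
    · positivity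
    · push Not at h
      have h1 := ha (n - j) (by omega)
      have h2 := hM j hjn
      have hw : wt n ≤ 4 * wt j := by
        rcases Nat.lt_or_ge (2 * (n - j)) n with h' | h'
        · have := wt_le_four_mul h'
          rwa [Nat.sub_sub_self hjn.le] at this
        · have e : n = 2 * j := by omega
          have hj2 : (n : ℝ) = 2 * j := by exact_mod_cast e
          have h3 : √(n : ℝ) ≤ 2 * √(j : ℝ) := by
            calc √(n : ℝ) ≤ √(2 ^ 2 * (j : ℝ)) := Real.sqrt_le_sqrt (by rw [hj2]; nlinarith)
              _ = _ := by rw [Real.sqrt_mul (by norm_num), Real.sqrt_sq (by norm_num)]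
          unfold wt
          rw [hj2] at h3 ⊢
          calc _ ≤ 2 * (j : ℝ) * (2 * √(j : ℝ)) := by gcongr
            _ = _ := by ring
      have hj1 : 1 ≤ j := by omega
      have hwj := wt_pos hj1
      have h4 : b j ≤ 4 * M / wt n := by
        rw [le_div_iff₀ hwn]
        calc b j * wt n ≤ b j * (4 * wt j) := by gcongr; exact hb0 j
          _ = 4 * (wt j * b j) := by ring
          _ ≤ 4 * M := by gcongr
      calc a (n - j) * b j ≤ (K / √((n - j : ℕ) : ℝ)) * (4 * M / wt n) := by
            gcongr
            exact hb0 j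
        _ = _ := by ring
  calc √(n : ℝ) * ∑ j ∈ Finset.range n, (if 2 * j < n then 0 else a (n - j) * b j)
      ≤ √(n : ℝ) * ((4 * K * M / wt n) * (2 * √(n : ℝ))) := by
        gcongr
        refine (Finset.sum_le_sum hterm).trans ?_
        rw [← Finset.mul_sum]
        have hwn := wt_pos hn
        gcongr
        exact sum_inv_sqrt_le n
    _ = 8 * K * M / √(n : ℝ) := by
        unfold wt
        have h2 : (√(n : ℝ)) ^ 2 = n := Real.sq_sqrt hn'.le
        field_simp
        rw [h2]; ring

lemma wt_mul_eq (hrec : ∀ n : ℕ, (n : ℝ) * b n = ∑ j ∈ Finset.range n, a (n - j) * b j) (n : ℕ) :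
    wt n * b n = (∑ j ∈ Finset.range n, if 2 * j < n then √(n : ℝ) * (a (n - j) * b j) else 0) +
      √(n : ℝ) * ∑ j ∈ Finset.range n, (if 2 * j < n then 0 else a (n - j) * b j) := by
  have : wt n * b n = √(n : ℝ) * ((n : ℝ) * b n) := by unfold wt; ring
  rw [this, hrec, Finset.mul_sum, Finset.mul_sum, ← Finset.sum_add_distrib]
  refine Finset.sum_congr rfl fun j _ => ?_
  split_ifs <;> simp

lemma exists_wt_mul_le (hb0 : ∀ n, 0 ≤ b n) (hb1 : ∀ n, b n ≤ 1) (ha0 : ∀ n, 0 ≤ a n)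
    (ha : ∀ n, 1 ≤ n → a n ≤ K / √(n : ℝ))
    (hrec : ∀ n : ℕ, (n : ℝ) * b n = ∑ j ∈ Finset.range n, a (n - j) * b j) :
    ∃ C, ∀ n, wt n * b n ≤ C := by
  have hK0 : 0 ≤ K := by
    have := (ha0 1).trans (ha 1 le_rfl)
    simpa using this
  obtain ⟨J, hJ⟩ : ∃ J : ℕ, 2 * K * ∑' j, (wt (j + J))⁻¹ ≤ 1 / 4 := by
    have := (tendsto_sum_nat_add fun n => (wt n)⁻¹).const_mul (2 * K)
    rw [mul_zero] at this
    exact (this.eventually (eventually_le_nhds (by norm_num : (0 : ℝ) < 1 / 4))).exists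
  obtain ⟨n₀, hn₀⟩ : ∃ n₀ : ℕ, ∀ n ≥ n₀, 8 * K / √(n : ℝ) ≤ 1 / 4 := by
    have h : Tendsto (fun n : ℕ => 8 * K / √(n : ℝ)) atTop (𝓝 0) :=
      tendsto_const_nhds.div_atTop (Real.tendsto_sqrt_atTop.comp tendsto_natCast_atTop_atTop)
    exact eventually_atTop.mp (h.eventually (eventually_le_nhds (by norm_num : (0 : ℝ) < 1 / 4)))
  refine ⟨max (wt n₀) (2 * (2 * K * (J + 1))), fun n => ?_⟩
  set C := max (wt n₀) (2 * (2 * K * (J + 1))) with hCdef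
  have hC0 : 0 ≤ C := (wt_nonneg _).trans (le_max_left _ _)
  induction n using Nat.strong_induction_on with
  | _ n ih =>
    rcases Nat.lt_or_ge n (max n₀ 1) with hlt | hge
    · have : wt n ≤ wt n₀ := by
        apply wt_mono
        rcases lt_max_iff.mp hlt with h | h <;> omega
      calc wt n * b n ≤ wt n * 1 := by gcongr; exacts [wt_nonneg n, hb1 n]
        _ ≤ C := by rw [mul_one]; exact this.trans (le_max_left _ _)
    · have hn1 : 1 ≤ n := (le_max_right _ _).trans hge
      have hn0 : n₀ ≤ n := (le_max_left _ _).trans hge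
      have hs : 0 < √(n : ℝ) := Real.sqrt_pos.mpr (by exact_mod_cast hn1)
      rw [wt_mul_eq hrec]
      have h2 := far_conv_le hb0 ha0 ha hn1 ih
      have h2' : 8 * K * C / √(n : ℝ) ≤ 1 / 4 * C := by
        calc 8 * K * C / √(n : ℝ) = (8 * K / √(n : ℝ)) * C := by ring
          _ ≤ _ := mul_le_mul_of_nonneg_right (hn₀ n hn0) hC0
      have hsum : ∑ j ∈ Finset.range n, b j ≤ (J + 1) + C * ∑' j, (wt (j + J))⁻¹ := by
        have hle : ∀ j ∈ Finset.range n, b j ≤ (if j < J + 1 then 1 else 0) +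
            (if J ≤ j then C * (wt j)⁻¹ else 0) := by
          intro j hj
          have hjn := Finset.mem_range.mp hj
          by_cases h : j < J + 1
          · have : 0 ≤ (if J ≤ j then C * (wt j)⁻¹ else 0) := by
              split_ifs
              · exact mul_nonneg hC0 (inv_nonneg.mpr (wt_nonneg _))
              · exact le_rfl
            simp only [if_pos h]
            linarith [hb1 j]
          · have hj1 : 1 ≤ j := by omega
            simp only [if_neg h, if_pos (by omega : J ≤ j), zero_add]
            have := ih j hjn
            rw [← div_eq_mul_inv, le_div_iff₀ (wt_pos hj1)]
            linarith
        refine (Finset.sum_le_sum hle).trans ?_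
        rw [Finset.sum_add_distrib]
        gcongr
        · rw [← Finset.sum_filter, Finset.sum_const, nsmul_eq_mul, mul_one]
          have : ((Finset.range n).filter (· < J + 1)).card ≤ J + 1 := by
            refine (Finset.card_le_card (t := Finset.range (J + 1)) ?_).trans (by simp)
            intro j hj
            simp at hj ⊢
            omega
          exact_mod_cast this
        · rw [← tsum_mul_left, ← Finset.sum_filter]
          have hsm : Summable fun j => C * (wt (j + J))⁻¹ :=
            ((summable_nat_add_iff J).mpr summable_inv_wt).mul_left C
          have hsub : (Finset.range n).filter (J ≤ ·) ⊆ (Finset.range n).image (· + J) := by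
            intro j hj
            simp at hj ⊢
            exact ⟨j - J, by omega, by omega⟩
          refine (Finset.sum_le_sum_of_subset_of_nonneg hsub fun j _ _ =>
            mul_nonneg hC0 (inv_nonneg.mpr (wt_nonneg _))).trans ?_
          rw [Finset.sum_image (by intro x _ y _ h; simpa using h)]
          exact hsm.sum_le_tsum _ fun j _ => mul_nonneg hC0 (inv_nonneg.mpr (wt_nonneg _))
      have h1 : (∑ j ∈ Finset.range n, if 2 * j < n then √(n : ℝ) * (a (n - j) * b j) else 0) ≤
          2 * K * ∑ j ∈ Finset.range n, b j := by
        rw [Finset.mul_sum]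
        refine Finset.sum_le_sum fun j hj => ?_
        have hjn := Finset.mem_range.mp hj
        split_ifs with h
        · have hp : 0 < √((n - j : ℕ) : ℝ) := Real.sqrt_pos.mpr (by
            have : 0 < n - j := by omega
            exact_mod_cast this)
          calc √(n : ℝ) * (a (n - j) * b j)
              ≤ (2 * √((n - j : ℕ) : ℝ)) * ((K / √((n - j : ℕ) : ℝ)) * b j) := by
                have := hb0 j
                have := ha0 (n - j)
                gcongr
                · exact sqrt_le_two_mul h
                · exact ha _ (by omega)
            _ = 2 * K * b j := by field_simp
        · have := hb0 j
          positivity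
      have h3 : 2 * K * ∑ j ∈ Finset.range n, b j ≤ 2 * K * (J + 1) + 1 / 4 * C := by
        calc 2 * K * ∑ j ∈ Finset.range n, b j
            ≤ 2 * K * ((J + 1) + C * ∑' j, (wt (j + J))⁻¹) := by gcongr
          _ = 2 * K * (J + 1) + (2 * K * ∑' j, (wt (j + J))⁻¹) * C := by ring
          _ ≤ _ := by gcongr
      have h4 : 2 * (2 * K * (J + 1)) ≤ C := le_max_right _ _
      linarith

lemma summable_of_wt_mul_le (hb0 : ∀ n, 0 ≤ b n) {C : ℝ} (hC : ∀ n, wt n * b n ≤ C) :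
    Summable b := by
  rw [← summable_nat_add_iff 1]
  refine Summable.of_nonneg_of_le (fun n => hb0 _) (fun n => ?_)
    (((summable_nat_add_iff 1).mpr summable_inv_wt).mul_left C)
  rw [← div_eq_mul_inv, le_div_iff₀ (wt_pos (by omega)), mul_comm]
  exact hC _

lemma tendsto_wt_mul_of_rec (hb0 : ∀ n, 0 ≤ b n) (hb1 : ∀ n, b n ≤ 1) (ha0 : ∀ n, 0 ≤ a n)
    {κ : ℝ} (ha : Tendsto (fun n : ℕ => √(n : ℝ) * a n) atTop (𝓝 κ))
    (hrec : ∀ n : ℕ, (n : ℝ) * b n = ∑ j ∈ Finset.range n, a (n - j) * b j) :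
    Summable b ∧ Tendsto (fun n => wt n * b n) atTop (𝓝 (κ * ∑' j, b j)) := by
  obtain ⟨K, hK⟩ := ha.bddAbove_range
  have hK' : ∀ n : ℕ, 1 ≤ n → a n ≤ K / √(n : ℝ) := by
    intro n hn
    rw [le_div_iff₀ (Real.sqrt_pos.mpr (by exact_mod_cast hn)), mul_comm]
    exact hK ⟨n, rfl⟩
  obtain ⟨C, hC⟩ := exists_wt_mul_le hb0 hb1 ha0 hK' hrec
  have hsum := summable_of_wt_mul_le hb0 hC
  refine ⟨hsum, ?_⟩
  have h1 := tendsto_half_conv (w := fun n : ℕ => √(n : ℝ)) (c := 2) (fun n => Real.sqrt_nonneg _)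
    (fun n j h => sqrt_le_two_mul h) tendsto_sqrt_ratio
    (fun n hn => Real.sqrt_pos.mpr (by exact_mod_cast hn)) hsum hb0 ha
  have h2 : Tendsto (fun n : ℕ => √(n : ℝ) *
      ∑ j ∈ Finset.range n, (if 2 * j < n then 0 else a (n - j) * b j)) atTop (𝓝 0) := by
    have h3 : Tendsto (fun n : ℕ => 8 * K * C / √(n : ℝ)) atTop (𝓝 0) :=
      tendsto_const_nhds.div_atTop (Real.tendsto_sqrt_atTop.comp tendsto_natCast_atTop_atTop)
    refine squeeze_zero' (Eventually.of_forall fun n => ?_) ?_ h3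
    · refine mul_nonneg (Real.sqrt_nonneg _) (Finset.sum_nonneg fun j _ => ?_)
      split_ifs
      · exact le_rfl
      · exact mul_nonneg (ha0 _) (hb0 _)
    · filter_upwards [eventually_ge_atTop 1] with n hn
      exact far_conv_le hb0 ha0 hK' hn fun j _ => hC j
  have := h1.add h2
  rw [add_zero] at this
  exact this.congr fun n => (wt_mul_eq hrec n).symm

lemma tendsto_wt_conv {x y : ℕ → ℝ} (hx0 : ∀ n, 0 ≤ x n) (hy0 : ∀ n, 0 ≤ y n)
    (hx : Summable x) (hy : Summable y) {α β : ℝ}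
    (hxα : Tendsto (fun n => wt n * x n) atTop (𝓝 α))
    (hyβ : Tendsto (fun n => wt n * y n) atTop (𝓝 β)) :
    Tendsto (fun n => wt n * ∑ j ∈ Finset.range (n + 1), x j * y (n - j)) atTop
      (𝓝 (β * ∑' j, x j + α * ∑' j, y j)) := by
  have h1 := tendsto_half_conv wt_nonneg (fun n j h => wt_le_four_mul h) tendsto_wt_ratio
    (fun n hn => wt_pos hn) hx hx0 hyβ
  have h2 := tendsto_half_conv wt_nonneg (fun n j h => wt_le_four_mul h) tendsto_wt_ratio
    (fun n hn => wt_pos hn) hy hy0 hxα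
  have h3 : Tendsto (fun n => if 2 * (n / 2) = n then wt n * (x (n / 2) * y (n / 2)) else 0) atTop
      (𝓝 0) := by
    have hd : Tendsto (fun n : ℕ => n / 2) atTop atTop := Nat.tendsto_div_const_atTop (by norm_num)
    have h4 : Tendsto (fun n : ℕ => 4 * ((wt (n / 2) * x (n / 2)) * y (n / 2))) atTop (𝓝 0) := by
      have := ((hxα.comp hd).mul (hy.tendsto_atTop_zero.comp hd)).const_mul 4
      simpa using this
    refine squeeze_zero (fun n => ?_) (fun n => ?_) h4
    · split_ifs
      · exact mul_nonneg (wt_nonneg _) (mul_nonneg (hx0 _) (hy0 _))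
      · exact le_rfl
    · split_ifs with h
      · have hw : wt n ≤ 4 * wt (n / 2) := by
          have hj2 : (n : ℝ) = 2 * ((n / 2 : ℕ) : ℝ) := by exact_mod_cast h.symm
          have h3 : √(n : ℝ) ≤ 2 * √((n / 2 : ℕ) : ℝ) := by
            calc √(n : ℝ) ≤ √(2 ^ 2 * ((n / 2 : ℕ) : ℝ)) :=
                  Real.sqrt_le_sqrt (by
                    rw [hj2]; have : (0:ℝ) ≤ ((n / 2 : ℕ) : ℝ) := Nat.cast_nonneg _
                    linarith)
              _ = _ := by rw [Real.sqrt_mul (by norm_num), Real.sqrt_sq (by norm_num)]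
          unfold wt
          calc (n : ℝ) * √(n : ℝ) ≤ 2 * ((n / 2 : ℕ) : ℝ) * (2 * √((n / 2 : ℕ) : ℝ)) := by
                rw [← hj2]
                gcongr
            _ = _ := by ring
        calc wt n * (x (n / 2) * y (n / 2)) ≤ 4 * wt (n / 2) * (x (n / 2) * y (n / 2)) := by
              gcongr
              exact mul_nonneg (hx0 _) (hy0 _)
          _ = _ := by ring
      · exact mul_nonneg (by norm_num) (mul_nonneg (mul_nonneg (wt_nonneg _) (hx0 _)) (hy0 _))
  have := (h1.add h2).add h3
  rw [add_zero] at this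
  refine this.congr' ?_
  filter_upwards [eventually_ge_atTop 1] with n hn
  have e1 : (∑ j ∈ Finset.range n, if 2 * j < n then wt n * (y (n - j) * x j) else 0) =
      ∑ j ∈ Finset.range (n + 1), if 2 * j < n then wt n * (x j * y (n - j)) else 0 := by
    rw [Finset.sum_range_succ, if_neg (by omega), add_zero]
    refine Finset.sum_congr rfl fun j _ => ?_
    rw [mul_comm (y _)]
  have e2 : (∑ j ∈ Finset.range n, if 2 * j < n then wt n * (x (n - j) * y j) else 0) =
      ∑ j ∈ Finset.range (n + 1), if n < 2 * j then wt n * (x j * y (n - j)) else 0 := by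
    rw [← Finset.sum_range_reflect, Finset.sum_range_succ', if_neg (by omega), add_zero]
    refine Finset.sum_congr rfl fun j hj => ?_
    have := Finset.mem_range.mp hj
    have e : n - (n - 1 - j) = j + 1 := by omega
    have e' : n - 1 - j = n - (j + 1) := by omega
    rw [e, e']
    congr 1
    apply propext
    constructor <;> intro h <;> omega
  have e3 : (if 2 * (n / 2) = n then wt n * (x (n / 2) * y (n / 2)) else 0) =
      ∑ j ∈ Finset.range (n + 1), if 2 * j = n then wt n * (x j * y (n - j)) else 0 := by
    split_ifs with h
    · rw [Finset.sum_eq_single (n / 2)]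
      · rw [if_pos h]
        congr 3
        omega
      · intro j _ hj
        rw [if_neg]
        omega
      · intro h'
        simp at h'
        omega
    · symm
      apply Finset.sum_eq_zero
      intro j _
      rw [if_neg]
      intro h'
      apply h
      omega
  rw [e1, e2, e3, ← Finset.sum_add_distrib, ← Finset.sum_add_distrib, Finset.mul_sum]
  refine Finset.sum_congr rfl fun j _ => ?_
  rcases lt_trichotomy (2 * j) n with h | h | h
  · rw [if_pos h, if_neg (by omega), if_neg (by omega)]; ring
  · rw [if_neg (by omega), if_neg (by omega), if_pos h]; ring
  · rw [if_neg (by omega), if_pos h, if_neg (by omega)]; ring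

end Renewal

/-- The tent function, supported on `[-1, 1]`. -/
def tent (θ : ℝ) : ℝ := max 0 (1 - |θ|)

lemma continuous_tent : Continuous tent := by unfold tent; fun_prop

lemma tent_of_one_le {θ : ℝ} (h : 1 ≤ |θ|) : tent θ = 0 := max_eq_left (by linarith)

lemma hasCompactSupport_tent : HasCompactSupport tent :=
  HasCompactSupport.intro (isCompact_Icc (a := (-1 : ℝ)) (b := 1)) fun x hx => by
    apply tent_of_one_le
    by_contra! h
    exact hx ⟨(abs_lt.mp h).1.le, (abs_lt.mp h).2.le⟩

/-- The Fejér kernel. -/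
def fejer (x : ℝ) : ℝ := Real.sinc (x / 2) ^ 2

lemma continuous_fejer : Continuous fejer := by
  unfold fejer; exact (Real.continuous_sinc.comp (by fun_prop)).pow 2

lemma fejer_nonneg (x : ℝ) : 0 ≤ fejer x := sq_nonneg _

lemma fejer_eq {x : ℝ} (hx : x ≠ 0) : fejer x = 2 * (1 - Real.cos x) / x ^ 2 := by
  have h : Real.cos x = 1 - 2 * Real.sin (x / 2) ^ 2 := by
    have h := Real.cos_two_mul (x / 2)
    rw [mul_div_cancel₀ x two_ne_zero] at h
    nlinarith [Real.sin_sq_add_cos_sq (x / 2)]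
  rw [fejer, Real.sinc_of_ne_zero (by simpa using hx), h]
  field_simp
  ring

lemma integral_tent_mul_cos (x : ℝ) : ∫ θ : ℝ, tent θ * Real.cos (x * θ) = fejer x := by
  have h1 : ∀ θ : ℝ, tent θ * Real.cos (x * θ) =
      (fun y => max 0 (1 - y) * Real.cos (x * y)) |θ| := by
    intro θ
    rcases abs_cases θ with ⟨h, _⟩ | ⟨h, _⟩ <;> simp [tent, h]
  rw [integral_congr_ae (ae_of_all _ h1),
    integral_comp_abs (f := fun y => max 0 (1 - y) * Real.cos (x * y))]
  have h2 : ∫ y in Ioi (0 : ℝ), max 0 (1 - y) * Real.cos (x * y) =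
      ∫ y in (0 : ℝ)..1, (1 - y) * Real.cos (x * y) := by
    rw [intervalIntegral.integral_of_le zero_le_one]
    rw [setIntegral_eq_of_subset_of_forall_sdiff_eq_zero measurableSet_Ioi
      (Ioc_subset_Ioi_self : Ioc (0 : ℝ) 1 ⊆ Ioi 0)]
    · refine setIntegral_congr_fun measurableSet_Ioc fun y hy => ?_
      rw [max_eq_right (by linarith [hy.2])]
    · intro y hy
      have : 1 < y := by
        by_contra! h
        exact hy.2 ⟨hy.1, h⟩
      rw [max_eq_left (by linarith), zero_mul]
  rw [h2]
  rcases eq_or_ne x 0 with rfl | hx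
  · simp only [zero_mul, Real.cos_zero, mul_one]
    rw [intervalIntegral.integral_sub (by simp) (by simp)]
    simp [fejer]
    norm_num
  · have hd : ∀ y ∈ uIcc (0 : ℝ) 1, HasDerivAt
        (fun y => (1 - y) * (Real.sin (x * y) / x) - Real.cos (x * y) / x ^ 2)
        ((1 - y) * Real.cos (x * y)) y := by
      intro y _
      have hl : HasDerivAt (fun y : ℝ => x * y) x y := by
        simpa using (hasDerivAt_id y).const_mul x
      have ha := ((hasDerivAt_id y).const_sub 1).mul ((hl.sin).div_const x)
      have hb := (hl.cos).div_const (x ^ 2)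
      refine (ha.sub hb).congr_deriv ?_
      simp only [id]
      field_simp
      ring
    rw [intervalIntegral.integral_eq_sub_of_hasDerivAt hd
      (Continuous.intervalIntegrable (by fun_prop) _ _), fejer_eq hx]
    simp
    field_simp
    ring

lemma integral_tent_mul_sin (x : ℝ) : ∫ θ : ℝ, tent θ * Real.sin (x * θ) = 0 := by
  have h := integral_neg_eq_self (fun θ : ℝ => tent θ * Real.sin (x * θ)) volume
  have h2 : ∀ θ : ℝ, tent (-θ) * Real.sin (x * -θ) = -(tent θ * Real.sin (x * θ)) := by
    intro θ; simp [tent]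
  simp_rw [h2, integral_neg] at h
  linarith

lemma integral_tent_mul_exp (x : ℝ) :
    ∫ θ : ℝ, (tent θ : ℂ) * Complex.exp (x * θ * Complex.I) = fejer x := by
  have h : ∀ θ : ℝ, (tent θ : ℂ) * Complex.exp (x * θ * Complex.I) =
      ((tent θ * Real.cos (x * θ) : ℝ) : ℂ) + ((tent θ * Real.sin (x * θ) : ℝ) : ℂ) *
          Complex.I := by
    intro θ
    rw [Complex.exp_mul_I]
    push_cast
    ring
  simp_rw [h]
  have hi : ∀ f : ℝ → ℝ, Continuous f → Integrable fun θ => ((tent θ * f θ : ℝ) : ℂ) := by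
    intro f hf
    exact ((continuous_tent.mul hf).integrable_of_hasCompactSupport
      hasCompactSupport_tent.mul_right).ofReal
  rw [integral_add (hi _ (by fun_prop)) ((hi _ (by fun_prop)).mul_const _), integral_mul_const]
  have e1 := integral_ofReal (𝕜 := ℂ) (μ := volume) (f := fun θ : ℝ => tent θ * Real.cos (x * θ))
  have e2 := integral_ofReal (𝕜 := ℂ) (μ := volume) (f := fun θ : ℝ => tent θ * Real.sin (x * θ))
  simp only [Complex.coe_algebraMap, RCLike.ofReal] at e1 e2
  erw [e1, e2, integral_tent_mul_cos, integral_tent_mul_sin]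
  simp

lemma fejer_le (x : ℝ) : fejer x ≤ 8 * (1 + x ^ 2)⁻¹ := by
  have h1 : fejer x ≤ 1 := by
    unfold fejer
    rw [sq_le_one_iff_abs_le_one]; exact Real.abs_sinc_le_one _
  rw [← div_eq_mul_inv, le_div_iff₀ (by positivity)]
  have h2 : fejer x * x ^ 2 ≤ 4 := by
    rcases eq_or_ne x 0 with rfl | hx
    · simp
    · rw [fejer_eq hx, div_mul_cancel₀ _ (by positivity)]
      linarith [Real.neg_one_le_cos x]
  nlinarith

lemma integrable_fejer : Integrable fejer := by
  refine (integrable_inv_one_add_sq.const_mul 8).mono'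
    continuous_fejer.aestronglyMeasurable (ae_of_all _ fun x => ?_)
  rw [Real.norm_of_nonneg (fejer_nonneg x)]
  exact fejer_le x

lemma integral_fejer_mul_exp (t : ℝ) :
    ∫ x : ℝ, (fejer x : ℂ) * Complex.exp (t * x * Complex.I) = 2 * Real.pi * tent t := by
  have hpi := Real.pi_pos
  have hc : Continuous fun θ : ℝ => (tent θ : ℂ) := Complex.continuous_ofReal.comp continuous_tent
  have hi : Integrable fun θ : ℝ => (tent θ : ℂ) :=
    (continuous_tent.integrable_of_hasCompactSupport hasCompactSupport_tent).ofReal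
  have hF : FourierTransform.fourier (fun θ : ℝ => (tent θ : ℂ)) =
      fun w : ℝ => (fejer (-2 * Real.pi * w) : ℂ) := by
    ext w
    rw [Real.fourier_real_eq_integral_exp_smul, ← integral_tent_mul_exp]
    congr 1; ext θ
    rw [smul_eq_mul, mul_comm]
    congr 2
    push_cast
    ring
  have hFi : Integrable fun w : ℝ => (fejer (-2 * Real.pi * w) : ℂ) :=
    (integrable_fejer.comp_mul_left' (by nlinarith)).ofReal
  have h := congrFun (hc.fourierInv_fourier_eq hi (hF ▸ hFi)) t
  rw [hF, Real.fourierInv_eq'] at h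
  have h2 := Measure.integral_comp_mul_left
    (fun x : ℝ => (fejer x : ℂ) * Complex.exp (-t * x * Complex.I)) (-2 * Real.pi)
  have h3 : ∫ x : ℝ, (fejer (-2 * Real.pi * x) : ℂ) *
      Complex.exp (-t * (-2 * Real.pi * x : ℝ) * Complex.I) = tent t := by
    rw [← h]
    congr 1; ext x
    rw [smul_eq_mul, mul_comm]
    congr 2
    simp
    ring
  rw [h3] at h2
  have h4 : ∫ x : ℝ, (fejer x : ℂ) * Complex.exp (-t * x * Complex.I) = 2 * Real.pi * tent t := by
    rw [h2, Complex.real_smul, abs_inv, abs_of_neg (by linarith)]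
    push_cast
    rw [← mul_assoc]
    have : (Real.pi : ℂ) ≠ 0 := by exact_mod_cast hpi.ne'
    rw [show (2 * (Real.pi : ℂ)) * (-(-2 * (Real.pi : ℂ)))⁻¹ = 1 by field_simp, one_mul]
  have h5 := integral_neg_eq_self
    (fun x : ℝ => (fejer x : ℂ) * Complex.exp (-t * x * Complex.I)) volume
  rw [h4] at h5
  rw [← h5]
  congr 1; ext x
  have : fejer (-x) = fejer x := by simp [fejer, neg_div]
  rw [this]
  congr 2
  push_cast
  ring

/-- A strictly positive kernel with compactly supported Fourier transform. -/
def posKer (x : ℝ) : ℝ := fejer x + fejer (x + Real.pi)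

/-- The Fourier transform of `posKer`. -/
def posKerHat (θ : ℝ) : ℂ := tent θ * (1 + Complex.exp (Real.pi * θ * Complex.I))

lemma continuous_posKer : Continuous posKer :=
  continuous_fejer.add (continuous_fejer.comp (by fun_prop))

lemma continuous_posKerHat : Continuous posKerHat := by
  have := continuous_tent
  unfold posKerHat
  fun_prop

lemma posKerHat_of_one_le {θ : ℝ} (h : 1 ≤ |θ|) : posKerHat θ = 0 := by
  simp [posKerHat, tent_of_one_le h]

lemma hasCompactSupport_posKerHat : HasCompactSupport posKerHat :=
  HasCompactSupport.intro (isCompact_Icc (a := (-1 : ℝ)) (b := 1)) fun x hx => by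
    apply posKerHat_of_one_le
    by_contra! h
    exact hx ⟨(abs_lt.mp h).1.le, (abs_lt.mp h).2.le⟩

lemma posKerHat_zero : posKerHat 0 = 2 := by
  simp [posKerHat, tent]; norm_num

lemma posKer_ge (x : ℝ) : 1 / (5 + |x|) ^ 2 ≤ posKer x := by
  have hpi := Real.pi_gt_three
  have hpi4 := Real.pi_le_four
  have hx := abs_nonneg x
  have key : ∀ y : ℝ, |y| ≤ 5 + |x| → 4 * Real.sin (y / 2) ^ 2 / (5 + |x|) ^ 2 ≤ fejer y := by
    intro y hy
    rcases eq_or_ne y 0 with rfl | hy0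
    · simp [fejer]
    · rw [fejer, Real.sinc_of_ne_zero (by simpa using hy0), div_pow, div_pow,
        div_div_eq_mul_div, mul_comm]
      norm_num
      refine div_le_div_of_nonneg_left (by positivity) (by positivity) ?_
      rw [← sq_abs y]
      gcongr
  have h1 := key x (by linarith)
  have h2 := key (x + Real.pi) ((abs_add_le _ _).trans (by rw [abs_of_pos Real.pi_pos]; linarith))
  have h3 : Real.sin ((x + Real.pi) / 2) = Real.cos (x / 2) := by
    rw [add_div, Real.sin_add_pi_div_two]
  rw [h3] at h2
  unfold posKer
  refine le_trans ?_ (add_le_add h1 h2)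
  rw [← add_div]
  gcongr
  nlinarith [Real.sin_sq_add_cos_sq (x / 2)]

lemma posKer_pos (x : ℝ) : 0 < posKer x := lt_of_lt_of_le (by positivity) (posKer_ge x)

lemma posKer_le (x : ℝ) : posKer x ≤ 2 := by
  have : ∀ x, fejer x ≤ 1 := by
    intro x
    unfold fejer
    rw [sq_le_one_iff_abs_le_one]; exact Real.abs_sinc_le_one _
  unfold posKer
  linarith [this x, this (x + Real.pi)]

lemma integral_posKerHat_mul_exp (x : ℝ) :
    ∫ θ : ℝ, posKerHat θ * Complex.exp (x * θ * Complex.I) = posKer x := by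
  have hi : ∀ x : ℝ, Integrable fun θ : ℝ => (tent θ : ℂ) * Complex.exp (x * θ * Complex.I) := by
    intro x
    have := continuous_tent
    refine Continuous.integrable_of_hasCompactSupport (by fun_prop) ?_
    exact HasCompactSupport.mul_right (hasCompactSupport_tent.comp_left (g := fun x : ℝ => (x : ℂ))
      (by simp))
  have h : ∀ θ : ℝ, posKerHat θ * Complex.exp (x * θ * Complex.I) =
      (tent θ : ℂ) * Complex.exp (x * θ * Complex.I) +
      (tent θ : ℂ) * Complex.exp ((x + Real.pi : ℝ) * θ * Complex.I) := by
    intro θ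
    have : ((x + Real.pi : ℝ) : ℂ) * θ * Complex.I = Real.pi * θ * Complex.I +
        x * θ * Complex.I := by
      push_cast; ring
    rw [this, Complex.exp_add, posKerHat]
    ring
  simp_rw [h]
  rw [integral_add (hi _) (hi _), integral_tent_mul_exp, integral_tent_mul_exp]
  simp [posKer]

lemma integral_posKer_mul_exp (t : ℝ) :
    ∫ x : ℝ, (posKer x : ℂ) * Complex.exp (t * x * Complex.I) = 2 * Real.pi * posKerHat (-t) := by
  have hi : Integrable fun x : ℝ => (fejer x : ℂ) * Complex.exp (t * x * Complex.I) := by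
    refine integrable_fejer.ofReal.mul_bdd (c := 1) (by fun_prop) (ae_of_all _ fun x => ?_)
    rw [← Complex.ofReal_mul, Complex.norm_exp_ofReal_mul_I]
  have h : ∀ x : ℝ, (posKer x : ℂ) * Complex.exp (t * x * Complex.I) =
      (fejer x : ℂ) * Complex.exp (t * x * Complex.I) +
      Complex.exp (-(t * Real.pi) * Complex.I) * ((fejer (x + Real.pi) : ℂ) *
        Complex.exp (t * (x + Real.pi : ℝ) * Complex.I)) := by
    intro x
    have : (t : ℂ) * x * Complex.I = -(t * Real.pi) * Complex.I +
      t * (x + Real.pi : ℝ) * Complex.I := by push_cast; ring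
    rw [posKer, this, Complex.exp_add]
    push_cast
    ring
  simp_rw [h]
  have hi2 := hi.comp_add_right Real.pi
  have e := integral_add_right_eq_self (μ := volume)
    (fun x : ℝ => (fejer x : ℂ) * Complex.exp (t * x * Complex.I)) Real.pi
  rw [integral_add hi (hi2.const_mul _), integral_const_mul, e, integral_fejer_mul_exp, posKerHat]
  have : tent (-t) = tent t := by simp [tent]
  rw [this]
  have : (Real.pi : ℂ) * ((-t : ℝ) : ℂ) * Complex.I = -(t * Real.pi) * Complex.I := by
    push_cast; ring
  rw [this]
  ring

lemma exists_norm_charFun_le {ρ : Measure ℝ} [IsProbabilityMeasure ρ]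
    (h0 : ∫ x, x ∂ρ = 0) (h1 : ∫ x, x ^ 2 ∂ρ = 1)
    (hlat : ∀ θ : ℝ, θ ≠ 0 → ‖charFun ρ θ‖ < 1) (A : ℝ) :
    ∃ c : ℝ, 0 < c ∧ ∀ s : ℝ, |s| ≤ A → ‖charFun ρ s‖ ≤ Real.exp (-(c * s ^ 2)) := by
  have ht := taylor_charFun_two (P := ρ) (X := id) aemeasurable_id (by simpa using h0)
    (by simpa using h1)
  rw [Measure.map_id] at ht
  have hev := ht.bound (show (0 : ℝ) < 1 / 4 by norm_num)
  obtain ⟨δ, hδ, hδ'⟩ := Metric.eventually_nhds_iff.mp hev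
  set δ' := min (δ / 2) 1 with hδ'def
  have hδ'0 : 0 < δ' := by positivity
  have hnear : ∀ s : ℝ, |s| ≤ δ' → ‖charFun ρ s‖ ≤ Real.exp (-(1 / 4 * s ^ 2)) := by
    intro s hs
    have hs1 : |s| ≤ 1 := hs.trans (min_le_right _ _)
    have hb := hδ' (show dist s 0 < δ by
      rw [Real.dist_eq, sub_zero]
      linarith [hs.trans (min_le_left _ _)])
    have hs2 : s ^ 2 ≤ 1 := by rw [← sq_abs]; nlinarith [abs_nonneg s]
    have hn : ‖(1 - (s : ℂ) ^ 2 / 2)‖ = 1 - s ^ 2 / 2 := by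
      have : (1 - (s : ℂ) ^ 2 / 2) = ((1 - s ^ 2 / 2 : ℝ) : ℂ) := by push_cast; ring
      rw [this, Complex.norm_real, Real.norm_of_nonneg (by linarith)]
    have h2 : ‖charFun ρ s‖ ≤ ‖charFun ρ s - (1 - (s : ℂ) ^ 2 / 2)‖ + ‖(1 - (s : ℂ) ^ 2 / 2)‖ := by
      have := norm_add_le (charFun ρ s - (1 - (s : ℂ) ^ 2 / 2)) (1 - (s : ℂ) ^ 2 / 2)
      rwa [sub_add_cancel] at this
    rw [hn] at h2
    rw [Real.norm_of_nonneg (sq_nonneg s)] at hb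
    have h3 := Real.add_one_le_exp (-(1 / 4 * s ^ 2))
    linarith
  have hcont : Continuous fun s => ‖charFun ρ s‖ := continuous_charFun.norm
  have hK : IsCompact (Icc (-A) A \ Ioo (-δ') δ') := isCompact_Icc.diff isOpen_Ioo
  obtain ⟨q, hq1, hq0, hq⟩ : ∃ q : ℝ, q < 1 ∧ 0 < q ∧
      ∀ s ∈ Icc (-A) A \ Ioo (-δ') δ', ‖charFun ρ s‖ ≤ q := by
    rcases (Icc (-A) A \ Ioo (-δ') δ').eq_empty_or_nonempty with he | hne
    · exact ⟨1 / 2, by norm_num, by norm_num, by simp [he]⟩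
    · obtain ⟨s₀, hs₀, hmax⟩ := hK.exists_isMaxOn hne hcont.continuousOn
      have hs0 : s₀ ≠ 0 := by
        rintro rfl
        exact hs₀.2 ⟨by linarith, hδ'0⟩
      refine ⟨max ‖charFun ρ s₀‖ (1 / 2), max_lt (hlat _ hs0) (by norm_num),
        lt_max_of_lt_right (by norm_num), fun s hs => (hmax hs).trans (le_max_left _ _)⟩
  have hlq : 0 < -Real.log q := by linarith [Real.log_neg hq0 hq1]
  refine ⟨min (1 / 4) (-Real.log q / (A ^ 2 + 1)), by positivity, fun s hs => ?_⟩
  by_cases h : |s| ≤ δ'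
  · refine (hnear s h).trans (Real.exp_le_exp.mpr ?_)
    have := mul_le_mul_of_nonneg_right (min_le_left (1 / 4) (-Real.log q / (A ^ 2 + 1)))
        (sq_nonneg s)
    linarith
  · push Not at h
    have hm : s ∈ Icc (-A) A \ Ioo (-δ') δ' :=
      ⟨⟨(abs_le.mp hs).1, (abs_le.mp hs).2⟩, fun hc => absurd (abs_lt.mpr hc) (not_lt.mpr h.le)⟩
    refine (hq s hm).trans ?_
    rw [← Real.exp_log hq0]
    refine Real.exp_le_exp.mpr ?_
    rw [Real.exp_log hq0]
    have h1 := mul_le_mul_of_nonneg_right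
      (min_le_right (1 / 4) (-Real.log q / (A ^ 2 + 1))) (sq_nonneg s)
    have hsA : s ^ 2 ≤ A ^ 2 + 1 := by
      rw [← sq_abs]; nlinarith [abs_nonneg s]
    have h2 : -Real.log q / (A ^ 2 + 1) * s ^ 2 ≤ -Real.log q := by
      rw [div_mul_eq_mul_div, div_le_iff₀ (by positivity)]
      gcongr
    linarith

/-- Local limit theorem on the Fourier side. -/
lemma tendsto_sqrt_mul_integral_charFun_pow {ρ : Measure ℝ} [IsProbabilityMeasure ρ]
    (h0 : ∫ x, x ∂ρ = 0) (h1 : ∫ x, x ^ 2 ∂ρ = 1)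
    (hlat : ∀ θ : ℝ, θ ≠ 0 → ‖charFun ρ θ‖ < 1) {G : ℝ → ℂ} (hG : Continuous G)
    (hGs : HasCompactSupport G) :
    Tendsto (fun n : ℕ => (√(n : ℝ) : ℂ) * ∫ s, G s * charFun ρ s ^ n) atTop
      (𝓝 (G 0 * (√(2 * Real.pi) : ℝ))) := by
  obtain ⟨A, hA⟩ : ∃ A : ℝ, ∀ s, G s ≠ 0 → |s| ≤ A := by
    obtain ⟨A, hA⟩ := hGs.isBounded.exists_norm_le
    exact ⟨A, fun s hs => by simpa using hA s (subset_tsupport _ hs)⟩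
  obtain ⟨c, hc, hcb⟩ := exists_norm_charFun_le h0 h1 hlat A
  obtain ⟨K, hK⟩ := hG.bounded_above_of_compact_support hGs
  have hlim : Tendsto (fun n : ℕ => ∫ x : ℝ, G ((√(n : ℝ))⁻¹ * x) *
      charFun ρ ((√(n : ℝ))⁻¹ * x) ^ n) atTop
      (𝓝 (∫ x : ℝ, G 0 * (Real.exp (-(1 / 2) * x ^ 2) : ℝ))) := by
    refine tendsto_integral_filter_of_dominated_convergence
      (fun x => K * Real.exp (-c * x ^ 2)) (Eventually.of_forall fun n => ?_)
      ((eventually_gt_atTop 0).mono fun n hn => ?_)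
      ((integrable_exp_neg_mul_sq hc).const_mul K) (ae_of_all _ fun x => ?_)
    · have : Continuous (charFun ρ) := continuous_charFun
      exact (by fun_prop : Continuous _).aestronglyMeasurable
    · refine ae_of_all _ fun x => ?_
      rw [norm_mul, norm_pow]
      have hK0 : 0 ≤ K := (norm_nonneg _).trans (hK 0)
      by_cases hz : G ((√(n : ℝ))⁻¹ * x) = 0
      · rw [hz, norm_zero, zero_mul]; positivity
      · have hs := hcb _ (hA _ hz)
        gcongr
        · exact hK _
        · calc _ ≤ Real.exp (-(c * ((√(n : ℝ))⁻¹ * x) ^ 2)) ^ n := by gcongr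
            _ = _ := by
              rw [← Real.exp_nat_mul, mul_pow, inv_pow, Real.sq_sqrt (by positivity)]
              congr 1
              field_simp
    · refine Tendsto.mul ?_ ?_
      · have : Tendsto (fun n : ℕ => (√(n : ℝ))⁻¹ * x) atTop (𝓝 (0 * x)) :=
          (tendsto_inv_atTop_zero.comp
            (Real.tendsto_sqrt_atTop.comp tendsto_natCast_atTop_atTop)).mul_const x
        rw [zero_mul] at this
        exact (hG.tendsto 0).comp this
      · have := tendsto_charFun_inv_sqrt_mul_pow (P := ρ) (X := id) aemeasurable_id
          (by simpa using h0) (by simpa using h1) x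
        rw [Measure.map_id] at this
        convert this using 2
        push_cast
        ring_nf
  have e : ∫ x : ℝ, G 0 * (Real.exp (-(1 / 2) * x ^ 2) : ℝ) = G 0 * (√(2 * Real.pi) : ℝ) := by
    rw [integral_const_mul]
    congr 1
    have := integral_gaussian (1 / 2)
    rw [show Real.pi / (1 / 2) = 2 * Real.pi by ring] at this
    rw [← this]
    exact integral_ofReal
  rw [e] at hlim
  refine hlim.congr' ?_
  filter_upwards [eventually_gt_atTop 0] with n hn
  rw [Measure.integral_comp_mul_left (fun s => G s * charFun ρ s ^ n), inv_inv,
    abs_of_nonneg (Real.sqrt_nonneg _), Complex.real_smul]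

section measure

/-- Convolution powers of a measure on the line. -/
def cpow (ρ : Measure ℝ) : ℕ → Measure ℝ
  | 0 => Measure.dirac 0
  | n + 1 => Measure.conv (cpow ρ n) ρ

instance isProbabilityMeasure_cpow (ρ : Measure ℝ) [IsProbabilityMeasure ρ] (n : ℕ) :
    IsProbabilityMeasure (cpow ρ n) := by
  induction n with
  | zero => unfold cpow; infer_instance
  | succ n ih => unfold cpow; infer_instance

lemma charFun_cpow (ρ : Measure ℝ) [IsProbabilityMeasure ρ] (n : ℕ) (t : ℝ) :
    charFun (cpow ρ n) t = charFun ρ t ^ n := by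
  induction n with
  | zero => simp [cpow]
  | succ n ih => rw [cpow, charFun_conv, ih, pow_succ]

lemma integral_posKer_mul_exp_measure (ν : Measure ℝ) [IsProbabilityMeasure ν] (t : ℝ) :
    ∫ x, (posKer x : ℂ) * Complex.exp (t * x * Complex.I) ∂ν =
      ∫ s, posKerHat (s - t) * charFun ν s := by
  have h1 : ∀ x : ℝ, (posKer x : ℂ) * Complex.exp (t * x * Complex.I) =
      ∫ θ : ℝ, posKerHat θ * Complex.exp (((θ + t : ℝ) : ℂ) * x * Complex.I) := by
    intro x
    rw [← integral_posKerHat_mul_exp, ← integral_mul_const]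
    congr 1; ext θ
    rw [mul_assoc, ← Complex.exp_add]
    congr 2
    push_cast; ring
  simp_rw [h1]
  have hmeas : Continuous fun p : ℝ × ℝ =>
      posKerHat p.2 * Complex.exp (((p.2 + t : ℝ) : ℂ) * p.1 * Complex.I) := by
    have := continuous_posKerHat
    fun_prop
  have hInt : Integrable (fun p : ℝ × ℝ =>
      posKerHat p.2 * Complex.exp (((p.2 + t : ℝ) : ℂ) * p.1 * Complex.I)) (ν.prod volume) := by
    have h2 : Integrable posKerHat := continuous_posKerHat.integrable_of_hasCompactSupport
      hasCompactSupport_posKerHat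
    refine (h2.comp_snd ν).mono hmeas.aestronglyMeasurable (ae_of_all _ fun p => ?_)
    rw [norm_mul, ← Complex.ofReal_mul, Complex.norm_exp_ofReal_mul_I, mul_one]
  rw [integral_integral_swap hInt]
  rw [← integral_sub_right_eq_self (fun s => ∫ x, posKerHat s *
    Complex.exp (((s + t : ℝ) : ℂ) * x * Complex.I) ∂ν) t]
  congr 1; ext s
  rw [integral_const_mul, charFun_apply_real]
  simp

variable {ρ : Measure ℝ} [IsProbabilityMeasure ρ]

lemma tendsto_sqrt_mul_integral_posKer_exp
    (h0 : ∫ x, x ∂ρ = 0) (h1 : ∫ x, x ^ 2 ∂ρ = 1)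
    (hlat : ∀ θ : ℝ, θ ≠ 0 → ‖charFun ρ θ‖ < 1) (t : ℝ) :
    Tendsto (fun n : ℕ => (√(n : ℝ) : ℂ) *
      ∫ x, (posKer x : ℂ) * Complex.exp (t * x * Complex.I) ∂(cpow ρ n)) atTop
      (𝓝 (posKerHat (-t) * (√(2 * Real.pi) : ℝ))) := by
  simp_rw [integral_posKer_mul_exp_measure, charFun_cpow]
  have := tendsto_sqrt_mul_integral_charFun_pow h0 h1 hlat
    (G := fun s => posKerHat (s - t)) (continuous_posKerHat.comp (by fun_prop))
    (hasCompactSupport_posKerHat.comp_homeomorph (Homeomorph.subRight t))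
  simpa using this

lemma integral_posKer_pos (ν : Measure ℝ) [IsProbabilityMeasure ν] : 0 < ∫ x, posKer x ∂ν := by
  have hi : Integrable posKer ν := Integrable.of_bound continuous_posKer.aestronglyMeasurable 2
    (ae_of_all _ fun x => by rw [Real.norm_of_nonneg (posKer_pos x).le]; exact posKer_le x)
  rw [integral_pos_iff_support_of_nonneg (fun x => (posKer_pos x).le) hi]
  have : Function.support posKer = univ := by
    ext x; simp [(posKer_pos x).ne']
  rw [this]; simp

/-- The probability measure proportional to `posKer` times `ν`. -/
def tiltPos (ν : Measure ℝ) : Measure ℝ :=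
  ν.withDensity fun x => ENNReal.ofReal (posKer x / ∫ y, posKer y ∂ν)

lemma integral_tiltPos {E : Type*} [NormedAddCommGroup E] [NormedSpace ℝ E]
    (ν : Measure ℝ) (hν : 0 < ∫ x, posKer x ∂ν) (f : ℝ → E) :
    ∫ x, f x ∂(tiltPos ν) = (∫ y, posKer y ∂ν)⁻¹ • ∫ x, posKer x • f x ∂ν := by
  have hm : Measurable posKer := continuous_posKer.measurable
  rw [tiltPos, integral_withDensity_eq_integral_toReal_smul (by fun_prop) (by simp),
    ← integral_smul]
  congr 1; ext x
  rw [ENNReal.toReal_ofReal (div_nonneg (posKer_pos x).le hν.le), smul_smul]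
  congr 1; ring

lemma isProbabilityMeasure_tiltPos (ν : Measure ℝ) (hν : 0 < ∫ x, posKer x ∂ν) :
    IsProbabilityMeasure (tiltPos ν) := by
  have hi : Integrable posKer ν := by
    by_contra h; rw [integral_undef h] at hν; exact hν.ne rfl
  constructor
  rw [tiltPos, withDensity_apply _ MeasurableSet.univ, Measure.restrict_univ,
    ← ofReal_integral_eq_lintegral_ofReal (hi.div_const _)
      (ae_of_all _ fun x => div_nonneg (posKer_pos x).le hν.le), integral_div, div_self hν.ne']
  simp

lemma integral_posKer : ∫ x, posKer x = 4 * Real.pi := by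
  have h := integral_posKer_mul_exp 0
  simp only [Complex.ofReal_zero, zero_mul, Complex.exp_zero, mul_one, neg_zero,
    posKerHat_zero] at h
  have h3 : ((∫ x, posKer x : ℝ) : ℂ) = ((4 * Real.pi : ℝ) : ℂ) := by
    rw [← integral_complex_ofReal, h]
    push_cast; ring
  exact_mod_cast h3

lemma tendsto_sqrt_mul_integral_posKer
    (h0 : ∫ x, x ∂ρ = 0) (h1 : ∫ x, x ^ 2 ∂ρ = 1)
    (hlat : ∀ θ : ℝ, θ ≠ 0 → ‖charFun ρ θ‖ < 1) :
    Tendsto (fun n : ℕ => √(n : ℝ) * ∫ x, posKer x ∂(cpow ρ n)) atTop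
      (𝓝 (2 * √(2 * Real.pi))) := by
  have h := tendsto_sqrt_mul_integral_posKer_exp h0 h1 hlat 0
  have h2 := (Complex.continuous_re.tendsto _).comp h
  convert h2 using 2
  · simp only [Function.comp, Complex.ofReal_zero, zero_mul, Complex.exp_zero, mul_one]
    rw [Complex.re_ofReal_mul]
    congr 1
    have := integral_ofReal (𝕜 := ℂ) (μ := cpow ρ ‹ℕ›) (f := posKer)
    erw [this]
    simp
  · rw [neg_zero, posKerHat_zero]
    simp

lemma tendsto_integral_tiltPos
    (h0 : ∫ x, x ∂ρ = 0) (h1 : ∫ x, x ^ 2 ∂ρ = 1)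
    (hlat : ∀ θ : ℝ, θ ≠ 0 → ‖charFun ρ θ‖ < 1) (f : BoundedContinuousFunction ℝ ℝ) :
    Tendsto (fun n : ℕ => ∫ x, f x ∂(tiltPos (cpow ρ n))) atTop
      (𝓝 (∫ x, f x ∂(tiltPos volume))) := by
  have hv : 0 < ∫ x, posKer x := by rw [integral_posKer]; positivity
  let P : ℕ → ProbabilityMeasure ℝ := fun n =>
    ⟨tiltPos (cpow ρ n), isProbabilityMeasure_tiltPos _ (integral_posKer_pos _)⟩
  let P0 : ProbabilityMeasure ℝ := ⟨tiltPos volume, isProbabilityMeasure_tiltPos _ hv⟩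
  have key : Tendsto P atTop (𝓝 P0) := by
    rw [ProbabilityMeasure.tendsto_iff_tendsto_charFun]
    intro t
    have e1 : ∀ ν : Measure ℝ, (0 < ∫ x, posKer x ∂ν) → charFun (tiltPos ν) t =
        ((∫ y, posKer y ∂ν : ℝ) : ℂ)⁻¹ *
          ∫ x, (posKer x : ℂ) * Complex.exp (t * x * Complex.I) ∂ν := by
      intro ν hν
      rw [charFun_apply_real, integral_tiltPos ν hν]
      simp only [Complex.real_smul, Complex.ofReal_inv]
    change Tendsto (fun n => charFun (tiltPos (cpow ρ n)) t) atTop (𝓝 (charFun (tiltPos volume) t))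
    rw [e1 volume hv]
    simp_rw [e1 _ (integral_posKer_pos (cpow ρ _))]
    rw [integral_posKer, integral_posKer_mul_exp]
    have hA := tendsto_sqrt_mul_integral_posKer_exp h0 h1 hlat t
    have hB := (Complex.continuous_ofReal.tendsto _).comp
      (tendsto_sqrt_mul_integral_posKer h0 h1 hlat)
    have hne : ((2 * √(2 * Real.pi) : ℝ) : ℂ) ≠ 0 := by
      have : 0 < √(2 * Real.pi) := by positivity
      exact_mod_cast (by positivity : 2 * √(2 * Real.pi) ≠ 0)
    have hC := hA.div hB hne
    have hlim : posKerHat (-t) * (√(2 * Real.pi) : ℝ) / ((2 * √(2 * Real.pi) : ℝ) : ℂ) =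
        ((4 * Real.pi : ℝ) : ℂ)⁻¹ * (2 * Real.pi * posKerHat (-t)) := by
      have h1 : (√(2 * Real.pi) : ℂ) ≠ 0 := by
        have : 0 < √(2 * Real.pi) := by positivity
        exact_mod_cast this.ne'
      have h2 : (Real.pi : ℂ) ≠ 0 := by exact_mod_cast Real.pi_ne_zero
      push_cast
      field_simp
      norm_num
    rw [hlim] at hC
    refine hC.congr' ?_
    filter_upwards [eventually_gt_atTop 0] with n hn
    have hs : (√(n : ℝ) : ℂ) ≠ 0 := by
      have : 0 < √(n : ℝ) := Real.sqrt_pos.mpr (by exact_mod_cast hn)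
      exact_mod_cast this.ne'
    simp only [Pi.div_apply, Function.comp, Complex.ofReal_mul]
    rw [mul_div_mul_left _ _ hs, div_eq_inv_mul]
  exact (ProbabilityMeasure.tendsto_iff_forall_integral_tendsto.mp key) f

/-- Local limit theorem for continuous functions with quadratic decay. -/
lemma tendsto_sqrt_mul_integral_of_continuous
    (h0 : ∫ x, x ∂ρ = 0) (h1 : ∫ x, x ^ 2 ∂ρ = 1)
    (hlat : ∀ θ : ℝ, θ ≠ 0 → ‖charFun ρ θ‖ < 1) {h : ℝ → ℝ} (hc : Continuous h) {C : ℝ}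
    (hC : ∀ x, |h x| * (5 + |x|) ^ 2 ≤ C) :
    Tendsto (fun n : ℕ => √(n : ℝ) * ∫ x, h x ∂(cpow ρ n)) atTop
      (𝓝 ((√(2 * Real.pi))⁻¹ * ∫ x, h x)) := by
  have hv : 0 < ∫ x, posKer x := by rw [integral_posKer]; positivity
  let f : BoundedContinuousFunction ℝ ℝ := BoundedContinuousFunction.ofNormedAddCommGroup
    (fun x => h x / posKer x) (hc.div continuous_posKer fun x => (posKer_pos x).ne') C
    (fun x => by
      rw [norm_div, Real.norm_of_nonneg (posKer_pos x).le, div_le_iff₀ (posKer_pos x)]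
      have hC0 : 0 ≤ C := le_trans (by positivity) (hC x)
      have h2 := mul_le_mul_of_nonneg_left (posKer_ge x) hC0
      refine le_trans ?_ h2
      rw [mul_one_div, le_div_iff₀ (by positivity)]
      exact hC x)
  have hf := tendsto_integral_tiltPos h0 h1 hlat f
  have e : ∀ ν : Measure ℝ, (0 < ∫ x, posKer x ∂ν) → ∫ x, f x ∂(tiltPos ν) =
      (∫ x, posKer x ∂ν)⁻¹ * ∫ x, h x ∂ν := by
    intro ν hν
    rw [integral_tiltPos ν hν, smul_eq_mul]
    congr 2; ext x
    change posKer x • (h x / posKer x) = h x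
    rw [smul_eq_mul, mul_div_cancel₀ _ (posKer_pos x).ne']
  rw [e volume hv] at hf
  simp_rw [e _ (integral_posKer_pos (cpow ρ _))] at hf
  have hm := (tendsto_sqrt_mul_integral_posKer h0 h1 hlat).mul hf
  rw [integral_posKer] at hm
  have hlim : 2 * √(2 * Real.pi) * ((4 * Real.pi)⁻¹ * ∫ x, h x) =
      (√(2 * Real.pi))⁻¹ * ∫ x, h x := by
    have h1 : 0 < √(2 * Real.pi) := by positivity
    have h2 : √(2 * Real.pi) * √(2 * Real.pi) = 2 * Real.pi :=
      Real.mul_self_sqrt (by positivity)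
    rw [← mul_assoc]
    congr 1
    rw [← mul_eq_one_iff_eq_inv₀ h1.ne']
    calc _ = 2 * (√(2 * Real.pi) * √(2 * Real.pi)) / (4 * Real.pi) := by ring
      _ = 1 := by rw [h2]; field_simp; norm_num
  rw [hlim] at hm
  refine hm.congr fun n => ?_
  have := (integral_posKer_pos (cpow ρ n)).ne'
  field_simp

end measure

section walkkernel

/-- The two-sided exponential. -/
def expAbs (u x : ℝ) : ℝ := Real.exp (-(u * |x|))

lemma continuous_expAbs (u : ℝ) : Continuous (expAbs u) := by unfold expAbs; fun_prop

lemma expAbs_nonneg (u x : ℝ) : 0 ≤ expAbs u x := (Real.exp_pos _).le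

lemma expAbs_le_one {u : ℝ} (hu : 0 < u) (x : ℝ) : expAbs u x ≤ 1 := by
  unfold expAbs
  rw [Real.exp_le_one_iff]
  have := abs_nonneg x
  nlinarith

lemma expAbs_mul_sq_le {u : ℝ} (hu : 0 < u) (x : ℝ) :
    expAbs u x * (5 + |x|) ^ 2 ≤ 50 + 4 / u ^ 2 := by
  have hx := abs_nonneg x
  have h := Real.quadratic_le_exp_of_nonneg (mul_nonneg hu.le hx)
  unfold expAbs
  rw [Real.exp_neg, inv_mul_le_iff₀ (Real.exp_pos _)]
  have h1 : 1 ≤ Real.exp (u * |x|) := by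
    rw [Real.one_le_exp_iff]; positivity
  have h2 : |x| ^ 2 ≤ 2 / u ^ 2 * Real.exp (u * |x|) := by
    rw [div_mul_eq_mul_div, le_div_iff₀ (by positivity)]
    nlinarith [mul_nonneg hu.le hx]
  have h3 : 4 / u ^ 2 = 2 * (2 / u ^ 2) := by ring
  rw [mul_add, h3]
  nlinarith [sq_nonneg (|x| - 5)]

lemma integral_expAbs_Iio {u : ℝ} (hu : 0 < u) : ∫ x in Iio (0 : ℝ), expAbs u x = 1 / u := by
  rw [← integral_Iic_eq_integral_Iio]
  have h : ∫ x in Iic (0 : ℝ), expAbs u x = ∫ x in Iic (0 : ℝ), Real.exp (u * x) := by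
    refine setIntegral_congr_fun measurableSet_Iic fun x hx => ?_
    rw [expAbs, abs_of_nonpos hx]; simp
  rw [h, integral_exp_mul_Iic hu]
  simp

lemma integral_expAbs_Ici {u : ℝ} (hu : 0 < u) : ∫ x in Ici (0 : ℝ), expAbs u x = 1 / u := by
  have h := integral_comp_neg_Iic (0 : ℝ) (expAbs u)
  rw [neg_zero] at h
  rw [integral_Ici_eq_integral_Ioi, ← h, ← integral_expAbs_Iio hu, integral_Iic_eq_integral_Iio]
  simp [expAbs]

lemma integrable_expAbs {u : ℝ} (hu : 0 < u) : Integrable (expAbs u) := by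
  have h1 : IntegrableOn (expAbs u) (Iio 0) := by
    by_contra h
    have := integral_expAbs_Iio hu
    rw [integral_undef h] at this
    exact (one_div_pos.mpr hu).ne this
  have h2 : IntegrableOn (expAbs u) (Ici 0) := by
    by_contra h
    have := integral_expAbs_Ici hu
    rw [integral_undef h] at this
    exact (one_div_pos.mpr hu).ne this
  rw [← integrableOn_univ, ← Iio_union_Ici (a := (0 : ℝ))]
  exact h1.union h2

/-- A continuous approximation of the indicator of the negative half-line. -/
def ramp (δ x : ℝ) : ℝ := max 0 (min 1 (-x / δ))

lemma continuous_ramp (δ : ℝ) : Continuous (ramp δ) := by unfold ramp; fun_prop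

lemma ramp_nonneg (δ x : ℝ) : 0 ≤ ramp δ x := le_max_left _ _

lemma ramp_le_one (δ x : ℝ) : ramp δ x ≤ 1 := max_le zero_le_one (min_le_left _ _)

lemma ramp_of_nonneg {δ x : ℝ} (hδ : 0 < δ) (hx : 0 ≤ x) : ramp δ x = 0 := by
  have : -x / δ ≤ 0 := div_nonpos_of_nonpos_of_nonneg (by linarith) hδ.le
  exact max_eq_left ((min_le_right _ _).trans this)

lemma ramp_of_le {δ x : ℝ} (hδ : 0 < δ) (hx : x ≤ -δ) : ramp δ x = 1 := by
  have : 1 ≤ -x / δ := by rw [le_div_iff₀ hδ]; linarith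
  unfold ramp
  rw [min_eq_left this]; simp

variable {ρ : Measure ℝ} [IsProbabilityMeasure ρ]

lemma tendsto_sqrt_mul_integral_Iio
    (h0 : ∫ x, x ∂ρ = 0) (h1 : ∫ x, x ^ 2 ∂ρ = 1)
    (hlat : ∀ θ : ℝ, θ ≠ 0 → ‖charFun ρ θ‖ < 1) {u : ℝ} (hu : 0 < u) :
    Tendsto (fun n : ℕ => √(n : ℝ) * ∫ x in Iio 0, expAbs u x ∂(cpow ρ n)) atTop
      (𝓝 ((√(2 * Real.pi))⁻¹ / u)) := by
  set κ := (√(2 * Real.pi))⁻¹ with hκ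
  have hκ0 : 0 < κ := by positivity
  have hlo : ∀ a δ : ℝ, Tendsto (fun n : ℕ => √(n : ℝ) *
      ∫ x, expAbs u x * ramp δ (x - a) ∂(cpow ρ n)) atTop
      (𝓝 (κ * ∫ x, expAbs u x * ramp δ (x - a))) := by
    intro a δ
    refine tendsto_sqrt_mul_integral_of_continuous h0 h1 hlat
      ((continuous_expAbs u).mul ((continuous_ramp δ).comp (by fun_prop)))
      (C := 50 + 4 / u ^ 2) fun x => ?_
    rw [abs_of_nonneg (mul_nonneg (expAbs_nonneg _ _) (ramp_nonneg _ _))]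
    refine le_trans ?_ (expAbs_mul_sq_le hu x)
    gcongr
    exact mul_le_of_le_one_right (expAbs_nonneg _ _) (ramp_le_one _ _)
  have hInt : ∀ (ν : Measure ℝ) [IsProbabilityMeasure ν] (a δ : ℝ),
      Integrable (fun x => expAbs u x * ramp δ (x - a)) ν := by
    intro ν _ a δ
    refine Integrable.of_bound (((continuous_expAbs u).mul
      ((continuous_ramp δ).comp (by fun_prop))).aestronglyMeasurable) 1 (ae_of_all _ fun x => ?_)
    rw [Real.norm_of_nonneg (mul_nonneg (expAbs_nonneg _ _) (ramp_nonneg _ _))]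
    exact mul_le_one₀ (expAbs_le_one hu x) (ramp_nonneg _ _) (ramp_le_one _ _)
  have hInt' : ∀ a δ : ℝ, Integrable (fun x => expAbs u x * ramp δ (x - a)) := by
    intro a δ
    refine (integrable_expAbs hu).mono' (((continuous_expAbs u).mul
      ((continuous_ramp δ).comp (by fun_prop))).aestronglyMeasurable) (ae_of_all _ fun x => ?_)
    rw [Real.norm_of_nonneg (mul_nonneg (expAbs_nonneg _ _) (ramp_nonneg _ _))]
    exact mul_le_of_le_one_right (expAbs_nonneg _ _) (ramp_le_one _ _)
  have hbox : ∀ δ : ℝ, 0 < δ → ∫ x, (Icc (-δ) δ).indicator (fun _ => (1 : ℝ)) x = 2 * δ := by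
    intro δ hδ
    rw [integral_indicator measurableSet_Icc]
    simp
    rw [max_eq_left (by linarith)]; ring
  have hboxi : ∀ δ : ℝ, Integrable ((Icc (-δ) δ).indicator (fun _ => (1 : ℝ))) := by
    intro δ
    rw [integrable_indicator_iff measurableSet_Icc]
    simp
  have hneg : Integrable ((Iio (0 : ℝ)).indicator (expAbs u)) :=
    (integrable_expAbs hu).indicator measurableSet_Iio
  have hnegν : ∀ (ν : Measure ℝ) [IsProbabilityMeasure ν],
      Integrable ((Iio (0 : ℝ)).indicator (expAbs u)) ν := by
    intro ν _
    refine Integrable.indicator (Integrable.of_bound (continuous_expAbs u).aestronglyMeasurable 1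
      (ae_of_all _ fun x => ?_)) measurableSet_Iio
    rw [Real.norm_of_nonneg (expAbs_nonneg _ _)]
    exact expAbs_le_one hu x
  have hnegv : ∫ x, (Iio (0 : ℝ)).indicator (expAbs u) x = 1 / u := by
    rw [integral_indicator measurableSet_Iio, integral_expAbs_Iio hu]
  have hL1 : ∀ δ : ℝ, 0 < δ → 1 / u - 2 * δ ≤ ∫ x, expAbs u x * ramp δ (x - 0) := by
    intro δ hδ
    rw [← hnegv, ← hbox δ hδ, ← integral_sub hneg (hboxi δ)]
    refine integral_mono (hneg.sub (hboxi δ)) (hInt' 0 δ) fun x => ?_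
    simp only [sub_zero]
    have h01 := expAbs_le_one hu x
    have h00 := expAbs_nonneg u x
    by_cases hx : x ≤ -δ
    · rw [ramp_of_le hδ hx, mul_one]
      have : (Iio (0 : ℝ)).indicator (expAbs u) x ≤ expAbs u x :=
        indicator_le_self' (fun _ _ => h00) x
      have h2 : 0 ≤ (Icc (-δ) δ).indicator (fun _ => (1 : ℝ)) x :=
        indicator_nonneg (fun _ _ => zero_le_one) x
      linarith
    · push Not at hx
      have hr := mul_nonneg h00 (ramp_nonneg δ x)
      by_cases hx0 : x < 0
      · rw [indicator_of_mem (show x ∈ Iio (0 : ℝ) from hx0),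
          indicator_of_mem (show x ∈ Icc (-δ) δ from ⟨hx.le, by linarith⟩)]
        linarith
      · rw [indicator_of_notMem (show x ∉ Iio (0 : ℝ) from hx0)]
        have h2 : 0 ≤ (Icc (-δ) δ).indicator (fun _ => (1 : ℝ)) x :=
          indicator_nonneg (fun _ _ => zero_le_one) x
        linarith
  have hL2 : ∀ δ : ℝ, 0 < δ → ∫ x, expAbs u x * ramp δ (x - δ) ≤ 1 / u + 2 * δ := by
    intro δ hδ
    rw [← hnegv, ← hbox δ hδ, ← integral_add hneg (hboxi δ)]
    refine integral_mono (hInt' δ δ) (hneg.add (hboxi δ)) fun x => ?_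
    simp only
    have h01 := expAbs_le_one hu x
    have h00 := expAbs_nonneg u x
    have hr := mul_le_of_le_one_right h00 (ramp_le_one δ (x - δ))
    have h2 : 0 ≤ (Icc (-δ) δ).indicator (fun _ => (1 : ℝ)) x :=
      indicator_nonneg (fun _ _ => zero_le_one) x
    by_cases hx0 : x < 0
    · rw [indicator_of_mem (show x ∈ Iio (0 : ℝ) from hx0)]
      linarith
    · rw [indicator_of_notMem (show x ∉ Iio (0 : ℝ) from hx0)]
      by_cases hxδ : x ≤ δ
      · rw [indicator_of_mem (show x ∈ Icc (-δ) δ from ⟨by linarith [not_lt.mp hx0], hxδ⟩)]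
        linarith
      · rw [ramp_of_nonneg hδ (by linarith), mul_zero]
        linarith
  have hS1 : ∀ δ : ℝ, 0 < δ → ∀ n : ℕ, √(n : ℝ) * ∫ x, expAbs u x * ramp δ (x - 0) ∂(cpow ρ n) ≤
      √(n : ℝ) * ∫ x in Iio 0, expAbs u x ∂(cpow ρ n) := by
    intro δ hδ n
    rw [← integral_indicator measurableSet_Iio]
    gcongr
    · exact hInt _ 0 δ
    · exact hnegν _
    · intro x
      simp only [sub_zero]
      by_cases hx0 : x < 0
      · rw [indicator_of_mem (show x ∈ Iio (0 : ℝ) from hx0)]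
        exact mul_le_of_le_one_right (expAbs_nonneg u x) (ramp_le_one δ _)
      · rw [ramp_of_nonneg hδ (by linarith), mul_zero]
        exact indicator_nonneg (fun _ _ => expAbs_nonneg _ _) x
  have hS2 : ∀ δ : ℝ, 0 < δ → ∀ n : ℕ, √(n : ℝ) * ∫ x in Iio 0, expAbs u x ∂(cpow ρ n) ≤
      √(n : ℝ) * ∫ x, expAbs u x * ramp δ (x - δ) ∂(cpow ρ n) := by
    intro δ hδ n
    rw [← integral_indicator measurableSet_Iio]
    gcongr
    · exact hnegν _
    · exact hInt _ δ δ
    · intro x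
      simp only
      by_cases hx0 : x < 0
      · rw [indicator_of_mem (show x ∈ Iio (0 : ℝ) from hx0), ramp_of_le hδ (by linarith), mul_one]
      · rw [indicator_of_notMem (show x ∉ Iio (0 : ℝ) from hx0)]
        exact mul_nonneg (expAbs_nonneg _ _) (ramp_nonneg _ _)
  rw [tendsto_order]
  constructor
  · intro a ha
    have hd : 0 < (κ / u - a) / (4 * κ) := by
      have : 0 < κ / u - a := by linarith
      positivity
    have hgt : a < κ * ∫ x, expAbs u x * ramp ((κ / u - a) / (4 * κ)) (x - 0) := by
      refine lt_of_lt_of_le ?_ (mul_le_mul_of_nonneg_left (hL1 _ hd) hκ0.le)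
      have : κ * (1 / u - 2 * ((κ / u - a) / (4 * κ))) = κ / u - (κ / u - a) / 2 := by
        field_simp; ring
      rw [this]; linarith
    filter_upwards [(hlo 0 _).eventually (lt_mem_nhds hgt)] with n hn
    exact hn.trans_le (hS1 _ hd n)
  · intro a ha
    have hd : 0 < (a - κ / u) / (4 * κ) := by
      have : 0 < a - κ / u := by linarith
      positivity
    have hgt : κ * ∫ x, expAbs u x * ramp ((a - κ / u) / (4 * κ)) (x - (a - κ / u) / (4 * κ)) <
        a := by
      refine lt_of_le_of_lt (mul_le_mul_of_nonneg_left (hL2 _ hd) hκ0.le) ?_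
      have : κ * (1 / u + 2 * ((a - κ / u) / (4 * κ))) = κ / u + (a - κ / u) / 2 := by
        field_simp; ring
      rw [this]; linarith
    filter_upwards [(hlo _ _).eventually (gt_mem_nhds hgt)] with n hn
    exact (hS2 _ hd n).trans_lt hn

lemma tendsto_sqrt_mul_integral_Ici
    (h0 : ∫ x, x ∂ρ = 0) (h1 : ∫ x, x ^ 2 ∂ρ = 1)
    (hlat : ∀ θ : ℝ, θ ≠ 0 → ‖charFun ρ θ‖ < 1) {u : ℝ} (hu : 0 < u) :
    Tendsto (fun n : ℕ => √(n : ℝ) * ∫ x in Ici 0, expAbs u x ∂(cpow ρ n)) atTop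
      (𝓝 ((√(2 * Real.pi))⁻¹ / u)) := by
  have hA := tendsto_sqrt_mul_integral_of_continuous h0 h1 hlat (continuous_expAbs u)
    (C := 50 + 4 / u ^ 2) fun x => by
      rw [abs_of_nonneg (expAbs_nonneg _ _)]; exact expAbs_mul_sq_le hu x
  have hB := tendsto_sqrt_mul_integral_Iio h0 h1 hlat hu
  have htot : ∫ x, expAbs u x = 2 / u := by
    rw [← integral_add_compl measurableSet_Iio (integrable_expAbs hu), compl_Iio,
      integral_expAbs_Iio hu, integral_expAbs_Ici hu]
    ring
  rw [htot] at hA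
  convert hA.sub hB using 2
  · rename_i n
    have hi : Integrable (expAbs u) (cpow ρ n) :=
      Integrable.of_bound (continuous_expAbs u).aestronglyMeasurable 1 (ae_of_all _ fun x => by
        rw [Real.norm_of_nonneg (expAbs_nonneg _ _)]
        exact expAbs_le_one hu x)
    rw [← integral_add_compl measurableSet_Iio hi, compl_Iio]
    ring
  · ring

lemma norm_charFun_lt_one (hnl : NonLattice ρ) {θ : ℝ} (hθ : θ ≠ 0) : ‖charFun ρ θ‖ < 1 := by
  refine lt_of_le_of_ne (norm_charFun_le_one θ) fun heq => hnl ?_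
  obtain ⟨a, ha⟩ : ∃ a : ℝ, charFun ρ θ = Complex.exp (a * Complex.I) :=
    ⟨Complex.arg (charFun ρ θ), by
      conv_lhs => rw [← Complex.norm_mul_exp_arg_mul_I (charFun ρ θ), heq]
      simp⟩
  have h1 : ∀ x : ℝ, Complex.exp (-a * Complex.I) * Complex.exp (θ * x * Complex.I) =
      Complex.exp ((θ * x - a : ℝ) * Complex.I) := by
    intro x
    rw [← Complex.exp_add]; congr 1; push_cast; ring
  have hexp : Integrable (fun x : ℝ => Complex.exp ((θ * x - a : ℝ) * Complex.I)) ρ :=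
    Integrable.of_bound (by fun_prop) 1
      (ae_of_all _ fun x => (Complex.norm_exp_ofReal_mul_I _).le)
  have h2 : ∫ x : ℝ, Complex.exp ((θ * x - a : ℝ) * Complex.I) ∂ρ = 1 := by
    simp_rw [← h1]
    rw [integral_const_mul, ← charFun_apply_real, ha, ← Complex.exp_add]
    simp
  have h3 : ∫ x : ℝ, Real.cos (θ * x - a) ∂ρ = 1 := by
    have h4 := integral_re hexp
    rw [h2] at h4
    simp only [RCLike.re_to_complex, Complex.exp_ofReal_mul_I_re, Complex.one_re] at h4
    exact h4
  have hci : Integrable (fun x : ℝ => Real.cos (θ * x - a)) ρ :=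
    Integrable.of_bound (by fun_prop) 1 (ae_of_all _ fun x => Real.abs_cos_le_one _)
  have h5 : ∫ x : ℝ, (1 - Real.cos (θ * x - a)) ∂ρ = 0 := by
    rw [integral_sub (integrable_const _) hci, h3]; simp
  rw [integral_eq_zero_iff_of_nonneg (fun x => sub_nonneg.mpr (Real.cos_le_one _))
    ((integrable_const _).sub hci)] at h5
  refine ⟨a / θ, 2 * Real.pi / θ, ?_⟩
  have h6 : {x : ℝ | ∃ k : ℤ, x = a / θ + k * (2 * Real.pi / θ)} =ᵐ[ρ] (univ : Set ℝ) := by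
    rw [eventuallyEq_univ]
    filter_upwards [h5] with x hx
    have hx1 : Real.cos (θ * x - a) = 1 := by
      simp only [Pi.zero_apply] at hx; linarith
    obtain ⟨k, hk⟩ := (Real.cos_eq_one_iff _).mp hx1
    refine ⟨k, ?_⟩
    field_simp
    linarith
  rw [measure_congr h6, measure_univ]

lemma cpow_map_mul (ρ : Measure ℝ) [IsProbabilityMeasure ρ] (c : ℝ) (n : ℕ) :
    cpow (ρ.map fun x => c * x) n = (cpow ρ n).map fun x => c * x := by
  induction n with
  | zero => simp [cpow, Measure.map_dirac' (measurable_const_mul c)]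
  | succ n ih =>
    rw [cpow, ih, cpow]
    have := Measure.map_conv_continuousLinearMap (μ := cpow ρ n) (ν := ρ)
      (L := c • ContinuousLinearMap.id ℝ ℝ)
    exact this.symm

theorem exists_local_limit (hv : 0 < ∫ x, x ^ 2 ∂ρ)
    (h0 : ∫ x, x ∂ρ = 0) (hnl : NonLattice ρ) :
    ∃ κ : ℝ, 0 < κ ∧ ∀ u : ℝ, 0 < u →
      Tendsto (fun n : ℕ => √(n : ℝ) * ∫ x in Iio 0, Real.exp (u * x) ∂(cpow ρ n)) atTop
        (𝓝 (κ / u)) ∧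
      Tendsto (fun n : ℕ => √(n : ℝ) * ∫ x in Ici 0, Real.exp (-u * x) ∂(cpow ρ n)) atTop
        (𝓝 (κ / u)) := by
  set σ := √(∫ x, x ^ 2 ∂ρ) with hσ
  have hσ0 : 0 < σ := Real.sqrt_pos.mpr hv
  have hσ2 : σ ^ 2 = ∫ x, x ^ 2 ∂ρ := Real.sq_sqrt hv.le
  have hmeas : Measurable fun x : ℝ => σ⁻¹ * x := measurable_const_mul _
  have : IsProbabilityMeasure (ρ.map fun x => σ⁻¹ * x) := Measure.isProbabilityMeasure_map
    hmeas.aemeasurable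
  have h0' : ∫ x, x ∂(ρ.map fun x => σ⁻¹ * x) = 0 := by
    rw [integral_map hmeas.aemeasurable (by fun_prop), integral_const_mul, h0, mul_zero]
  have h1' : ∫ x, x ^ 2 ∂(ρ.map fun x => σ⁻¹ * x) = 1 := by
    rw [integral_map hmeas.aemeasurable (by fun_prop)]
    simp_rw [mul_pow]
    rw [integral_const_mul, ← hσ2]
    field_simp
  have hlat' : ∀ θ : ℝ, θ ≠ 0 → ‖charFun (ρ.map fun x => σ⁻¹ * x) θ‖ < 1 := by
    intro θ hθ
    have : charFun (ρ.map fun x => σ⁻¹ * x) θ = charFun ρ (σ⁻¹ * θ) := charFun_map_mul _ _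
    rw [this]
    exact norm_charFun_lt_one hnl (by positivity)
  refine ⟨(√(2 * Real.pi))⁻¹ / σ, by positivity, fun u hu => ⟨?_, ?_⟩⟩
  · have h := tendsto_sqrt_mul_integral_Iio h0' h1' hlat' (mul_pos hu hσ0)
    convert h using 2
    · rename_i n
      congr 1
      rw [cpow_map_mul, setIntegral_map measurableSet_Iio
        (continuous_expAbs _).aestronglyMeasurable hmeas.aemeasurable]
      have : (fun x => σ⁻¹ * x) ⁻¹' Iio (0 : ℝ) = Iio 0 := by
        ext x
        simp only [mem_preimage, mem_Iio]
        constructor <;> intro hx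
        · by_contra! hc
          have : 0 ≤ σ⁻¹ * x := by positivity
          linarith
        · exact mul_neg_of_pos_of_neg (by positivity) hx
      rw [this]
      refine setIntegral_congr_fun measurableSet_Iio fun x hx => ?_
      rw [expAbs, abs_mul, abs_of_pos (by positivity : 0 < σ⁻¹), abs_of_neg hx]
      congr 1
      field_simp
    · field_simp
  · have h := tendsto_sqrt_mul_integral_Ici h0' h1' hlat' (mul_pos hu hσ0)
    convert h using 2
    · rename_i n
      congr 1
      rw [cpow_map_mul, setIntegral_map measurableSet_Ici
        (continuous_expAbs _).aestronglyMeasurable hmeas.aemeasurable]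
      have : (fun x => σ⁻¹ * x) ⁻¹' Ici (0 : ℝ) = Ici 0 := by
        ext x
        simp only [mem_preimage, mem_Ici]
        constructor <;> intro hx
        · by_contra! hc
          have : σ⁻¹ * x < 0 := mul_neg_of_pos_of_neg (by positivity) hc
          linarith
        · positivity
      rw [this]
      refine setIntegral_congr_fun measurableSet_Ici fun x hx => ?_
      rw [expAbs, abs_mul, abs_of_pos (by positivity : 0 < σ⁻¹), abs_of_nonneg hx]
      congr 1
      field_simp
    · field_simp

end walkkernel

section killedwalk

/-- The law of the walk with step `ρ`, killed when leaving `D`. -/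
def killed (ρ : Measure ℝ) (D : Set ℝ) : ℕ → Measure ℝ
  | 0 => Measure.dirac 0
  | n + 1 => (Measure.conv (killed ρ D n) ρ).restrict D

variable {ρ : Measure ℝ} [IsProbabilityMeasure ρ] {D : Set ℝ}

instance isFiniteMeasure_killed (n : ℕ) : IsFiniteMeasure (killed ρ D n) := by
  induction n with
  | zero => unfold killed; infer_instance
  | succ n ih => unfold killed; infer_instance

lemma isFiniteMeasure_sum {ι : Type*} (s : Finset ι) (m : ι → Measure ℝ)
    [∀ i, IsFiniteMeasure (m i)] : IsFiniteMeasure (∑ i ∈ s, m i) := by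
  classical
  induction s using Finset.induction_on with
  | empty => simp only [Finset.sum_empty]; infer_instance
  | insert a s ha ih => rw [Finset.sum_insert ha]; infer_instance

lemma conv_finset_sum {ι : Type*} (s : Finset ι) (m : ι → Measure ℝ)
    [∀ i, IsFiniteMeasure (m i)] (ν : Measure ℝ) [IsFiniteMeasure ν] :
    Measure.conv ν (∑ i ∈ s, m i) = ∑ i ∈ s, Measure.conv ν (m i) := by
  classical
  induction s using Finset.induction_on with
  | empty => simp
  | insert a s ha ih =>
    have := isFiniteMeasure_sum s m
    rw [Finset.sum_insert ha, Finset.sum_insert ha, Measure.conv_add, ih]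

lemma conv_smul_nat (n : ℕ) (ν m : Measure ℝ) [IsFiniteMeasure ν] [IsFiniteMeasure m] :
    Measure.conv ν (n • m) = n • Measure.conv ν m := by
  have h := conv_finset_sum (Finset.range n) (fun _ => m) ν
  simpa using h

lemma conv_restrict_add (ν m : Measure ℝ) [IsFiniteMeasure ν] [IsFiniteMeasure m]
    (hD : MeasurableSet D) :
    Measure.conv ν m = Measure.conv (ν.restrict D) m + Measure.conv (ν.restrict Dᶜ) m := by
  rw [← Measure.add_conv, Measure.restrict_add_restrict_compl hD]

/-- Convolution of measures carried by a set closed under addition is carried by that set. -/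
lemma restrict_conv_of_add_mem (hD : MeasurableSet D) (hadd : ∀ x ∈ D, ∀ y ∈ D, x + y ∈ D)
    (ν m : Measure ℝ) [IsFiniteMeasure ν] [IsFiniteMeasure m] (hν : ν Dᶜ = 0) (hm : m Dᶜ = 0) :
    (Measure.conv ν m) Dᶜ = 0 := by
  rw [Measure.conv, Measure.map_apply measurable_add hD.compl]
  have hsub : (fun p : ℝ × ℝ => p.1 + p.2) ⁻¹' Dᶜ ⊆ (Dᶜ ×ˢ univ) ∪ (univ ×ˢ Dᶜ) := by
    rintro ⟨x, y⟩ h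
    by_contra hc
    simp only [mem_union, mem_prod, mem_univ, and_true, true_and, not_or, mem_compl_iff,
      not_not] at hc
    exact h (hadd x hc.1 y hc.2)
  refine measure_mono_null hsub (measure_union_null ?_ ?_)
  · rw [Measure.prod_prod, hν, zero_mul]
  · rw [Measure.prod_prod, hm, mul_zero]

lemma cpow_succ' (n : ℕ) : cpow ρ (n + 1) = Measure.conv ρ (cpow ρ n) := by
  rw [cpow, Measure.conv_comm]

omit [IsProbabilityMeasure ρ] in
lemma killed_compl (hD : MeasurableSet D) (n : ℕ) : killed ρ D (n + 1) Dᶜ = 0 := by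
  rw [killed, Measure.restrict_apply hD.compl]; simp

/-- Spitzer's recursion. -/
lemma nsmul_killed (hD : MeasurableSet D) (hadd : ∀ x ∈ D, ∀ y ∈ D, x + y ∈ D)
    (haddc : ∀ x ∈ Dᶜ, ∀ y ∈ Dᶜ, x + y ∈ Dᶜ) (n : ℕ) :
    n • killed ρ D n =
      ∑ j ∈ Finset.range n, Measure.conv ((cpow ρ (j + 1)).restrict D)
          (killed ρ D (n - 1 - j)) := by
  induction n with
  | zero => simp
  | succ n ih =>
    set β := killed ρ D with hβ
    let δ : ℕ → Measure ℝ := fun n => (Measure.conv (β n) ρ).restrict Dᶜ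
    have hδfin : ∀ n, IsFiniteMeasure (δ n) := fun n => by
      change IsFiniteMeasure ((Measure.conv (β n) ρ).restrict Dᶜ); infer_instance
    have hstep : ∀ n, Measure.conv ρ (β n) = β (n + 1) + δ n := by
      intro n
      rw [Measure.conv_comm, ← Measure.restrict_add_restrict_compl (μ := Measure.conv (β n) ρ) hD]
      rfl
    let a : ℕ → Measure ℝ := fun j => (cpow ρ (j + 1)).restrict D
    let p : ℕ → Measure ℝ := fun j => (cpow ρ (j + 1)).restrict Dᶜ
    have hafin : ∀ n, IsFiniteMeasure (a n) := fun n => by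
      change IsFiniteMeasure ((cpow ρ (n + 1)).restrict D); infer_instance
    have hpfin : ∀ n, IsFiniteMeasure (p n) := fun n => by
      change IsFiniteMeasure ((cpow ρ (n + 1)).restrict Dᶜ); infer_instance
    -- first expansion
    have h1 : ∀ N : ℕ, ∑ j ∈ Finset.range N, Measure.conv (cpow ρ (j + 1)) (β (N - 1 - j)) =
        ∑ j ∈ Finset.range N, Measure.conv (a j) (β (N - 1 - j)) +
        ∑ j ∈ Finset.range N, Measure.conv (p j) (β (N - 1 - j)) := by
      intro N
      rw [← Finset.sum_add_distrib]
      exact Finset.sum_congr rfl fun j _ => conv_restrict_add _ _ hD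
    -- second expansion
    have h2 : ∑ j ∈ Finset.range (n + 1), Measure.conv (cpow ρ (j + 1)) (β (n + 1 - 1 - j)) =
        (n + 1) • (β (n + 1) + δ n) +
          ∑ j ∈ Finset.range n, (Measure.conv (p j) (β (n - j)) +
              Measure.conv (p j) (δ (n - 1 - j))) := by
      have e1 : ∑ j ∈ Finset.range (n + 1), Measure.conv (cpow ρ (j + 1)) (β (n + 1 - 1 - j)) =
          Measure.conv ρ (∑ j ∈ Finset.range (n + 1), Measure.conv (cpow ρ j) (β (n - j))) := by
        rw [conv_finset_sum]
        refine Finset.sum_congr rfl fun j _ => ?_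
        rw [cpow_succ', Measure.conv_assoc, Nat.add_sub_cancel]
      have e2 : ∑ j ∈ Finset.range (n + 1), Measure.conv (cpow ρ j) (β (n - j)) =
          (n + 1) • β n + ∑ j ∈ Finset.range n, Measure.conv (p j) (β (n - 1 - j)) := by
        rw [Finset.sum_range_succ']
        have e3 : ∀ j, n - (j + 1) = n - 1 - j := fun j => by omega
        have e4 : ∑ j ∈ Finset.range n, Measure.conv (cpow ρ (j + 1)) (β (n - (j + 1))) =
            ∑ j ∈ Finset.range n, Measure.conv (cpow ρ (j + 1)) (β (n - 1 - j)) :=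
          Finset.sum_congr rfl fun j _ => by rw [e3 j]
        rw [e4, h1 n, ← ih]
        rw [show cpow ρ 0 = Measure.dirac 0 from rfl, Measure.dirac_zero_conv, Nat.sub_zero]
        rw [add_nsmul, one_nsmul]
        abel
      have := isFiniteMeasure_sum (Finset.range n) fun j => Measure.conv (p j) (β (n - 1 - j))
      have hfs : IsFiniteMeasure ((n + 1) • β n) := by
        have := isFiniteMeasure_sum (Finset.range (n + 1)) fun _ => β n
        simpa using this
      rw [e1, e2, Measure.conv_add, conv_smul_nat, hstep, conv_finset_sum]
      congr 1
      refine Finset.sum_congr rfl fun j hj => ?_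
      have hj' := Finset.mem_range.mp hj
      rw [← Measure.conv_assoc, Measure.conv_comm ρ, Measure.conv_assoc, hstep, Measure.conv_add]
      congr 3
      omega
    rw [h1 (n + 1), Finset.sum_range_succ (fun j => Measure.conv (p j) (β (n + 1 - 1 - j))),
      Finset.sum_add_distrib] at h2
    have hsupp : ∀ j ∈ Finset.range (n + 1), (Measure.conv (a j) (β (n + 1 - 1 - j))) Dᶜ = 0 := by
      intro j hj
      have haD : a j Dᶜ = 0 := by
        change ((cpow ρ (j + 1)).restrict D) Dᶜ = 0
        rw [Measure.restrict_apply hD.compl]; simp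
      rcases Nat.eq_zero_or_pos (n + 1 - 1 - j) with h0 | h0
      · rw [h0]
        change (Measure.conv (a j) (Measure.dirac 0)) Dᶜ = 0
        rw [Measure.conv_dirac_zero, haD]
      · obtain ⟨m, hm⟩ := Nat.exists_eq_succ_of_ne_zero h0.ne'
        rw [hm]
        exact restrict_conv_of_add_mem hD hadd _ _ haD (killed_compl hD m)
    have hpD : ∀ j, p j D = 0 := by
      intro j
      change ((cpow ρ (j + 1)).restrict Dᶜ) D = 0
      rw [Measure.restrict_apply hD]; simp
    have hδD : ∀ j, δ j D = 0 := by
      intro j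
      change ((Measure.conv (β j) ρ).restrict Dᶜ) D = 0
      rw [Measure.restrict_apply hD]; simp
    have hpδ : ∀ i j, (Measure.conv (p i) (δ j)) D = 0 := by
      intro i j
      have := restrict_conv_of_add_mem hD.compl haddc (p i) (δ j)
        (by rw [compl_compl]; exact hpD i) (by rw [compl_compl]; exact hδD j)
      rwa [compl_compl] at this
    have hres := isFiniteMeasure_sum (Finset.range n) fun j => Measure.conv (p j) (β (n - j))
    ext s hs
    have key := congrArg (fun m : Measure ℝ => m (s ∩ D)) h2
    simp only [Measure.add_apply, Measure.smul_apply, Measure.finsetSum_apply] at key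
    have z1 : (Measure.conv (p n) (β (n + 1 - 1 - n))) (s ∩ D) = 0 := by
      rw [Nat.add_sub_cancel, Nat.sub_self]
      change (Measure.conv (p n) (Measure.dirac 0)) (s ∩ D) = 0
      rw [Measure.conv_dirac_zero]
      exact measure_mono_null inter_subset_right (hpD n)
    have z2 : δ n (s ∩ D) = 0 := measure_mono_null inter_subset_right (hδD n)
    have z3 : ∑ j ∈ Finset.range n, (Measure.conv (p j) (δ (n - 1 - j))) (s ∩ D) = 0 :=
      Finset.sum_eq_zero fun j _ => measure_mono_null inter_subset_right (hpδ _ _)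
    rw [z1, z2, z3, add_zero, add_zero, add_zero] at key
    have hne : ∑ j ∈ Finset.range n, (Measure.conv (p j) (β (n + 1 - 1 - j))) (s ∩ D) ≠ ⊤ :=
      (ENNReal.sum_lt_top.mpr fun j _ => measure_lt_top _ _).ne
    rw [Nat.add_sub_cancel] at key hne
    have key2 := (ENNReal.add_left_inj hne).mp key
    have hin : ∀ m : Measure ℝ, m Dᶜ = 0 → m s = m (s ∩ D) := by
      intro m hm
      refine le_antisymm ?_ (measure_mono inter_subset_left)
      calc m s ≤ m (s ∩ D ∪ Dᶜ) := measure_mono fun x hx => by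
            by_cases h : x ∈ D
            · exact Or.inl ⟨hx, h⟩
            · exact Or.inr h
        _ ≤ m (s ∩ D) + m Dᶜ := measure_union_le _ _
        _ = _ := by rw [hm, add_zero]
    rw [Measure.smul_apply, Measure.finsetSum_apply, hin _ (killed_compl hD n), ← key2]
    refine Finset.sum_congr rfl fun j hj => ?_
    exact (hin _ (by simpa using hsupp j hj)).symm

/-- Exponential moments of the killed walk. -/
def kmgf (ρ : Measure ℝ) (D : Set ℝ) (c : ℝ) (n : ℕ) : ℝ :=
  ∫ x, Real.exp (c * x) ∂(killed ρ D n)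

omit [IsProbabilityMeasure ρ] in
lemma kmgf_zero (c : ℝ) : kmgf ρ D c 0 = 1 := by simp [kmgf, killed]

omit [IsProbabilityMeasure ρ] in
lemma kmgf_nonneg (c : ℝ) (n : ℕ) : 0 ≤ kmgf ρ D c n :=
  integral_nonneg fun _ => (Real.exp_pos _).le

lemma killed_univ_le (n : ℕ) : killed ρ D n univ ≤ 1 := by
  induction n with
  | zero => simp [killed]
  | succ n ih =>
    rw [killed]
    refine (Measure.restrict_apply_le _ _).trans ?_
    rw [Measure.conv, Measure.map_apply measurable_add MeasurableSet.univ, preimage_univ,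
      ← univ_prod_univ, Measure.prod_prod, measure_univ (μ := ρ), mul_one]
    exact ih

lemma lintegral_exp_conv (c : ℝ) (ν m : Measure ℝ) [IsFiniteMeasure ν] [IsFiniteMeasure m] :
    ∫⁻ x, ENNReal.ofReal (Real.exp (c * x)) ∂(Measure.conv ν m) =
      (∫⁻ x, ENNReal.ofReal (Real.exp (c * x)) ∂ν) *
        ∫⁻ x, ENNReal.ofReal (Real.exp (c * x)) ∂m := by
  rw [Measure.lintegral_conv (by fun_prop)]
  rw [← lintegral_mul_const _ (by fun_prop)]
  congr 1; ext x
  rw [← lintegral_const_mul _ (by fun_prop)]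
  congr 1; ext y
  rw [← ENNReal.ofReal_mul (Real.exp_pos _).le, ← Real.exp_add, mul_add]

lemma ofReal_kmgf {c : ℝ} (hD : MeasurableSet D) (hc : ∀ x ∈ D, c * x ≤ 0) (n : ℕ) :
    ∫⁻ x, ENNReal.ofReal (Real.exp (c * x)) ∂(killed ρ D n) = ENNReal.ofReal (kmgf ρ D c n) ∧
      kmgf ρ D c n ≤ 1 := by
  have hle : ∀ᵐ x ∂(killed ρ D n), Real.exp (c * x) ≤ 1 := by
    cases n with
    | zero => simp [killed, ae_dirac_eq]
    | succ n =>
      rw [killed]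
      filter_upwards [ae_restrict_mem hD] with x hx
      exact Real.exp_le_one_iff.mpr (hc x hx)
  have h1 : ∫⁻ x, ENNReal.ofReal (Real.exp (c * x)) ∂(killed ρ D n) ≤ 1 := by
    calc _ ≤ ∫⁻ _, 1 ∂(killed ρ D n) := lintegral_mono_ae (by
          filter_upwards [hle] with x hx
          simpa using ENNReal.ofReal_le_ofReal hx)
      _ ≤ 1 := by rw [lintegral_one]; exact killed_univ_le n
  have h2 : kmgf ρ D c n =
      (∫⁻ x, ENNReal.ofReal (Real.exp (c * x)) ∂(killed ρ D n)).toReal :=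
    integral_eq_lintegral_of_nonneg_ae (ae_of_all _ fun _ => (Real.exp_pos _).le)
      (by fun_prop)
  constructor
  · rw [h2, ENNReal.ofReal_toReal (ne_top_of_le_ne_top ENNReal.one_ne_top h1)]
  · rw [h2]
    exact ENNReal.toReal_le_of_le_ofReal zero_le_one (by simpa using h1)

lemma kmgf_rec {c : ℝ} (hD : MeasurableSet D) (hadd : ∀ x ∈ D, ∀ y ∈ D, x + y ∈ D)
    (haddc : ∀ x ∈ Dᶜ, ∀ y ∈ Dᶜ, x + y ∈ Dᶜ) (hc : ∀ x ∈ D, c * x ≤ 0) (n : ℕ) :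
    (n : ℝ) * kmgf ρ D c n = ∑ j ∈ Finset.range n,
      (∫ x in D, Real.exp (c * x) ∂(cpow ρ (n - j))) * kmgf ρ D c j := by
  have h := congrArg (fun m : Measure ℝ => ∫⁻ x, ENNReal.ofReal (Real.exp (c * x)) ∂m)
    (nsmul_killed (ρ := ρ) hD hadd haddc n)
  rw [lintegral_smul_measure, lintegral_finsetSum_measure, (ofReal_kmgf hD hc n).1] at h
  have ha : ∀ j, ∫⁻ x in D, ENNReal.ofReal (Real.exp (c * x)) ∂(cpow ρ j) =
      ENNReal.ofReal (∫ x in D, Real.exp (c * x) ∂(cpow ρ j)) := by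
    intro j
    refine (ofReal_integral_eq_lintegral_ofReal ?_
      (ae_of_all _ fun _ => (Real.exp_pos _).le)).symm
    refine Measure.integrableOn_of_bounded (M := 1) (measure_ne_top _ _) (by fun_prop) ?_
    filter_upwards [ae_restrict_mem hD] with x hx
    rw [Real.norm_of_nonneg (Real.exp_pos _).le]
    exact Real.exp_le_one_iff.mpr (hc x hx)
  have hsum : ∀ j ∈ Finset.range n,
      ∫⁻ x, ENNReal.ofReal (Real.exp (c * x))
        ∂(Measure.conv ((cpow ρ (j + 1)).restrict D) (killed ρ D (n - 1 - j))) =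
      ENNReal.ofReal ((∫ x in D, Real.exp (c * x) ∂(cpow ρ (j + 1))) *
        kmgf ρ D c (n - 1 - j)) := by
    intro j _
    rw [lintegral_exp_conv, ha, (ofReal_kmgf hD hc _).1, ← ENNReal.ofReal_mul
      (integral_nonneg fun _ => (Real.exp_pos _).le)]
  rw [Finset.sum_congr rfl hsum, ← ENNReal.ofReal_sum_of_nonneg (fun j _ =>
    mul_nonneg (integral_nonneg fun _ => (Real.exp_pos _).le) (kmgf_nonneg _ _))] at h
  have h' := congrArg ENNReal.toReal h
  rw [ENNReal.toReal_ofReal (Finset.sum_nonneg fun j _ =>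
    mul_nonneg (integral_nonneg fun _ => (Real.exp_pos _).le) (kmgf_nonneg _ _)), nsmul_eq_mul,
    ENNReal.toReal_mul, ENNReal.toReal_ofReal (kmgf_nonneg _ _), ENNReal.toReal_natCast] at h'
  rw [h', ← Finset.sum_range_reflect]
  refine Finset.sum_congr rfl fun j hj => ?_
  have := Finset.mem_range.mp hj
  congr 3
  · congr 2; omega
  · omega

end killedwalk

section killedasymp

variable {ρ : Measure ℝ} [IsProbabilityMeasure ρ]

/-- Local asymptotics of the exponential moments of the walk killed on leaving a half line. -/
def KilledAsymp (ρ : Measure ℝ) (κ : ℝ) : Prop :=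
  0 < κ ∧ ∀ u : ℝ, 0 < u →
    (Summable (kmgf ρ (Iio 0) u) ∧ Tendsto (fun n => wt n * kmgf ρ (Iio 0) u n) atTop
      (𝓝 (κ / u * ∑' j, kmgf ρ (Iio 0) u j))) ∧
    (Summable (kmgf ρ (Ici 0) (-u)) ∧ Tendsto (fun n => wt n * kmgf ρ (Ici 0) (-u) n) atTop
      (𝓝 (κ / u * ∑' j, kmgf ρ (Ici 0) (-u) j)))

theorem exists_killedAsymp (hv : 0 < ∫ x, x ^ 2 ∂ρ)
    (h0 : ∫ x, x ∂ρ = 0) (hnl : NonLattice ρ) : ∃ κ, KilledAsymp ρ κ := by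
  obtain ⟨κ, hκ, h⟩ := exists_local_limit hv h0 hnl
  refine ⟨κ, hκ, fun u hu => ?_⟩
  constructor
  · have hc : ∀ x ∈ Iio (0 : ℝ), u * x ≤ 0 := fun x hx => by
      have := mem_Iio.mp hx; nlinarith
    refine tendsto_wt_mul_of_rec (a := fun n => ∫ x in Iio 0, Real.exp (u * x) ∂(cpow ρ n))
      (fun n => kmgf_nonneg u n) (fun n => (ofReal_kmgf measurableSet_Iio hc n).2)
      (fun n => integral_nonneg fun _ => (Real.exp_pos _).le) (h u hu).1 fun n => ?_
    refine kmgf_rec measurableSet_Iio ?_ ?_ hc n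
    · intro x hx y hy; simp only [mem_Iio] at *; linarith
    · intro x hx y hy; simp only [mem_compl_iff, mem_Iio, not_lt] at *; linarith
  · have hc : ∀ x ∈ Ici (0 : ℝ), -u * x ≤ 0 := fun x hx => by
      have := mem_Ici.mp hx; nlinarith
    refine tendsto_wt_mul_of_rec (a := fun n => ∫ x in Ici 0, Real.exp (-u * x) ∂(cpow ρ n))
      (fun n => kmgf_nonneg (-u) n) (fun n => (ofReal_kmgf measurableSet_Ici hc n).2)
      (fun n => integral_nonneg fun _ => (Real.exp_pos _).le) (h u hu).2 fun n => ?_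
    refine kmgf_rec measurableSet_Ici ?_ ?_ hc n
    · intro x hx y hy; simp only [mem_Ici] at *; linarith
    · intro x hx y hy; simp only [mem_compl_iff, mem_Ici, not_le] at *; linarith

/-- Green measure of the walk killed on leaving `D`. -/
def green (ρ : Measure ℝ) (D : Set ℝ) : Measure ℝ := Measure.sum (killed ρ D)

/-- The renewal function of strictly descending records, with values in `[0,∞]`. -/
def uE (ρ : Measure ℝ) (x : ℝ) : ENNReal := green ρ (Iio 0) (Ici (-x))

/-- The renewal function of weakly ascending records, with values in `[0,∞]`. -/
def vE (ρ : Measure ℝ) (y : ℝ) : ENNReal := green ρ (Ici 0) (Iio y)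

omit [IsProbabilityMeasure ρ] in
lemma uE_mono : Monotone (uE ρ) := fun _ _ h =>
  measure_mono (Ici_subset_Ici.mpr (neg_le_neg h))

omit [IsProbabilityMeasure ρ] in
lemma vE_mono : Monotone (vE ρ) := fun _ _ h => measure_mono (Iio_subset_Iio h)

omit [IsProbabilityMeasure ρ] in
@[fun_prop]
lemma measurable_uE : Measurable (uE ρ) := uE_mono.measurable

omit [IsProbabilityMeasure ρ] in
@[fun_prop]
lemma measurable_vE : Measurable (vE ρ) := vE_mono.measurable

lemma lintegral_exp_green {D : Set ℝ} (hD : MeasurableSet D) {c : ℝ} (hc : ∀ x ∈ D, c * x ≤ 0)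
    (hs : Summable (kmgf ρ D c)) :
    ∫⁻ x, ENNReal.ofReal (Real.exp (c * x)) ∂(green ρ D) =
      ENNReal.ofReal (∑' j, kmgf ρ D c j) := by
  rw [green, lintegral_sum_measure, ENNReal.ofReal_tsum_of_nonneg (kmgf_nonneg c) hs]
  exact tsum_congr fun n => (ofReal_kmgf hD hc n).1

lemma lintegral_exp_green_Iio {κ : ℝ} (h : KilledAsymp ρ κ) {u : ℝ} (hu : 0 < u) :
    ∫⁻ x, ENNReal.ofReal (Real.exp (u * x)) ∂(green ρ (Iio 0)) =
      ENNReal.ofReal (∑' j, kmgf ρ (Iio 0) u j) :=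
  lintegral_exp_green measurableSet_Iio (fun x hx => by
    have := mem_Iio.mp hx; nlinarith) (h.2 u hu).1.1

lemma lintegral_exp_green_Ici {κ : ℝ} (h : KilledAsymp ρ κ) {u : ℝ} (hu : 0 < u) :
    ∫⁻ x, ENNReal.ofReal (Real.exp (-u * x)) ∂(green ρ (Ici 0)) =
      ENNReal.ofReal (∑' j, kmgf ρ (Ici 0) (-u) j) :=
  lintegral_exp_green measurableSet_Ici (fun x hx => by
    have := mem_Ici.mp hx; nlinarith) (h.2 u hu).2.1

lemma uE_le {κ : ℝ} (h : KilledAsymp ρ κ) {u : ℝ} (hu : 0 < u) (x : ℝ) :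
    uE ρ x ≤ ENNReal.ofReal (Real.exp (u * x)) * ENNReal.ofReal (∑' j, kmgf ρ (Iio 0) u j) := by
  rw [← lintegral_exp_green_Iio h hu, ← lintegral_const_mul _ (by fun_prop), uE,
    ← lintegral_indicator_one measurableSet_Ici]
  refine lintegral_mono fun a => ?_
  by_cases ha : a ∈ Ici (-x)
  · rw [indicator_of_mem ha, ← ENNReal.ofReal_mul (Real.exp_pos _).le, ← Real.exp_add]
    have := mem_Ici.mp ha
    exact ENNReal.one_le_ofReal.mpr (Real.one_le_exp (by nlinarith))
  · rw [indicator_of_notMem ha]; exact zero_le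

lemma vE_le {κ : ℝ} (h : KilledAsymp ρ κ) {u : ℝ} (hu : 0 < u) (y : ℝ) :
    vE ρ y ≤ ENNReal.ofReal (Real.exp (u * y)) *
      ENNReal.ofReal (∑' j, kmgf ρ (Ici 0) (-u) j) := by
  rw [← lintegral_exp_green_Ici h hu, ← lintegral_const_mul _ (by fun_prop), vE,
    ← lintegral_indicator_one measurableSet_Iio]
  refine lintegral_mono fun a => ?_
  by_cases ha : a ∈ Iio y
  · rw [indicator_of_mem ha, ← ENNReal.ofReal_mul (Real.exp_pos _).le, ← Real.exp_add]
    have := mem_Iio.mp ha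
    exact ENNReal.one_le_ofReal.mpr (Real.one_le_exp (by nlinarith))
  · rw [indicator_of_notMem ha]; exact zero_le

lemma uE_lt_top {κ : ℝ} (h : KilledAsymp ρ κ) (x : ℝ) : uE ρ x < ⊤ :=
  (uE_le h one_pos x).trans_lt (ENNReal.mul_lt_top ENNReal.ofReal_lt_top ENNReal.ofReal_lt_top)

lemma vE_lt_top {κ : ℝ} (h : KilledAsymp ρ κ) (x : ℝ) : vE ρ x < ⊤ :=
  (vE_le h one_pos x).trans_lt (ENNReal.mul_lt_top ENNReal.ofReal_lt_top ENNReal.ofReal_lt_top)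

omit [IsProbabilityMeasure ρ] in
lemma killed_Iio_null (n : ℕ) : killed ρ (Iio 0) n (Ioi 0) = 0 := by
  cases n with
  | zero => simp [killed]
  | succ n =>
    refine measure_mono_null ?_ (killed_compl measurableSet_Iio n)
    intro x hx; simp only [mem_Ioi, mem_compl_iff, mem_Iio, not_lt] at *; linarith

omit [IsProbabilityMeasure ρ] in
lemma killed_Ici_null (n : ℕ) : killed ρ (Ici 0) n (Iio 0) = 0 := by
  cases n with
  | zero => simp [killed]
  | succ n =>
    refine measure_mono_null ?_ (killed_compl measurableSet_Ici n)
    intro x hx; simpa using hx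

omit [IsProbabilityMeasure ρ] in
lemma ae_green_Iio : ∀ᵐ a ∂(green ρ (Iio 0)), a ≤ 0 := by
  rw [ae_iff, green, Measure.sum_apply _ (by measurability)]
  simp only [not_le, ENNReal.tsum_eq_zero]
  exact fun n => killed_Iio_null n

omit [IsProbabilityMeasure ρ] in
lemma ae_green_Ici : ∀ᵐ a ∂(green ρ (Ici 0)), 0 ≤ a := by
  rw [ae_iff, green, Measure.sum_apply _ (by measurability)]
  simp only [not_le, ENNReal.tsum_eq_zero]
  exact fun n => killed_Ici_null n

instance sFinite_green (D : Set ℝ) : SFinite (green ρ D) := by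
  unfold green; infer_instance

lemma lintegral_exp_neg_Ioi {c : ℝ} (hc : 0 < c) (a : ℝ) :
    ∫⁻ y in Ioi a, ENNReal.ofReal (Real.exp (-c * y)) =
      ENNReal.ofReal (c⁻¹ * Real.exp (-c * a)) := by
  rw [← ofReal_integral_eq_lintegral_ofReal (exp_neg_integrableOn_Ioi a hc)
    (ae_of_all _ fun _ => (Real.exp_pos _).le)]
  congr 1
  rw [integral_exp_mul_Ioi (by linarith)]
  field_simp

lemma lintegral_exp_mul_uE {κ : ℝ} (h : KilledAsymp ρ κ) {u : ℝ} (hu : 0 < u) :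
    ∫⁻ w in Ioi 0, ENNReal.ofReal (Real.exp (-u * w)) * uE ρ w =
      ENNReal.ofReal (u⁻¹ * ∑' j, kmgf ρ (Iio 0) u j) := by
  have h1 : ∀ w, ENNReal.ofReal (Real.exp (-u * w)) * uE ρ w =
      ∫⁻ a, ENNReal.ofReal (Real.exp (-u * w)) * (if -w ≤ a then 1 else 0) ∂(green ρ (Iio 0)) := by
    intro w
    rw [lintegral_const_mul _ (Measurable.ite measurableSet_Ici (by fun_prop) (by fun_prop)), uE,
      ← lintegral_indicator_one measurableSet_Ici]
    rfl
  simp_rw [h1]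
  rw [lintegral_lintegral_swap]
  · rw [ENNReal.ofReal_mul (inv_pos.mpr hu).le, ← lintegral_exp_green_Iio h hu,
      ← lintegral_const_mul _ (by fun_prop)]
    refine lintegral_congr_ae ?_
    filter_upwards [ae_green_Iio (ρ := ρ)] with a ha
    rw [← ENNReal.ofReal_mul (inv_pos.mpr hu).le]
    have h2 := lintegral_exp_neg_Ioi hu (-a)
    rw [show -u * -a = u * a by ring] at h2
    rw [← h2, ← lintegral_indicator measurableSet_Ioi, ← lintegral_indicator measurableSet_Ioi]
    refine lintegral_congr_ae ?_
    have : ∀ᵐ w : ℝ, w ≠ -a := by simp [ae_iff, measure_singleton]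
    filter_upwards [this] with w hw
    by_cases h3 : -a < w
    · rw [indicator_of_mem (show w ∈ Ioi 0 by simp only [mem_Ioi]; linarith),
        indicator_of_mem (show w ∈ Ioi (-a) from h3), if_pos (by linarith), mul_one]
    · rw [indicator_of_notMem (show w ∉ Ioi (-a) from h3)]
      by_cases h4 : w ∈ Ioi 0
      · rw [indicator_of_mem h4, if_neg, mul_zero]
        intro h5
        exact hw (le_antisymm (not_lt.mp h3) (by linarith))
      · rw [indicator_of_notMem h4]
  · refine Measurable.aemeasurable ?_
    refine Measurable.mul (by fun_prop) (Measurable.ite ?_ (by fun_prop) (by fun_prop))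
    exact measurableSet_le (by fun_prop) (by fun_prop)

lemma lintegral_exp_mul_vE {κ : ℝ} (h : KilledAsymp ρ κ) {u : ℝ} (hu : 0 < u) :
    ∫⁻ w in Ioi 0, ENNReal.ofReal (Real.exp (-u * w)) * vE ρ w =
      ENNReal.ofReal (u⁻¹ * ∑' j, kmgf ρ (Ici 0) (-u) j) := by
  have h1 : ∀ w, ENNReal.ofReal (Real.exp (-u * w)) * vE ρ w =
      ∫⁻ a, ENNReal.ofReal (Real.exp (-u * w)) * (if a < w then 1 else 0) ∂(green ρ (Ici 0)) := by
    intro w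
    rw [lintegral_const_mul _ (Measurable.ite measurableSet_Iio (by fun_prop) (by fun_prop)), vE,
      ← lintegral_indicator_one measurableSet_Iio]
    rfl
  simp_rw [h1]
  rw [lintegral_lintegral_swap]
  · rw [ENNReal.ofReal_mul (inv_pos.mpr hu).le, ← lintegral_exp_green_Ici h hu,
      ← lintegral_const_mul _ (by fun_prop)]
    refine lintegral_congr_ae ?_
    filter_upwards [ae_green_Ici (ρ := ρ)] with a ha
    rw [← ENNReal.ofReal_mul (inv_pos.mpr hu).le]
    rw [← lintegral_exp_neg_Ioi hu a, ← lintegral_indicator measurableSet_Ioi,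
      ← lintegral_indicator measurableSet_Ioi]
    refine lintegral_congr fun w => ?_
    by_cases h3 : a < w
    · rw [indicator_of_mem (show w ∈ Ioi 0 by simp only [mem_Ioi]; linarith),
        indicator_of_mem (show w ∈ Ioi a from h3), if_pos h3, mul_one]
    · rw [indicator_of_notMem (show w ∉ Ioi a from h3)]
      by_cases h4 : w ∈ Ioi 0
      · rw [indicator_of_mem h4, if_neg h3, mul_zero]
      · rw [indicator_of_notMem h4]
  · refine Measurable.aemeasurable ?_
    refine Measurable.mul (by fun_prop) (Measurable.ite ?_ (by fun_prop) (by fun_prop))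
    exact measurableSet_lt (by fun_prop) (by fun_prop)

omit [IsProbabilityMeasure ρ] in
lemma tendsto_vE_sub (y : ℝ) :
    Tendsto (fun n : ℕ => vE ρ (y - 1 / ((n : ℝ) + 1))) atTop (𝓝 (vE ρ y)) := by
  have hU : Iio y = ⋃ n : ℕ, Iio (y - 1 / ((n : ℝ) + 1)) := by
    ext x
    simp only [mem_Iio, mem_iUnion]
    constructor
    · intro hx
      obtain ⟨n, hn⟩ := exists_nat_one_div_lt (sub_pos.mpr hx)
      exact ⟨n, by linarith⟩
    · rintro ⟨n, hn⟩
      have : (0 : ℝ) < 1 / ((n : ℝ) + 1) := by positivity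
      linarith
  unfold vE
  rw [hU]
  refine tendsto_measure_iUnion_atTop fun m n hmn => Iio_subset_Iio ?_
  have : 1 / ((n : ℝ) + 1) ≤ 1 / ((m : ℝ) + 1) := by
    apply one_div_le_one_div_of_le (by positivity)
    have : (m : ℝ) ≤ n := by exact_mod_cast hmn
    linarith
  linarith

omit [IsProbabilityMeasure ρ] in
lemma one_le_uE {x : ℝ} (hx : 0 ≤ x) : 1 ≤ uE ρ x := by
  rw [uE, green, Measure.sum_apply _ measurableSet_Ici]
  refine le_trans ?_ (ENNReal.le_tsum 0)
  simp [killed, hx]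

end killedasymp

section pathspace

open Classical in
/-- Indicator of a proposition with values in `[0,∞]`. -/
def ind (p : Prop) : ENNReal := if p then 1 else 0

lemma ind_pos {p : Prop} (h : p) : ind p = 1 := if_pos h

lemma ind_neg {p : Prop} (h : ¬p) : ind p = 0 := if_neg h

lemma ind_and (p q : Prop) : ind (p ∧ q) = ind p * ind q := by
  by_cases hp : p <;> by_cases hq : q <;> simp [ind, hp, hq]

lemma ind_le_one (p : Prop) : ind p ≤ 1 := by
  by_cases hp : p <;> simp [ind, hp]

lemma ind_ne_top (p : Prop) : ind p ≠ ⊤ := ((ind_le_one p).trans_lt ENNReal.one_lt_top).ne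

lemma ind_mono {p q : Prop} (h : p → q) : ind p ≤ ind q := by
  by_cases hp : p
  · rw [ind_pos hp, ind_pos (h hp)]
  · rw [ind_neg hp]; exact zero_le

lemma measurable_ind {α : Type*} [MeasurableSpace α] {p : α → Prop} (h : MeasurableSet {x | p x}) :
    Measurable fun x => ind (p x) := by
  classical
  exact Measurable.ite h measurable_const measurable_const

lemma lintegral_ind_mul {α : Type*} [MeasurableSpace α] (m : Measure α) {p : α → Prop}
    (h : MeasurableSet {x | p x}) (f : α → ENNReal) :
    ∫⁻ x, ind (p x) * f x ∂m = ∫⁻ x in {x | p x}, f x ∂m := by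
  rw [← lintegral_indicator h]
  congr 1; ext x
  by_cases hx : p x
  · rw [ind_pos hx, one_mul, indicator_of_mem (show x ∈ {x | p x} from hx)]
  · rw [ind_neg hx, zero_mul, indicator_of_notMem (show x ∉ {x | p x} from hx)]

lemma lintegral_ind_mem_mul {α : Type*} [MeasurableSpace α] (m : Measure α) {s : Set α}
    (h : MeasurableSet s) (f : α → ENNReal) :
    ∫⁻ x, ind (x ∈ s) * f x ∂m = ∫⁻ x in s, f x ∂m := lintegral_ind_mul m h f

/-- Sequences of pairs (increment, mark). -/
abbrev Path := ℕ → ℝ × ℝ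

/-- The law of an i.i.d. sequence. -/
abbrev pathLaw (ν : Measure (ℝ × ℝ)) : Measure Path := Measure.infinitePi fun _ => ν

/-- The walk along a sequence. -/
def pS (x : Path) (n : ℕ) : ℝ := ∑ i ∈ Finset.range n, (x i).1

/-- Shift of a sequence. -/
def pshift (k : ℕ) (x : Path) : Path := fun i => x (i + k)

/-- The index reversal of the first `n` places. -/
def revIdx (n i : ℕ) : ℕ := if i < n then n - 1 - i else i

/-- Reversal of the first `n` entries of a sequence. -/
def prev (n : ℕ) (x : Path) : Path := fun i => x (revIdx n i)

@[fun_prop]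
lemma measurable_pS (n : ℕ) : Measurable fun x : Path => pS x n := by
  unfold pS; fun_prop

@[fun_prop]
lemma measurable_pshift (k : ℕ) : Measurable (pshift k) := by
  unfold pshift; fun_prop

@[fun_prop]
lemma measurable_prev (n : ℕ) : Measurable (prev n) := by
  unfold prev; fun_prop

@[simp] lemma pS_zero (x : Path) : pS x 0 = 0 := by simp [pS]

lemma pS_succ (x : Path) (n : ℕ) : pS x (n + 1) = pS x n + (x n).1 := by
  simp [pS, Finset.sum_range_succ]

lemma pS_add (x : Path) (k n : ℕ) : pS x (k + n) = pS x k + pS (pshift k x) n := by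
  simp only [pS, pshift, Finset.sum_range_add]
  congr 1
  exact Finset.sum_congr rfl fun i _ => by rw [add_comm]

lemma pS_congr {x y : Path} {n : ℕ} (h : ∀ i < n, x i = y i) : pS x n = pS y n :=
  Finset.sum_congr rfl fun i hi => by rw [h i (Finset.mem_range.mp hi)]

lemma pS_prev (x : Path) {n i : ℕ} (hi : i ≤ n) : pS (prev n x) i = pS x n - pS x (n - i) := by
  induction i with
  | zero => simp
  | succ i ih =>
    rw [pS_succ, ih (by omega)]
    have h1 : prev n x i = x (n - 1 - i) := by simp [prev, revIdx, show i < n by omega]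
    have h2 : n - i = (n - 1 - i) + 1 := by omega
    rw [h1, h2, pS_succ, show n - (i + 1) = n - 1 - i by omega]
    ring

variable {ν : Measure (ℝ × ℝ)} [IsProbabilityMeasure ν]

lemma map_prev (n : ℕ) : (pathLaw ν).map (prev n) = pathLaw ν := by
  have hinv : ∀ i, revIdx n (revIdx n i) = i := by
    intro i; unfold revIdx; split_ifs <;> omega
  have hinj : Function.Injective (revIdx n) := fun i j h => by
    rw [← hinv i, h, hinv]
  exact Measure.map_infinitePi_infinitePi_of_inj (P := fun _ => ν) hinj

lemma lintegral_prev (n : ℕ) {F : Path → ENNReal} (hF : Measurable F) :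
    ∫⁻ x, F (prev n x) ∂(pathLaw ν) = ∫⁻ x, F x ∂(pathLaw ν) := by
  conv_rhs => rw [← map_prev n, lintegral_map hF (measurable_prev n)]

/-- Concatenation of the first `k` entries of a sequence with another sequence. -/
def pjoin (k : ℕ) (p : Path × Path) : Path := fun i => if i < k then p.1 i else p.2 (i - k)

lemma measurable_pjoin (k : ℕ) : Measurable (pjoin k) := by
  refine measurable_pi_lambda _ fun i => ?_
  unfold pjoin
  by_cases h : i < k
  · simp only [h, if_true]; fun_prop
  · simp only [h, if_false]; fun_prop

lemma map_pjoin (k : ℕ) :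
    ((pathLaw ν).prod (pathLaw ν)).map (pjoin k) = pathLaw ν := by
  classical
  refine Measure.eq_infinitePi _ fun s t ht => ?_
  rw [Measure.map_apply (measurable_pjoin k)
    (MeasurableSet.pi s.countable_toSet fun i _ => ht i)]
  have hpre : pjoin k ⁻¹' (Set.pi s t) =
      (Set.pi (s.filter (· < k)) t) ×ˢ
        (Set.pi ((s.filter (fun i => ¬ i < k)).image (· - k)) fun i => t (i + k)) := by
    ext ⟨x, y⟩
    simp only [mem_preimage, Set.mem_pi, Finset.mem_coe, mem_prod, Finset.mem_filter,
      Finset.mem_image, pjoin]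
    constructor
    · intro h
      refine ⟨fun i hi => by simpa [hi.2] using h i hi.1, ?_⟩
      rintro _ ⟨i, hi, rfl⟩
      have := h i hi.1
      rw [if_neg hi.2] at this
      rwa [Nat.sub_add_cancel (not_lt.mp hi.2)]
    · rintro ⟨h1, h2⟩ i hi
      by_cases hk : i < k
      · rw [if_pos hk]; exact h1 i ⟨hi, hk⟩
      · rw [if_neg hk]
        have := h2 (i - k) ⟨i, ⟨hi, hk⟩, rfl⟩
        rwa [Nat.sub_add_cancel (not_lt.mp hk)] at this
  rw [hpre, Measure.prod_prod, Measure.infinitePi_pi _ (fun i _ => ht i),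
    Measure.infinitePi_pi _ (fun i _ => ht _), Finset.prod_image]
  · rw [← Finset.prod_filter_mul_prod_filter_not s (· < k)]
    congr 1
    refine Finset.prod_congr rfl fun i hi => ?_
    rw [Nat.sub_add_cancel (not_lt.mp (Finset.mem_filter.mp hi).2)]
  · intro i hi j hj h
    have h1 := (Finset.mem_filter.mp hi).2
    have h2 := (Finset.mem_filter.mp hj).2
    simp only at h
    omega

/-- The Markov property at time `k`. -/
lemma lintegral_pshift (k : ℕ) {F : Path → Path → ENNReal}
    (hF : Measurable (Function.uncurry F))
    (hdep : ∀ x x' : Path, (∀ i < k, x i = x' i) → F x = F x') :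
    ∫⁻ x, F x (pshift k x) ∂(pathLaw ν) = ∫⁻ x, ∫⁻ y, F x y ∂(pathLaw ν) ∂(pathLaw ν) := by
  conv_lhs => rw [← map_pjoin (ν := ν) k]
  rw [lintegral_map _ (measurable_pjoin k)]
  · rw [lintegral_prod _]
    · refine lintegral_congr fun x => lintegral_congr fun y => ?_
      have h1 : pshift k (pjoin k (x, y)) = y := by
        funext i; simp [pshift, pjoin]
      rw [h1]
      refine congrFun (hdep _ _ fun i hi => ?_) y
      simp [pjoin, hi]
    · refine Measurable.aemeasurable ?_
      exact hF.comp ((measurable_pjoin k).prodMk ((measurable_pshift k).comp (measurable_pjoin k)))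
  · exact hF.comp (measurable_id.prodMk (measurable_pshift k))

/-- The walk stays in `D` at times `1, …, n`. -/
def stay (D : Set ℝ) (n : ℕ) (x : Path) : Prop := ∀ i, 1 ≤ i → i ≤ n → pS x i ∈ D

lemma stay_congr {D : Set ℝ} {n : ℕ} {x y : Path} (h : ∀ i < n, x i = y i) :
    stay D n x ↔ stay D n y := by
  unfold stay
  refine forall_congr' fun i => forall_congr' fun _ => forall_congr' fun hi => ?_
  rw [pS_congr fun j hj => h j (lt_of_lt_of_le hj hi)]

lemma stay_succ {D : Set ℝ} {n : ℕ} {x : Path} :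
    stay D (n + 1) x ↔ stay D n x ∧ pS x (n + 1) ∈ D := by
  constructor
  · exact fun h => ⟨fun i h1 h2 => h i h1 (by omega), h _ (by omega) le_rfl⟩
  · rintro ⟨h, h'⟩ i h1 h2
    rcases Nat.lt_or_ge i (n + 1) with h3 | h3
    · exact h i h1 (by omega)
    · rw [show i = n + 1 by omega]; exact h'

lemma measurableSet_stay {D : Set ℝ} (hD : MeasurableSet D) (n : ℕ) :
    MeasurableSet {x : Path | stay D n x} := by
  unfold stay
  simp only [ofPred_forall]
  refine MeasurableSet.iInter fun i => MeasurableSet.iInter fun _ => MeasurableSet.iInter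
    fun _ => ?_
  exact measurable_pS i hD

/-- The law of the walk on the event that it stays in `D`. -/
lemma lintegral_stay {D : Set ℝ} (hD : MeasurableSet D) (n : ℕ) {f : ℝ → ENNReal}
    (hf : Measurable f) :
    ∫⁻ x, ind (stay D n x) * f (pS x n) ∂(pathLaw ν) =
      ∫⁻ a, f a ∂(killed (ν.map Prod.fst) D n) := by
  have : IsProbabilityMeasure (ν.map Prod.fst) :=
    Measure.isProbabilityMeasure_map measurable_fst.aemeasurable
  induction n generalizing f with
  | zero =>
    have : ∀ x : Path, stay D 0 x := fun x i h1 h2 => by omega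
    simp [killed, ind_pos (this _), lintegral_dirac' _ hf]
  | succ n ih =>
    have hmf : Measurable fun a => ind (a ∈ D) * f a := (measurable_ind hD).mul hf
    have h1 := lintegral_pshift (ν := ν) n (F := fun x y =>
      ind (stay D n x) * (ind (pS x n + (y 0).1 ∈ D) * f (pS x n + (y 0).1)))
      (by
        refine Measurable.mul ?_ (hmf.comp (by fun_prop))
        exact measurable_ind (measurable_fst (measurableSet_stay hD n)))
      (fun x x' h => by
        funext y
        rw [pS_congr h, (propext (stay_congr h) : stay D n x = stay D n x')])
    have h2 : ∀ x : Path, ind (stay D (n + 1) x) * f (pS x (n + 1)) =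
        ind (stay D n x) * (ind (pS x n + (pshift n x 0).1 ∈ D) *
          f (pS x n + (pshift n x 0).1)) := by
      intro x
      have h3 : pS x n + (pshift n x 0).1 = pS x (n + 1) := by
        rw [pS_succ]; simp [pshift]
      rw [h3, (propext stay_succ : stay D (n + 1) x = _), ind_and, mul_assoc]
    simp_rw [h2]
    rw [h1, killed, ← lintegral_ind_mem_mul _ hD, Measure.lintegral_conv hmf, ← ih]
    · refine lintegral_congr fun x => ?_
      rw [lintegral_const_mul' _ _ (ind_ne_top _)]
      congr 1
      have hg : Measurable fun b => ind (pS x n + b ∈ D) * f (pS x n + b) :=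
        hmf.comp (measurable_const_add _)
      have e := lintegral_map (μ := pathLaw ν) (hg.comp measurable_fst)
        (measurable_pi_apply (0 : ℕ))
      rw [Measure.infinitePi_map_eval] at e
      rw [lintegral_map hg measurable_fst]
      exact e.symm
    · exact Measurable.lintegral_prod_right' (f := fun p : ℝ × ℝ => ind (p.1 + p.2 ∈ D) *
        f (p.1 + p.2))
        (hmf.comp (by fun_prop))

/-- Time `j` splits the walk up to time `N` into a part with increments to `j` in `D` and a
part with increments from `j` in `Dᶜ`. -/
def splitAt (D : Set ℝ) (N j : ℕ) (x : Path) : Prop :=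
  (∀ i < j, pS x j - pS x i ∈ D) ∧ stay Dᶜ (N - j) (pshift j x)

lemma stay_prev {D : Set ℝ} (j : ℕ) (x : Path) :
    (∀ i < j, pS (prev j x) j - pS (prev j x) i ∈ D) ↔ stay D j x := by
  have h : ∀ i ≤ j, pS (prev j x) j - pS (prev j x) i = pS x (j - i) := by
    intro i hi
    rw [pS_prev x le_rfl, pS_prev x hi]; simp
  constructor
  · intro H i h1 h2
    have := H (j - i) (by omega)
    rwa [h _ (by omega), show j - (j - i) = i by omega] at this
  · intro H i hi
    rw [h i hi.le]
    exact H _ (by omega) (by omega)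

lemma measurableSet_left {D : Set ℝ} (hD : MeasurableSet D) (j : ℕ) :
    MeasurableSet {x : Path | ∀ i < j, pS x j - pS x i ∈ D} := by
  simp only [ofPred_forall]
  refine MeasurableSet.iInter fun i => MeasurableSet.iInter fun _ => ?_
  exact (show Measurable fun x : Path => pS x j - pS x i by fun_prop) hD

lemma lintegral_splitAt {D : Set ℝ} (hD : MeasurableSet D) {N j : ℕ} (hj : j ≤ N)
    {G : ℝ → ℝ → ENNReal} (hG : Measurable (Function.uncurry G)) :
    ∫⁻ x, ind (splitAt D N j x) * G (pS x j) (pS x N - pS x j) ∂(pathLaw ν) =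
      ∫⁻ a, ∫⁻ b, G a b ∂(killed (ν.map Prod.fst) Dᶜ (N - j)) ∂(killed (ν.map Prod.fst) D j) := by
  have : IsProbabilityMeasure (ν.map Prod.fst) :=
    Measure.isProbabilityMeasure_map measurable_fst.aemeasurable
  have hA := measurable_ind (measurableSet_left hD j)
  have hB := measurable_ind (measurableSet_stay hD.compl (N - j))
  have h1 := lintegral_pshift (ν := ν) j (F := fun x y =>
      ind (∀ i < j, pS x j - pS x i ∈ D) *
        (ind (stay Dᶜ (N - j) y) * G (pS x j) (pS y (N - j))))
      (by
        refine Measurable.mul (hA.comp measurable_fst) (Measurable.mul (hB.comp measurable_snd) ?_)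
        exact hG.comp (((measurable_pS j).comp measurable_fst).prodMk
          ((measurable_pS (N - j)).comp measurable_snd)))
      (fun x x' h => by
        funext y
        have e1 : (∀ i < j, pS x j - pS x i ∈ D) = (∀ i < j, pS x' j - pS x' i ∈ D) := by
          refine propext (forall_congr' fun i => forall_congr' fun hi => ?_)
          rw [pS_congr h, pS_congr fun l hl => h l (hl.trans hi)]
        rw [e1, pS_congr h])
  have h2 : ∀ x : Path, ind (splitAt D N j x) * G (pS x j) (pS x N - pS x j) =
      ind (∀ i < j, pS x j - pS x i ∈ D) *
        (ind (stay Dᶜ (N - j) (pshift j x)) * G (pS x j) (pS (pshift j x) (N - j))) := by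
    intro x
    have h3 : pS x N - pS x j = pS (pshift j x) (N - j) := by
      have := pS_add x j (N - j)
      rw [Nat.add_sub_cancel' hj] at this
      linarith
    rw [h3, splitAt, ind_and, mul_assoc]
  simp_rw [h2]
  rw [h1]
  have hGa : ∀ a, Measurable fun b => G a b := fun a => hG.comp
      (measurable_const.prodMk measurable_id)
  have hG' : Measurable fun a => ∫⁻ b, G a b ∂(killed (ν.map Prod.fst) Dᶜ (N - j)) :=
    Measurable.lintegral_prod_right' (f := Function.uncurry G) hG
  have h4 : ∀ x : Path, ∫⁻ y, ind (∀ i < j, pS x j - pS x i ∈ D) *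
        (ind (stay Dᶜ (N - j) y) * G (pS x j) (pS y (N - j))) ∂(pathLaw ν) =
      ind (∀ i < j, pS x j - pS x i ∈ D) *
        ∫⁻ b, G (pS x j) b ∂(killed (ν.map Prod.fst) Dᶜ (N - j)) := by
    intro x
    rw [lintegral_const_mul' _ _ (ind_ne_top _),
      lintegral_stay hD.compl (N - j) (hGa _)]
  simp_rw [h4]
  have h5 := lintegral_prev (ν := ν) j (hA.mul (hG'.comp (measurable_pS j)))
  simp only [Pi.mul_apply, Function.comp_apply] at h5
  rw [← h5, ← lintegral_stay hD j hG']
  refine lintegral_congr fun x => ?_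
  rw [(propext (stay_prev j x) : (∀ i < j, _) = stay D j x), pS_prev x le_rfl]
  simp

end pathspace

section pathtilt

variable {ν : Measure (ℝ × ℝ)} [IsProbabilityMeasure ν]

lemma splitAt_iff {D : Set ℝ} {N j : ℕ} (hj : j ≤ N) (x : Path) :
    splitAt D N j x ↔ (∀ i < j, pS x j - pS x i ∈ D) ∧
      ∀ l, j < l → l ≤ N → pS x l - pS x j ∉ D := by
  unfold splitAt stay
  refine and_congr_right fun _ => ?_
  have h : ∀ i, pS (pshift j x) i = pS x (j + i) - pS x j := fun i => by rw [pS_add]; ring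
  constructor
  · intro H l h1 h2
    have := H (l - j) (by omega) (by omega)
    rwa [h, Nat.add_sub_cancel' h1.le] at this
  · intro H i h1 h2
    rw [h]
    exact H (j + i) (by omega) (by omega)

lemma exists_splitAt {D : Set ℝ} (hadd : ∀ x ∈ D, ∀ y ∈ D, x + y ∈ D)
    (haddc : ∀ x ∉ D, ∀ y ∉ D, x + y ∉ D) (N : ℕ) (x : Path) :
    ∃ j ≤ N, splitAt D N j x := by
  induction N with
  | zero => exact ⟨0, le_rfl, (splitAt_iff le_rfl x).mpr ⟨fun i hi => by omega,
      fun l h1 h2 => by omega⟩⟩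
  | succ N ih =>
    by_cases hall : ∀ i < N + 1, pS x (N + 1) - pS x i ∈ D
    · exact ⟨N + 1, le_rfl, (splitAt_iff le_rfl x).mpr ⟨hall,
      fun l h1 h2 => by omega⟩⟩
    · push Not at hall
      obtain ⟨i, hi, hiD⟩ := hall
      obtain ⟨j, hj, hs⟩ := ih
      rw [splitAt_iff hj] at hs
      refine ⟨j, by omega, (splitAt_iff (by omega) x).mpr ⟨hs.1, fun l h1 h2 => ?_⟩⟩
      rcases Nat.lt_or_ge l (N + 1) with hl | hl
      · exact hs.2 l h1 (by omega)
      · obtain rfl : l = N + 1 := by omega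
        rcases lt_trichotomy i j with h | h | h
        · intro hD
          apply hiD
          have := hadd _ hD _ (hs.1 i h)
          rwa [show pS x (N + 1) - pS x j + (pS x j - pS x i) = pS x (N + 1) - pS x i by ring]
            at this
        · rwa [← h]
        · have := haddc _ hiD _ (hs.2 i h (by omega))
          rwa [show pS x (N + 1) - pS x i + (pS x i - pS x j) = pS x (N + 1) - pS x j by ring]
            at this

lemma splitAt_unique {D : Set ℝ} {N i j : ℕ} {x : Path} (hi : i ≤ N) (hj : j ≤ N)
    (h1 : splitAt D N i x) (h2 : splitAt D N j x) : i = j := by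
  rw [splitAt_iff hi] at h1
  rw [splitAt_iff hj] at h2
  rcases lt_trichotomy i j with h | h | h
  · exact absurd (h2.1 i h) (h1.2 j h hj)
  · exact h
  · exact absurd (h1.1 j h) (h2.2 i h hi)

lemma sum_ind_splitAt {D : Set ℝ} (hadd : ∀ x ∈ D, ∀ y ∈ D, x + y ∈ D)
    (haddc : ∀ x ∉ D, ∀ y ∉ D, x + y ∉ D) (N : ℕ) (x : Path) (c : ENNReal) (f : ℕ → ENNReal)
    (hf : ∀ j ≤ N, splitAt D N j x → f j = c) :
    ∑ j ∈ Finset.range (N + 1), ind (splitAt D N j x) * f j = c := by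
  obtain ⟨j, hj, hs⟩ := exists_splitAt hadd haddc N x
  rw [Finset.sum_eq_single_of_mem j (Finset.mem_range.mpr (by omega)), ind_pos hs, one_mul,
    hf j hj hs]
  intro i hi hij
  rw [ind_neg, zero_mul]
  intro h
  exact hij (splitAt_unique (by have := Finset.mem_range.mp hi; omega) hj h hs)

lemma measurableSet_splitAt {D : Set ℝ} (hD : MeasurableSet D) (N j : ℕ) :
    MeasurableSet {x : Path | splitAt D N j x} :=
  (measurableSet_left hD j).inter (measurable_pshift j (measurableSet_stay hD.compl _))

/-- Decomposition of a path functional at the splitting time. -/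
lemma lintegral_eq_sum_split {D : Set ℝ} (hD : MeasurableSet D)
    (hadd : ∀ x ∈ D, ∀ y ∈ D, x + y ∈ D)
    (haddc : ∀ x ∉ D, ∀ y ∉ D, x + y ∉ D) (N : ℕ) {F : Path → ENNReal} {G : ℝ → ℝ → ENNReal}
    (hG : Measurable (Function.uncurry G))
    (hFG : ∀ x, ∀ j ≤ N, splitAt D N j x → F x = G (pS x j) (pS x N - pS x j)) :
    ∫⁻ x, F x ∂(pathLaw ν) = ∑ j ∈ Finset.range (N + 1),
      ∫⁻ a, ∫⁻ b, G a b ∂(killed (ν.map Prod.fst) Dᶜ (N - j)) ∂(killed (ν.map Prod.fst) D j) := by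
  have h1 : ∀ x, F x = ∑ j ∈ Finset.range (N + 1),
      ind (splitAt D N j x) * G (pS x j) (pS x N - pS x j) := fun x =>
    (sum_ind_splitAt hadd haddc N x _ _ fun j hj hs => (hFG x j hj hs).symm).symm
  simp_rw [h1]
  rw [lintegral_finsetSum]
  · exact Finset.sum_congr rfl fun j hj =>
      lintegral_splitAt hD (by have := Finset.mem_range.mp hj; omega) hG
  · intro j _
    exact (measurable_ind (measurableSet_splitAt hD N j)).mul
      (hG.comp ((measurable_pS j).prodMk ((measurable_pS N).sub (measurable_pS j))))

/-- The walk stays strictly below `y` up to time `N`. -/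
def below (y : ℝ) (N : ℕ) (x : Path) : Prop := ∀ i ≤ N, pS x i < y

lemma measurableSet_below (N : ℕ) : MeasurableSet {p : ℝ × Path | below p.1 N p.2} := by
  unfold below
  simp only [ofPred_forall]
  refine MeasurableSet.iInter fun i => MeasurableSet.iInter fun _ => ?_
  exact measurableSet_lt (by fun_prop) (by fun_prop)

/-- The semigroup of the reflected walk `y - S` killed on leaving `(0, ∞)`. -/
def pE (ν : Measure (ℝ × ℝ)) (N : ℕ) (y : ℝ) (H : ℝ → ENNReal) : ENNReal :=
  ∫⁻ x, ind (below y N x) * H (y - pS x N) ∂(pathLaw ν)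

lemma measurable_ind_below (N : ℕ) {H : ℝ → ENNReal} (hH : Measurable H) :
    Measurable fun p : ℝ × Path => ind (below p.1 N p.2) * H (p.1 - pS p.2 N) :=
  (measurable_ind (measurableSet_below N)).mul (hH.comp (by fun_prop))

lemma add_mem_Ici : ∀ x ∈ Ici (0 : ℝ), ∀ y ∈ Ici (0 : ℝ), x + y ∈ Ici (0 : ℝ) := by
  intro x hx y hy; simp only [mem_Ici] at *; linarith

lemma add_notMem_Ici : ∀ x ∉ Ici (0 : ℝ), ∀ y ∉ Ici (0 : ℝ), x + y ∉ Ici (0 : ℝ) := by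
  intro x hx y hy; simp only [mem_Ici, not_le] at *; linarith

/-- Decomposition at the last time of the maximum. -/
lemma pE_eq_sum (N : ℕ) (y : ℝ) {H : ℝ → ENNReal} (hH : Measurable H) :
    pE ν N y H = ∑ j ∈ Finset.range (N + 1),
      ∫⁻ a, ∫⁻ b, ind (a < y) * H (y - a - b) ∂(killed (ν.map Prod.fst) (Iio 0) (N - j))
        ∂(killed (ν.map Prod.fst) (Ici 0) j) := by
  have h := lintegral_eq_sum_split (ν := ν) measurableSet_Ici add_mem_Ici add_notMem_Ici N
    (F := fun x => ind (below y N x) * H (y - pS x N))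
    (G := fun a b => ind (a < y) * H (y - a - b))
    (by
      refine Measurable.mul (measurable_ind ?_) (hH.comp (by fun_prop))
      exact measurableSet_lt measurable_fst measurable_const)
    (fun x j hj hs => by
      have hb : below y N x = (pS x j < y) := by
        rw [splitAt_iff hj] at hs
        refine propext ⟨fun h => h j hj, fun h i hi => ?_⟩
        rcases lt_trichotomy i j with h' | h' | h'
        · have := mem_Ici.mp (hs.1 i h'); linarith
        · rw [h']; exact h
        · have := hs.2 i h' hi; simp only [mem_Ici, not_le] at this; linarith
      simp only [hb]
      congr 2; ring)
  rw [compl_Ici] at h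
  exact h

lemma lintegral_exp_mul_pE (N : ℕ) {lam u : ℝ} (hl : 0 < lam) (hu : 0 < u) :
    ∫⁻ y in Ioi 0, ENNReal.ofReal (Real.exp (-lam * y)) *
        pE ν N y (fun w => ENNReal.ofReal (Real.exp (-u * w))) =
      ENNReal.ofReal ((lam + u)⁻¹ * ∑ j ∈ Finset.range (N + 1),
        kmgf (ν.map Prod.fst) (Ici 0) (-lam) j * kmgf (ν.map Prod.fst) (Iio 0) u (N - j)) := by
  have : IsProbabilityMeasure (ν.map Prod.fst) :=
    Measure.isProbabilityMeasure_map measurable_fst.aemeasurable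
  set ρ := ν.map Prod.fst
  have hpE : ∀ y, pE ν N y (fun w => ENNReal.ofReal (Real.exp (-u * w))) =
      ∑ j ∈ Finset.range (N + 1), ENNReal.ofReal (kmgf ρ (Iio 0) u (N - j)) *
        ∫⁻ a, ind (a < y) * ENNReal.ofReal (Real.exp (-u * (y - a))) ∂(killed ρ (Ici 0) j) := by
    intro y
    rw [pE_eq_sum N y (by fun_prop)]
    refine Finset.sum_congr rfl fun j _ => ?_
    rw [← (ofReal_kmgf (ρ := ρ) (D := Iio 0) measurableSet_Iio (c := u) (fun x hx => by
      have := mem_Iio.mp hx; nlinarith) (N - j)).1, ← lintegral_const_mul]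
    · refine lintegral_congr fun a => ?_
      rw [← lintegral_mul_const _ (by fun_prop)]
      refine lintegral_congr fun b => ?_
      rw [mul_left_comm, ← ENNReal.ofReal_mul (Real.exp_pos _).le, ← Real.exp_add]
      congr 3; ring
    · exact (measurable_ind measurableSet_Iio).mul (by fun_prop)
  simp_rw [hpE, Finset.mul_sum]
  have hm2 : Measurable fun p : ℝ × ℝ => ind (p.2 < p.1) *
      ENNReal.ofReal (Real.exp (-u * (p.1 - p.2))) :=
    (measurable_ind (measurableSet_lt measurable_snd measurable_fst)).mul (by fun_prop)
  rw [lintegral_finsetSum]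
  swap
  · intro j _
    refine Measurable.mul (by fun_prop) (Measurable.const_mul ?_ _)
    exact Measurable.lintegral_prod_right' hm2
  rw [ENNReal.ofReal_sum_of_nonneg (fun j _ => mul_nonneg (by positivity)
    (mul_nonneg (kmgf_nonneg _ _) (kmgf_nonneg _ _)))]
  refine Finset.sum_congr rfl fun j _ => ?_
  have h1 : ∀ y, ENNReal.ofReal (Real.exp (-lam * y)) *
      (ENNReal.ofReal (kmgf ρ (Iio 0) u (N - j)) *
        ∫⁻ a, ind (a < y) * ENNReal.ofReal (Real.exp (-u * (y - a))) ∂(killed ρ (Ici 0) j)) =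
      ENNReal.ofReal (kmgf ρ (Iio 0) u (N - j)) * ∫⁻ a, ENNReal.ofReal (Real.exp (-lam * y)) *
        (ind (a < y) * ENNReal.ofReal (Real.exp (-u * (y - a)))) ∂(killed ρ (Ici 0) j) := by
    intro y
    rw [lintegral_const_mul' _ _ ENNReal.ofReal_ne_top, mul_left_comm]
  simp_rw [h1]
  have hm3 : Measurable fun p : ℝ × ℝ => ENNReal.ofReal (Real.exp (-lam * p.1)) *
      (ind (p.2 < p.1) * ENNReal.ofReal (Real.exp (-u * (p.1 - p.2)))) :=
    Measurable.mul (by fun_prop) hm2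
  rw [lintegral_const_mul' _ _ ENNReal.ofReal_ne_top, lintegral_lintegral_swap hm3.aemeasurable]
  have h2 : ∫⁻ a, (∫⁻ y in Ioi 0, ENNReal.ofReal (Real.exp (-lam * y)) *
      (ind (a < y) * ENNReal.ofReal (Real.exp (-u * (y - a))))) ∂(killed ρ (Ici 0) j) =
      ∫⁻ a, ENNReal.ofReal ((lam + u)⁻¹) * ENNReal.ofReal (Real.exp (-lam * a))
        ∂(killed ρ (Ici 0) j) := by
    refine lintegral_congr_ae ?_
    have hnn : ∀ᵐ a ∂(killed ρ (Ici 0) j), 0 ≤ a := by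
      rw [ae_iff]; simp only [not_le]; exact killed_Ici_null j
    filter_upwards [hnn] with a ha
    have h3 : ∀ y, ENNReal.ofReal (Real.exp (-lam * y)) *
        (ind (a < y) * ENNReal.ofReal (Real.exp (-u * (y - a)))) =
        ind (y ∈ Ioi a) * (ENNReal.ofReal (Real.exp (u * a)) *
          ENNReal.ofReal (Real.exp (-(lam + u) * y))) := by
      intro y
      rw [mul_left_comm, ← ENNReal.ofReal_mul (Real.exp_pos _).le,
        ← ENNReal.ofReal_mul (Real.exp_pos _).le, ← Real.exp_add, ← Real.exp_add]
      congr 3; ring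
    simp_rw [h3]
    rw [lintegral_ind_mem_mul _ measurableSet_Ioi, Measure.restrict_restrict measurableSet_Ioi,
      inter_eq_left.mpr (Ioi_subset_Ioi ha), lintegral_const_mul' _ _ ENNReal.ofReal_ne_top,
      lintegral_exp_neg_Ioi (by positivity), ← ENNReal.ofReal_mul (Real.exp_pos _).le,
      ← ENNReal.ofReal_mul (by positivity), mul_left_comm, ← Real.exp_add]
    congr 3; ring
  rw [h2, lintegral_const_mul' _ _ ENNReal.ofReal_ne_top,
    (ofReal_kmgf (ρ := ρ) (D := Ici 0) measurableSet_Ici (c := -lam) (fun x hx => by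
      have := mem_Ici.mp hx; nlinarith) j).1, ← ENNReal.ofReal_mul (by positivity),
    ← ENNReal.ofReal_mul (kmgf_nonneg _ _)]
  congr 1; ring

end pathtilt

/-- Convergence of mixed moments on the unit square implies convergence of the integrals of
products of continuous functions. -/
lemma tendsto_lintegral_of_moments {m : ℕ → Measure (ℝ × ℝ)} {m' : Measure (ℝ × ℝ)}
    (hm : ∀ N, ∀ᵐ p ∂(m N), p.1 ∈ Icc (0 : ℝ) 1 ∧ p.2 ∈ Icc (0 : ℝ) 1)
    (hm' : ∀ᵐ p ∂m', p.1 ∈ Icc (0 : ℝ) 1 ∧ p.2 ∈ Icc (0 : ℝ) 1)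
    (hfin : ∀ N, IsFiniteMeasure (m N)) [IsFiniteMeasure m']
    (hmom : ∀ i j : ℕ, Tendsto (fun N => ∫⁻ p, ENNReal.ofReal (p.1 ^ i * p.2 ^ j) ∂(m N)) atTop
      (𝓝 (∫⁻ p, ENNReal.ofReal (p.1 ^ i * p.2 ^ j) ∂m')))
    {f g : ℝ → ℝ} (hf : ContinuousOn f (Icc 0 1)) (hg : ContinuousOn g (Icc 0 1))
    (hf0 : ∀ x ∈ Icc (0 : ℝ) 1, 0 ≤ f x) (hg0 : ∀ x ∈ Icc (0 : ℝ) 1, 0 ≤ g x)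
    (hfm : Measurable f) (hgm : Measurable g) :
    Tendsto (fun N => ∫⁻ p, ENNReal.ofReal (f p.1 * g p.2) ∂(m N)) atTop
      (𝓝 (∫⁻ p, ENNReal.ofReal (f p.1 * g p.2) ∂m')) := by
  obtain ⟨Cf, hCf⟩ := isCompact_Icc.exists_bound_of_continuousOn hf
  obtain ⟨Cg, hCg⟩ := isCompact_Icc.exists_bound_of_continuousOn hg
  -- integrability of bounded functions
  have key : ∀ (μ : Measure (ℝ × ℝ)), IsFiniteMeasure μ →
      (∀ᵐ p ∂μ, p.1 ∈ Icc (0 : ℝ) 1 ∧ p.2 ∈ Icc (0 : ℝ) 1) → ∀ F : ℝ × ℝ → ℝ, Measurable F →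
      ∀ C : ℝ, (∀ p : ℝ × ℝ, p.1 ∈ Icc (0 : ℝ) 1 → p.2 ∈ Icc (0 : ℝ) 1 → |F p| ≤ C) →
      Integrable F μ := by
    intro μ _ hμ F hF C hC
    refine Integrable.of_bound hF.aestronglyMeasurable C ?_
    filter_upwards [hμ] with p hp using hC p hp.1 hp.2
  have hmono : ∀ (μ : Measure (ℝ × ℝ)), IsFiniteMeasure μ →
      (∀ᵐ p ∂μ, p.1 ∈ Icc (0 : ℝ) 1 ∧ p.2 ∈ Icc (0 : ℝ) 1) → ∀ i j : ℕ,
      Integrable (fun p : ℝ × ℝ => p.1 ^ i * p.2 ^ j) μ := by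
    intro μ h1 h2 i j
    refine key μ h1 h2 _ (by fun_prop) 1 fun p h3 h4 => ?_
    rw [abs_of_nonneg (mul_nonneg (pow_nonneg h3.1 _) (pow_nonneg h4.1 _))]
    exact mul_le_one₀ (pow_le_one₀ h3.1 h3.2) (pow_nonneg h4.1 _) (pow_le_one₀ h4.1 h4.2)
  have hconv : ∀ (μ : Measure (ℝ × ℝ)), IsFiniteMeasure μ →
      (∀ᵐ p ∂μ, p.1 ∈ Icc (0 : ℝ) 1 ∧ p.2 ∈ Icc (0 : ℝ) 1) → ∀ F : ℝ × ℝ → ℝ, Integrable F μ →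
      (∀ p : ℝ × ℝ, p.1 ∈ Icc (0 : ℝ) 1 → p.2 ∈ Icc (0 : ℝ) 1 → 0 ≤ F p) →
      ∫⁻ p, ENNReal.ofReal (F p) ∂μ = ENNReal.ofReal (∫ p, F p ∂μ) := by
    intro μ _ hμ F hF h0
    rw [ofReal_integral_eq_lintegral_ofReal hF]
    filter_upwards [hμ] with p hp using h0 p hp.1 hp.2
  have hfgm : Measurable fun p : ℝ × ℝ => f p.1 * g p.2 := by fun_prop
  have hfgb : ∀ p : ℝ × ℝ, p.1 ∈ Icc (0 : ℝ) 1 → p.2 ∈ Icc (0 : ℝ) 1 →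
      |f p.1 * g p.2| ≤ Cf * Cg := by
    intro p h1 h2
    rw [abs_mul]
    exact mul_le_mul (hCf _ h1) (hCg _ h2) (abs_nonneg _) ((abs_nonneg _).trans (hCf _ h1))
  have hfgi := fun μ h1 h2 => key μ h1 h2 _ hfgm (Cf * Cg) hfgb
  have hfg0 : ∀ p : ℝ × ℝ, p.1 ∈ Icc (0 : ℝ) 1 → p.2 ∈ Icc (0 : ℝ) 1 → 0 ≤ f p.1 * g p.2 :=
    fun p h1 h2 => mul_nonneg (hf0 _ h1) (hg0 _ h2)
  rw [hconv m' inferInstance hm' _ (hfgi m' inferInstance hm') hfg0]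
  simp_rw [fun N => hconv (m N) (hfin N) (hm N) _ (hfgi (m N) (hfin N) (hm N)) hfg0]
  refine ENNReal.tendsto_ofReal ?_
  -- real moments
  have hmomR : ∀ i j : ℕ, Tendsto (fun N => ∫ p, p.1 ^ i * p.2 ^ j ∂(m N)) atTop
      (𝓝 (∫ p, p.1 ^ i * p.2 ^ j ∂m')) := by
    intro i j
    have h0 : ∀ p : ℝ × ℝ, p.1 ∈ Icc (0 : ℝ) 1 → p.2 ∈ Icc (0 : ℝ) 1 → 0 ≤ p.1 ^ i * p.2 ^ j :=
      fun p h1 h2 => mul_nonneg (pow_nonneg h1.1 _) (pow_nonneg h2.1 _)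
    have h1 := hmom i j
    rw [hconv m' inferInstance hm' _ (hmono m' inferInstance hm' i j) h0] at h1
    simp_rw [fun N => hconv (m N) (hfin N) (hm N) _ (hmono (m N) (hfin N) (hm N) i j) h0] at h1
    have h2 := (ENNReal.tendsto_toReal ENNReal.ofReal_ne_top).comp h1
    have h3 : ∀ μ : Measure (ℝ × ℝ), (∀ᵐ p ∂μ, p.1 ∈ Icc (0 : ℝ) 1 ∧ p.2 ∈ Icc (0 : ℝ) 1) →
        0 ≤ ∫ p, p.1 ^ i * p.2 ^ j ∂μ := fun μ hμ => integral_nonneg_of_ae (by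
      filter_upwards [hμ] with p hp using h0 p hp.1 hp.2)
    rw [ENNReal.toReal_ofReal (h3 m' hm')] at h2
    refine h2.congr fun N => ?_
    simp only [Function.comp]
    rw [ENNReal.toReal_ofReal (h3 _ (hm N))]
  have hpoly : ∀ P R : Polynomial ℝ, Tendsto (fun N => ∫ p, P.eval p.1 * R.eval p.2 ∂(m N)) atTop
      (𝓝 (∫ p, P.eval p.1 * R.eval p.2 ∂m')) := by
    intro P R
    have h : ∀ μ : Measure (ℝ × ℝ), IsFiniteMeasure μ →
        (∀ᵐ p ∂μ, p.1 ∈ Icc (0 : ℝ) 1 ∧ p.2 ∈ Icc (0 : ℝ) 1) →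
        ∫ p, P.eval p.1 * R.eval p.2 ∂μ = ∑ i ∈ Finset.range (P.natDegree + 1),
          ∑ j ∈ Finset.range (R.natDegree + 1),
            P.coeff i * R.coeff j * ∫ p, p.1 ^ i * p.2 ^ j ∂μ := by
      intro μ h1 h2
      have e : ∀ p : ℝ × ℝ, P.eval p.1 * R.eval p.2 = ∑ i ∈ Finset.range (P.natDegree + 1),
          ∑ j ∈ Finset.range (R.natDegree + 1),
            P.coeff i * R.coeff j * (p.1 ^ i * p.2 ^ j) := by
        intro p
        rw [Polynomial.eval_eq_sum_range, Polynomial.eval_eq_sum_range, Finset.sum_mul_sum]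
        exact Finset.sum_congr rfl fun i _ => Finset.sum_congr rfl fun j _ => by ring
      simp_rw [e]
      rw [integral_finsetSum _ fun i _ => integrable_finsetSum _ fun j _ =>
        (hmono μ h1 h2 i j).const_mul _]
      refine Finset.sum_congr rfl fun i _ => ?_
      rw [integral_finsetSum _ fun j _ => (hmono μ h1 h2 i j).const_mul _]
      exact Finset.sum_congr rfl fun j _ => integral_const_mul _ _
    rw [h m' inferInstance hm']
    simp_rw [fun N => h (m N) (hfin N) (hm N)]
    exact tendsto_finsetSum _ fun i _ => tendsto_finsetSum _ fun j _ =>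
      (hmomR i j).const_mul _
  have hmass : Tendsto (fun N => (m N).real univ) atTop (𝓝 (m'.real univ)) := by
    have := hmomR 0 0
    simpa using this
  rw [Metric.tendsto_atTop]
  intro ε hε
  set M := m'.real univ + 1
  have hM : 0 < M := by positivity
  have hCf0 : 0 ≤ Cf := (norm_nonneg _).trans (hCf 0 (by simp))
  have hCg0 : 0 ≤ Cg := (norm_nonneg _).trans (hCg 0 (by simp))
  set δ := min 1 (ε / (4 * M * (Cf + Cg + 1)))
  have hδ : 0 < δ := by positivity
  obtain ⟨P, hP⟩ := exists_polynomial_near_of_continuousOn 0 1 f hf δ hδ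
  obtain ⟨R, hR⟩ := exists_polynomial_near_of_continuousOn 0 1 g hg δ hδ
  have hclose : ∀ p : ℝ × ℝ, p.1 ∈ Icc (0 : ℝ) 1 → p.2 ∈ Icc (0 : ℝ) 1 →
      |f p.1 * g p.2 - P.eval p.1 * R.eval p.2| ≤ ε / (4 * M) := by
    intro p h1 h2
    have e1 := (hP _ h1).le
    have e2 := (hR _ h2).le
    have e3 := hCf _ h1
    have e4 := hCg _ h2
    rw [Real.norm_eq_abs] at e3 e4
    have : f p.1 * g p.2 - P.eval p.1 * R.eval p.2 =
      -((P.eval p.1 - f p.1) * g p.2) - f p.1 * (R.eval p.2 - g p.2)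
        - (P.eval p.1 - f p.1) * (R.eval p.2 - g p.2) := by ring
    rw [this]
    calc _ ≤ δ * Cg + Cf * δ + δ * δ := by
          refine (abs_sub _ _).trans (add_le_add ((abs_sub _ _).trans (add_le_add ?_ ?_)) ?_)
          · rw [abs_neg, abs_mul]; gcongr
          · rw [abs_mul]; gcongr
          · rw [abs_mul]; gcongr
      _ ≤ δ * (Cf + Cg + 1) := by
          have : δ * δ ≤ δ * 1 := by gcongr; exact min_le_left _ _
          linarith
      _ ≤ ε / (4 * M * (Cf + Cg + 1)) * (Cf + Cg + 1) := by gcongr; exact min_le_right _ _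
      _ = ε / (4 * M) := by field_simp
  have hPb : ∃ C, ∀ p : ℝ × ℝ, p.1 ∈ Icc (0 : ℝ) 1 → p.2 ∈ Icc (0 : ℝ) 1 →
      |P.eval p.1 * R.eval p.2| ≤ C := by
    refine ⟨ε / (4 * M) + Cf * Cg, fun p h1 h2 => ?_⟩
    have e1 := hclose p h1 h2
    have e2 := hfgb p h1 h2
    rw [abs_le] at *
    constructor <;> linarith
  obtain ⟨CP, hCP⟩ := hPb
  have hdiff : ∀ μ : Measure (ℝ × ℝ), IsFiniteMeasure μ →
      (∀ᵐ p ∂μ, p.1 ∈ Icc (0 : ℝ) 1 ∧ p.2 ∈ Icc (0 : ℝ) 1) →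
      |∫ p, f p.1 * g p.2 ∂μ - ∫ p, P.eval p.1 * R.eval p.2 ∂μ| ≤ ε / (4 * M) * μ.real univ := by
    intro μ h1 h2
    have hPm : Measurable fun p : ℝ × ℝ => P.eval p.1 * R.eval p.2 :=
      ((P.continuous.comp continuous_fst).mul (R.continuous.comp continuous_snd)).measurable
    rw [← integral_sub (hfgi μ h1 h2) (key μ h1 h2 _ hPm CP hCP)]
    rw [← Real.norm_eq_abs]
    refine norm_integral_le_of_norm_le_const ?_
    filter_upwards [h2] with p hp using hclose p hp.1 hp.2
  obtain ⟨N1, hN1⟩ := Metric.tendsto_atTop.mp (hpoly P R) (ε / 4) (by positivity)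
  obtain ⟨N2, hN2⟩ := Metric.tendsto_atTop.mp hmass 1 one_pos
  refine ⟨max N1 N2, fun N hN => ?_⟩
  have a1 := hN1 N (le_trans (le_max_left _ _) hN)
  have a2 := hN2 N (le_trans (le_max_right _ _) hN)
  have a3 := hdiff (m N) (hfin N) (hm N)
  have a4 := hdiff m' inferInstance hm'
  rw [Real.dist_eq] at *
  have a5 : (m N).real univ ≤ M := by
    have := (abs_lt.mp a2).2
    simp only [M]; linarith
  have b3 : ε / (4 * M) * (m N).real univ ≤ ε / 4 := by
    calc _ ≤ ε / (4 * M) * M := by gcongr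
      _ = ε / 4 := by field_simp
  have b4 : ε / (4 * M) * m'.real univ ≤ ε / 4 := by
    calc _ ≤ ε / (4 * M) * M := by gcongr; simp only [M]; linarith
      _ = ε / 4 := by field_simp
  rw [abs_le] at a3 a4
  rw [abs_lt] at a1 ⊢
  constructor <;> linarith

section duality

variable {ν : Measure (ℝ × ℝ)} [IsProbabilityMeasure ν]

/-- The joint law of exponentials of the starting point and of the end point of the reflected
walk, as a measure on the unit square. -/
def weakMeas (ν : Measure (ℝ × ℝ)) (N : ℕ) : Measure (ℝ × ℝ) :=
  ENNReal.ofReal (wt N) • ((((volume : Measure ℝ).restrict (Ioi 0)).prod (pathLaw ν)).withDensity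
    fun p => ENNReal.ofReal (Real.exp (-p.1 / 2)) * (ind (below p.1 N p.2) *
      ENNReal.ofReal (Real.exp (-(p.1 - pS p.2 N) / 2)))).map
    fun p => (Real.exp (-p.1 / 2), Real.exp (-(p.1 - pS p.2 N) / 2))

/-- The limit of `weakMeas`. -/
def weakLim (ρ : Measure ℝ) (κ : ℝ) : Measure (ℝ × ℝ) :=
  ENNReal.ofReal κ • (((((volume : Measure ℝ).restrict (Ioi 0)).withDensity
      fun y => ENNReal.ofReal (Real.exp (-y / 2)) * vE ρ y).map fun y => Real.exp (-y / 2)).prod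
    ((((volume : Measure ℝ).restrict (Ioi 0)).withDensity
      fun y => ENNReal.ofReal (Real.exp (-y / 2)) * uE ρ y).map fun y => Real.exp (-y / 2)))

lemma exp_mem_Icc {y : ℝ} (hy : 0 < y) : Real.exp (-y / 2) ∈ Icc (0 : ℝ) 1 :=
  ⟨(Real.exp_pos _).le, Real.exp_le_one_iff.mpr (by linarith)⟩

lemma measurable_weakDens (N : ℕ) : Measurable fun p : ℝ × Path =>
    ENNReal.ofReal (Real.exp (-p.1 / 2)) * (ind (below p.1 N p.2) *
      ENNReal.ofReal (Real.exp (-(p.1 - pS p.2 N) / 2))) :=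
  Measurable.mul (by fun_prop)
    (measurable_ind_below N (H := fun w => ENNReal.ofReal (Real.exp (-w / 2))) (by fun_prop))

lemma lintegral_weakMeas (N : ℕ) {f g : ℝ → ℝ} (hf : Measurable f) (hg : Measurable g)
    (hf0 : ∀ x ∈ Icc (0 : ℝ) 1, 0 ≤ f x) :
    ∫⁻ p, ENNReal.ofReal (f p.1 * g p.2) ∂(weakMeas ν N) = ENNReal.ofReal (wt N) *
      ∫⁻ y in Ioi 0, ENNReal.ofReal (Real.exp (-y / 2) * f (Real.exp (-y / 2))) *
        pE ν N y (fun w => ENNReal.ofReal (Real.exp (-w / 2) * g (Real.exp (-w / 2)))) := by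
  have hd := measurable_weakDens N
  have hφ : Measurable fun p : ℝ × Path =>
    (Real.exp (-p.1 / 2), Real.exp (-(p.1 - pS p.2 N) / 2)) := by fun_prop
  have hF : Measurable fun p : ℝ × ℝ => ENNReal.ofReal (f p.1 * g p.2) := by fun_prop
  have hF' : Measurable fun p : ℝ × Path =>
    ENNReal.ofReal (f (Real.exp (-p.1 / 2)) * g (Real.exp (-(p.1 - pS p.2 N) / 2))) := hF.comp hφ
  rw [weakMeas, lintegral_smul_measure, lintegral_map hF hφ, smul_eq_mul,
    lintegral_withDensity_eq_lintegral_mul _ hd hF', lintegral_prod _ (hd.mul hF').aemeasurable]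
  congr 1
  refine setLIntegral_congr_fun measurableSet_Ioi fun y hy => ?_
  simp only [pE, Pi.mul_apply]
  rw [← lintegral_const_mul' _ _ ENNReal.ofReal_ne_top]
  refine lintegral_congr fun x => ?_
  rw [ENNReal.ofReal_mul (hf0 _ (exp_mem_Icc hy)), ENNReal.ofReal_mul (Real.exp_pos _).le,
    ENNReal.ofReal_mul (Real.exp_pos _).le]
  ring

lemma lintegral_weakLim (ρ : Measure ℝ) (κ : ℝ) {f g : ℝ → ℝ} (hf : Measurable f)
    (hg : Measurable g) (hf0 : ∀ x ∈ Icc (0 : ℝ) 1, 0 ≤ f x) :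
    ∫⁻ p, ENNReal.ofReal (f p.1 * g p.2) ∂(weakLim ρ κ) = ENNReal.ofReal κ *
      ((∫⁻ y in Ioi 0, ENNReal.ofReal (Real.exp (-y / 2) * f (Real.exp (-y / 2))) * vE ρ y) *
      ∫⁻ y in Ioi 0, ENNReal.ofReal (Real.exp (-y / 2) * g (Real.exp (-y / 2))) * uE ρ y) := by
  have one : ∀ (q : ℝ → ENNReal) (hq : Measurable q) (f : ℝ → ℝ) (_ : Measurable f),
      ∫⁻ x, ENNReal.ofReal (f x) ∂((((volume : Measure ℝ).restrict (Ioi 0)).withDensity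
        fun y => ENNReal.ofReal (Real.exp (-y / 2)) * q y).map fun y => Real.exp (-y / 2)) =
      ∫⁻ y in Ioi 0, ENNReal.ofReal (Real.exp (-y / 2) * f (Real.exp (-y / 2))) * q y := by
    intro q hq f hf
    have h1 : Measurable fun y : ℝ => ENNReal.ofReal (f (Real.exp (-y / 2))) := by fun_prop
    have h2 : Measurable fun y : ℝ => ENNReal.ofReal (Real.exp (-y / 2)) * q y := by fun_prop
    rw [lintegral_map (by fun_prop) (by fun_prop), lintegral_withDensity_eq_lintegral_mul _ h2 h1]
    refine lintegral_congr fun y => ?_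
    simp only [Pi.mul_apply]
    rw [ENNReal.ofReal_mul (Real.exp_pos _).le]; ring
  rw [weakLim, lintegral_smul_measure, smul_eq_mul, ← one _ measurable_vE _ hf,
    ← one _ measurable_uE _ hg]
  congr 1
  have hsf : ∀ (q : ℝ → ENNReal), Measurable q → SFinite
      ((((volume : Measure ℝ).restrict (Ioi 0)).withDensity
        fun y => ENNReal.ofReal (Real.exp (-y / 2)) * q y).map fun y => Real.exp (-y / 2)) := by
    intro q hq; infer_instance
  have := hsf _ (measurable_uE (ρ := ρ))
  have := hsf _ (measurable_vE (ρ := ρ))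
  have hf0' : ∀ᵐ x ∂((((volume : Measure ℝ).restrict (Ioi 0)).withDensity
      fun y => ENNReal.ofReal (Real.exp (-y / 2)) * vE ρ y).map fun y => Real.exp (-y / 2)),
      0 ≤ f x := by
    rw [ae_map_iff (by fun_prop) (measurableSet_le measurable_const hf)]
    refine (withDensity_absolutelyContinuous _ _).ae_le ?_
    filter_upwards [ae_restrict_mem measurableSet_Ioi] with y hy using hf0 _ (exp_mem_Icc hy)
  rw [← lintegral_prod_mul (by fun_prop) (by fun_prop)]
  refine lintegral_congr_ae ?_
  filter_upwards [Measure.quasiMeasurePreserving_fst.ae hf0'] with p hp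
  rw [ENNReal.ofReal_mul hp]

omit [IsProbabilityMeasure ν] in
lemma ae_weakMeas (N : ℕ) :
    ∀ᵐ p ∂(weakMeas ν N), p.1 ∈ Icc (0 : ℝ) 1 ∧ p.2 ∈ Icc (0 : ℝ) 1 := by
  refine Measure.ae_smul_measure ?_ _
  refine (ae_map_iff (Measurable.aemeasurable (by fun_prop))
    ((measurableSet_Icc.preimage measurable_fst).inter
      (measurableSet_Icc.preimage measurable_snd))).mpr ?_
  rw [ae_withDensity_iff (measurable_weakDens N)]
  refine ae_of_all _ fun p hp => ?_
  have hb : below p.1 N p.2 := by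
    by_contra hb
    rw [ind_neg hb] at hp
    simp at hp
  have h0 := hb 0 (Nat.zero_le _)
  rw [pS_zero] at h0
  exact ⟨exp_mem_Icc h0, exp_mem_Icc (by linarith [hb N le_rfl])⟩

lemma ae_weakLim (ρ : Measure ℝ) (κ : ℝ) :
    ∀ᵐ p ∂(weakLim ρ κ), p.1 ∈ Icc (0 : ℝ) 1 ∧ p.2 ∈ Icc (0 : ℝ) 1 := by
  refine Measure.ae_smul_measure ?_ _
  have one : ∀ (q : ℝ → ENNReal),
      ∀ᵐ x ∂((((volume : Measure ℝ).restrict (Ioi 0)).withDensity q).map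
        fun y => Real.exp (-y / 2)), x ∈ Icc (0 : ℝ) 1 := by
    intro q
    refine (ae_map_iff (Measurable.aemeasurable (by fun_prop)) measurableSet_Icc).mpr ?_
    refine (withDensity_absolutelyContinuous _ _).ae_le ?_
    filter_upwards [ae_restrict_mem measurableSet_Ioi] with y hy using exp_mem_Icc hy
  filter_upwards [Measure.quasiMeasurePreserving_fst.ae (one _),
    Measure.quasiMeasurePreserving_snd.ae (one _)] with p h1 h2 using ⟨h1, h2⟩

lemma exp_half_mul_pow (y : ℝ) (i : ℕ) :
    Real.exp (-y / 2) * Real.exp (-y / 2) ^ i = Real.exp (-(((i : ℝ) + 1) / 2) * y) := by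
  rw [← Real.exp_nat_mul, ← Real.exp_add]
  congr 1; ring

lemma moment_weakMeas (N i j : ℕ) :
    ∫⁻ p, ENNReal.ofReal (p.1 ^ i * p.2 ^ j) ∂(weakMeas ν N) = ENNReal.ofReal
      ((((i : ℝ) + 1) / 2 + ((j : ℝ) + 1) / 2)⁻¹ * (wt N * ∑ l ∈ Finset.range (N + 1),
        kmgf (ν.map Prod.fst) (Ici 0) (-(((i : ℝ) + 1) / 2)) l *
          kmgf (ν.map Prod.fst) (Iio 0) (((j : ℝ) + 1) / 2) (N - l))) := by
  rw [lintegral_weakMeas N (f := fun x => x ^ i) (g := fun x => x ^ j) (by fun_prop) (by fun_prop)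
    (fun x hx => pow_nonneg hx.1 _)]
  simp_rw [exp_half_mul_pow]
  rw [lintegral_exp_mul_pE N (by positivity) (by positivity), ← ENNReal.ofReal_mul (wt_nonneg N)]
  congr 1; ring

lemma moment_weakLim {ρ : Measure ℝ} [IsProbabilityMeasure ρ] {κ : ℝ} (h : KilledAsymp ρ κ)
    (i j : ℕ) :
    ∫⁻ p, ENNReal.ofReal (p.1 ^ i * p.2 ^ j) ∂(weakLim ρ κ) = ENNReal.ofReal
      (κ * (((((i : ℝ) + 1) / 2)⁻¹ * ∑' l, kmgf ρ (Ici 0) (-(((i : ℝ) + 1) / 2)) l) *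
        ((((j : ℝ) + 1) / 2)⁻¹ * ∑' l, kmgf ρ (Iio 0) (((j : ℝ) + 1) / 2) l))) := by
  rw [lintegral_weakLim ρ κ (f := fun x => x ^ i) (g := fun x => x ^ j) (by fun_prop) (by fun_prop)
    (fun x hx => pow_nonneg hx.1 _)]
  simp_rw [exp_half_mul_pow]
  have := h.1.le
  have h1 : 0 ≤ ∑' l, kmgf ρ (Ici 0) (-(((i : ℝ) + 1) / 2)) l := tsum_nonneg (kmgf_nonneg _)
  have h2 : 0 ≤ ∑' l, kmgf ρ (Iio 0) (((j : ℝ) + 1) / 2) l := tsum_nonneg (kmgf_nonneg _)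
  rw [lintegral_exp_mul_vE h (by positivity), lintegral_exp_mul_uE h (by positivity),
    ENNReal.ofReal_mul h.1.le, ENNReal.ofReal_mul (mul_nonneg (by positivity) h1)]

lemma isFiniteMeasure_weakMeas (N : ℕ) : IsFiniteMeasure (weakMeas ν N) := by
  have := moment_weakMeas (ν := ν) N 0 0
  simp only [pow_zero, mul_one, ENNReal.ofReal_one, lintegral_one] at this
  exact ⟨this ▸ ENNReal.ofReal_lt_top⟩

lemma isFiniteMeasure_weakLim {ρ : Measure ℝ} [IsProbabilityMeasure ρ] {κ : ℝ}
    (h : KilledAsymp ρ κ) : IsFiniteMeasure (weakLim ρ κ) := by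
  have := moment_weakLim h 0 0
  simp only [pow_zero, mul_one, ENNReal.ofReal_one, lintegral_one] at this
  exact ⟨this ▸ ENNReal.ofReal_lt_top⟩

lemma tendsto_moment {κ : ℝ} (h : KilledAsymp (ν.map Prod.fst) κ) (i j : ℕ) :
    Tendsto (fun N => ∫⁻ p, ENNReal.ofReal (p.1 ^ i * p.2 ^ j) ∂(weakMeas ν N)) atTop
      (𝓝 (∫⁻ p, ENNReal.ofReal (p.1 ^ i * p.2 ^ j) ∂(weakLim (ν.map Prod.fst) κ))) := by
  have : IsProbabilityMeasure (ν.map Prod.fst) :=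
    Measure.isProbabilityMeasure_map measurable_fst.aemeasurable
  rw [moment_weakLim h]
  simp_rw [moment_weakMeas]
  refine ENNReal.tendsto_ofReal ?_
  set a : ℝ := ((i : ℝ) + 1) / 2
  set b : ℝ := ((j : ℝ) + 1) / 2
  have ha : 0 < a := by positivity
  have hb : 0 < b := by positivity
  have := (tendsto_wt_conv (kmgf_nonneg _) (kmgf_nonneg _) (h.2 a ha).2.1 (h.2 b hb).1.1
    (h.2 a ha).2.2 (h.2 b hb).1.2).const_mul ((a + b)⁻¹)
  convert this using 2
  field_simp

/-- The function on `[0,1]` that corresponds to `G` under the change of variables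
`x = exp (-w/2)`. -/
def expChart (G : ℝ → ℝ) (x : ℝ) : ℝ := G (-2 * Real.log x) / x

lemma expChart_exp (G : ℝ → ℝ) (w : ℝ) :
    Real.exp (-w / 2) * expChart G (Real.exp (-w / 2)) = G w := by
  rw [expChart, Real.log_exp, mul_div_cancel₀ _ (Real.exp_ne_zero _)]
  congr 1; ring

lemma continuousOn_expChart {G : ℝ → ℝ} (hG : Continuous G) {C : ℝ}
    (hC : ∀ w, 0 ≤ w → |G w| ≤ C * Real.exp (-w)) : ContinuousOn (expChart G) (Icc 0 1) := by
  intro x hx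
  rcases hx.1.eq_or_lt with h0 | h0
  · subst h0
    have hv : expChart G 0 = 0 := by simp [expChart]
    rw [ContinuousWithinAt, hv]
    refine squeeze_zero_norm' (a := fun x => C * |x|) ?_ ?_
    · filter_upwards [self_mem_nhdsWithin] with y hy
      rcases hy.1.eq_or_lt with h1 | h1
      · simp [expChart, ← h1]
      · have h2 := hC (-2 * Real.log y) (by
          have := Real.log_nonpos hy.1 hy.2; linarith)
        rw [show -(-2 * Real.log y) = Real.log y + Real.log y by ring, Real.exp_add,
          Real.exp_log h1] at h2
        rw [expChart, norm_div, Real.norm_eq_abs, Real.norm_eq_abs, abs_of_pos h1,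
          div_le_iff₀ h1]
        linarith
    · have : Tendsto (fun x : ℝ => C * |x|) (𝓝 0) (𝓝 (C * |(0 : ℝ)|)) :=
        (continuous_const.mul continuous_abs).tendsto 0
      rw [abs_zero, mul_zero] at this
      exact this.mono_left nhdsWithin_le_nhds
  · refine ContinuousAt.continuousWithinAt ?_
    unfold expChart
    refine ContinuousAt.div (hG.continuousAt.comp ?_) continuousAt_id h0.ne'
    exact continuousAt_const.mul (Real.continuousAt_log h0.ne')

/-- Weak convergence of the reflected walk killed on leaving the half line, normalised. -/
theorem tendsto_pE_weak {κ : ℝ} (h : KilledAsymp (ν.map Prod.fst) κ) {G₁ G₂ : ℝ → ℝ}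
    (h1 : Continuous G₁) (h2 : Continuous G₂) (h10 : ∀ w, 0 ≤ G₁ w) (h20 : ∀ w, 0 ≤ G₂ w)
    {C₁ C₂ : ℝ} (h1C : ∀ w, 0 ≤ w → G₁ w ≤ C₁ * Real.exp (-w))
    (h2C : ∀ w, 0 ≤ w → G₂ w ≤ C₂ * Real.exp (-w)) :
    Tendsto (fun N => ENNReal.ofReal (wt N) *
      ∫⁻ y in Ioi 0, ENNReal.ofReal (G₁ y) * pE ν N y (fun w => ENNReal.ofReal (G₂ w))) atTop
      (𝓝 (ENNReal.ofReal κ * ((∫⁻ y in Ioi 0, ENNReal.ofReal (G₁ y) * vE (ν.map Prod.fst) y) *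
        ∫⁻ w in Ioi 0, ENNReal.ofReal (G₂ w) * uE (ν.map Prod.fst) w))) := by
  have : IsProbabilityMeasure (ν.map Prod.fst) :=
    Measure.isProbabilityMeasure_map measurable_fst.aemeasurable
  have hm : ∀ G : ℝ → ℝ, Continuous G → Measurable (expChart G) := fun G hG =>
    (hG.measurable.comp (by fun_prop)).div measurable_id
  have hn : ∀ G : ℝ → ℝ, (∀ w, 0 ≤ G w) → ∀ x ∈ Icc (0 : ℝ) 1, 0 ≤ expChart G x :=
    fun G hG x hx => div_nonneg (hG _) hx.1
  have := isFiniteMeasure_weakLim h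
  have key := tendsto_lintegral_of_moments (m := weakMeas ν) (m' := weakLim (ν.map Prod.fst) κ)
    ae_weakMeas (ae_weakLim _ κ) isFiniteMeasure_weakMeas (tendsto_moment h)
    (continuousOn_expChart h1 fun w hw => by rw [abs_of_nonneg (h10 w)]; exact h1C w hw)
    (continuousOn_expChart h2 fun w hw => by rw [abs_of_nonneg (h20 w)]; exact h2C w hw)
    (hn _ h10) (hn _ h20) (hm _ h1) (hm _ h2)
  rw [lintegral_weakLim _ κ (hm _ h1) (hm _ h2) (hn _ h10)] at key
  simp_rw [fun N => lintegral_weakMeas (ν := ν) N (hm _ h1) (hm _ h2) (hn _ h10),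
    expChart_exp] at key
  exact key

end duality

section endpoint

variable {ν : Measure (ℝ × ℝ)} [IsProbabilityMeasure ν]

instance isProbabilityMeasure_map_fst : IsProbabilityMeasure (ν.map Prod.fst) :=
  Measure.isProbabilityMeasure_map measurable_fst.aemeasurable

omit [IsProbabilityMeasure ν] in
lemma pE_of_nonpos (N : ℕ) {y : ℝ} (hy : y ≤ 0) (H : ℝ → ENNReal) : pE ν N y H = 0 := by
  unfold pE
  have : ∀ x : Path, ind (below y N x) * H (y - pS x N) = 0 := fun x => by
    rw [ind_neg, zero_mul]
    intro h
    have := h 0 (Nat.zero_le _)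
    rw [pS_zero] at this
    linarith
  simp [this]

omit [IsProbabilityMeasure ν] in
lemma mul_pE_le (N : ℕ) {y y' : ℝ} (hy : y ≤ y') {c : ENNReal} (hc : c ≠ ⊤) {H H' : ℝ → ENNReal}
    (hH : ∀ w, c * H w ≤ H' (w + (y' - y))) : c * pE ν N y H ≤ pE ν N y' H' := by
  unfold pE
  rw [← lintegral_const_mul' _ _ hc]
  refine lintegral_mono fun x => ?_
  rw [mul_left_comm]
  refine mul_le_mul' (ind_mono fun h i hi => (h i hi).trans_le hy) ?_
  have := hH (y - pS x N)
  rwa [show y - pS x N + (y' - y) = y' - pS x N by ring] at this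

lemma exists_pE_exp_le {κ : ℝ} (h : KilledAsymp (ν.map Prod.fst) κ) {lam α : ℝ} (hl : 0 < lam)
    (hα : 0 < α) : ∃ C : ℝ, 0 < C ∧ ∀ N, 1 ≤ N → ∀ y,
      pE ν N y (fun w => ENNReal.ofReal (Real.exp (-α * w))) ≤
        ENNReal.ofReal (C * Real.exp (lam * y) / wt N) := by
  have hconv := (tendsto_wt_conv (kmgf_nonneg _) (kmgf_nonneg _) (h.2 lam hl).2.1 (h.2 α hα).1.1
    (h.2 lam hl).2.2 (h.2 α hα).1.2)
  obtain ⟨K, hK⟩ := hconv.bddAbove_range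
  refine ⟨Real.exp (lam + α) * ((lam + α)⁻¹ * (|K| + 1)), by positivity, fun N hN y => ?_⟩
  rcases le_or_gt y 0 with hy | hy
  · rw [pE_of_nonpos N hy]; exact zero_le
  have hw := wt_pos hN
  set H : ℝ → ENNReal := fun w => ENNReal.ofReal (Real.exp (-α * w))
  have h1 : ∀ y' ∈ Ioc y (y + 1), ENNReal.ofReal (Real.exp (-lam * (y + 1) - α)) * pE ν N y H ≤
      ENNReal.ofReal (Real.exp (-lam * y')) * pE ν N y' H := by
    intro y' hy'
    rw [sub_eq_add_neg, Real.exp_add, ENNReal.ofReal_mul (Real.exp_pos _).le, mul_assoc]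
    refine mul_le_mul' (ENNReal.ofReal_le_ofReal (Real.exp_le_exp.mpr ?_))
      (mul_pE_le N hy'.1.le ENNReal.ofReal_ne_top fun w => ?_)
    · nlinarith [hy'.2]
    · rw [← ENNReal.ofReal_mul (Real.exp_pos _).le, ← Real.exp_add]
      refine ENNReal.ofReal_le_ofReal (Real.exp_le_exp.mpr ?_)
      nlinarith [hy'.2]
  have h2 : ENNReal.ofReal (Real.exp (-lam * (y + 1) - α)) * pE ν N y H ≤
      ∫⁻ y' in Ioi 0, ENNReal.ofReal (Real.exp (-lam * y')) * pE ν N y' H := by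
    calc _ = ∫⁻ _ in Ioc y (y + 1), ENNReal.ofReal (Real.exp (-lam * (y + 1) - α)) *
        pE ν N y H := by
          rw [setLIntegral_const]; simp
      _ ≤ ∫⁻ y' in Ioc y (y + 1), ENNReal.ofReal (Real.exp (-lam * y')) * pE ν N y' H :=
          setLIntegral_mono' measurableSet_Ioc h1
      _ ≤ _ := lintegral_mono_set fun x hx => lt_trans hy hx.1
  rw [lintegral_exp_mul_pE N hl hα] at h2
  have h3 := hK (mem_range_self N)
  set Sg := ∑ j ∈ Finset.range (N + 1),
    kmgf (ν.map Prod.fst) (Ici 0) (-lam) j * kmgf (ν.map Prod.fst) (Iio 0) α (N - j)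
  have h4 : Sg ≤ (|K| + 1) / wt N := by
    rw [le_div_iff₀ hw]
    linarith [le_abs_self K]
  have h5 : pE ν N y H ≤ ENNReal.ofReal (Real.exp (lam * (y + 1) + α)) *
      ENNReal.ofReal ((lam + α)⁻¹ * Sg) := by
    calc pE ν N y H = ENNReal.ofReal (Real.exp (lam * (y + 1) + α)) *
          (ENNReal.ofReal (Real.exp (-lam * (y + 1) - α)) * pE ν N y H) := by
          rw [← mul_assoc, ← ENNReal.ofReal_mul (Real.exp_pos _).le, ← Real.exp_add,
            show lam * (y + 1) + α + (-lam * (y + 1) - α) = 0 by ring]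
          simp
      _ ≤ _ := mul_le_mul_right h2 _
  refine h5.trans ?_
  rw [← ENNReal.ofReal_mul (Real.exp_pos _).le]
  refine ENNReal.ofReal_le_ofReal ?_
  calc Real.exp (lam * (y + 1) + α) * ((lam + α)⁻¹ * Sg)
      ≤ Real.exp (lam * (y + 1) + α) * ((lam + α)⁻¹ * ((|K| + 1) / wt N)) := by gcongr
    _ = _ := by
      rw [show lam * (y + 1) + α = lam + α + lam * y by ring, Real.exp_add]
      ring

/-- Backward moving average. -/
def smooth (H : ℝ → ℝ) (δ w : ℝ) : ℝ := δ⁻¹ * ∫ s in (w - δ)..w, H s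

section smooth

variable {H : ℝ → ℝ} (hm : Measurable H) (h0 : ∀ w, 0 ≤ H w) (hneg : ∀ w ≤ 0, H w = 0) {C : ℝ}
  (hC : ∀ w, H w ≤ C * Real.exp (-w))

include hm h0 hneg hC

lemma intervalIntegrable_of_exp_bound (a b : ℝ) : IntervalIntegrable H volume a b := by
  have hC0 : 0 ≤ C := by
    have := (h0 0).trans (hC 0)
    simpa using this
  refine (intervalIntegrable_const (c := C)).mono_fun' hm.aestronglyMeasurable
    (ae_of_all _ fun w => ?_)
  show ‖H w‖ ≤ C
  rw [Real.norm_eq_abs, abs_of_nonneg (h0 w)]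
  rcases le_or_gt w 0 with hw | hw
  · rw [hneg w hw]; exact hC0
  · refine (hC w).trans ?_
    have : Real.exp (-w) ≤ 1 := Real.exp_le_one_iff.mpr (by linarith)
    nlinarith

lemma continuous_smooth (δ : ℝ) : Continuous (smooth H δ) := by
  have hi := intervalIntegrable_of_exp_bound hm h0 hneg hC
  have h : ∀ w, smooth H δ w = δ⁻¹ * ((∫ s in (0 : ℝ)..w, H s) - ∫ s in (0 : ℝ)..(w - δ), H s) := by
    intro w
    rw [smooth, intervalIntegral.integral_interval_sub_left (hi _ _) (hi _ _)]
  rw [show smooth H δ = _ from funext h]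
  have hp := intervalIntegral.continuous_primitive hi 0
  exact continuous_const.mul (hp.sub (hp.comp (continuous_id.sub continuous_const)))

omit hm hneg hC in
lemma smooth_nonneg {δ : ℝ} (hδ : 0 < δ) (w : ℝ) : 0 ≤ smooth H δ w :=
  mul_nonneg (inv_nonneg.mpr hδ.le)
    (intervalIntegral.integral_nonneg (by linarith) fun s _ => h0 s)

lemma smooth_le_of_le {δ : ℝ} (hδ : 0 < δ) {w c : ℝ} (h : ∀ s ∈ Icc (w - δ) w, H s ≤ c) :
    smooth H δ w ≤ c := by
  have hi := intervalIntegrable_of_exp_bound hm h0 hneg hC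
  have := intervalIntegral.integral_mono_on (μ := volume) (by linarith) (hi (w - δ) w)
    (intervalIntegrable_const (c := c)) h
  rw [intervalIntegral.integral_const, smul_eq_mul, sub_sub_cancel] at this
  rw [smooth, inv_mul_le_iff₀ hδ]
  exact this

lemma ofReal_smooth {δ : ℝ} (hδ : 0 < δ) (w : ℝ) : ENNReal.ofReal (smooth H δ w) =
    ENNReal.ofReal δ⁻¹ * ∫⁻ s in Ico 0 δ, ENNReal.ofReal (H (w - s)) := by
  have hi := intervalIntegrable_of_exp_bound hm h0 hneg hC
  rw [smooth, ENNReal.ofReal_mul (inv_nonneg.mpr hδ.le)]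
  congr 1
  rw [intervalIntegral.integral_of_le (by linarith), ofReal_integral_eq_lintegral_ofReal
    ((intervalIntegrable_iff_integrableOn_Ioc_of_le (by linarith)).mp (hi _ _))
    (ae_of_all _ h0)]
  have : (fun s => w - s) ⁻¹' Ioc (w - δ) w = Ico 0 δ := by
    ext s; simp only [mem_preimage, mem_Ioc, mem_Ico]; constructor <;> rintro ⟨h1, h2⟩ <;>
      constructor <;> linarith
  rw [← (Measure.measurePreserving_sub_left volume w).setLIntegral_comp_preimage measurableSet_Ioc
    (hm.ennreal_ofReal), this]

lemma le_lintegral_smooth {q : ℝ → ENNReal} (hq : Monotone q) {δ : ℝ} (hδ : 0 < δ) :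
    ∫⁻ w in Ioi 0, ENNReal.ofReal (H w) * q w ≤
      ∫⁻ w in Ioi 0, ENNReal.ofReal (smooth H δ w) * q w := by
  have hqm := hq.measurable
  have hset : ∀ w, w ∉ Ioi (0 : ℝ) → H w = 0 := fun w hw => hneg w (not_lt.mp hw)
  have hall : ∀ f : ℝ → ENNReal, (∀ w, w ∉ Ioi (0 : ℝ) → f w = 0) →
      ∫⁻ w in Ioi 0, f w = ∫⁻ w, f w := by
    intro f hf
    refine setLIntegral_eq_of_support_subset ?_
    intro w hw
    by_contra hc
    exact hw (hf w hc)
  have hs0 : ∀ w, w ∉ Ioi (0 : ℝ) → smooth H δ w = 0 := by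
    intro w hw
    refine le_antisymm (smooth_le_of_le hm h0 hneg hC hδ fun s hs => ?_)
      (smooth_nonneg h0 hδ w)
    exact (hneg s (hs.2.trans (not_lt.mp hw))).le
  rw [hall _ (fun w hw => by simp [hset w hw]), hall _ (fun w hw => by simp [hs0 w hw])]
  simp_rw [ofReal_smooth hm h0 hneg hC hδ]
  have h1 : ∀ w, ENNReal.ofReal δ⁻¹ * (∫⁻ s in Ico 0 δ, ENNReal.ofReal (H (w - s))) * q w =
      ENNReal.ofReal δ⁻¹ * ∫⁻ s in Ico 0 δ, ENNReal.ofReal (H (w - s)) * q w := by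
    intro w
    rw [mul_assoc, lintegral_mul_const _ (by fun_prop)]
  simp_rw [h1]
  rw [lintegral_const_mul' _ _ ENNReal.ofReal_ne_top]
  have hm2 : Measurable (Function.uncurry fun w s : ℝ => ENNReal.ofReal (H (w - s)) * q w) := by
    unfold Function.uncurry; fun_prop
  rw [lintegral_lintegral_swap hm2.aemeasurable]
  calc ∫⁻ w, ENNReal.ofReal (H w) * q w
      = ENNReal.ofReal δ⁻¹ * ∫⁻ _ in Ico 0 δ, ∫⁻ w, ENNReal.ofReal (H w) * q w := by
        rw [setLIntegral_const, Real.volume_Ico, sub_zero, mul_comm, mul_assoc,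
          ← ENNReal.ofReal_mul hδ.le, mul_inv_cancel₀ hδ.ne', ENNReal.ofReal_one, mul_one]
    _ ≤ _ := by
        refine mul_le_mul_right (setLIntegral_mono' measurableSet_Ico fun s hs => ?_) _
        calc _ ≤ ∫⁻ w, ENNReal.ofReal (H w) * q (w + s) :=
              lintegral_mono fun w => mul_le_mul_right (hq (by linarith [hs.1])) _
          _ = _ := by
              rw [← lintegral_sub_right_eq_self (fun w => ENNReal.ofReal (H w) * q (w + s)) s]
              simp

end smooth

lemma lintegral_mul_uE_lt_top {ρ : Measure ℝ} [IsProbabilityMeasure ρ] {κ : ℝ}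
    (h : KilledAsymp ρ κ) {H : ℝ → ℝ} {C : ℝ} (hC : ∀ w, H w ≤ C * Real.exp (-w)) :
    ∫⁻ w in Ioi 0, ENNReal.ofReal (H w) * uE ρ w < ⊤ := by
  calc _ ≤ ∫⁻ w in Ioi 0, ENNReal.ofReal |C| * (ENNReal.ofReal (Real.exp (-1 * w)) * uE ρ w) := by
        refine lintegral_mono fun w => ?_
        rw [← mul_assoc, ← ENNReal.ofReal_mul (abs_nonneg _), neg_one_mul]
        refine mul_le_mul_left (ENNReal.ofReal_le_ofReal ((hC w).trans ?_)) _
        have := Real.exp_pos (-w)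
        nlinarith [le_abs_self C]
    _ < ⊤ := by
        rw [lintegral_const_mul' _ _ ENNReal.ofReal_ne_top, lintegral_exp_mul_uE h one_pos]
        exact ENNReal.mul_lt_top ENNReal.ofReal_lt_top ENNReal.ofReal_lt_top

/-- Lower bound in the local limit theorem for the reflected walk, with a fixed width of the
smoothing. -/
lemma le_liminf_pE_aux {κ : ℝ} (h : KilledAsymp (ν.map Prod.fst) κ) {H : ℝ → ℝ}
    (hm : Measurable H) (h0 : ∀ w, 0 ≤ H w) (hneg : ∀ w ≤ 0, H w = 0) {C : ℝ}
    (hC : ∀ w, H w ≤ C * Real.exp (-w))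
    (hmon : ∀ s w, 0 ≤ s → s ≤ 1 / 10 → (1 - 5 * s) * H w ≤ H (w + s)) {y δ : ℝ}
    (hδ : 0 < δ) (hδ1 : δ ≤ 1 / 10) (hy : δ < y) :
    ENNReal.ofReal ((1 - 5 * δ) ^ 2 * κ) * vE (ν.map Prod.fst) (y - δ) *
        ∫⁻ w in Ioi 0, ENNReal.ofReal (H w) * uE (ν.map Prod.fst) w ≤
      liminf (fun N => ENNReal.ofReal (wt N) * pE ν N y fun w => ENNReal.ofReal (H w)) atTop := by
  set ρ := ν.map Prod.fst
  have hC0 : 0 ≤ C := by simpa using (h0 0).trans (hC 0)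
  have h5 : 0 ≤ 1 - 5 * δ := by linarith
  set G : ℝ → ℝ := fun x => max 0 (δ / 2 - |x - (y - δ / 2)|)
  have hGc : Continuous G := by fun_prop
  have hGsupp : ∀ x, x ∉ Icc (y - δ) y → G x = 0 := by
    intro x hx
    refine max_eq_left ?_
    by_contra hc
    apply hx
    have : |x - (y - δ / 2)| < δ / 2 := by linarith
    rw [abs_lt] at this
    constructor <;> linarith
  have hG0 : ∀ w, 0 ≤ G w := fun w => le_max_left _ _
  have hG1 : ∀ w, G w ≤ δ / 2 := fun w => max_le (by linarith)
      (by linarith [abs_nonneg (w - (y - δ / 2))])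
  have hGexp : ∀ w, 0 ≤ w → G w ≤ (δ / 2 * Real.exp y) * Real.exp (-w) := by
    intro w _
    by_cases hw : w ∈ Icc (y - δ) y
    · refine (hG1 w).trans ?_
      rw [mul_assoc, ← Real.exp_add]
      have : 1 ≤ Real.exp (y + -w) := Real.one_le_exp (by linarith [hw.2])
      nlinarith
    · rw [hGsupp w hw]; positivity
  -- the mass of the kernel
  set K : ENNReal := ∫⁻ x in Ioi 0, ENNReal.ofReal (G x)
  have hKtop : K ≠ ⊤ := by
    refine (lt_of_le_of_lt (lintegral_mono (g := (Icc (y - δ) y).indicator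
      fun _ => ENNReal.ofReal (δ / 2)) fun x => ?_) ?_).ne
    · by_cases hx : x ∈ Icc (y - δ) y
      · rw [indicator_of_mem hx]; exact ENNReal.ofReal_le_ofReal (hG1 x)
      · rw [indicator_of_notMem hx, hGsupp x hx]; simp
    · refine (setLIntegral_le_lintegral _ _).trans_lt ?_
      rw [lintegral_indicator_const measurableSet_Icc]
      exact ENNReal.mul_lt_top ENNReal.ofReal_lt_top (by simp)
  have hK0 : K ≠ 0 := by
    intro hK
    rw [lintegral_eq_zero_iff hGc.measurable.ennreal_ofReal] at hK
    have hsub : Ioo (y - δ) y ⊆ {x | ¬ (ENNReal.ofReal (G x) = (0 : ℝ → ENNReal) x)} ∩ Ioi 0 := by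
      intro x hx
      refine ⟨?_, mem_Ioi.mpr (by linarith [hx.1])⟩
      simp only [Pi.zero_apply, ENNReal.ofReal_eq_zero, not_le, mem_ofPred_eq]
      refine lt_max_of_lt_right ?_
      have : |x - (y - δ / 2)| < δ / 2 := abs_lt.mpr ⟨by linarith [hx.1], by linarith [hx.2]⟩
      linarith
    have h1 := measure_mono (μ := volume) hsub
    have h2 := ae_iff.mp hK
    rw [Measure.restrict_apply' measurableSet_Ioi] at h2
    simp only [Pi.zero_apply] at h1 h2
    rw [h2, Real.volume_Ioo, nonpos_iff_eq_zero, ENNReal.ofReal_eq_zero] at h1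
    linarith
  -- comparison with the smoothed function
  have hsm : ∀ w, (1 - 5 * δ) * smooth H δ w ≤ H w := by
    intro w
    rcases h5.eq_or_lt with h6 | h6
    · rw [← h6, zero_mul]; exact h0 w
    · rw [← le_div_iff₀' h6]
      refine smooth_le_of_le hm h0 hneg hC hδ fun s hs => ?_
      rw [le_div_iff₀' h6]
      have := hmon (w - s) s (by linarith [hs.2]) (by linarith [hs.1])
      rw [add_sub_cancel] at this
      refine le_trans (mul_le_mul_of_nonneg_right ?_ (h0 s)) this
      linarith [hs.1]
  have hsmexp : ∀ w, 0 ≤ w → smooth H δ w ≤ (C * Real.exp δ) * Real.exp (-w) := by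
    intro w _
    refine smooth_le_of_le hm h0 hneg hC hδ fun s hs => (hC s).trans ?_
    rw [mul_assoc, ← Real.exp_add]
    gcongr
    linarith [hs.1]
  have hlim := tendsto_pE_weak h hGc (continuous_smooth hm h0 hneg hC δ) hG0
    (smooth_nonneg h0 hδ) hGexp hsmexp
  -- finite bounds
  have hN : ∀ N, ENNReal.ofReal ((1 - 5 * δ) ^ 2) * (ENNReal.ofReal (wt N) *
      ∫⁻ x in Ioi 0, ENNReal.ofReal (G x) * pE ν N x (fun w => ENNReal.ofReal (smooth H δ w))) ≤
      K * (ENNReal.ofReal (wt N) * pE ν N y fun w => ENNReal.ofReal (H w)) := by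
    intro N
    rw [mul_left_comm, mul_left_comm K, ← lintegral_const_mul' _ _ ENNReal.ofReal_ne_top,
      ← lintegral_mul_const _ (by fun_prop)]
    refine mul_le_mul_right (lintegral_mono fun x => ?_) _
    by_cases hx : x ∈ Icc (y - δ) y
    · rw [mul_left_comm]
      refine mul_le_mul_right (mul_pE_le N hx.2 ENNReal.ofReal_ne_top fun w => ?_) _
      rw [← ENNReal.ofReal_mul (sq_nonneg _)]
      refine ENNReal.ofReal_le_ofReal ?_
      have e1 := hmon (y - x) w (by linarith [hx.2]) (by linarith [hx.1])
      have e2 := hsm w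
      calc (1 - 5 * δ) ^ 2 * smooth H δ w = (1 - 5 * δ) * ((1 - 5 * δ) * smooth H δ w) := by ring
        _ ≤ (1 - 5 * δ) * H w := by gcongr
        _ ≤ (1 - 5 * (y - x)) * H w := by
            refine mul_le_mul_of_nonneg_right ?_ (h0 w)
            linarith [hx.1]
        _ ≤ _ := e1
    · simp [hGsupp x hx]
  have hl2 := ENNReal.Tendsto.const_mul (a := ENNReal.ofReal ((1 - 5 * δ) ^ 2)) hlim
    (Or.inr ENNReal.ofReal_ne_top)
  have hl3 : ∀ a : ENNReal, liminf (fun N => K * (ENNReal.ofReal (wt N) *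
      pE ν N y fun w => ENNReal.ofReal (H w))) atTop = K * liminf (fun N => ENNReal.ofReal (wt N) *
      pE ν N y fun w => ENNReal.ofReal (H w)) atTop := fun _ =>
    ENNReal.liminf_const_mul_of_ne_top hKtop
  have hl4 := hl2.liminf_eq ▸ liminf_le_liminf (Eventually.of_forall hN)
  rw [hl3 0] at hl4
  rw [← ENNReal.mul_le_mul_iff_right hK0 hKtop]
  refine le_trans ?_ hl4
  rw [ENNReal.ofReal_mul (sq_nonneg _)]
  have hv : K * vE ρ (y - δ) ≤ ∫⁻ x in Ioi 0, ENNReal.ofReal (G x) * vE ρ x := by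
    rw [← lintegral_mul_const _ (by fun_prop)]
    refine lintegral_mono fun x => ?_
    by_cases hx : x ∈ Icc (y - δ) y
    · exact mul_le_mul_right (vE_mono hx.1) _
    · simp [hGsupp x hx]
  have hu := le_lintegral_smooth hm h0 hneg hC (uE_mono (ρ := ρ)) hδ
  calc _ = ENNReal.ofReal ((1 - 5 * δ) ^ 2) * (ENNReal.ofReal κ * ((K * vE ρ (y - δ)) *
        ∫⁻ w in Ioi 0, ENNReal.ofReal (H w) * uE ρ w)) := by ring
    _ ≤ _ := by gcongr

/-- Lower bound in the local limit theorem for the reflected walk. -/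
theorem le_liminf_pE {κ : ℝ} (h : KilledAsymp (ν.map Prod.fst) κ) {H : ℝ → ℝ}
    (hm : Measurable H) (h0 : ∀ w, 0 ≤ H w) (hneg : ∀ w ≤ 0, H w = 0) {C : ℝ}
    (hC : ∀ w, H w ≤ C * Real.exp (-w))
    (hmon : ∀ s w, 0 ≤ s → s ≤ 1 / 10 → (1 - 5 * s) * H w ≤ H (w + s)) {y : ℝ} (hy : 0 < y) :
    ENNReal.ofReal κ * vE (ν.map Prod.fst) y *
        ∫⁻ w in Ioi 0, ENNReal.ofReal (H w) * uE (ν.map Prod.fst) w ≤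
      liminf (fun N => ENNReal.ofReal (wt N) * pE ν N y fun w => ENNReal.ofReal (H w)) atTop := by
  have ht : Tendsto (fun n : ℕ => 1 / ((n : ℝ) + 1)) atTop (𝓝 0) :=
    tendsto_one_div_add_atTop_nhds_zero_nat
  have h1 : Tendsto (fun n : ℕ => ENNReal.ofReal ((1 - 5 * (1 / ((n : ℝ) + 1))) ^ 2 * κ)) atTop
      (𝓝 (ENNReal.ofReal κ)) := by
    have : Tendsto (fun n : ℕ => (1 - 5 * (1 / ((n : ℝ) + 1))) ^ 2 * κ) atTop
        (𝓝 ((1 - 5 * 0) ^ 2 * κ)) := (((ht.const_mul 5).const_sub 1).pow 2).mul_const κ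
    rw [show ((1 : ℝ) - 5 * 0) ^ 2 * κ = κ by ring] at this
    exact ENNReal.tendsto_ofReal this
  have h2 := ENNReal.Tendsto.mul h1 (Or.inr (vE_lt_top h y).ne)
    (tendsto_vE_sub (ρ := ν.map Prod.fst) y) (Or.inr ENNReal.ofReal_ne_top)
  have h3 := ENNReal.Tendsto.mul_const (b := ∫⁻ w in Ioi 0, ENNReal.ofReal (H w) *
    uE (ν.map Prod.fst) w) h2 (Or.inr (lintegral_mul_uE_lt_top h hC).ne)
  refine le_of_tendsto h3 ?_
  have hy' : 0 < min y (1 / 10) := by positivity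
  filter_upwards [ht.eventually_lt_const hy'] with n hn
  exact le_liminf_pE_aux h hm h0 hneg hC hmon (by positivity)
    (hn.le.trans (min_le_right _ _)) (hn.trans_le (min_le_left _ _))

end endpoint

section block

variable {ν : Measure (ℝ × ℝ)} [IsProbabilityMeasure ν]

/-- The walk started at height `w - S k` stays positive up to time `k`. -/
def tailPos (k : ℕ) (w : ℝ) (b : Path) : Prop := ∀ i ≤ k, 0 < w - pS b k + pS b i

lemma measurableSet_tailPos (k : ℕ) : MeasurableSet {p : ℝ × Path | tailPos k p.1 p.2} := by
  unfold tailPos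
  simp only [ofPred_forall]
  refine MeasurableSet.iInter fun i => MeasurableSet.iInter fun _ => ?_
  exact measurableSet_lt (by fun_prop) (by fun_prop)

lemma tailPos_congr {k : ℕ} {w : ℝ} {b b' : Path} (h : ∀ i < k, b i = b' i) :
    tailPos k w b ↔ tailPos k w b' := by
  unfold tailPos
  refine forall_congr' fun i => forall_congr' fun hi => ?_
  rw [pS_congr h, pS_congr fun j hj => h j (lt_of_lt_of_le hj hi)]

lemma stay_block_iff {k : ℕ} (hk : 1 ≤ k) (N : ℕ) (x : Path) :
    stay (Iio 0) (k + (N + k)) x ↔ stay (Iio 0) k x ∧ below (-pS x k) N (pshift k x) ∧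
      tailPos k (-pS x k - pS (pshift k x) N) (prev k (pshift N (pshift k x))) := by
  have h1 : ∀ i, pS x (k + i) = pS x k + pS (pshift k x) i := fun i => pS_add x k i
  have h2 : ∀ i, pS (pshift k x) (N + i) =
      pS (pshift k x) N + pS (pshift N (pshift k x)) i := fun i => pS_add _ N i
  set y := pshift k x with hy
  set c := pshift N y with hc
  have h3 : ∀ i ≤ k, -pS x k - pS y N - pS (prev k c) k + pS (prev k c) i =
      -pS x (k + (N + (k - i))) := by
    intro i hi
    rw [pS_prev c le_rfl, pS_prev c hi, h1, h2]; simp; ring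
  constructor
  · intro h
    refine ⟨fun i hi1 hi2 => h i hi1 (by omega), fun i hi => ?_, fun i hi => ?_⟩
    · have := mem_Iio.mp (h (k + i) (by omega) (by omega))
      rw [h1] at this; linarith
    · rw [h3 i hi]
      have := mem_Iio.mp (h (k + (N + (k - i))) (by omega) (by omega))
      linarith
  · rintro ⟨ha, hb, ht⟩ i hi1 hi2
    rcases le_total i k with h | h
    · exact ha i hi1 h
    · rcases le_total i (k + N) with h' | h'
      · have := hb (i - k) (by omega)
        have h4 := h1 (i - k)
        rw [show k + (i - k) = i by omega] at h4
        rw [mem_Iio, h4]; linarith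
      · have := ht (k - (i - (k + N))) (by omega)
        rw [h3 _ (by omega), show k + (N + (k - (k - (i - (k + N))))) = i by omega] at this
        rw [mem_Iio]; linarith

/-- Decomposition of a path staying negative into its first `k` steps, `N` middle steps and
its last `k` steps (reversed). -/
lemma lintegral_block {k : ℕ} (hk : 1 ≤ k) (N : ℕ) {G : Path → Path → ℝ → ENNReal}
    (hG : Measurable fun p : Path × Path × ℝ => G p.1 p.2.1 p.2.2)
    (hGa : ∀ a a' : Path, (∀ i < k, a i = a' i) → G a = G a')
    (hGb : ∀ a b b' : Path, (∀ i < k, b i = b' i) → G a b = G a b') :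
    ∫⁻ x, ind (stay (Iio 0) (k + (N + k)) x) *
        G x (prev (k + (N + k)) x) (-pS x (k + (N + k))) ∂(pathLaw ν) =
      ∫⁻ a, ind (stay (Iio 0) k a) * ∫⁻ b, pE ν N (-pS a k)
        (fun w => ind (tailPos k w b) * G a b (w - pS b k)) ∂(pathLaw ν) ∂(pathLaw ν) := by
  let T : Path → Path → ℝ → ENNReal := fun a b w => ind (tailPos k w b) * G a b (w - pS b k)
  have hT : Measurable fun p : Path × Path × ℝ => T p.1 p.2.1 p.2.2 := by
    refine Measurable.mul ?_ ?_
    · exact (measurable_ind (measurableSet_tailPos k)).comp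
        (measurable_snd.snd.prodMk measurable_snd.fst)
    · have hz : Measurable fun p : Path × Path × ℝ => p.2.2 - pS p.2.1 k := by fun_prop
      exact hG.comp (measurable_fst.prodMk (measurable_snd.fst.prodMk hz))
  have hTa : ∀ a a' : Path, (∀ i < k, a i = a' i) → T a = T a' := fun a a' h => by
    funext b w; simp only [T, hGa a a' h]
  have hTb : ∀ a b b' : Path, (∀ i < k, b i = b' i) → T a b = T a b' := fun a b b' h => by
    funext w; simp only [T, hGb a b b' h, pS_congr h, propext (tailPos_congr h)]
  have hmb : Measurable fun p : Path × Path => ind (below (-pS p.1 k) N p.2) :=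
    (measurable_ind (measurableSet_below N)).comp
      ((measurable_pS k).neg.comp measurable_fst |>.prodMk measurable_snd)
  let F : Path → Path → ENNReal := fun x y => ind (stay (Iio 0) k x) *
    (ind (below (-pS x k) N y) * T x (prev k (pshift N y)) (-pS x k - pS y N))
  have h1 : ∀ x, ind (stay (Iio 0) (k + (N + k)) x) *
      G x (prev (k + (N + k)) x) (-pS x (k + (N + k))) = F x (pshift k x) := by
    intro x
    have h2 : ∀ i < k, prev (k + (N + k)) x i = prev k (pshift N (pshift k x)) i := by
      intro i hi
      simp only [prev, revIdx, pshift, hi, show i < k + (N + k) by omega, if_true]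
      congr 1; omega
    have h3 : -pS x k - pS (pshift k x) N - pS (prev k (pshift N (pshift k x))) k =
        -pS x (k + (N + k)) := by
      rw [pS_prev _ le_rfl, pS_add, pS_add]; simp; ring
    simp only [F, T]
    rw [hGb _ _ _ h2, propext (stay_block_iff hk N x), ind_and, ind_and, h3]
    ring
  simp_rw [h1]
  rw [lintegral_pshift k]
  · refine lintegral_congr fun a => ?_
    simp only [F]
    rw [lintegral_const_mul' _ _ (ind_ne_top _)]
    congr 1
    have h4 := lintegral_pshift (ν := ν) N (F := fun y c => ind (below (-pS a k) N y) *
      T a (prev k c) (-pS a k - pS y N))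
      ((hmb.comp (measurable_const.prodMk measurable_fst)).mul
        (hT.comp (measurable_const.prodMk (((measurable_prev k).comp measurable_snd).prodMk
          (by fun_prop)))))
      (fun y y' h => by
        funext c
        have : below (-pS a k) N y = below (-pS a k) N y' := by
          refine propext (forall_congr' fun i => forall_congr' fun hi => ?_)
          rw [pS_congr fun j hj => h j (lt_of_lt_of_le hj hi)]
        simp only [this, pS_congr h])
    rw [h4]
    have h5 : ∀ y, ∫⁻ c, ind (below (-pS a k) N y) * T a (prev k c) (-pS a k - pS y N)
        ∂(pathLaw ν) = ∫⁻ c, ind (below (-pS a k) N y) * T a c (-pS a k - pS y N)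
        ∂(pathLaw ν) := fun y =>
      lintegral_prev k (F := fun c => ind (below (-pS a k) N y) * T a c (-pS a k - pS y N))
        (measurable_const.mul (hT.comp (measurable_const.prodMk
          (measurable_id.prodMk measurable_const))))
    simp_rw [h5]
    rw [lintegral_lintegral_swap]
    · rfl
    · refine Measurable.aemeasurable ?_
      exact (hmb.comp (measurable_const.prodMk measurable_fst)).mul
        (hT.comp (measurable_const.prodMk (measurable_snd.prodMk (by fun_prop))))
  · refine Measurable.mul ?_ (hmb.mul ?_)
    · exact measurable_ind (measurable_fst (measurableSet_stay measurableSet_Iio k))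
    · exact hT.comp (measurable_fst.prodMk (((measurable_prev k).comp
        ((measurable_pshift N).comp measurable_snd)).prodMk (by fun_prop)))
  · intro x x' h
    funext y
    simp only [F, hTa x x' h, pS_congr h, propext (stay_congr h)]

end block

section blocklimit

variable {ν : Measure (ℝ × ℝ)} [IsProbabilityMeasure ν]

/-- Functionals of two paths and a height that are regular enough for the block limit theorem:
they depend on the first `k` places only, take values in `[0,2]`, and vary slowly in the height. -/
structure BlockFun (k : ℕ) (Ψ : Path → Path → ℝ → ℝ) : Prop where
  meas : Measurable fun p : Path × Path × ℝ => Ψ p.1 p.2.1 p.2.2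
  left : ∀ a a' : Path, (∀ i < k, a i = a' i) → Ψ a = Ψ a'
  right : ∀ a b b' : Path, (∀ i < k, b i = b' i) → Ψ a b = Ψ a b'
  nonneg : ∀ a b z, 0 ≤ Ψ a b z
  le_two : ∀ a b z, Ψ a b z ≤ 2
  slow : ∀ a b z s, 0 ≤ z → 0 ≤ s → s ≤ 1 / 10 → (1 - 5 * s) * Ψ a b z ≤ Real.exp (-s) *
      Ψ a b (z + s)

/-- The exponentially weighted expectation of `Ψ` over paths staying negative. -/
def blockE (ν : Measure (ℝ × ℝ)) (n : ℕ) (Ψ : Path → Path → ℝ → ℝ) : ENNReal :=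
  ∫⁻ x, ind (stay (Iio 0) n x) *
    ENNReal.ofReal (Real.exp (pS x n) * Ψ x (prev n x) (-pS x n)) ∂(pathLaw ν)

omit [IsProbabilityMeasure ν] in
lemma measurable_path_iff {k : ℕ} {Ψ : Path → Path → ℝ → ℝ} (hΨ : BlockFun k Ψ) (a b : Path) :
    Measurable fun w => Ψ a b w :=
  hΨ.meas.comp (measurable_const.prodMk (measurable_const.prodMk measurable_id))

/-- The weight of the middle part of the path, given both ends. -/
def tailW (k : ℕ) (Ψ : Path → Path → ℝ → ℝ) (a b : Path) (w : ℝ) : ENNReal :=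
  ind (tailPos k w b) * ENNReal.ofReal (Real.exp (-(w - pS b k)) * Ψ a b (w - pS b k))

lemma measurable_tailW {k : ℕ} {Ψ : Path → Path → ℝ → ℝ} (hΨ : BlockFun k Ψ) :
    Measurable fun p : Path × Path × ℝ => tailW k Ψ p.1 p.2.1 p.2.2 := by
  have hz : Measurable fun p : Path × Path × ℝ => p.2.2 - pS p.2.1 k := by fun_prop
  refine Measurable.mul ?_ (ENNReal.measurable_ofReal.comp (Measurable.mul ?_ ?_))
  · exact (measurable_ind (measurableSet_tailPos k)).comp
      (measurable_snd.snd.prodMk measurable_snd.fst)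
  · exact Real.measurable_exp.comp hz.neg
  · exact hΨ.meas.comp (measurable_fst.prodMk (measurable_snd.fst.prodMk hz))

lemma blockE_eq {k : ℕ} (hk : 1 ≤ k) (N : ℕ) {Ψ : Path → Path → ℝ → ℝ} (hΨ : BlockFun k Ψ) :
    blockE ν (k + (N + k)) Ψ = ∫⁻ a, ∫⁻ b, ind (stay (Iio 0) k a) *
      pE ν N (-pS a k) (tailW k Ψ a b) ∂(pathLaw ν) ∂(pathLaw ν) := by
  have h := lintegral_block (ν := ν) hk N
    (G := fun a b z => ENNReal.ofReal (Real.exp (-z) * Ψ a b z))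
    (ENNReal.measurable_ofReal.comp (Measurable.mul
      (Real.measurable_exp.comp measurable_snd.snd.neg) hΨ.meas))
    (fun a a' h => by funext b z; rw [hΨ.left a a' h])
    (fun a b b' h => by funext z; rw [hΨ.right a b b' h])
  simp only [neg_neg] at h
  rw [blockE, h]
  refine lintegral_congr fun a => ?_
  rw [← lintegral_const_mul' _ _ (ind_ne_top _)]
  rfl

lemma measurable_pE_tailW {k : ℕ} (N : ℕ) {Ψ : Path → Path → ℝ → ℝ} (hΨ : BlockFun k Ψ) :
    Measurable fun p : Path × Path => ind (stay (Iio 0) k p.1) *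
      pE ν N (-pS p.1 k) (tailW k Ψ p.1 p.2) := by
  refine Measurable.mul ?_ ?_
  · exact measurable_ind (measurable_fst (measurableSet_stay measurableSet_Iio k))
  · refine Measurable.lintegral_prod_right' (f := fun q : (Path × Path) × Path =>
      ind (below (-pS q.1.1 k) N q.2) * tailW k Ψ q.1.1 q.1.2 (-pS q.1.1 k - pS q.2 N)) ?_
    have h1 : Measurable fun q : (Path × Path) × Path => -pS q.1.1 k :=
      (measurable_pS k).neg.comp measurable_fst.fst
    have h2 : Measurable fun q : (Path × Path) × Path => -pS q.1.1 k - pS q.2 N :=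
      h1.sub ((measurable_pS N).comp measurable_snd)
    refine Measurable.mul ?_ ?_
    · exact (measurable_ind (measurableSet_below N)).comp (h1.prodMk measurable_snd)
    · exact (measurable_tailW hΨ).comp
        (measurable_fst.fst.prodMk (measurable_fst.snd.prodMk h2))

lemma le_liminf_tailW {κ : ℝ} (h : KilledAsymp (ν.map Prod.fst) κ) {k : ℕ}
    {Ψ : Path → Path → ℝ → ℝ} (hΨ : BlockFun k Ψ) (a b : Path) {y : ℝ} (hy : 0 < y) :
    ENNReal.ofReal κ * vE (ν.map Prod.fst) y *
        ∫⁻ w in Ioi 0, tailW k Ψ a b w * uE (ν.map Prod.fst) w ≤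
      liminf (fun N => ENNReal.ofReal (wt N) * pE ν N y (tailW k Ψ a b)) atTop := by
  classical
  let H : ℝ → ℝ := fun w =>
    if tailPos k w b then Real.exp (-(w - pS b k)) * Ψ a b (w - pS b k) else 0
  have hH : tailW k Ψ a b = fun w => ENNReal.ofReal (H w) := by
    funext w
    by_cases hw : tailPos k w b
    · simp [tailW, H, hw, ind_pos]
    · simp [tailW, H, hw, ind_neg]
  rw [hH]
  refine le_liminf_pE h (C := 2 * Real.exp (pS b k)) ?_ ?_ ?_ ?_ ?_ hy
  · refine Measurable.ite ?_ ?_ measurable_const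
    · exact (measurable_id.prodMk measurable_const : Measurable fun w : ℝ => (w, b))
        (measurableSet_tailPos k)
    · exact Measurable.mul (by fun_prop) ((measurable_path_iff hΨ a b).comp (by fun_prop))
  · intro w
    simp only [H]
    split_ifs
    · exact mul_nonneg (Real.exp_pos _).le (hΨ.nonneg _ _ _)
    · exact le_rfl
  · intro w hw
    refine if_neg fun ht => ?_
    have := ht k le_rfl
    linarith
  · intro w
    have e : Real.exp (-(w - pS b k)) = Real.exp (pS b k) * Real.exp (-w) := by
      rw [← Real.exp_add]; congr 1; ring
    simp only [H]
    split_ifs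
    · rw [e]
      have := hΨ.le_two a b (w - pS b k)
      have h1 := mul_pos (Real.exp_pos (pS b k)) (Real.exp_pos (-w))
      nlinarith
    · positivity
  · intro s w hs hs1
    simp only [H]
    by_cases hw : tailPos k w b
    · have hw' : tailPos k (w + s) b := fun i hi => by have := hw i hi; linarith
      have hz : 0 ≤ w - pS b k := by
        have := hw 0 (Nat.zero_le _)
        rw [pS_zero] at this; linarith
      rw [if_pos hw, if_pos hw', show w + s - pS b k = w - pS b k + s by ring,
        show -(w - pS b k + s) = -(w - pS b k) + -s by ring, Real.exp_add]
      have := mul_le_mul_of_nonneg_left (hΨ.slow a b (w - pS b k) s hz hs hs1)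
        (Real.exp_pos (-(w - pS b k))).le
      linarith
    · rw [if_neg hw, mul_zero]
      split_ifs
      · exact mul_nonneg (Real.exp_pos _).le (hΨ.nonneg _ _ _)
      · exact le_rfl

/-- Fatou's lemma for iterated integrals. -/
lemma lintegral_lintegral_le_liminf {α : Type*} [MeasurableSpace α] {m : Measure α} [SFinite m]
    {f : ℕ → α → α → ENNReal} (hf : ∀ N, Measurable (Function.uncurry (f N))) {g : α → α → ENNReal}
    (h : ∀ a b, g a b ≤ liminf (fun N => f N a b) atTop) :
    ∫⁻ a, ∫⁻ b, g a b ∂m ∂m ≤ liminf (fun N => ∫⁻ a, ∫⁻ b, f N a b ∂m ∂m) atTop := by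
  have f2 : ∀ a, ∫⁻ b, g a b ∂m ≤ liminf (fun N => ∫⁻ b, f N a b ∂m) atTop := fun a =>
    (lintegral_mono (h a)).trans (lintegral_liminf_le fun N => (hf N).of_uncurry_left)
  exact (lintegral_mono f2).trans (lintegral_liminf_le fun N => (hf N).lintegral_prod_right')

lemma le_liminf_blockE {κ : ℝ} (h : KilledAsymp (ν.map Prod.fst) κ) {k : ℕ} (hk : 1 ≤ k)
    {Ψ : Path → Path → ℝ → ℝ} (hΨ : BlockFun k Ψ) :
    ∫⁻ a, ∫⁻ b, ind (stay (Iio 0) k a) * (ENNReal.ofReal κ * vE (ν.map Prod.fst) (-pS a k) *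
        ∫⁻ w in Ioi 0, tailW k Ψ a b w * uE (ν.map Prod.fst) w) ∂(pathLaw ν) ∂(pathLaw ν) ≤
      liminf (fun N => ENNReal.ofReal (wt N) * blockE ν (k + (N + k)) Ψ) atTop := by
  have e : ∀ N, ENNReal.ofReal (wt N) * blockE ν (k + (N + k)) Ψ =
      ∫⁻ a, ∫⁻ b, ENNReal.ofReal (wt N) * (ind (stay (Iio 0) k a) *
        pE ν N (-pS a k) (tailW k Ψ a b)) ∂(pathLaw ν) ∂(pathLaw ν) := by
    intro N
    rw [blockE_eq hk N hΨ, ← lintegral_const_mul' _ _ ENNReal.ofReal_ne_top]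
    exact lintegral_congr fun a => (lintegral_const_mul' _ _ ENNReal.ofReal_ne_top).symm
  simp_rw [e]
  refine lintegral_lintegral_le_liminf
    (fun N => (measurable_pE_tailW N hΨ).const_mul (ENNReal.ofReal (wt N))) fun a b => ?_
  by_cases hs : stay (Iio 0) k a
  · simp only [ind_pos hs, one_mul]
    exact le_liminf_tailW h hΨ a b (neg_pos.mpr (mem_Iio.mp (hs k hk le_rfl)))
  · simp [ind_neg hs]

end blocklimit

section blockident

variable {ν : Measure (ℝ × ℝ)} [IsProbabilityMeasure ν]

/-- The walk started at `z` stays nonnegative at times `1, …, k`. -/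
def posP (k : ℕ) (z : ℝ) (b : Path) : Prop := ∀ i, 1 ≤ i → i ≤ k → 0 ≤ z + pS b i

lemma measurableSet_posP (k : ℕ) : MeasurableSet {p : ℝ × Path | posP k p.1 p.2} := by
  unfold posP
  simp only [ofPred_forall]
  refine MeasurableSet.iInter fun i => MeasurableSet.iInter fun _ => MeasurableSet.iInter
    fun _ => ?_
  exact measurableSet_le (by fun_prop) (by fun_prop)

/-- The law of the path under the measure conditioned to stay negative. -/
def IsHMinus (ν : Measure (ℝ × ℝ)) (P : Measure Path) : Prop :=
  IsProbabilityMeasure P ∧ ∀ k, 1 ≤ k → ∀ φ : Path → ENNReal, Measurable φ → (∀ x, φ x ≤ 2) →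
    (∀ a a' : Path, (∀ i < k, a i = a' i) → φ a = φ a') →
    ∫⁻ x, φ x ∂P =
      ∫⁻ x, ind (stay (Iio 0) k x) * (φ x * vE (ν.map Prod.fst) (-pS x k)) ∂(pathLaw ν)

/-- The laws of the path under the measures conditioned to stay nonnegative. -/
def IsHPlus (ν : Measure (ℝ × ℝ)) (P : ℝ → Measure Path) : Prop :=
  ∀ z, 0 ≤ z → IsProbabilityMeasure (P z) ∧ ∀ k, ∀ φ : Path → ENNReal, Measurable φ →
    (∀ x, φ x ≤ 2) → (∀ a a' : Path, (∀ i < k, a i = a' i) → φ a = φ a') →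
    uE (ν.map Prod.fst) z * ∫⁻ x, φ x ∂(P z) =
      ∫⁻ x, ind (posP k z x) * (φ x * uE (ν.map Prod.fst) (z + pS x k)) ∂(pathLaw ν)

lemma lintegral_swap3 {α : Type*} [MeasurableSpace α] {m : Measure α} [SFinite m]
    {n : Measure ℝ} [SFinite n] {F : α → α → ℝ → ENNReal}
    (hF : Measurable fun p : α × α × ℝ => F p.1 p.2.1 p.2.2) :
    ∫⁻ a, ∫⁻ b, ∫⁻ z, F a b z ∂n ∂m ∂m = ∫⁻ z, ∫⁻ b, ∫⁻ a, F a b z ∂m ∂m ∂n := by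
  have h1 : ∀ a, ∫⁻ b, ∫⁻ z, F a b z ∂n ∂m = ∫⁻ z, ∫⁻ b, F a b z ∂m ∂n := fun a =>
    lintegral_lintegral_swap (hF.comp measurable_prodMk_left).aemeasurable
  have h2 : ∀ z, ∫⁻ a, ∫⁻ b, F a b z ∂m ∂m = ∫⁻ b, ∫⁻ a, F a b z ∂m ∂m := fun z =>
    lintegral_lintegral_swap (hF.comp (measurable_fst.prodMk
      (measurable_snd.prodMk measurable_const))).aemeasurable
  simp_rw [h1]
  rw [lintegral_lintegral_swap]
  · simp_rw [h2]
  · refine Measurable.aemeasurable ?_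
    exact Measurable.lintegral_prod_right' (f := fun q : (α × ℝ) × α => F q.1.1 q.2 q.1.2)
      (hF.comp (measurable_fst.fst.prodMk (measurable_snd.prodMk measurable_fst.snd)))

omit [IsProbabilityMeasure ν] in
lemma lintegral_tailW (k : ℕ) {Ψ : Path → Path → ℝ → ℝ} (a b : Path) :
    ∫⁻ w in Ioi 0, tailW k Ψ a b w * uE (ν.map Prod.fst) w =
      ∫⁻ z in Ioi 0, ind (posP k z b) * (ENNReal.ofReal (Real.exp (-z) * Ψ a b z) *
        uE (ν.map Prod.fst) (z + pS b k)) := by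
  have h1 : ∫⁻ w in Ioi 0, tailW k Ψ a b w * uE (ν.map Prod.fst) w =
      ∫⁻ w, tailW k Ψ a b w * uE (ν.map Prod.fst) w := by
    rw [← lintegral_indicator measurableSet_Ioi]
    refine lintegral_congr fun w => ?_
    by_cases hw : w ∈ Ioi (0 : ℝ)
    · rw [indicator_of_mem hw]
    · rw [indicator_of_notMem hw, tailW, ind_neg, zero_mul, zero_mul]
      intro ht
      have := ht k le_rfl
      apply hw; rw [mem_Ioi]; linarith
  rw [h1, ← lintegral_add_right_eq_self _ (pS b k), ← lintegral_indicator measurableSet_Ioi]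
  refine lintegral_congr_ae ?_
  have hfin : ∀ᵐ z : ℝ, ∀ i ∈ Finset.range (k + 1), z ≠ -pS b i := by
    rw [Filter.eventually_all_finset]
    intro i _
    exact (Countable.ae_notMem (countable_singleton (-pS b i)) volume).mono fun z hz h => hz h
  filter_upwards [hfin] with z hz
  have e : z + pS b k - pS b k = z := by ring
  by_cases hz0 : z ∈ Ioi (0 : ℝ)
  · rw [indicator_of_mem hz0, tailW, e, mul_assoc]
    congr 2
    refine propext ⟨fun h i h1 h2 => ?_, fun h i hi => ?_⟩
    · have := h i h2
      rw [e] at this; exact this.le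
    · rw [e]
      rcases Nat.eq_zero_or_pos i with rfl | h0
      · simpa using hz0
      · refine lt_of_le_of_ne (h i h0 hi) fun h' => ?_
        exact hz i (Finset.mem_range.mpr (by omega)) (by linarith)
  · rw [indicator_of_notMem hz0, tailW, ind_neg, zero_mul, zero_mul]
    intro ht
    have := ht 0 (Nat.zero_le _)
    rw [pS_zero] at this
    exact hz0 (by rw [mem_Ioi]; linarith)

/-- The limit of the weighted block expectations. -/
def blockI (ν : Measure (ℝ × ℝ)) (κ : ℝ) (Pp : ℝ → Measure Path) (Pm : Measure Path)
    (Ψ : Path → Path → ℝ → ℝ) : ENNReal :=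
  ENNReal.ofReal κ * ∫⁻ z in Ioi 0, ENNReal.ofReal (Real.exp (-z)) * (uE (ν.map Prod.fst) z *
    ∫⁻ b, ∫⁻ a, ENNReal.ofReal (Ψ a b z) ∂Pm ∂(Pp z))

lemma blockI_eq (κ : ℝ) {Pp : ℝ → Measure Path} {Pm : Measure Path} (hp : IsHPlus ν Pp)
    (hm : IsHMinus ν Pm) {k : ℕ} (hk : 1 ≤ k) {Ψ : Path → Path → ℝ → ℝ} (hΨ : BlockFun k Ψ) :
    ∫⁻ a, ∫⁻ b, ind (stay (Iio 0) k a) * (ENNReal.ofReal κ * vE (ν.map Prod.fst) (-pS a k) *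
        ∫⁻ w in Ioi 0, tailW k Ψ a b w * uE (ν.map Prod.fst) w) ∂(pathLaw ν) ∂(pathLaw ν) =
      blockI ν κ Pp Pm Ψ := by
  set ρ := ν.map Prod.fst with hρ
  have := hm.1
  let F : Path → Path → ℝ → ENNReal := fun a b z => ind (stay (Iio 0) k a) *
    (vE ρ (-pS a k) * (ind (posP k z b) * (ENNReal.ofReal (Real.exp (-z) * Ψ a b z) *
        uE ρ (z + pS b k))))
  have hA : Measurable fun a : Path => vE ρ (-pS a k) := measurable_vE.comp (measurable_pS k).neg
  have hΨm : Measurable fun p : Path × Path × ℝ => ENNReal.ofReal (Ψ p.1 p.2.1 p.2.2) :=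
    ENNReal.measurable_ofReal.comp hΨ.meas
  have hF : Measurable fun p : Path × Path × ℝ => F p.1 p.2.1 p.2.2 := by
    refine Measurable.mul ?_ (Measurable.mul ?_ (Measurable.mul ?_ (Measurable.mul ?_ ?_)))
    · exact measurable_ind (measurable_fst (measurableSet_stay measurableSet_Iio k))
    · exact hA.comp measurable_fst
    · exact (measurable_ind (measurableSet_posP k)).comp
        (measurable_snd.snd.prodMk measurable_snd.fst)
    · exact ENNReal.measurable_ofReal.comp ((Real.measurable_exp.comp
        measurable_snd.snd.neg).mul hΨ.meas)
    · exact measurable_uE.comp (measurable_snd.snd.add ((measurable_pS k).comp measurable_snd.fst))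
  have h1 : ∀ a b, ind (stay (Iio 0) k a) * (ENNReal.ofReal κ * vE ρ (-pS a k) *
        ∫⁻ w in Ioi 0, tailW k Ψ a b w * uE ρ w) =
      ENNReal.ofReal κ * ∫⁻ z in Ioi 0, F a b z := by
    intro a b
    have hm1 : Measurable fun z : ℝ => ind (posP k z b) *
        (ENNReal.ofReal (Real.exp (-z) * Ψ a b z) * uE ρ (z + pS b k)) := by
      refine Measurable.mul ?_ (Measurable.mul ?_ ?_)
      · exact (measurable_ind (measurableSet_posP k)).comp
          (measurable_id.prodMk measurable_const)
      · exact ENNReal.measurable_ofReal.comp ((Real.measurable_exp.comp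
          measurable_neg).mul (measurable_path_iff hΨ a b))
      · exact measurable_uE.comp (measurable_id.add measurable_const)
    simp only [F]
    rw [lintegral_const_mul' _ _ (ind_ne_top _), lintegral_const_mul _ hm1, hρ, lintegral_tailW]
    ring
  simp_rw [h1]
  have h2 : ∀ a, ∫⁻ b, ENNReal.ofReal κ * (∫⁻ z in Ioi 0, F a b z) ∂(pathLaw ν) =
      ENNReal.ofReal κ * ∫⁻ b, (∫⁻ z in Ioi 0, F a b z) ∂(pathLaw ν) := fun a =>
    lintegral_const_mul' _ _ ENNReal.ofReal_ne_top
  simp_rw [h2]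
  rw [lintegral_const_mul' _ _ ENNReal.ofReal_ne_top, lintegral_swap3 hF, blockI]
  congr 1
  refine setLIntegral_congr_fun measurableSet_Ioi fun z hz => ?_
  have hz0 : 0 ≤ z := (mem_Ioi.mp hz).le
  have hΨz : Measurable fun p : Path × Path => ENNReal.ofReal (Ψ p.2 p.1 z) :=
    hΨm.comp (measurable_snd.prodMk (measurable_fst.prodMk measurable_const))
  rw [(hp z hz0).2 k (fun b => ∫⁻ a, ENNReal.ofReal (Ψ a b z) ∂Pm)
    (Measurable.lintegral_prod_right' hΨz)
    (fun b => (lintegral_mono fun a => show _ ≤ (2 : ENNReal) by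
      simpa using ENNReal.ofReal_le_ofReal (hΨ.le_two a b z)).trans (by simp))
    (fun b b' h => lintegral_congr fun a => by rw [hΨ.right a b b' h]),
    ← lintegral_const_mul' _ _ ENNReal.ofReal_ne_top]
  refine lintegral_congr fun b => ?_
  rw [hm.2 k hk (fun a => ENNReal.ofReal (Ψ a b z)) (hΨz.comp measurable_prodMk_left)
    (fun a => by simpa using ENNReal.ofReal_le_ofReal (hΨ.le_two a b z))
    (fun a a' h => by rw [hΨ.left a a' h])]
  have h3 : ∀ a, F a b z = (ENNReal.ofReal (Real.exp (-z)) * ind (posP k z b) * uE ρ (z + pS b k)) *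
      (ind (stay (Iio 0) k a) * (ENNReal.ofReal (Ψ a b z) * vE ρ (-pS a k))) := by
    intro a
    simp only [F]
    rw [ENNReal.ofReal_mul (Real.exp_pos _).le]
    ring
  simp_rw [h3]
  rw [lintegral_const_mul]
  · ring
  · refine Measurable.mul (measurable_ind (measurableSet_stay measurableSet_Iio k))
      (Measurable.mul (hΨz.comp measurable_prodMk_left) hA)

end blockident

lemma tendsto_of_liminf_add {a b : ℕ → ENNReal} {A B T : ENNReal} (hT : T ≠ ⊤)
    (hab : Tendsto (fun n => a n + b n) atTop (𝓝 T)) (hAB : A + B = T)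
    (ha : A ≤ liminf a atTop) (hb : B ≤ liminf b atTop) : Tendsto a atTop (𝓝 A) := by
  have hA : A ≠ ⊤ := ne_top_of_le_ne_top hT (hAB ▸ le_self_add)
  have hB : B ≠ ⊤ := ne_top_of_le_ne_top hT (hAB ▸ le_add_self)
  refine tendsto_order.2 ⟨fun c hc => eventually_lt_of_lt_liminf (hc.trans_le ha), fun d hd => ?_⟩
  rcases eq_or_ne B 0 with rfl | hB0
  · rw [add_zero] at hAB
    subst hAB
    filter_upwards [hab.eventually (gt_mem_nhds hd)] with n hn
    exact lt_of_le_of_lt le_self_add hn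
  · obtain ⟨d', h1, h2⟩ := exists_between hd
    have h3 : B - (d' - A) < B := ENNReal.sub_lt_self hB hB0 (tsub_pos_of_lt h1).ne'
    have hc : B - (d' - A) ≠ ⊤ := ne_top_of_le_ne_top hB tsub_le_self
    have h4 : T < d + (B - (d' - A)) := by
      calc T ≤ d' + (B - (d' - A)) := by
            rw [← hAB]
            calc A + B ≤ A + ((d' - A) + (B - (d' - A))) := by gcongr; exact le_add_tsub
              _ = d' + (B - (d' - A)) := by rw [← add_assoc, add_tsub_cancel_of_le h1.le]
        _ < _ := ENNReal.add_lt_add_right hc h2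
    filter_upwards [hab.eventually (gt_mem_nhds h4),
      eventually_lt_of_lt_liminf (h3.trans_le hb)] with n hn hn'
    have : a n + (B - (d' - A)) < d + (B - (d' - A)) :=
      lt_of_le_of_lt (by gcongr) hn
    exact lt_of_add_lt_add_right this

section tendstoblock

variable {ν : Measure (ℝ × ℝ)} [IsProbabilityMeasure ν]

lemma lintegral_stay_exp {u : ℝ} (hu : 0 < u) (n : ℕ) :
    ∫⁻ x, ind (stay (Iio 0) n x) * ENNReal.ofReal (Real.exp (u * pS x n)) ∂(pathLaw ν) =
      ENNReal.ofReal (kmgf (ν.map Prod.fst) (Iio 0) u n) := by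
  rw [lintegral_stay measurableSet_Iio n (f := fun a => ENNReal.ofReal (Real.exp (u * a)))
    (by fun_prop)]
  exact (ofReal_kmgf measurableSet_Iio (fun x hx => by
    have := mem_Iio.mp hx; nlinarith) n).1

lemma measurable_blockE_integrand {k : ℕ} {Ψ : Path → Path → ℝ → ℝ} (hΨ : BlockFun k Ψ) (n : ℕ) :
    Measurable fun x => ind (stay (Iio 0) n x) *
      ENNReal.ofReal (Real.exp (pS x n) * Ψ x (prev n x) (-pS x n)) := by
  refine Measurable.mul (measurable_ind (measurableSet_stay measurableSet_Iio n))
    (ENNReal.measurable_ofReal.comp ((Real.measurable_exp.comp (measurable_pS n)).mul ?_))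
  exact hΨ.meas.comp (measurable_id.prodMk ((measurable_prev n).prodMk (measurable_pS n).neg))

lemma blockE_add {k : ℕ} {Ψ : Path → Path → ℝ → ℝ} (hΨ : BlockFun k Ψ)
    (hΨ' : BlockFun k fun a b z => 2 - Ψ a b z) (n : ℕ) :
    blockE ν n Ψ + blockE ν n (fun a b z => 2 - Ψ a b z) =
      ENNReal.ofReal (2 * kmgf (ν.map Prod.fst) (Iio 0) 1 n) := by
  rw [blockE, blockE, ← lintegral_add_left (measurable_blockE_integrand hΨ n),
    ENNReal.ofReal_mul zero_le_two, ← lintegral_stay_exp one_pos,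
    ← lintegral_const_mul' _ _ ENNReal.ofReal_ne_top]
  refine lintegral_congr fun x => ?_
  rw [← mul_add, ← ENNReal.ofReal_add (mul_nonneg (Real.exp_pos _).le (hΨ.nonneg _ _ _))
    (mul_nonneg (Real.exp_pos _).le (hΨ'.nonneg _ _ _)), mul_left_comm,
    ← ENNReal.ofReal_mul zero_le_two]
  congr 2
  rw [one_mul]; ring

/-- The inner integral of `blockI`, with the conditioned laws expressed through the walk. -/
def blockJ (ν : Measure (ℝ × ℝ)) (k : ℕ) (Pm : Measure Path)
    (Ψ : Path → Path → ℝ → ℝ) (z : ℝ) : ENNReal :=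
  ∫⁻ b, ind (posP k z b) * ((∫⁻ a, ENNReal.ofReal (Ψ a b z) ∂Pm) *
    uE (ν.map Prod.fst) (z + pS b k)) ∂(pathLaw ν)

lemma measurable_blockJ {Pm : Measure Path} [IsProbabilityMeasure Pm] {k : ℕ}
    {Ψ : Path → Path → ℝ → ℝ} (hΨ : BlockFun k Ψ) : Measurable (blockJ ν k Pm Ψ) := by
  refine Measurable.lintegral_prod_right' (f := fun p : ℝ × Path => ind (posP k p.1 p.2) *
    ((∫⁻ a, ENNReal.ofReal (Ψ a p.2 p.1) ∂Pm) * uE (ν.map Prod.fst) (p.1 + pS p.2 k))) ?_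
  refine Measurable.mul (measurable_ind (measurableSet_posP k)) (Measurable.mul ?_ ?_)
  · refine Measurable.lintegral_prod_right' (f := fun q : (ℝ × Path) × Path =>
      ENNReal.ofReal (Ψ q.2 q.1.2 q.1.1)) ?_
    exact ENNReal.measurable_ofReal.comp (hΨ.meas.comp
      (measurable_snd.prodMk (measurable_fst.snd.prodMk measurable_fst.fst)))
  · exact measurable_uE.comp (measurable_fst.add ((measurable_pS k).comp measurable_snd))

lemma measurable_inner {Pm : Measure Path} [IsProbabilityMeasure Pm] {k : ℕ}
    {Ψ : Path → Path → ℝ → ℝ} (hΨ : BlockFun k Ψ) (z : ℝ) :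
    Measurable fun b => ∫⁻ a, ENNReal.ofReal (Ψ a b z) ∂Pm :=
  Measurable.lintegral_prod_right' (f := fun q : Path × Path => ENNReal.ofReal (Ψ q.2 q.1 z))
    (ENNReal.measurable_ofReal.comp (hΨ.meas.comp
      (measurable_snd.prodMk (measurable_fst.prodMk measurable_const))))

omit [IsProbabilityMeasure ν] in
lemma uE_mul_eq_blockJ {Pp : ℝ → Measure Path} {Pm : Measure Path} (hp : IsHPlus ν Pp)
    [IsProbabilityMeasure Pm] {k : ℕ} {Ψ : Path → Path → ℝ → ℝ} (hΨ : BlockFun k Ψ) {z : ℝ}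
    (hz : 0 ≤ z) :
    uE (ν.map Prod.fst) z * ∫⁻ b, ∫⁻ a, ENNReal.ofReal (Ψ a b z) ∂Pm ∂(Pp z) =
      blockJ ν k Pm Ψ z :=
  (hp z hz).2 k (fun b => ∫⁻ a, ENNReal.ofReal (Ψ a b z) ∂Pm) (measurable_inner hΨ z)
    (fun b => (lintegral_mono fun a => show _ ≤ (2 : ENNReal) by
      simpa using ENNReal.ofReal_le_ofReal (hΨ.le_two a b z)).trans (by simp))
    (fun b b' h => lintegral_congr fun a => by rw [hΨ.right a b b' h])

lemma blockI_add {κ : ℝ} (h : KilledAsymp (ν.map Prod.fst) κ) {Pp : ℝ → Measure Path}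
    {Pm : Measure Path} (hp : IsHPlus ν Pp) (hm : IsHMinus ν Pm) {k : ℕ}
    {Ψ : Path → Path → ℝ → ℝ} (hΨ : BlockFun k Ψ) (hΨ' : BlockFun k fun a b z => 2 - Ψ a b z) :
    blockI ν κ Pp Pm Ψ + blockI ν κ Pp Pm (fun a b z => 2 - Ψ a b z) =
      ENNReal.ofReal (2 * (κ * ∑' j, kmgf (ν.map Prod.fst) (Iio 0) 1 j)) := by
  have := hm.1
  have hD := lintegral_exp_mul_uE h one_pos
  rw [inv_one, one_mul] at hD
  rw [blockI, blockI, ← mul_add, ← lintegral_add_left', mul_left_comm,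
    ENNReal.ofReal_mul h.1.le, ENNReal.ofReal_mul zero_le_two, ← hD,
    ← lintegral_const_mul' (ENNReal.ofReal 2) _ ENNReal.ofReal_ne_top]
  · congr 1
    refine setLIntegral_congr_fun measurableSet_Ioi fun z (hz : (0 : ℝ) < z) => ?_
    have := (hp z hz.le).1
    have e : (∫⁻ b, ∫⁻ a, ENNReal.ofReal (Ψ a b z) ∂Pm ∂(Pp z)) +
        ∫⁻ b, ∫⁻ a, ENNReal.ofReal (2 - Ψ a b z) ∂Pm ∂(Pp z) = ENNReal.ofReal 2 := by
      rw [← lintegral_add_left (measurable_inner hΨ z)]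
      have e1 : ∀ b, (∫⁻ a, ENNReal.ofReal (Ψ a b z) ∂Pm) +
          ∫⁻ a, ENNReal.ofReal (2 - Ψ a b z) ∂Pm = ENNReal.ofReal 2 := by
        intro b
        rw [← lintegral_add_left]
        · have e2 : ∀ a, ENNReal.ofReal (Ψ a b z) + ENNReal.ofReal (2 - Ψ a b z) =
              ENNReal.ofReal 2 := fun a => by
            rw [← ENNReal.ofReal_add (hΨ.nonneg _ _ _) (hΨ'.nonneg _ _ _)]; congr 1; ring
          simp_rw [e2]; simp
        · exact ENNReal.measurable_ofReal.comp (hΨ.meas.comp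
            (measurable_id.prodMk (measurable_const.prodMk measurable_const)))
      simp_rw [e1]; simp
    rw [← mul_add, ← mul_add, e, neg_one_mul]
    ring
  · refine AEMeasurable.congr (f := fun z => ENNReal.ofReal (Real.exp (-z)) * blockJ ν k Pm Ψ z)
      (Measurable.aemeasurable (Measurable.mul (by fun_prop) (measurable_blockJ hΨ))) ?_
    filter_upwards [self_mem_ae_restrict measurableSet_Ioi] with z hz
    rw [uE_mul_eq_blockJ hp hΨ (mem_Ioi.mp hz).le]

theorem tendsto_blockE {κ : ℝ} (h : KilledAsymp (ν.map Prod.fst) κ) {Pp : ℝ → Measure Path}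
    {Pm : Measure Path} (hp : IsHPlus ν Pp) (hm : IsHMinus ν Pm) {k : ℕ} (hk : 1 ≤ k)
    {Ψ : Path → Path → ℝ → ℝ} (hΨ : BlockFun k Ψ) (hΨ' : BlockFun k fun a b z => 2 - Ψ a b z) :
    Tendsto (fun n => ENNReal.ofReal (wt n) * blockE ν n Ψ) atTop (𝓝 (blockI ν κ Pp Pm Ψ)) := by
  have hlow : ∀ Ψ' : Path → Path → ℝ → ℝ, BlockFun k Ψ' → blockI ν κ Pp Pm Ψ' ≤
      liminf (fun n => ENNReal.ofReal (wt n) * blockE ν n Ψ') atTop := by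
    intro Ψ' h'
    rw [← blockI_eq κ hp hm hk h']
    refine (le_liminf_blockE h hk h').trans ?_
    rw [← liminf_nat_add (fun n => ENNReal.ofReal (wt n) * blockE ν n Ψ') (k + k)]
    refine liminf_le_liminf (Eventually.of_forall fun N => ?_)
    rw [show N + (k + k) = k + (N + k) by ring]
    exact mul_le_mul_left (ENNReal.ofReal_le_ofReal (wt_mono (by omega))) _
  refine tendsto_of_liminf_add ENNReal.ofReal_ne_top ?_ (blockI_add h hp hm hΨ hΨ')
    (hlow _ hΨ) (hlow _ hΨ')
  simp_rw [← mul_add, blockE_add hΨ hΨ']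
  have h1 := (h.2 1 one_pos).1.2
  rw [div_one] at h1
  refine Tendsto.congr (fun n => ?_) (ENNReal.tendsto_ofReal (h1.const_mul 2))
  rw [← ENNReal.ofReal_mul (wt_nonneg n)]
  congr 1; ring

end tendstoblock

section functional

/-- Clamping to `[0, K]`. -/
def cl (K y : ℝ) : ℝ := max 0 (min K y)

lemma cl_nonneg (K y : ℝ) : 0 ≤ cl K y := le_max_left _ _

lemma cl_le {K : ℝ} (hK : 0 ≤ K) (y : ℝ) : cl K y ≤ K := max_le hK (min_le_left _ _)

lemma cl_eq {K y : ℝ} (h0 : 0 ≤ y) (h1 : y ≤ K) : cl K y = y := by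
  rw [cl, min_eq_right h1, max_eq_right h0]

@[fun_prop]
lemma measurable_cl (K : ℝ) : Measurable (cl K) := by unfold cl; fun_prop

/-- Forward sum of clamped marks weighted by `e^{-S}`. -/
def pb (K : ℝ) (k : ℕ) (x : Path) : ℝ :=
  ∑ i ∈ Finset.range k, cl K (x i).2 * Real.exp (-pS x i)

/-- Sum of clamped marks weighted by `e^{S}`. -/
def pd (K : ℝ) (k : ℕ) (x : Path) : ℝ :=
  ∑ i ∈ Finset.range k, cl K (x i).2 * Real.exp (pS x (i + 1))

/-- The survival probability as a function of the sum of marks. -/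
def rV (r d : ℝ) : ℝ := (d + (1 - r)⁻¹)⁻¹

/-- The elementary factor of the functional. -/
def om (lam u₁ u₂ b V E : ℝ) : ℝ := V / (1 + (lam * u₁ + u₂ * V * E) * b)

/-- The limiting functional truncated at level `k`. -/
def Psi (K lam r₁ r₂ : ℝ) (k : ℕ) (a b : Path) (z : ℝ) : ℝ :=
  om lam 1 1 (pb K k b) (rV r₁ (pd K k a)) (Real.exp (-z)) *
    om lam 1 1 (pb K k b) (rV r₂ (pd K k a)) (Real.exp (-z))

@[fun_prop]
lemma measurable_pb (K : ℝ) (k : ℕ) : Measurable (pb K k) := by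
  refine Finset.measurable_fun_sum _ fun i _ => ?_
  exact ((measurable_cl K).comp (by fun_prop)).mul (by fun_prop)

@[fun_prop]
lemma measurable_pd (K : ℝ) (k : ℕ) : Measurable (pd K k) := by
  refine Finset.measurable_fun_sum _ fun i _ => ?_
  exact ((measurable_cl K).comp (by fun_prop)).mul (by fun_prop)

lemma pb_nonneg (K : ℝ) (k : ℕ) (x : Path) : 0 ≤ pb K k x :=
  Finset.sum_nonneg fun _ _ => mul_nonneg (cl_nonneg _ _) (Real.exp_pos _).le

lemma pd_nonneg (K : ℝ) (k : ℕ) (x : Path) : 0 ≤ pd K k x :=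
  Finset.sum_nonneg fun _ _ => mul_nonneg (cl_nonneg _ _) (Real.exp_pos _).le

lemma pb_congr (K : ℝ) {k : ℕ} {x y : Path} (h : ∀ i < k, x i = y i) : pb K k x = pb K k y :=
  Finset.sum_congr rfl fun i hi => by
    have := Finset.mem_range.mp hi
    rw [h i this, pS_congr fun j hj => h j (hj.trans this)]

lemma pd_congr (K : ℝ) {k : ℕ} {x y : Path} (h : ∀ i < k, x i = y i) : pd K k x = pd K k y :=
  Finset.sum_congr rfl fun i hi => by
    have := Finset.mem_range.mp hi
    rw [h i this, pS_congr fun j hj => h j (by omega)]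

lemma one_le_inv_one_sub {r : ℝ} (h0 : 0 ≤ r) (h1 : r < 1) : 1 ≤ (1 - r)⁻¹ :=
  (one_le_inv₀ (by linarith)).mpr (by linarith)

lemma rV_pos {r d : ℝ} (h0 : 0 ≤ r) (h1 : r < 1) (hd : 0 ≤ d) : 0 < rV r d :=
  inv_pos.mpr (by have := one_le_inv_one_sub h0 h1; linarith)

lemma rV_le_one {r d : ℝ} (h0 : 0 ≤ r) (h1 : r < 1) (hd : 0 ≤ d) : rV r d ≤ 1 :=
  inv_le_one_of_one_le₀ (by have := one_le_inv_one_sub h0 h1; linarith)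

lemma abs_rV_sub_le {r d d' : ℝ} (h0 : 0 ≤ r) (h1 : r < 1) (hd' : 0 ≤ d') (h : d' ≤ d) :
    |rV r d - rV r d'| ≤ d - d' := by
  have := one_le_inv_one_sub h0 h1
  have e : rV r d - rV r d' = -(rV r d * rV r d' * (d - d')) := by
    unfold rV
    have h2 : d + (1 - r)⁻¹ ≠ 0 := by linarith
    have h3 : d' + (1 - r)⁻¹ ≠ 0 := by linarith
    generalize (1 - r)⁻¹ = c at *
    field_simp; ring
  rw [e, abs_neg, abs_of_nonneg (mul_nonneg (mul_nonneg (rV_pos h0 h1 (hd'.trans h)).le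
    (rV_pos h0 h1 hd').le) (by linarith))]
  exact mul_le_of_le_one_left (by linarith) (mul_le_one₀ (rV_le_one h0 h1 (hd'.trans h))
    (rV_pos h0 h1 hd').le (rV_le_one h0 h1 hd'))

lemma om_nonneg {lam u₁ u₂ b V E : ℝ} (hl : 0 ≤ lam) (hu₁ : 0 ≤ u₁) (hu₂ : 0 ≤ u₂) (hb : 0 ≤ b)
    (hV : 0 ≤ V) (hE : 0 ≤ E) : 0 ≤ om lam u₁ u₂ b V E := by
  unfold om; positivity

lemma om_le_one {lam u₁ u₂ b V E : ℝ} (hl : 0 ≤ lam) (hu₁ : 0 ≤ u₁) (hu₂ : 0 ≤ u₂) (hb : 0 ≤ b)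
    (hV : 0 ≤ V) (hV1 : V ≤ 1) (hE : 0 ≤ E) : om lam u₁ u₂ b V E ≤ 1 := by
  unfold om
  have : 0 ≤ (lam * u₁ + u₂ * V * E) * b := by positivity
  rw [div_le_one (by linarith)]; linarith

lemma om_anti {lam b V E E' : ℝ} (hl : 0 ≤ lam) (hb : 0 ≤ b) (hV : 0 ≤ V) (hE : 0 ≤ E)
    (h : E ≤ E') : om lam 1 1 b V E' ≤ om lam 1 1 b V E := by
  unfold om
  have : 0 ≤ (lam * 1 + 1 * V * E) * b := by positivity
  gcongr

lemma om_le_mul {lam b V E c : ℝ} (hl : 0 ≤ lam) (hb : 0 ≤ b) (hV : 0 ≤ V) (hE : 0 ≤ E)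
    (hc : 1 ≤ c) : om lam 1 1 b V E ≤ c * om lam 1 1 b V (c * E) := by
  unfold om
  have h1 : 0 ≤ (lam * 1 + 1 * V * E) * b := by positivity
  have h2 : 0 ≤ (lam * 1 + 1 * V * (c * E)) * b := by positivity
  rw [← mul_div_assoc, div_le_div_iff₀ (by linarith) (by linarith)]
  have h3 : 0 ≤ lam * b := by positivity
  nlinarith [mul_nonneg (mul_nonneg hV (sub_nonneg.mpr hc)) (add_nonneg zero_le_one h3)]

lemma blockFun_aux {P P' s : ℝ} (h0 : 0 ≤ P) (h1 : P ≤ 1) (hs : 0 ≤ s) (hs1 : s ≤ 1 / 10)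
    (hm : P ≤ P') (hM : P' ≤ Real.exp s * Real.exp s * P) :
    (1 - 5 * s) * P ≤ Real.exp (-s) * P' ∧ (1 - 5 * s) * (2 - P) ≤ Real.exp (-s) * (2 - P') := by
  have e1 : 1 - s ≤ Real.exp (-s) := by linarith [Real.add_one_le_exp (-s)]
  have e2 : Real.exp s ≤ 1 + 2 * s := by
    have := Real.abs_exp_sub_one_le (x := s) (by rw [abs_of_nonneg hs]; linarith)
    rw [abs_of_nonneg hs] at this
    linarith [le_abs_self (Real.exp s - 1)]
  have e3 : Real.exp (-s) * Real.exp s = 1 := by rw [← Real.exp_add]; simp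
  have e4 := Real.exp_pos (-s)
  constructor
  · nlinarith [mul_nonneg hs h0]
  · have : Real.exp (-s) * P' ≤ (1 + 2 * s) * P := by
      calc Real.exp (-s) * P' ≤ Real.exp (-s) * (Real.exp s * Real.exp s * P) := by gcongr
        _ = Real.exp s * P := by rw [← mul_assoc, ← mul_assoc, e3, one_mul]
        _ ≤ _ := by gcongr
    nlinarith [mul_nonneg hs h0]

variable {K lam r₁ r₂ : ℝ}

lemma Psi_nonneg (hl : 0 ≤ lam) (h₁ : 0 ≤ r₁) (h₁' : r₁ < 1) (h₂ : 0 ≤ r₂) (h₂' : r₂ < 1)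
    (k : ℕ) (a b : Path) (z : ℝ) : 0 ≤ Psi K lam r₁ r₂ k a b z :=
  mul_nonneg
    (om_nonneg hl zero_le_one zero_le_one (pb_nonneg _ _ _) (rV_pos h₁ h₁' (pd_nonneg _ _ _)).le
      (Real.exp_pos _).le)
    (om_nonneg hl zero_le_one zero_le_one (pb_nonneg _ _ _) (rV_pos h₂ h₂' (pd_nonneg _ _ _)).le
      (Real.exp_pos _).le)

lemma Psi_le_one (hl : 0 ≤ lam) (h₁ : 0 ≤ r₁) (h₁' : r₁ < 1) (h₂ : 0 ≤ r₂) (h₂' : r₂ < 1)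
    (k : ℕ) (a b : Path) (z : ℝ) : Psi K lam r₁ r₂ k a b z ≤ 1 :=
  mul_le_one₀
    (om_le_one hl zero_le_one zero_le_one (pb_nonneg _ _ _) (rV_pos h₁ h₁' (pd_nonneg _ _ _)).le
      (rV_le_one h₁ h₁' (pd_nonneg _ _ _)) (Real.exp_pos _).le)
    (om_nonneg hl zero_le_one zero_le_one (pb_nonneg _ _ _) (rV_pos h₂ h₂' (pd_nonneg _ _ _)).le
      (Real.exp_pos _).le)
    (om_le_one hl zero_le_one zero_le_one (pb_nonneg _ _ _) (rV_pos h₂ h₂' (pd_nonneg _ _ _)).le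
      (rV_le_one h₂ h₂' (pd_nonneg _ _ _)) (Real.exp_pos _).le)

lemma Psi_slow (hl : 0 ≤ lam) (h₁ : 0 ≤ r₁) (h₁' : r₁ < 1) (h₂ : 0 ≤ r₂) (h₂' : r₂ < 1)
    (k : ℕ) (a b : Path) (z : ℝ) {s : ℝ} (hs : 0 ≤ s) :
    Psi K lam r₁ r₂ k a b z ≤ Psi K lam r₁ r₂ k a b (z + s) ∧
      Psi K lam r₁ r₂ k a b (z + s) ≤ Real.exp s * Real.exp s * Psi K lam r₁ r₂ k a b z := by
  have hb := pb_nonneg K k b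
  have hd := pd_nonneg K k a
  have hE : Real.exp (-(z + s)) ≤ Real.exp (-z) := Real.exp_le_exp.mpr (by linarith)
  have hE' : Real.exp s * Real.exp (-(z + s)) = Real.exp (-z) := by
    rw [← Real.exp_add]; congr 1; ring
  have p1 := (rV_pos h₁ h₁' hd).le
  have p2 := (rV_pos h₂ h₂' hd).le
  constructor
  · exact mul_le_mul (om_anti hl hb p1 (Real.exp_pos _).le hE)
      (om_anti hl hb p2 (Real.exp_pos _).le hE)
      (om_nonneg hl zero_le_one zero_le_one hb p2 (Real.exp_pos _).le)
      (om_nonneg hl zero_le_one zero_le_one hb p1 (Real.exp_pos _).le)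
  · have q1 := om_le_mul hl hb p1 (Real.exp_pos (-(z + s))).le (Real.one_le_exp hs)
    have q2 := om_le_mul hl hb p2 (Real.exp_pos (-(z + s))).le (Real.one_le_exp hs)
    rw [hE'] at q1 q2
    refine (mul_le_mul q1 q2 (om_nonneg hl zero_le_one zero_le_one hb p2 (Real.exp_pos _).le)
      (mul_nonneg (Real.exp_pos _).le
        (om_nonneg hl zero_le_one zero_le_one hb p1 (Real.exp_pos _).le))).trans_eq ?_
    unfold Psi; ring

lemma measurable_Psi (K lam r₁ r₂ : ℝ) (k : ℕ) :
    Measurable fun p : Path × Path × ℝ => Psi K lam r₁ r₂ k p.1 p.2.1 p.2.2 := by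
  have m1 : Measurable fun p : Path × Path × ℝ => pb K k p.2.1 :=
    (measurable_pb K k).comp measurable_snd.fst
  have m2 : Measurable fun p : Path × Path × ℝ => pd K k p.1 :=
    (measurable_pd K k).comp measurable_fst
  unfold Psi om rV
  fun_prop

lemma blockFun_Psi (hl : 0 ≤ lam) (h₁ : 0 ≤ r₁) (h₁' : r₁ < 1) (h₂ : 0 ≤ r₂) (h₂' : r₂ < 1)
    (k : ℕ) : BlockFun k (Psi K lam r₁ r₂ k) where
  meas := measurable_Psi K lam r₁ r₂ k
  left a a' h := by
    funext b z
    simp only [Psi, pd_congr K h]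
  right a b b' h := by
    funext z
    simp only [Psi, pb_congr K h]
  nonneg := Psi_nonneg hl h₁ h₁' h₂ h₂' k
  le_two a b z := (Psi_le_one hl h₁ h₁' h₂ h₂' k a b z).trans one_le_two
  slow a b z s _ hs hs1 := (blockFun_aux (Psi_nonneg hl h₁ h₁' h₂ h₂' k a b z)
    (Psi_le_one hl h₁ h₁' h₂ h₂' k a b z) hs hs1 (Psi_slow hl h₁ h₁' h₂ h₂' k a b z hs).1
    (Psi_slow hl h₁ h₁' h₂ h₂' k a b z hs).2).1

lemma blockFun_two_sub_Psi (hl : 0 ≤ lam) (h₁ : 0 ≤ r₁) (h₁' : r₁ < 1) (h₂ : 0 ≤ r₂)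
    (h₂' : r₂ < 1) (k : ℕ) : BlockFun k fun a b z => 2 - Psi K lam r₁ r₂ k a b z where
  meas := measurable_const.sub (measurable_Psi K lam r₁ r₂ k)
  left a a' h := by
    funext b z
    simp only [Psi, pd_congr K h]
  right a b b' h := by
    funext z
    simp only [Psi, pb_congr K h]
  nonneg a b z := by linarith [Psi_le_one (K := K) hl h₁ h₁' h₂ h₂' k a b z]
  le_two a b z := by linarith [Psi_nonneg (K := K) hl h₁ h₁' h₂ h₂' k a b z]
  slow a b z s _ hs hs1 := (blockFun_aux (Psi_nonneg hl h₁ h₁' h₂ h₂' k a b z)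
    (Psi_le_one hl h₁ h₁' h₂ h₂' k a b z) hs hs1 (Psi_slow hl h₁ h₁' h₂ h₂' k a b z hs).1
    (Psi_slow hl h₁ h₁' h₂ h₂' k a b z hs).2).2

end functional

section truncation

variable {K lam r₁ r₂ : ℝ}

/-- The factor `(1 - e^{-y}) / y` arising from the branching part. -/
def phiOne (y : ℝ) : ℝ := (1 - Real.exp (-y)) / y

lemma phiOne_nonneg {y : ℝ} (hy : 0 < y) : 0 ≤ phiOne y :=
  div_nonneg (by linarith [Real.exp_le_one_iff.mpr (show -y ≤ 0 by linarith)]) hy.le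

lemma phiOne_le_one {y : ℝ} (hy : 0 < y) : phiOne y ≤ 1 := by
  rw [phiOne, div_le_one hy]
  linarith [Real.add_one_le_exp (-y)]

lemma one_sub_phiOne_le {y : ℝ} (hy : 0 < y) : 1 - phiOne y ≤ y := by
  rw [sub_le_comm, phiOne, le_div_iff₀ hy]
  have h1 : Real.exp (-y) ≤ 1 / (1 + y) := by
    rw [Real.exp_neg, one_div]
    exact inv_anti₀ (by linarith) (by linarith [Real.add_one_le_exp y])
  have h2 : 1 / (1 + y) ≤ 1 - y + y * y := by
    rw [div_le_iff₀ (by linarith)]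
    nlinarith [pow_pos hy 3]
  nlinarith

lemma abs_om_sub_le (hl : 0 < lam) {u₁ u₂ b b' V V' E : ℝ} (hu₁ : 0 ≤ u₁) (hu₁' : u₁ ≤ 1)
    (hu₂ : 0 ≤ u₂) (hu₂' : u₂ ≤ 1) (hb' : 0 ≤ b') (hb : b' ≤ b) (hV : 0 ≤ V) (hV1 : V ≤ 1)
    (hV' : 0 ≤ V') (hE : 0 ≤ E) (hE1 : E ≤ 1) :
    |om lam u₁ u₂ b V E - om lam 1 1 b' V' E| ≤
      |V - V'| + (1 - u₁) + (lam + 1) * (b - b') + (|V - V'| + (1 - u₂)) / lam := by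
  have hb0 := hb'.trans hb
  set A := 1 + (lam * u₁ + u₂ * V * E) * b with hA
  set A' := 1 + (lam * 1 + 1 * V' * E) * b' with hA'
  have hA1 : 1 ≤ A := by have : 0 ≤ (lam * u₁ + u₂ * V * E) * b := by positivity
                         linarith
  have hAl : 1 + lam * b' ≤ A' := by
    have : 0 ≤ V' * E * b' := by positivity
    rw [hA']; linarith
  have hlb : 0 ≤ lam * b' := by positivity
  have hA1' : 1 ≤ A' := by linarith
  have hApos : 0 < A := by linarith
  have hApos' : 0 < A' := by linarith
  have e : om lam u₁ u₂ b V E - om lam 1 1 b' V' E =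
      (V - V') / A' + V / A * ((A' - A) / A') := by
    rw [om, om, ← hA, ← hA']
    field_simp
    ring
  have t1 : |(V - V') / A'| ≤ |V - V'| := by
    rw [abs_div, abs_of_pos hApos']
    exact div_le_self (abs_nonneg _) hA1'
  have t2 : |V / A| ≤ 1 := by
    rw [abs_of_nonneg (by positivity), div_le_one hApos]; linarith
  have t3 : |(A' - A) / A'| ≤ (1 - u₁) + (lam + 1) * (b - b') + (|V - V'| + (1 - u₂)) / lam := by
    have hVV := abs_nonneg (V - V')
    rw [abs_div, abs_of_pos hApos', div_le_iff₀ hApos']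
    have e2 : A' - A = lam * b' * (1 - u₁) + lam * u₁ * (b' - b) +
        E * b' * ((V' - V) + V * (1 - u₂)) + E * u₂ * V * (b' - b) := by rw [hA, hA']; ring
    have b1 : lam * b' * (1 - u₁) ≤ (1 - u₁) * A' := by nlinarith
    have b2 : lam * u₁ * (b - b') + E * u₂ * V * (b - b') ≤ (lam + 1) * (b - b') * A' := by
      have h1 : E * u₂ * V ≤ 1 :=
        mul_le_one₀ (mul_le_one₀ hE1 hu₂ hu₂') hV hV1
      have h2 : lam * u₁ ≤ lam := mul_le_of_le_one_right hl.le hu₁'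
      have h3 : 0 ≤ b - b' := by linarith
      calc _ = (lam * u₁ + E * u₂ * V) * (b - b') := by ring
        _ ≤ (lam + 1) * (b - b') := by gcongr
        _ ≤ _ := le_mul_of_one_le_right (by positivity) hA1'
    have b3 : E * b' * (|V - V'| + (1 - u₂)) ≤ (|V - V'| + (1 - u₂)) / lam * A' := by
      have h0 : 0 ≤ |V - V'| + (1 - u₂) := by linarith
      have h1 : E * b' ≤ A' / lam := by
        rw [le_div_iff₀ hl]
        have : E * b' ≤ b' := mul_le_of_le_one_left hb' hE1
        nlinarith
      calc _ ≤ A' / lam * (|V - V'| + (1 - u₂)) := by gcongr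
        _ = _ := by ring
    have b4 : |(V' - V) + V * (1 - u₂)| ≤ |V - V'| + (1 - u₂) := by
      refine (abs_add_le _ _).trans ?_
      rw [abs_sub_comm, abs_of_nonneg (mul_nonneg hV (by linarith))]
      have : V * (1 - u₂) ≤ 1 - u₂ := mul_le_of_le_one_left (by linarith) hV1
      linarith
    have b5 := abs_le.mp b4
    have hEb : 0 ≤ E * b' := by positivity
    have hs : 0 ≤ lam * u₁ * (b - b') := mul_nonneg (by positivity) (by linarith)
    have hs' : 0 ≤ E * u₂ * V * (b - b') := mul_nonneg (by positivity) (by linarith)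
    have hs'' : 0 ≤ lam * b' * (1 - u₁) := mul_nonneg hlb (by linarith)
    rw [e2, abs_le]
    constructor <;>
      nlinarith [mul_le_mul_of_nonneg_left b5.1 hEb, mul_le_mul_of_nonneg_left b5.2 hEb]
  rw [e]
  refine (abs_add_le _ _).trans ?_
  rw [abs_mul]
  have := mul_le_mul t2 t3 (abs_nonneg _) zero_le_one
  linarith

/-- The full functional along the reversed path. -/
def Gfull (K lam r₁ r₂ : ℝ) (m n : ℕ) (x : Path) : ℝ :=
  om lam (phiOne (lam * Real.exp (-pS (prev n x) m)))
      (Real.exp (-(lam * Real.exp (-pS (prev n x) m))))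
      (pb K m (prev n x)) (rV r₁ (pd K (n - m) x)) (Real.exp (pS x n)) *
    om lam (phiOne (lam * Real.exp (-pS (prev n x) m)))
        (Real.exp (-(lam * Real.exp (-pS (prev n x) m))))
      (pb K m (prev n x)) (rV r₂ (pd K (n - m) x)) (Real.exp (pS x n))

lemma abs_mul_sub_mul_le {a b c d : ℝ} (hb : |b| ≤ 1) (hc : |c| ≤ 1) :
    |a * b - c * d| ≤ |a - c| + |b - d| := by
  have : a * b - c * d = (a - c) * b + c * (b - d) := by ring
  rw [this]
  refine (abs_add_le _ _).trans ?_
  rw [abs_mul, abs_mul]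
  nlinarith [abs_nonneg (a - c), abs_nonneg (b - d)]

lemma pb_sub (K : ℝ) {k m : ℕ} (h : k ≤ m) (x : Path) :
    pb K m x - pb K k x = ∑ i ∈ Finset.Ico k m, cl K (x i).2 * Real.exp (-pS x i) := by
  rw [pb, pb, ← Finset.sum_range_add_sum_Ico _ h]; ring

lemma pd_sub (K : ℝ) {k m : ℕ} (h : k ≤ m) (x : Path) :
    pd K m x - pd K k x = ∑ i ∈ Finset.Ico k m, cl K (x i).2 * Real.exp (pS x (i + 1)) := by
  rw [pd, pd, ← Finset.sum_range_add_sum_Ico _ h]; ring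

lemma abs_om_sub_om_le (hK : 0 ≤ K) (hl : 0 < lam) {r : ℝ} (h0 : 0 ≤ r) (h1 : r < 1) {k m n : ℕ}
    (hkm : k ≤ m) (hmn : k + m < n) {x : Path} (hx : pS x n ≤ 0) :
    |om lam (phiOne (lam * Real.exp (-pS (prev n x) m)))
        (Real.exp (-(lam * Real.exp (-pS (prev n x) m))))
        (pb K m (prev n x)) (rV r (pd K (n - m) x)) (Real.exp (pS x n)) -
      om lam 1 1 (pb K k (prev n x)) (rV r (pd K k x)) (Real.exp (pS x n))| ≤
      (lam + 2 + 1 / lam) * (K + 1) *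
        ∑ j ∈ Finset.Ioc k (n - k), Real.exp ((pS x j - pS x n) / 2) ^ 2 := by
  set g : ℕ → ℝ := fun j => Real.exp ((pS x j - pS x n) / 2) ^ 2 with hg
  have hg' : ∀ j, g j = Real.exp (pS x j - pS x n) := fun j => by
    rw [hg]; simp only []; rw [← Real.exp_nat_mul]; congr 1; push_cast; ring
  have hg0 : ∀ j, 0 ≤ g j := fun j => sq_nonneg _
  set G := ∑ j ∈ Finset.Ioc k (n - k), g j with hG
  have hsub : ∀ s : Finset ℕ, s ⊆ Finset.Ioc k (n - k) → ∑ j ∈ s, g j ≤ G := fun s hs =>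
    Finset.sum_le_sum_of_subset_of_nonneg hs fun j _ _ => hg0 j
  have hG0 : 0 ≤ G := Finset.sum_nonneg fun j _ => hg0 j
  set y := Real.exp (-pS (prev n x) m) with hy
  have hypos : 0 < y := Real.exp_pos _
  have hyG : y ≤ G := by
    have : y = g (n - m) := by
      rw [hg', hy, pS_prev x (by omega)]; congr 1; ring
    rw [this]
    exact Finset.single_le_sum (f := g) (fun j _ => hg0 j)
      (Finset.mem_Ioc.mpr ⟨by omega, by omega⟩)
  have hbG : pb K m (prev n x) - pb K k (prev n x) ≤ K * G := by
    rw [pb_sub K hkm]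
    calc _ ≤ ∑ i ∈ Finset.Ico k m, K * g (n - i) := by
          refine Finset.sum_le_sum fun i hi => ?_
          have := Finset.mem_Ico.mp hi
          rw [hg', pS_prev x (by omega), neg_sub]
          exact mul_le_mul_of_nonneg_right (cl_le hK _) (Real.exp_pos _).le
      _ = K * ∑ j ∈ (Finset.Ico k m).image (fun i => n - i), g j := by
          rw [← Finset.mul_sum, Finset.sum_image]
          intro i hi j hj hij
          have hi := Finset.mem_Ico.mp hi
          have hj := Finset.mem_Ico.mp hj
          simp only [] at hij
          omega
      _ ≤ _ := by
          refine mul_le_mul_of_nonneg_left (hsub _ fun j hj => ?_) hK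
          obtain ⟨i, hi, rfl⟩ := Finset.mem_image.mp hj
          have := Finset.mem_Ico.mp hi
          exact Finset.mem_Ioc.mpr ⟨by omega, by omega⟩
  have hdG : pd K (n - m) x - pd K k x ≤ K * G := by
    rw [pd_sub K (by omega)]
    calc _ ≤ ∑ i ∈ Finset.Ico k (n - m), K * g (i + 1) := by
          refine Finset.sum_le_sum fun i hi => ?_
          rw [hg']
          exact mul_le_mul (cl_le hK _) (Real.exp_le_exp.mpr (by linarith)) (Real.exp_pos _).le hK
      _ = K * ∑ j ∈ (Finset.Ico k (n - m)).image (fun i => i + 1), g j := by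
          rw [← Finset.mul_sum, Finset.sum_image]
          intro i hi j hj hij
          simp only [] at hij
          omega
      _ ≤ _ := by
          refine mul_le_mul_of_nonneg_left (hsub _ fun j hj => ?_) hK
          obtain ⟨i, hi, rfl⟩ := Finset.mem_image.mp hj
          have := Finset.mem_Ico.mp hi
          exact Finset.mem_Ioc.mpr ⟨by omega, by omega⟩
  have hb0 : pb K k (prev n x) ≤ pb K m (prev n x) := by
    rw [← sub_nonneg, pb_sub K hkm]
    exact Finset.sum_nonneg fun _ _ => mul_nonneg (cl_nonneg _ _) (Real.exp_pos _).le
  have hd0 : pd K k x ≤ pd K (n - m) x := by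
    rw [← sub_nonneg, pd_sub K (by omega)]
    exact Finset.sum_nonneg fun _ _ => mul_nonneg (cl_nonneg _ _) (Real.exp_pos _).le
  have hly : 0 < lam * y := by positivity
  have hVd := abs_rV_sub_le h0 h1 (pd_nonneg K k x) hd0
  have hu2 : 1 - Real.exp (-(lam * y)) ≤ lam * y := by
    linarith [Real.add_one_le_exp (-(lam * y))]
  have hu1 := one_sub_phiOne_le hly
  refine (abs_om_sub_le hl (phiOne_nonneg hly) (phiOne_le_one hly) (Real.exp_pos _).le
    (Real.exp_le_one_iff.mpr (by linarith)) (pb_nonneg K k _) hb0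
    (rV_pos h0 h1 (pd_nonneg _ _ _)).le (rV_le_one h0 h1 (pd_nonneg _ _ _))
    (rV_pos h0 h1 (pd_nonneg _ _ _)).le (Real.exp_pos _).le (Real.exp_le_one_iff.mpr hx)).trans ?_
  set Vd := |rV r (pd K (n - m) x) - rV r (pd K k x)|
  have hVG : Vd ≤ K * G := hVd.trans hdG
  have hKG : 0 ≤ K * G := mul_nonneg hK hG0
  calc _ ≤ K * G + lam * G + (lam + 1) * (K * G) + (K * G + lam * G) / lam := by
        gcongr <;> nlinarith
    _ = (lam + 2 + 1 / lam) * (K * G) + (lam + 1) * G := by field_simp; ring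
    _ ≤ (lam + 2 + 1 / lam) * (K * G) + (lam + 2 + 1 / lam) * G := by
        have : 0 < 1 / lam := by positivity
        exact add_le_add_right (mul_le_mul_of_nonneg_right (by linarith) hG0) _
    _ = _ := by ring

lemma Gfull_mem (hl : 0 < lam) (h₁ : 0 ≤ r₁) (h₁' : r₁ < 1) (h₂ : 0 ≤ r₂) (h₂' : r₂ < 1)
    (m n : ℕ) (x : Path) : 0 ≤ Gfull K lam r₁ r₂ m n x ∧ Gfull K lam r₁ r₂ m n x ≤ 1 := by
  have hly : 0 < lam * Real.exp (-pS (prev n x) m) := by positivity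
  have a0 := phiOne_nonneg hly
  have a1 := (Real.exp_pos (-(lam * Real.exp (-pS (prev n x) m)))).le
  have v1 := rV_pos h₁ h₁' (pd_nonneg K (n - m) x)
  have v2 := rV_pos h₂ h₂' (pd_nonneg K (n - m) x)
  have w1 := rV_le_one h₁ h₁' (pd_nonneg K (n - m) x)
  have w2 := rV_le_one h₂ h₂' (pd_nonneg K (n - m) x)
  have hb := pb_nonneg K m (prev n x)
  have hE := (Real.exp_pos (pS x n)).le
  exact ⟨mul_nonneg (om_nonneg hl.le a0 a1 hb v1.le hE) (om_nonneg hl.le a0 a1 hb v2.le hE),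
    mul_le_one₀ (om_le_one hl.le a0 a1 hb v1.le w1 hE) (om_nonneg hl.le a0 a1 hb v2.le hE)
      (om_le_one hl.le a0 a1 hb v2.le w2 hE)⟩

lemma abs_Gfull_sub_Psi_le (hK : 0 ≤ K) (hl : 0 < lam) (h₁ : 0 ≤ r₁) (h₁' : r₁ < 1) (h₂ : 0 ≤ r₂)
    (h₂' : r₂ < 1) {k m n : ℕ} (hkm : k ≤ m) (hmn : k + m < n) {x : Path} (hx : pS x n ≤ 0) :
    |Gfull K lam r₁ r₂ m n x - Psi K lam r₁ r₂ k x (prev n x) (-pS x n)| ≤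
      (2 * ((lam + 2 + 1 / lam) * (K + 1))) *
        ∑ j ∈ Finset.Ioc k (n - k), Real.exp ((pS x j - pS x n) / 2) := by
  set s := ∑ j ∈ Finset.Ioc k (n - k), Real.exp ((pS x j - pS x n) / 2) with hs
  set C := 2 * ((lam + 2 + 1 / lam) * (K + 1)) with hC
  have hs0 : 0 ≤ s := Finset.sum_nonneg fun _ _ => (Real.exp_pos _).le
  have hsq : ∑ j ∈ Finset.Ioc k (n - k), Real.exp ((pS x j - pS x n) / 2) ^ 2 ≤ s ^ 2 :=
    Finset.sum_sq_le_sq_sum_of_nonneg fun _ _ => (Real.exp_pos _).le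
  have hl' : 0 < 1 / lam := by positivity
  have hC1 : 1 ≤ C := by nlinarith [mul_nonneg hl.le hK, mul_nonneg hl'.le hK]
  have hP0 := Psi_nonneg (K := K) hl.le h₁ h₁' h₂ h₂' k x (prev n x) (-pS x n)
  have hP1 := Psi_le_one (K := K) hl.le h₁ h₁' h₂ h₂' k x (prev n x) (-pS x n)
  obtain ⟨hG0, hG1⟩ := Gfull_mem (K := K) hl h₁ h₁' h₂ h₂' m n x
  rcases le_or_gt 1 s with h | h
  · calc _ ≤ 1 := by rw [abs_le]; constructor <;> linarith
      _ ≤ C * s := by nlinarith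
  · have hle : |Gfull K lam r₁ r₂ m n x - Psi K lam r₁ r₂ k x (prev n x) (-pS x n)| ≤
        C * s ^ 2 := by
      have c1 := abs_om_sub_om_le hK hl h₁ h₁' hkm hmn hx
      have c2 := abs_om_sub_om_le hK hl h₂ h₂' hkm hmn hx
      have hly : 0 < lam * Real.exp (-pS (prev n x) m) := by positivity
      have hE := (Real.exp_pos (pS x n)).le
      refine (abs_mul_sub_mul_le ?_ ?_).trans ?_
      · rw [abs_of_nonneg (om_nonneg hl.le (phiOne_nonneg hly) (Real.exp_pos _).le (pb_nonneg _ _ _)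
          (rV_pos h₂ h₂' (pd_nonneg _ _ _)).le hE)]
        exact om_le_one hl.le (phiOne_nonneg hly) (Real.exp_pos _).le (pb_nonneg _ _ _)
          (rV_pos h₂ h₂' (pd_nonneg _ _ _)).le (rV_le_one h₂ h₂' (pd_nonneg _ _ _)) hE
      · rw [abs_of_nonneg (om_nonneg hl.le zero_le_one zero_le_one (pb_nonneg _ _ _)
          (rV_pos h₁ h₁' (pd_nonneg _ _ _)).le (Real.exp_pos _).le)]
        exact om_le_one hl.le zero_le_one zero_le_one (pb_nonneg _ _ _)
          (rV_pos h₁ h₁' (pd_nonneg _ _ _)).le (rV_le_one h₁ h₁' (pd_nonneg _ _ _))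
          (Real.exp_pos _).le
      · rw [neg_neg]
        have := mul_le_mul_of_nonneg_left hsq
          (show 0 ≤ (lam + 2 + 1 / lam) * (K + 1) by positivity)
        linarith
    refine hle.trans ?_
    have : s ^ 2 ≤ s := by nlinarith
    exact mul_le_mul_of_nonneg_left this (by linarith)

end truncation

section truncationbound

variable {ν : Measure (ℝ × ℝ)} [IsProbabilityMeasure ν]

lemma exists_kmgf_le {ρ : Measure ℝ} {κ : ℝ} (h : KilledAsymp ρ κ) {u : ℝ} (hu : 0 < u) :
    ∃ C : ℝ, 0 < C ∧ ∀ j, 1 ≤ j → kmgf ρ (Iio 0) u j ≤ C / wt j := by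
  obtain ⟨C, hC⟩ := (h.2 u hu).1.2.bddAbove_range
  refine ⟨max C 1, by positivity, fun j hj => ?_⟩
  rw [le_div_iff₀ (wt_pos hj), mul_comm]
  exact (hC ⟨j, rfl⟩).trans (le_max_left _ _)

lemma below_of_stay {j N : ℕ} (hj : 1 ≤ j) {x : Path} (hx : stay (Iio 0) (j + N) x) :
    stay (Iio 0) j x ∧ below (-pS x j) N (pshift j x) := by
  refine ⟨fun i h1 h2 => hx i h1 (by omega), fun i hi => ?_⟩
  have := mem_Iio.mp (hx (j + i) (by omega) (by omega))
  rw [pS_add] at this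
  linarith

lemma exists_lintegral_stay_two_le {κ : ℝ} (h : KilledAsymp (ν.map Prod.fst) κ) :
    ∃ C : ℝ, 0 < C ∧ ∀ j N, 1 ≤ j → 1 ≤ N →
      ∫⁻ x, ind (stay (Iio 0) (j + N) x) *
        ENNReal.ofReal (Real.exp ((pS x j + pS x (j + N)) / 2)) ∂(pathLaw ν) ≤
      ENNReal.ofReal (C / (wt j * wt N)) := by
  obtain ⟨C₁, hC₁, h1⟩ := exists_kmgf_le h (u := 1 / 4) (by norm_num)
  obtain ⟨C₂, hC₂, h2⟩ := exists_pE_exp_le h (lam := 1 / 4) (α := 1 / 2) (by norm_num) (by norm_num)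
  refine ⟨C₂ * C₁, by positivity, fun j N hj hN => ?_⟩
  have hwj := wt_pos hj
  have hwN := wt_pos hN
  set F : Path → Path → ENNReal := fun x y => ind (stay (Iio 0) j x) *
    (ENNReal.ofReal (Real.exp (1 / 2 * pS x j)) * (ind (below (-pS x j) N y) *
      ENNReal.ofReal (Real.exp (-(1 / 2) * (-pS x j - pS y N))))) with hF
  have hFm : Measurable (Function.uncurry F) := by
    have m1 : Measurable fun p : Path × Path => ind (stay (Iio 0) j p.1) :=
      (measurable_ind (measurableSet_stay measurableSet_Iio j)).comp measurable_fst
    have m2 : Measurable fun p : Path × Path => (-pS p.1 j, p.2) := by fun_prop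
    have m3 := (measurable_ind_below N (H := fun w => ENNReal.ofReal (Real.exp (-(1 / 2) * w)))
      (by fun_prop)).comp m2
    exact m1.mul (Measurable.mul (by fun_prop) m3)
  have hdep : ∀ x x' : Path, (∀ i < j, x i = x' i) → F x = F x' := by
    intro x x' hxx
    funext y
    simp only [hF, pS_congr hxx]
    congr 2
    exact propext (stay_congr hxx)
  calc _ ≤ ∫⁻ x, F x (pshift j x) ∂(pathLaw ν) := by
        refine lintegral_mono fun x => ?_
        by_cases hx : stay (Iio 0) (j + N) x
        · obtain ⟨ha, hb⟩ := below_of_stay hj hx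
          simp only [hF]
          rw [ind_pos hx, ind_pos ha, ind_pos hb, one_mul, one_mul, one_mul,
            ← ENNReal.ofReal_mul (Real.exp_pos _).le, ← Real.exp_add, pS_add]
          apply le_of_eq; congr 2; ring
        · rw [ind_neg hx, zero_mul]; exact zero_le
    _ = ∫⁻ x, ∫⁻ y, F x y ∂(pathLaw ν) ∂(pathLaw ν) := lintegral_pshift j hFm hdep
    _ = ∫⁻ x, ind (stay (Iio 0) j x) * (ENNReal.ofReal (Real.exp (1 / 2 * pS x j)) *
          pE ν N (-pS x j) (fun w => ENNReal.ofReal (Real.exp (-(1 / 2) * w)))) ∂(pathLaw ν) := by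
        refine lintegral_congr fun x => ?_
        simp only [hF]
        rw [lintegral_const_mul' _ _ (ind_ne_top _), lintegral_const_mul' _ _ ENNReal.ofReal_ne_top]
        rfl
    _ ≤ ∫⁻ x, ENNReal.ofReal (C₂ / wt N) * (ind (stay (Iio 0) j x) *
          ENNReal.ofReal (Real.exp (1 / 4 * pS x j))) ∂(pathLaw ν) := by
        refine lintegral_mono fun x => ?_
        rw [mul_left_comm (ENNReal.ofReal (C₂ / wt N))]
        refine mul_le_mul_right ?_ _
        refine (mul_le_mul_right (h2 N hN _) _).trans_eq ?_
        rw [← ENNReal.ofReal_mul (Real.exp_pos _).le, ← ENNReal.ofReal_mul (by positivity)]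
        congr 1
        rw [show 1 / 4 * pS x j = 1 / 2 * pS x j + 1 / 4 * -pS x j by ring, Real.exp_add]
        ring
    _ = ENNReal.ofReal (C₂ / wt N) * ENNReal.ofReal (kmgf (ν.map Prod.fst) (Iio 0) (1 / 4) j) := by
        rw [lintegral_const_mul' _ _ ENNReal.ofReal_ne_top, lintegral_stay_exp (by norm_num)]
    _ ≤ _ := by
        rw [← ENNReal.ofReal_mul (by positivity)]
        refine ENNReal.ofReal_le_ofReal ?_
        calc _ ≤ C₂ / wt N * (C₁ / wt j) := by gcongr; exact h1 j hj
          _ = _ := by field_simp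

lemma wt_add_le {j N : ℕ} : wt (j + N) ≤ 3 * (wt j + wt N) := by
  have key : ∀ m, wt (2 * m) ≤ 3 * wt m := by
    intro m
    unfold wt
    have h : √((2 * m : ℕ) : ℝ) ≤ 3 / 2 * √(m : ℝ) := by
      rw [Real.sqrt_le_left (by positivity), mul_pow, Real.sq_sqrt (by positivity)]
      push_cast
      nlinarith [(Nat.cast_nonneg m : (0 : ℝ) ≤ m)]
    calc _ ≤ ((2 * m : ℕ) : ℝ) * (3 / 2 * √(m : ℝ)) := by gcongr
      _ = _ := by push_cast; ring
  have h1 := wt_nonneg j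
  have h2 := wt_nonneg N
  rcases le_total j N with h | h
  · linarith [wt_mono (show j + N ≤ 2 * N by omega), key N]
  · linarith [wt_mono (show j + N ≤ 2 * j by omega), key j]

/-- The tail sums of the inverse weights. -/
def wtTail (k : ℕ) : ℝ := ∑' j, (wt (j + k))⁻¹

lemma tendsto_wtTail : Tendsto wtTail atTop (𝓝 0) :=
  tendsto_sum_nat_add fun j => (wt j)⁻¹

lemma sum_inv_wt_le {k : ℕ} {s : Finset ℕ} (hs : ∀ j ∈ s, k ≤ j) :
    ∑ j ∈ s, (wt j)⁻¹ ≤ wtTail k := by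
  have h := Summable.sum_le_tsum (f := fun j => (wt (j + k))⁻¹) (s.image fun j => j - k)
    (fun j _ => inv_nonneg.mpr (wt_nonneg _)) ((summable_nat_add_iff k).mpr summable_inv_wt)
  rw [Finset.sum_image (fun i hi j hj hij => by
    have := hs i hi; have := hs j hj; omega)] at h
  refine le_trans (le_of_eq (Finset.sum_congr rfl fun j hj => ?_)) h
  rw [Nat.sub_add_cancel (hs j hj)]

lemma exists_truncation_bound {κ : ℝ} (h : KilledAsymp (ν.map Prod.fst) κ) {K lam r₁ r₂ : ℝ}
    (hK : 0 ≤ K) (hl : 0 < lam) (h₁ : 0 ≤ r₁) (h₁' : r₁ < 1) (h₂ : 0 ≤ r₂) (h₂' : r₂ < 1) :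
    ∃ C : ℝ, 0 < C ∧ ∀ k m n, 1 ≤ k → k ≤ m → k + m < n →
      ENNReal.ofReal (wt n) * ∫⁻ x, ind (stay (Iio 0) n x) * ENNReal.ofReal (Real.exp (pS x n) *
        |Gfull K lam r₁ r₂ m n x - Psi K lam r₁ r₂ k x (prev n x) (-pS x n)|) ∂(pathLaw ν) ≤
      ENNReal.ofReal (C * wtTail k) := by
  obtain ⟨C, hC, hR⟩ := exists_lintegral_stay_two_le h
  set C₀ := 2 * ((lam + 2 + 1 / lam) * (K + 1)) with hC₀
  have hC₀' : 0 < C₀ := by positivity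
  refine ⟨6 * C₀ * C, by positivity, fun k m n hk hkm hmn => ?_⟩
  have hm : ∀ j, Measurable fun x => ind (stay (Iio 0) n x) *
      ENNReal.ofReal (Real.exp ((pS x j + pS x n) / 2)) := fun j =>
    (measurable_ind (measurableSet_stay measurableSet_Iio n)).mul (by fun_prop)
  calc _ ≤ ENNReal.ofReal (wt n) * ∫⁻ x, ENNReal.ofReal C₀ * ∑ j ∈ Finset.Ioc k (n - k),
          ind (stay (Iio 0) n x) * ENNReal.ofReal (Real.exp ((pS x j + pS x n) / 2))
            ∂(pathLaw ν) := by
        refine mul_le_mul_right (lintegral_mono fun x => ?_) _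
        by_cases hx : stay (Iio 0) n x
        · simp only [ind_pos hx, one_mul]
          rw [← ENNReal.ofReal_sum_of_nonneg fun _ _ => (Real.exp_pos _).le,
            ← ENNReal.ofReal_mul hC₀'.le]
          refine ENNReal.ofReal_le_ofReal ?_
          have := abs_Gfull_sub_Psi_le (K := K) hK hl h₁ h₁' h₂ h₂' hkm hmn
            (mem_Iio.mp (hx n (by omega) le_rfl)).le
          refine (mul_le_mul_of_nonneg_left this (Real.exp_pos _).le).trans_eq ?_
          rw [mul_left_comm, Finset.mul_sum, Finset.mul_sum, Finset.mul_sum]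
          refine Finset.sum_congr rfl fun j _ => ?_
          rw [← Real.exp_add, hC₀]
          congr 2; ring
        · rw [ind_neg hx, zero_mul]; exact zero_le
    _ = ENNReal.ofReal (wt n) * (ENNReal.ofReal C₀ * ∑ j ∈ Finset.Ioc k (n - k),
          ∫⁻ x, ind (stay (Iio 0) n x) * ENNReal.ofReal (Real.exp ((pS x j + pS x n) / 2))
            ∂(pathLaw ν)) := by
        rw [lintegral_const_mul' _ _ ENNReal.ofReal_ne_top, lintegral_finsetSum _ fun j _ => hm j]
    _ ≤ ENNReal.ofReal (wt n) * (ENNReal.ofReal C₀ * ∑ j ∈ Finset.Ioc k (n - k),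
          ENNReal.ofReal (C / (wt j * wt (n - j)))) := by
        gcongr with j hj
        have := Finset.mem_Ioc.mp hj
        have := hR j (n - j) (by omega) (by omega)
        rwa [Nat.add_sub_cancel' (by omega)] at this
    _ = ENNReal.ofReal (wt n * (C₀ * ∑ j ∈ Finset.Ioc k (n - k), C / (wt j * wt (n - j)))) := by
        rw [ENNReal.ofReal_mul (wt_nonneg n), ENNReal.ofReal_mul hC₀'.le,
          ENNReal.ofReal_sum_of_nonneg fun j _ =>
            div_nonneg hC.le (mul_nonneg (wt_nonneg _) (wt_nonneg _))]
    _ ≤ _ := by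
        refine ENNReal.ofReal_le_ofReal ?_
        have e1 : ∀ j ∈ Finset.Ioc k (n - k), wt n * (C₀ * (C / (wt j * wt (n - j)))) ≤
            3 * C₀ * C * ((wt j)⁻¹ + (wt (n - j))⁻¹) := by
          intro j hj
          have := Finset.mem_Ioc.mp hj
          have hwj := wt_pos (show 1 ≤ j by omega)
          have hwN := wt_pos (show 1 ≤ n - j by omega)
          have hw := wt_add_le (j := j) (N := n - j)
          rw [Nat.add_sub_cancel' (by omega)] at hw
          calc _ ≤ 3 * (wt j + wt (n - j)) * (C₀ * (C / (wt j * wt (n - j)))) := by gcongr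
            _ = _ := by field_simp; ring
        rw [Finset.mul_sum, Finset.mul_sum]
        refine (Finset.sum_le_sum e1).trans ?_
        rw [← Finset.mul_sum, Finset.sum_add_distrib]
        have s1 := sum_inv_wt_le (k := k) (s := Finset.Ioc k (n - k)) fun j hj =>
          (Finset.mem_Ioc.mp hj).1.le
        have s2 := sum_inv_wt_le (k := k) (s := (Finset.Ioc k (n - k)).image fun j => n - j) (by
          intro j hj
          obtain ⟨i, hi, rfl⟩ := Finset.mem_image.mp hj
          have := Finset.mem_Ioc.mp hi
          omega)
        rw [Finset.sum_image (fun i hi j hj hij => by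
          have := Finset.mem_Ioc.mp hi; have := Finset.mem_Ioc.mp hj
          omega)] at s2
        have : 0 ≤ 3 * C₀ * C := by positivity
        nlinarith

end truncationbound

section limitfunctional

variable {ν : Measure (ℝ × ℝ)} [IsProbabilityMeasure ν]

lemma summable_of_min_one {a : ℕ → ℝ} (h0 : ∀ j, 0 ≤ a j) (h : Summable fun j => min 1 (a j)) :
    Summable a := by
  refine Summable.of_norm_bounded_eventually_nat h ?_
  filter_upwards [h.tendsto_atTop_zero.eventually (gt_mem_nhds one_pos)] with j hj
  rw [Real.norm_of_nonneg (h0 j)]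
  rcases le_total (a j) 1 with h1 | h1
  · rw [min_eq_right h1]
  · rw [min_eq_left h1] at hj; exact absurd hj (lt_irrefl _)

lemma ae_summable_of_lintegral_le {α : Type*} [MeasurableSpace α] {P : Measure α}
    {a : ℕ → α → ℝ} (hm : ∀ j, Measurable (a j)) (h0 : ∀ j x, 0 ≤ a j x) {c : ℕ → ENNReal}
    (hc : ∑' j, c j ≠ ⊤)
    (h : ∀ j, ∫⁻ x, ENNReal.ofReal (min 1 (a j x)) ∂P ≤ c j) :
    ∀ᵐ x ∂P, Summable fun j => a j x := by
  have hm' : ∀ j, Measurable fun x => ENNReal.ofReal (min 1 (a j x)) := fun j =>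
    ENNReal.measurable_ofReal.comp (measurable_const.min (hm j))
  have h1 : ∫⁻ x, ∑' j, ENNReal.ofReal (min 1 (a j x)) ∂P ≠ ⊤ := by
    rw [lintegral_tsum fun j => (hm' j).aemeasurable]
    exact ne_top_of_le_ne_top hc (ENNReal.tsum_le_tsum h)
  filter_upwards [ae_lt_top (Measurable.tsum hm') h1] with x hx
  refine summable_of_min_one (fun j => h0 j x) ?_
  refine (ENNReal.summable_toReal hx.ne).congr fun j => ?_
  rw [ENNReal.toReal_ofReal (le_min zero_le_one (h0 j x))]

lemma min_one_exp_le {s : ℝ} : min 1 (Real.exp s) ≤ Real.exp (s / 2) := by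
  rcases le_total s 0 with h | h
  · exact (min_le_right _ _).trans (Real.exp_le_exp.mpr (by linarith))
  · exact (min_le_left _ _).trans (Real.one_le_exp (by linarith))

lemma ae_summable_exp_minus {κ : ℝ} (h : KilledAsymp (ν.map Prod.fst) κ) {Pm : Measure Path}
    (hm : IsHMinus ν Pm) : ∀ᵐ x ∂Pm, Summable fun j => Real.exp (pS x (j + 1)) := by
  have h4 : (0 : ℝ) < 1 / 4 := by norm_num
  set C := ∑' j, kmgf (ν.map Prod.fst) (Ici 0) (-(1 / 4)) j
  refine ae_summable_of_lintegral_le (fun j => by fun_prop) (fun j x => (Real.exp_pos _).le)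
    (c := fun j => ENNReal.ofReal (C) *
      ENNReal.ofReal (kmgf (ν.map Prod.fst) (Iio 0) (1 / 4) (j + 1))) ?_ fun j => ?_
  · rw [ENNReal.tsum_mul_left, ← ENNReal.ofReal_tsum_of_nonneg (fun j => kmgf_nonneg _ _)
      ((summable_nat_add_iff 1).mpr (h.2 _ h4).1.1)]
    exact ENNReal.mul_ne_top ENNReal.ofReal_ne_top ENNReal.ofReal_ne_top
  · rw [hm.2 (j + 1) (by omega) (fun x => ENNReal.ofReal (min 1 (Real.exp (pS x (j + 1)))))
      (by fun_prop) (fun x => ?_) (fun a a' haa => by rw [pS_congr haa]), ← lintegral_stay_exp h4,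
      ← lintegral_const_mul' _ _ ENNReal.ofReal_ne_top]
    · refine lintegral_mono fun x => ?_
      rw [mul_left_comm (ENNReal.ofReal C)]
      refine mul_le_mul_right ?_ _
      calc _ ≤ ENNReal.ofReal (Real.exp (pS x (j + 1) / 2)) *
            (ENNReal.ofReal (Real.exp (1 / 4 * -pS x (j + 1))) * ENNReal.ofReal C) := by
            gcongr
            · exact min_one_exp_le
            · exact vE_le h h4 _
        _ = _ := by
            rw [← mul_assoc, ← ENNReal.ofReal_mul (Real.exp_pos _).le, ← Real.exp_add, mul_comm]
            congr 3; ring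
    · calc _ ≤ ENNReal.ofReal 1 := ENNReal.ofReal_le_ofReal (min_le_left _ _)
        _ ≤ 2 := by simp

lemma posP_iff_splitAt {z : ℝ} (hz : 0 ≤ z) {N j : ℕ} (hj : j ≤ N) {x : Path}
    (h : splitAt (Iio 0) N j x) : posP N z x ↔ 0 ≤ z + pS x j := by
  obtain ⟨h1, h2⟩ := h
  constructor
  · intro H
    rcases Nat.eq_zero_or_pos j with rfl | hj0
    · simpa using hz
    · exact H j hj0 hj
  · intro H i hi1 hi
    rcases lt_or_ge i j with h3 | h3
    · have := mem_Iio.mp (h1 i h3); linarith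
    · rcases h3.eq_or_lt with rfl | h4
      · exact H
      · have := h2 (i - j) (by omega) (by omega)
        have e := pS_add x j (i - j)
        rw [Nat.add_sub_cancel' h3] at e
        simp only [mem_compl_iff, mem_Iio, not_lt] at this
        linarith

lemma lintegral_posP_exp_le {u z : ℝ} (hu : 0 < u) (hz : 0 ≤ z) (N : ℕ) :
    ∫⁻ x, ind (posP N z x) * ENNReal.ofReal (Real.exp (-u * (z + pS x N))) ∂(pathLaw ν) ≤
      ENNReal.ofReal (Real.exp z) * ∑ j ∈ Finset.range (N + 1),
        ENNReal.ofReal (kmgf (ν.map Prod.fst) (Iio 0) 1 j) *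
          ENNReal.ofReal (kmgf (ν.map Prod.fst) (Ici 0) (-u) (N - j)) := by
  rw [lintegral_eq_sum_split (ν := ν) (D := Iio 0) measurableSet_Iio
    (fun x hx y hy => by simp only [mem_Iio] at *; linarith)
    (fun x hx y hy => by simp only [mem_Iio, not_lt] at *; linarith) N
    (G := fun a b => ind (0 ≤ z + a) * ENNReal.ofReal (Real.exp (-u * (z + (a + b)))))
    ?_ ?_, Finset.mul_sum]
  · refine Finset.sum_le_sum fun j _ => ?_
    have hc : (Iio (0 : ℝ))ᶜ = Ici 0 := by ext; simp
    rw [hc, ← (ofReal_kmgf (ρ := ν.map Prod.fst) (D := Iio 0) (c := 1) measurableSet_Iio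
        (fun x hx => by
        have := mem_Iio.mp hx; linarith) j).1,
      ← (ofReal_kmgf (ρ := ν.map Prod.fst) (D := Ici 0) (c := -u) measurableSet_Ici (fun x hx => by
        have := mem_Ici.mp hx; nlinarith) (N - j)).1]
    calc _ ≤ ∫⁻ a, (ENNReal.ofReal (Real.exp z) * ENNReal.ofReal (Real.exp (1 * a))) *
          ∫⁻ b, ENNReal.ofReal (Real.exp (-u * b)) ∂(killed (ν.map Prod.fst) (Ici 0) (N - j))
            ∂(killed (ν.map Prod.fst) (Iio 0) j) := by
          refine lintegral_mono fun a => ?_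
          rw [← lintegral_const_mul' _ _ (by finiteness)]
          refine lintegral_mono fun b => ?_
          by_cases ha : 0 ≤ z + a
          · rw [ind_pos ha, one_mul, ← ENNReal.ofReal_mul (Real.exp_pos _).le,
              ← ENNReal.ofReal_mul (by positivity), ← Real.exp_add, ← Real.exp_add]
            refine ENNReal.ofReal_le_ofReal (Real.exp_le_exp.mpr ?_)
            nlinarith
          · rw [ind_neg ha, zero_mul]; exact zero_le
      _ = _ := by
          rw [lintegral_mul_const _ (by fun_prop), lintegral_const_mul' _ _ ENNReal.ofReal_ne_top,
            mul_assoc]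
  · exact Measurable.mul (measurable_ind (measurableSet_le measurable_const (by fun_prop)))
      (by fun_prop)
  · intro x j hj hx
    rw [show ind (posP N z x) = ind (0 ≤ z + pS x j) from
      congrArg ind (propext (posP_iff_splitAt hz hj hx))]
    congr 4; ring

lemma ae_summable_exp_plus {κ : ℝ} (h : KilledAsymp (ν.map Prod.fst) κ) {Pp : ℝ → Measure Path}
    (hp : IsHPlus ν Pp) {z : ℝ} (hz : 0 ≤ z) :
    ∀ᵐ x ∂(Pp z), Summable fun j => Real.exp (-pS x j) := by
  have h4 : (0 : ℝ) < 1 / 4 := by norm_num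
  set C := ∑' j, kmgf (ν.map Prod.fst) (Iio 0) (1 / 4) j
  set D : ℕ → ENNReal := fun N => ∑ j ∈ Finset.range (N + 1),
        ENNReal.ofReal (kmgf (ν.map Prod.fst) (Iio 0) 1 j) *
          ENNReal.ofReal (kmgf (ν.map Prod.fst) (Ici 0) (-(1 / 4)) (N - j)) with hD
  have hDs : ∑' N, D N ≠ ⊤ := by
    have := h.2 1 one_pos
    have := h.2 _ h4
    have e : ∀ N, D N = ENNReal.ofReal (∑ j ∈ Finset.range (N + 1),
        kmgf (ν.map Prod.fst) (Iio 0) 1 j *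
          kmgf (ν.map Prod.fst) (Ici 0) (-(1 / 4)) (N - j)) := fun N => by
      rw [ENNReal.ofReal_sum_of_nonneg fun j _ =>
        mul_nonneg (kmgf_nonneg _ _) (kmgf_nonneg _ _)]
      exact Finset.sum_congr rfl fun j _ => (ENNReal.ofReal_mul (kmgf_nonneg _ _)).symm
    simp_rw [e]
    rw [← ENNReal.ofReal_tsum_of_nonneg (fun N => Finset.sum_nonneg fun j _ =>
        mul_nonneg (kmgf_nonneg _ _) (kmgf_nonneg _ _))]
    · exact ENNReal.ofReal_ne_top
    · exact (summable_norm_sum_mul_range_of_summable_norm (h.2 1 one_pos).1.1.norm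
        (h.2 _ h4).2.1.norm).of_norm
  refine ae_summable_of_lintegral_le (fun j => by fun_prop) (fun j x => (Real.exp_pos _).le)
    (c := fun N => ENNReal.ofReal C * ENNReal.ofReal (Real.exp (z / 2)) *
      (ENNReal.ofReal (Real.exp z) * D N)) ?_ fun N => ?_
  · rw [ENNReal.tsum_mul_left, ENNReal.tsum_mul_left]
    finiteness
  · have hu := (hp z hz).2 N (fun x => ENNReal.ofReal (min 1 (Real.exp (-pS x N))))
      (by fun_prop) (fun x => by
        calc _ ≤ ENNReal.ofReal 1 := ENNReal.ofReal_le_ofReal (min_le_left _ _)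
          _ ≤ 2 := by simp) (fun a a' haa => by rw [pS_congr haa])
    calc _ ≤ uE (ν.map Prod.fst) z * ∫⁻ x, ENNReal.ofReal (min 1 (Real.exp (-pS x N))) ∂(Pp z) :=
          le_mul_of_one_le_left' (one_le_uE hz)
      _ = _ := hu
      _ ≤ ∫⁻ x, ENNReal.ofReal C * ENNReal.ofReal (Real.exp (z / 2)) * (ind (posP N z x) *
            ENNReal.ofReal (Real.exp (-(1 / 4) * (z + pS x N)))) ∂(pathLaw ν) := by
          refine lintegral_mono fun x => ?_
          rw [mul_left_comm (ENNReal.ofReal C * _)]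
          refine mul_le_mul_right ?_ _
          calc _ ≤ ENNReal.ofReal (Real.exp (-pS x N / 2)) *
                (ENNReal.ofReal (Real.exp (1 / 4 * (z + pS x N))) * ENNReal.ofReal C) := by
                gcongr
                · exact min_one_exp_le
                · exact uE_le h h4 _
            _ = _ := by
                rw [← mul_assoc, ← ENNReal.ofReal_mul (Real.exp_pos _).le, ← Real.exp_add, mul_comm,
                  mul_assoc, ← ENNReal.ofReal_mul (Real.exp_pos _).le, ← Real.exp_add]
                congr 3; ring
      _ ≤ _ := by
          rw [lintegral_const_mul' _ _ (by finiteness)]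
          exact mul_le_mul_right (lintegral_posP_exp_le h4 hz N) _

end limitfunctional

section limitvalue

variable {ν : Measure (ℝ × ℝ)} [IsProbabilityMeasure ν] {K lam r₁ r₂ : ℝ}

/-- The infinite forward sum of clamped marks weighted by `e^{-S}`. -/
def pbInf (K : ℝ) (x : Path) : ℝ := ∑' i, cl K (x i).2 * Real.exp (-pS x i)

/-- The infinite sum of clamped marks weighted by `e^{S}`. -/
def pdInf (K : ℝ) (x : Path) : ℝ := ∑' i, cl K (x i).2 * Real.exp (pS x (i + 1))

/-- The limiting functional. -/
def PsiInf (K lam r₁ r₂ : ℝ) (a b : Path) (z : ℝ) : ℝ :=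
  om lam 1 1 (pbInf K b) (rV r₁ (pdInf K a)) (Real.exp (-z)) *
    om lam 1 1 (pbInf K b) (rV r₂ (pdInf K a)) (Real.exp (-z))

lemma measurable_tsum_of_nonneg {α : Type*} [MeasurableSpace α] {f : ℕ → α → ℝ}
    (hm : ∀ i, Measurable (f i)) (h0 : ∀ i x, 0 ≤ f i x) : Measurable fun x => ∑' i, f i x := by
  have e : (fun x => ∑' i, f i x) = fun x => (∑' i, ENNReal.ofReal (f i x)).toReal := by
    funext x
    rw [ENNReal.tsum_toReal_eq fun _ => ENNReal.ofReal_ne_top]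
    exact tsum_congr fun i => (ENNReal.toReal_ofReal (h0 i x)).symm
  rw [e]
  exact (Measurable.tsum fun i => ENNReal.measurable_ofReal.comp (hm i)).ennreal_toReal

@[fun_prop]
lemma measurable_pbInf (K : ℝ) : Measurable (pbInf K) :=
  measurable_tsum_of_nonneg (fun i => ((measurable_cl K).comp (by fun_prop)).mul (by fun_prop))
    fun _ _ => mul_nonneg (cl_nonneg _ _) (Real.exp_pos _).le

@[fun_prop]
lemma measurable_pdInf (K : ℝ) : Measurable (pdInf K) :=
  measurable_tsum_of_nonneg (fun i => ((measurable_cl K).comp (by fun_prop)).mul (by fun_prop))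
    fun _ _ => mul_nonneg (cl_nonneg _ _) (Real.exp_pos _).le

lemma pbInf_nonneg (K : ℝ) (x : Path) : 0 ≤ pbInf K x :=
  tsum_nonneg fun _ => mul_nonneg (cl_nonneg _ _) (Real.exp_pos _).le

lemma pdInf_nonneg (K : ℝ) (x : Path) : 0 ≤ pdInf K x :=
  tsum_nonneg fun _ => mul_nonneg (cl_nonneg _ _) (Real.exp_pos _).le

lemma tendsto_pb (hK : 0 ≤ K) {x : Path} (h : Summable fun j => Real.exp (-pS x j)) :
    Tendsto (fun k => pb K k x) atTop (𝓝 (pbInf K x)) :=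
  (Summable.of_nonneg_of_le (fun _ => mul_nonneg (cl_nonneg _ _) (Real.exp_pos _).le)
    (fun _ => mul_le_mul_of_nonneg_right (cl_le hK _) (Real.exp_pos _).le)
    (h.mul_left K)).hasSum.tendsto_sum_nat

lemma tendsto_pd (hK : 0 ≤ K) {x : Path} (h : Summable fun j => Real.exp (pS x (j + 1))) :
    Tendsto (fun k => pd K k x) atTop (𝓝 (pdInf K x)) :=
  (Summable.of_nonneg_of_le (fun _ => mul_nonneg (cl_nonneg _ _) (Real.exp_pos _).le)
    (fun _ => mul_le_mul_of_nonneg_right (cl_le hK _) (Real.exp_pos _).le)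
    (h.mul_left K)).hasSum.tendsto_sum_nat

lemma PsiInf_nonneg (hl : 0 ≤ lam) (h₁ : 0 ≤ r₁) (h₁' : r₁ < 1) (h₂ : 0 ≤ r₂) (h₂' : r₂ < 1)
    (a b : Path) (z : ℝ) : 0 ≤ PsiInf K lam r₁ r₂ a b z :=
  mul_nonneg
    (om_nonneg hl zero_le_one zero_le_one (pbInf_nonneg _ _) (rV_pos h₁ h₁' (pdInf_nonneg _ _)).le
      (Real.exp_pos _).le)
    (om_nonneg hl zero_le_one zero_le_one (pbInf_nonneg _ _) (rV_pos h₂ h₂' (pdInf_nonneg _ _)).le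
      (Real.exp_pos _).le)

lemma PsiInf_le_one (hl : 0 ≤ lam) (h₁ : 0 ≤ r₁) (h₁' : r₁ < 1) (h₂ : 0 ≤ r₂) (h₂' : r₂ < 1)
    (a b : Path) (z : ℝ) : PsiInf K lam r₁ r₂ a b z ≤ 1 :=
  mul_le_one₀
    (om_le_one hl zero_le_one zero_le_one (pbInf_nonneg _ _) (rV_pos h₁ h₁' (pdInf_nonneg _ _)).le
      (rV_le_one h₁ h₁' (pdInf_nonneg _ _)) (Real.exp_pos _).le)
    (om_nonneg hl zero_le_one zero_le_one (pbInf_nonneg _ _) (rV_pos h₂ h₂' (pdInf_nonneg _ _)).le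
      (Real.exp_pos _).le)
    (om_le_one hl zero_le_one zero_le_one (pbInf_nonneg _ _) (rV_pos h₂ h₂' (pdInf_nonneg _ _)).le
      (rV_le_one h₂ h₂' (pdInf_nonneg _ _)) (Real.exp_pos _).le)

lemma tendsto_om {lam E b r d : ℝ} (hl : 0 ≤ lam) (hb : 0 ≤ b) (hE : 0 ≤ E) (h0 : 0 ≤ r)
    (h1 : r < 1) (hd : 0 ≤ d) {bs ds : ℕ → ℝ} (hbs : Tendsto bs atTop (𝓝 b))
    (hds : Tendsto ds atTop (𝓝 d)) :
    Tendsto (fun k => om lam 1 1 (bs k) (rV r (ds k)) E) atTop (𝓝 (om lam 1 1 b (rV r d) E)) := by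
  have hV := rV_pos h0 h1 hd
  have hV' : Tendsto (fun k => rV r (ds k)) atTop (𝓝 (rV r d)) :=
    (hds.add_const _).inv₀ (by have := one_le_inv_one_sub h0 h1; positivity)
  refine hV'.div ((((hV'.const_mul 1).mul_const E).const_add (lam * 1)).mul hbs |>.const_add 1) ?_
  positivity

lemma tendsto_Psi (hK : 0 ≤ K) (hl : 0 ≤ lam) (h₁ : 0 ≤ r₁) (h₁' : r₁ < 1) (h₂ : 0 ≤ r₂)
    (h₂' : r₂ < 1) {a b : Path} (ha : Summable fun j => Real.exp (pS a (j + 1)))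
    (hb : Summable fun j => Real.exp (-pS b j)) (z : ℝ) :
    Tendsto (fun k => Psi K lam r₁ r₂ k a b z) atTop (𝓝 (PsiInf K lam r₁ r₂ a b z)) :=
  (tendsto_om hl (pbInf_nonneg _ _) (Real.exp_pos _).le h₁ h₁' (pdInf_nonneg _ _)
    (tendsto_pb hK hb) (tendsto_pd hK ha)).mul
  (tendsto_om hl (pbInf_nonneg _ _) (Real.exp_pos _).le h₂ h₂' (pdInf_nonneg _ _)
    (tendsto_pb hK hb) (tendsto_pd hK ha))

lemma tendsto_lintegral_le_one {α : Type*} [MeasurableSpace α] {P : Measure α}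
    [IsProbabilityMeasure P] {F : ℕ → α → ENNReal} {f : α → ENNReal} (hF : ∀ k, Measurable (F k))
    (h1 : ∀ k a, F k a ≤ 1) (h : ∀ᵐ a ∂P, Tendsto (fun k => F k a) atTop (𝓝 (f a))) :
    Tendsto (fun k => ∫⁻ a, F k a ∂P) atTop (𝓝 (∫⁻ a, f a ∂P)) :=
  tendsto_lintegral_of_dominated_convergence (fun _ => 1) hF (fun k => .of_forall (h1 k))
    (by simp) h

lemma lintegral_le_one_of_le {α : Type*} [MeasurableSpace α] {P : Measure α}
    [IsProbabilityMeasure P] {f : α → ENNReal} (h1 : ∀ a, f a ≤ 1) : ∫⁻ a, f a ∂P ≤ 1 :=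
  (lintegral_mono h1).trans (by simp)

lemma ofReal_Psi_le_one (hl : 0 ≤ lam) (h₁ : 0 ≤ r₁) (h₁' : r₁ < 1) (h₂ : 0 ≤ r₂) (h₂' : r₂ < 1)
    (k : ℕ) (a b : Path) (z : ℝ) : ENNReal.ofReal (Psi K lam r₁ r₂ k a b z) ≤ 1 := by
  simpa using ENNReal.ofReal_le_ofReal (Psi_le_one (K := K) hl h₁ h₁' h₂ h₂' k a b z)

lemma measurable_ofReal_Psi (k : ℕ) (b : Path) (z : ℝ) :
    Measurable fun a => ENNReal.ofReal (Psi K lam r₁ r₂ k a b z) := by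
  unfold Psi om rV
  fun_prop

lemma tendsto_innerPsi_aux {κ : ℝ} (h : KilledAsymp (ν.map Prod.fst) κ)
    {Pm : Measure Path} (hm : IsHMinus ν Pm) (hK : 0 ≤ K) (hl : 0 ≤ lam)
    (h₁ : 0 ≤ r₁) (h₁' : r₁ < 1) (h₂ : 0 ≤ r₂) (h₂' : r₂ < 1) (z : ℝ) {b : Path}
    (hb : Summable fun j => Real.exp (-pS b j)) :
    Tendsto (fun k => ∫⁻ a, ENNReal.ofReal (Psi K lam r₁ r₂ k a b z) ∂Pm) atTop
      (𝓝 (∫⁻ a, ENNReal.ofReal (PsiInf K lam r₁ r₂ a b z) ∂Pm)) := by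
  have := hm.1
  refine tendsto_lintegral_le_one (fun k => measurable_ofReal_Psi k b z) (fun k a =>
    ofReal_Psi_le_one hl h₁ h₁' h₂ h₂' k a b z) ?_
  filter_upwards [ae_summable_exp_minus h hm] with a ha
  exact ENNReal.tendsto_ofReal (tendsto_Psi hK hl h₁ h₁' h₂ h₂' ha hb z)

lemma tendsto_innerPsi {κ : ℝ} (h : KilledAsymp (ν.map Prod.fst) κ) {Pp : ℝ → Measure Path}
    {Pm : Measure Path} (hp : IsHPlus ν Pp) (hm : IsHMinus ν Pm) (hK : 0 ≤ K) (hl : 0 ≤ lam)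
    (h₁ : 0 ≤ r₁) (h₁' : r₁ < 1) (h₂ : 0 ≤ r₂) (h₂' : r₂ < 1) {z : ℝ} (hz : 0 ≤ z) :
    Tendsto (fun k => ∫⁻ b, ∫⁻ a, ENNReal.ofReal (Psi K lam r₁ r₂ k a b z) ∂Pm ∂(Pp z)) atTop
      (𝓝 (∫⁻ b, ∫⁻ a, ENNReal.ofReal (PsiInf K lam r₁ r₂ a b z) ∂Pm ∂(Pp z))) := by
  have := hm.1
  have := (hp z hz).1
  refine tendsto_lintegral_le_one
    (fun k => measurable_inner (blockFun_Psi hl h₁ h₁' h₂ h₂' k) z) (fun k b => ?_) ?_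
  · exact lintegral_le_one_of_le fun a => ofReal_Psi_le_one hl h₁ h₁' h₂ h₂' k a b z
  · filter_upwards [ae_summable_exp_plus h hp hz] with b hb
    exact tendsto_innerPsi_aux h hm hK hl h₁ h₁' h₂ h₂' z hb

/-- The integrand in the limit, as a function of the height. -/
def limU (ν : Measure (ℝ × ℝ)) (K lam r₁ r₂ : ℝ) (Pp : ℝ → Measure Path) (Pm : Measure Path)
    (z : ℝ) : ENNReal :=
  uE (ν.map Prod.fst) z * ∫⁻ b, ∫⁻ a, ENNReal.ofReal (PsiInf K lam r₁ r₂ a b z) ∂Pm ∂(Pp z)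

lemma tendsto_limU {κ : ℝ} (h : KilledAsymp (ν.map Prod.fst) κ) {Pp : ℝ → Measure Path}
    {Pm : Measure Path} (hp : IsHPlus ν Pp) (hm : IsHMinus ν Pm) (hK : 0 ≤ K) (hl : 0 ≤ lam)
    (h₁ : 0 ≤ r₁) (h₁' : r₁ < 1) (h₂ : 0 ≤ r₂) (h₂' : r₂ < 1) {z : ℝ} (hz : 0 ≤ z) :
    Tendsto (fun k => blockJ ν k Pm (Psi K lam r₁ r₂ k) z) atTop
      (𝓝 (limU ν K lam r₁ r₂ Pp Pm z)) := by
  have := hm.1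
  simp_rw [← uE_mul_eq_blockJ hp (blockFun_Psi hl h₁ h₁' h₂ h₂' _) hz]
  exact ENNReal.Tendsto.const_mul (tendsto_innerPsi h hp hm hK hl h₁ h₁' h₂ h₂' hz)
    (Or.inr (uE_lt_top h z).ne)

lemma aemeasurable_limU {κ : ℝ} (h : KilledAsymp (ν.map Prod.fst) κ) {Pp : ℝ → Measure Path}
    {Pm : Measure Path} (hp : IsHPlus ν Pp) (hm : IsHMinus ν Pm) (hK : 0 ≤ K) (hl : 0 ≤ lam)
    (h₁ : 0 ≤ r₁) (h₁' : r₁ < 1) (h₂ : 0 ≤ r₂) (h₂' : r₂ < 1) :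
    AEMeasurable (limU ν K lam r₁ r₂ Pp Pm) (volume.restrict (Ioi 0)) := by
  have := hm.1
  refine aemeasurable_of_tendsto_metrizable_ae atTop
    (f := fun k => blockJ ν k Pm (Psi K lam r₁ r₂ k))
    (fun k => (measurable_blockJ (blockFun_Psi hl h₁ h₁' h₂ h₂' k)).aemeasurable) ?_
  filter_upwards [ae_restrict_mem measurableSet_Ioi] with z hz
  exact tendsto_limU h hp hm hK hl h₁ h₁' h₂ h₂' (mem_Ioi.mp hz).le

omit [IsProbabilityMeasure ν] in
lemma limU_le {Pp : ℝ → Measure Path} {Pm : Measure Path}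
    (hp : ∀ z, 0 ≤ z → IsProbabilityMeasure (Pp z)) (hm : IsProbabilityMeasure Pm)
    (hl : 0 ≤ lam) (h₁ : 0 ≤ r₁) (h₁' : r₁ < 1) (h₂ : 0 ≤ r₂) (h₂' : r₂ < 1) {z : ℝ}
    (hz : 0 ≤ z) : limU ν K lam r₁ r₂ Pp Pm z ≤ uE (ν.map Prod.fst) z := by
  have := hp z hz
  refine mul_le_of_le_one_right' ?_
  refine lintegral_le_one_of_le fun b => lintegral_le_one_of_le fun a => ?_
  simpa using ENNReal.ofReal_le_ofReal (PsiInf_le_one (K := K) hl h₁ h₁' h₂ h₂' a b z)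

lemma tendsto_blockI_Psi {κ : ℝ} (h : KilledAsymp (ν.map Prod.fst) κ) {Pp : ℝ → Measure Path}
    {Pm : Measure Path} (hp : IsHPlus ν Pp) (hm : IsHMinus ν Pm) (hK : 0 ≤ K) (hl : 0 ≤ lam)
    (h₁ : 0 ≤ r₁) (h₁' : r₁ < 1) (h₂ : 0 ≤ r₂) (h₂' : r₂ < 1) :
    Tendsto (fun k => blockI ν κ Pp Pm (Psi K lam r₁ r₂ k)) atTop
      (𝓝 (blockI ν κ Pp Pm (PsiInf K lam r₁ r₂))) := by
  have := hm.1
  refine ENNReal.Tendsto.const_mul ?_ (Or.inr ENNReal.ofReal_ne_top)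
  have e : ∀ k, ∫⁻ z in Ioi 0, ENNReal.ofReal (Real.exp (-z)) * (uE (ν.map Prod.fst) z *
      ∫⁻ b, ∫⁻ a, ENNReal.ofReal (Psi K lam r₁ r₂ k a b z) ∂Pm ∂(Pp z)) =
      ∫⁻ z in Ioi 0, ENNReal.ofReal (Real.exp (-z)) * blockJ ν k Pm (Psi K lam r₁ r₂ k) z :=
    fun k => setLIntegral_congr_fun measurableSet_Ioi fun z (hz : z ∈ Ioi 0) => by
      rw [uE_mul_eq_blockJ hp (blockFun_Psi hl h₁ h₁' h₂ h₂' k) (mem_Ioi.mp hz).le]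
  simp_rw [e]
  refine tendsto_lintegral_of_dominated_convergence'
    (fun z => ENNReal.ofReal (Real.exp (-z)) * uE (ν.map Prod.fst) z) (fun k => ?_) (fun k => ?_)
    ?_ ?_
  · exact (Measurable.mul (by fun_prop)
      (measurable_blockJ (blockFun_Psi hl h₁ h₁' h₂ h₂' k))).aemeasurable
  · filter_upwards [ae_restrict_mem measurableSet_Ioi] with z hz
    have := (hp z (mem_Ioi.mp hz).le).1
    refine mul_le_mul_right ?_ _
    rw [← uE_mul_eq_blockJ hp (blockFun_Psi hl h₁ h₁' h₂ h₂' k) (mem_Ioi.mp hz).le]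
    refine mul_le_of_le_one_right' ?_
    exact lintegral_le_one_of_le fun b => lintegral_le_one_of_le fun a =>
      ofReal_Psi_le_one hl h₁ h₁' h₂ h₂' k a b z
  · have := lintegral_exp_mul_uE h (u := 1) one_pos
    simp only [neg_mul, one_mul] at this
    rw [this]; exact ENNReal.ofReal_ne_top
  · filter_upwards [ae_restrict_mem measurableSet_Ioi] with z hz
    exact ENNReal.Tendsto.const_mul (tendsto_limU h hp hm hK hl h₁ h₁' h₂ h₂' (mem_Ioi.mp hz).le)
      (Or.inr ENNReal.ofReal_ne_top)

end limitvalue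

section fulllimit

lemma tendsto_of_approx {a : ℕ → ENNReal} {b : ℕ → ℕ → ENNReal} {c e : ℕ → ENNReal} {L : ENNReal}
    (hL : L ≠ ⊤) (he : Tendsto e atTop (𝓝 0)) (he' : ∀ k, e k ≠ ⊤)
    (hb : ∀ᶠ k in atTop, Tendsto (b k) atTop (𝓝 (c k))) (hc : Tendsto c atTop (𝓝 L))
    (h1 : ∀ᶠ k in atTop, ∀ᶠ n in atTop, a n ≤ b k n + e k)
    (h2 : ∀ᶠ k in atTop, ∀ᶠ n in atTop, b k n ≤ a n + e k) : Tendsto a atTop (𝓝 L) := by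
  refine tendsto_of_le_liminf_of_limsup_le ?_ ?_
  · have h3 : Tendsto (fun k => c k - e k) atTop (𝓝 (L - 0)) :=
      ENNReal.Tendsto.sub hc he (Or.inl hL)
    rw [tsub_zero] at h3
    refine le_of_tendsto h3 ?_
    filter_upwards [hb, h2] with k hk h2k
    have h4 : Tendsto (fun n => b k n - e k) atTop (𝓝 (c k - e k)) :=
      ENNReal.Tendsto.sub hk tendsto_const_nhds (Or.inr (he' k))
    rw [← h4.liminf_eq]
    exact liminf_le_liminf (h2k.mono fun n hn => tsub_le_iff_right.mpr hn)
  · have h3 : Tendsto (fun k => c k + e k) atTop (𝓝 (L + 0)) := hc.add he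
    rw [add_zero] at h3
    refine ge_of_tendsto h3 ?_
    filter_upwards [hb, h1] with k hk h1k
    rw [← (hk.add_const (e k)).limsup_eq]
    exact limsup_le_limsup h1k

variable {ν : Measure (ℝ × ℝ)} [IsProbabilityMeasure ν] {K lam r₁ r₂ : ℝ}

lemma measurable_Gfull (K lam r₁ r₂ : ℝ) (m n : ℕ) : Measurable (Gfull K lam r₁ r₂ m n) := by
  have h1 : Measurable fun x : Path => pS (prev n x) m := (measurable_pS m).comp (measurable_prev n)
  have h2 : Measurable fun x : Path => pb K m (prev n x) :=
    (measurable_pb K m).comp (measurable_prev n)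
  unfold Gfull om rV phiOne
  fun_prop

lemma measurable_Psi_prev (K lam r₁ r₂ : ℝ) (k n : ℕ) :
    Measurable fun x => Psi K lam r₁ r₂ k x (prev n x) (-pS x n) := by
  have h2 : Measurable fun x : Path => pb K k (prev n x) :=
    (measurable_pb K k).comp (measurable_prev n)
  unfold Psi om rV
  fun_prop

lemma lintegral_le_of_abs_sub {α : Type*} [MeasurableSpace α] {P : Measure α} {w : α → ENNReal}
    {E f g : α → ℝ} {c d : ENNReal} (hw : Measurable w) (hE : Measurable E) (hf : Measurable f)
    (hE0 : ∀ x, 0 ≤ E x) (hf0 : ∀ x, 0 ≤ f x)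
    (hd : c * ∫⁻ x, w x * ENNReal.ofReal (E x * |g x - f x|) ∂P ≤ d) :
    c * ∫⁻ x, w x * ENNReal.ofReal (E x * g x) ∂P ≤
      c * ∫⁻ x, w x * ENNReal.ofReal (E x * f x) ∂P + d := by
  refine le_trans ?_ (add_le_add_right hd _)
  rw [← mul_add, ← lintegral_add_left (by fun_prop)]
  refine mul_le_mul_right (lintegral_mono fun x => ?_) _
  rw [← mul_add, ← ENNReal.ofReal_add (mul_nonneg (hE0 x) (hf0 x))
    (mul_nonneg (hE0 x) (abs_nonneg _)), ← mul_add]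
  refine mul_le_mul_right (ENNReal.ofReal_le_ofReal (mul_le_mul_of_nonneg_left ?_ (hE0 x))) _
  linarith [le_abs_self (g x - f x)]

theorem tendsto_Gfull {κ : ℝ} (h : KilledAsymp (ν.map Prod.fst) κ) {Pp : ℝ → Measure Path}
    {Pm : Measure Path} (hp : IsHPlus ν Pp) (hm : IsHMinus ν Pm) (hK : 0 ≤ K) (hl : 0 < lam)
    (h₁ : 0 ≤ r₁) (h₁' : r₁ < 1) (h₂ : 0 ≤ r₂) (h₂' : r₂ < 1) {m : ℕ → ℕ}
    (hm1 : Tendsto m atTop atTop) (hm2 : Tendsto (fun n => n - m n) atTop atTop) :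
    Tendsto (fun n => ENNReal.ofReal (wt n) * ∫⁻ x, ind (stay (Iio 0) n x) *
      ENNReal.ofReal (Real.exp (pS x n) * Gfull K lam r₁ r₂ (m n) n x) ∂(pathLaw ν)) atTop
      (𝓝 (blockI ν κ Pp Pm (PsiInf K lam r₁ r₂))) := by
  have := hm.1
  obtain ⟨C, hC, hbound⟩ := exists_truncation_bound h hK hl h₁ h₁' h₂ h₂'
  have hfin : blockI ν κ Pp Pm (PsiInf K lam r₁ r₂) ≠ ⊤ := by
    refine ENNReal.mul_ne_top ENNReal.ofReal_ne_top (ne_top_of_le_ne_top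
      (ENNReal.ofReal_ne_top (r := (1 : ℝ)⁻¹ * ∑' j, kmgf (ν.map Prod.fst) (Iio 0) 1 j)) ?_)
    rw [← lintegral_exp_mul_uE h one_pos]
    refine setLIntegral_mono' measurableSet_Ioi fun z hz => ?_
    rw [neg_one_mul]
    exact mul_le_mul_right (limU_le (fun z hz => (hp z hz).1) hm.1 hl.le h₁ h₁' h₂ h₂'
      (mem_Ioi.mp hz).le) _
  have hnear : ∀ k, ∀ᶠ n in atTop, k ≤ m n ∧ k + m n < n := fun k => by
    filter_upwards [hm1.eventually_ge_atTop k, hm2.eventually_ge_atTop (k + 1)] with n h3 h4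
    omega
  refine tendsto_of_approx (b := fun k n => ENNReal.ofReal (wt n) * blockE ν n (Psi K lam r₁ r₂ k))
    (e := fun k => ENNReal.ofReal (C * wtTail k)) hfin ?_ (fun k => ENNReal.ofReal_ne_top)
    ?_ (tendsto_blockI_Psi h hp hm hK hl.le h₁ h₁' h₂ h₂') ?_ ?_
  · have := ENNReal.tendsto_ofReal (tendsto_wtTail.const_mul C)
    simpa using this
  · filter_upwards [eventually_ge_atTop 1] with k hk
    exact tendsto_blockE h hp hm hk (blockFun_Psi hl.le h₁ h₁' h₂ h₂' k)
      (blockFun_two_sub_Psi hl.le h₁ h₁' h₂ h₂' k)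
  · filter_upwards [eventually_ge_atTop 1] with k hk
    filter_upwards [hnear k] with n hn
    exact lintegral_le_of_abs_sub (measurable_ind (measurableSet_stay measurableSet_Iio n))
      (measurable_pS n).exp (measurable_Psi_prev K lam r₁ r₂ k n) (fun x => (Real.exp_pos _).le)
      (fun x => Psi_nonneg hl.le h₁ h₁' h₂ h₂' k x _ _) (hbound k (m n) n hk hn.1 hn.2)
  · filter_upwards [eventually_ge_atTop 1] with k hk
    filter_upwards [hnear k] with n hn
    refine lintegral_le_of_abs_sub (measurable_ind (measurableSet_stay measurableSet_Iio n))
      (measurable_pS n).exp (measurable_Gfull K lam r₁ r₂ (m n) n) (fun x => (Real.exp_pos _).le)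
      (fun x => (Gfull_mem hl h₁ h₁' h₂ h₂' (m n) n x).1) ?_
    simp_rw [abs_sub_comm (Psi K lam r₁ r₂ k _ _ _)]
    exact hbound k (m n) n hk hn.1 hn.2

end fulllimit

section environment

variable {μ : Measure Ω} {Q : ℕ → Ω → Measure ℕ}

/-- The pair of log-mean and normalized second factorial moment of an offspring law. -/
def lawPair (q : Measure ℕ) : ℝ × ℝ :=
  (Real.log (∑' i : ℕ, (i : ℝ) * (q {i}).toReal),
    (∑' i : ℕ, ((i : ℝ) * ((i : ℝ) - 1)) * (q {i}).toReal) /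
      (2 * (∑' i : ℕ, (i : ℝ) * (q {i}).toReal) ^ 2))

/-- The path of pairs attached to an environment. -/
def envMap (Q : ℕ → Ω → Measure ℕ) (ω : Ω) : Path := fun i => (Xenv Q (i + 1) ω, etaEnv Q (i + 1) ω)

lemma measurable_lawPair : Measurable lawPair := by
  have h0 : ∀ i : ℕ, Measurable fun q : Measure ℕ => (q {i}).toReal := fun i =>
    (Measure.measurable_coe (MeasurableSet.of_discrete)).ennreal_toReal
  have h1 : Measurable fun q : Measure ℕ => ∑' i : ℕ, (i : ℝ) * (q {i}).toReal :=
    measurable_tsum_of_nonneg (fun i => (h0 i).const_mul _) fun i q => by positivity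
  have h2 : Measurable fun q : Measure ℕ =>
      ∑' i : ℕ, ((i : ℝ) * ((i : ℝ) - 1)) * (q {i}).toReal := by
    refine measurable_tsum_of_nonneg (fun i => (h0 i).const_mul _) fun i q => ?_
    rcases Nat.eq_zero_or_pos i with rfl | hi
    · simp
    · have : (1 : ℝ) ≤ i := by exact_mod_cast hi
      exact mul_nonneg (mul_nonneg (by linarith) (by linarith)) ENNReal.toReal_nonneg
  exact (Real.measurable_log.comp h1).prodMk (h2.div ((h1.pow_const 2).const_mul 2))

lemma measurable_envMap (hQ : ∀ i, Measurable (Q i)) : Measurable (envMap Q) :=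
  measurable_pi_lambda _ fun i => measurable_lawPair.comp (hQ (i + 1))

omit [MeasurableSpace Ω] in
lemma pS_envMap (ω : Ω) (n : ℕ) : pS (envMap Q ω) n = walk (Xenv Q) n ω := by
  induction n with
  | zero => simp [walk]
  | succ n ih => rw [pS_succ, ih, walk, walk, Finset.sum_Icc_succ_top (by omega)]; rfl

lemma map_envMap [IsProbabilityMeasure μ] (h : IIDseq μ Q) :
    μ.map (envMap Q) = pathLaw (μ.map fun ω => lawPair (Q 1 ω)) := by
  obtain ⟨hm, hi, hd⟩ := h
  have hi' : iIndepFun (fun i ω => lawPair (Q (i + 1) ω)) μ :=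
    (hi.precomp (g := fun i : ℕ => i + 1) (add_left_injective 1)).comp (fun _ => lawPair)
      fun _ => measurable_lawPair
  have hm' : ∀ i, Measurable fun ω => lawPair (Q (i + 1) ω) := fun i =>
    measurable_lawPair.comp (hm (i + 1))
  have := (iIndepFun_iff_map_fun_eq_infinitePi_map hm').mp hi'
  have e : envMap Q = fun ω i => lawPair (Q (i + 1) ω) := rfl
  rw [e, this, pathLaw]
  congr 1
  funext i
  exact ((hd (i + 1)).comp measurable_lawPair).map_eq

/-- Truncation of a path after `k` entries. -/
def ptrunc (k : ℕ) (x : Path) : Path := fun i => if i < k then x i else 0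

omit [MeasurableSpace Ω] in
lemma measurable_ptrunc_envMap (k : ℕ) :
    Measurable[envFiltration Q k] fun ω => ptrunc k (envMap Q ω) := by
  refine @measurable_pi_lambda _ _ _ (envFiltration Q k) _ _ fun i => ?_
  by_cases hi : i < k
  · have e : (fun ω => ptrunc k (envMap Q ω) i) = fun ω => lawPair (Q (i + 1) ω) := by
      funext ω; exact if_pos hi
    rw [e]
    have h1 : MeasurableSpace.comap (Q (i + 1)) inferInstance ≤ envFiltration Q k :=
      le_iSup₂_of_le (i + 1) (Finset.mem_Icc.mpr ⟨by omega, by omega⟩) le_rfl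
    exact measurable_lawPair.comp ((comap_measurable (Q (i + 1))).mono h1 le_rfl)
  · have e : (fun ω => ptrunc k (envMap Q ω) i) = fun _ => 0 := by
      funext ω; exact if_neg hi
    rw [e]
    exact measurable_const

omit [MeasurableSpace Ω] in
lemma measurable_envFiltration {β : Type*} [MeasurableSpace β] {k : ℕ} {φ : Path → β}
    (hφ : Measurable φ) (hloc : ∀ a a' : Path, (∀ i < k, a i = a' i) → φ a = φ a') :
    Measurable[envFiltration Q k] fun ω => φ (envMap Q ω) := by
  have e : (fun ω => φ (envMap Q ω)) = fun ω => φ (ptrunc k (envMap Q ω)) := by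
    funext ω
    exact hloc _ _ fun i hi => (if_pos hi).symm
  rw [e]
  exact hφ.comp (measurable_ptrunc_envMap k)

omit [MeasurableSpace Ω] in
lemma posSet_eq (z : ℝ) (k : ℕ) : posSet (Xenv Q) z k = {ω | posP k z (envMap Q ω)} := by
  ext ω
  simp only [posSet, posP, pS_envMap, mem_ofPred_eq, Finset.mem_Icc, and_imp]

omit [MeasurableSpace Ω] in
lemma negSet_eq (k : ℕ) : negSet (Xenv Q) 0 k = {ω | stay (Iio 0) k (envMap Q ω)} := by
  ext ω
  simp only [negSet, stay, pS_envMap, mem_ofPred_eq, Finset.mem_Icc, and_imp, zero_add, mem_Iio]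

end environment

section renewalid

variable {μ : Measure Ω} {Q : ℕ → Ω → Measure ℕ}

omit [MeasurableSpace Ω] in
lemma Mwalk_neg_iff (k : ℕ) (ω : Ω) :
    Mwalk (Xenv Q) (k + 1) ω < 0 ↔ stay (Iio 0) (k + 1) (envMap Q ω) := by
  simp only [Mwalk, Finset.sup'_lt_iff, stay, pS_envMap, Finset.mem_Icc, and_imp, mem_Iio]

omit [MeasurableSpace Ω] in
lemma Lwalk_nonneg_iff (k : ℕ) (ω : Ω) :
    0 ≤ Lwalk (Xenv Q) (k + 1) ω ↔ stay (Ici 0) (k + 1) (envMap Q ω) := by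
  simp only [Lwalk, Finset.le_inf'_iff, stay, pS_envMap, Finset.mem_Icc, and_imp, mem_Ici]

lemma killed_eq_map [IsProbabilityMeasure μ] {ν : Measure (ℝ × ℝ)} [IsProbabilityMeasure ν]
    (hQ : ∀ i, Measurable (Q i)) (hν : μ.map (envMap Q) = pathLaw ν) {D A : Set ℝ}
    (hD : MeasurableSet D) (hA : MeasurableSet A) (n : ℕ) :
    killed (ν.map Prod.fst) D n A =
      μ {ω | walk (Xenv Q) n ω ∈ A ∧ stay D n (envMap Q ω)} := by
  have hS : MeasurableSet {x : Path | pS x n ∈ A ∧ stay D n x} :=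
    (measurable_pS n hA).inter (measurableSet_stay hD n)
  have e : {ω | walk (Xenv Q) n ω ∈ A ∧ stay D n (envMap Q ω)} =
      envMap Q ⁻¹' {x : Path | pS x n ∈ A ∧ stay D n x} := by
    ext ω; simp only [mem_ofPred_eq, mem_preimage, pS_envMap]
  rw [e, ← Measure.map_apply (measurable_envMap hQ) hS, hν, ← lintegral_indicator_one hA,
    ← lintegral_stay hD n (measurable_one.indicator hA), ← lintegral_indicator_one hS]
  refine lintegral_congr fun x => ?_
  by_cases h1 : stay D n x <;> by_cases h2 : pS x n ∈ A <;> simp [ind, h1, h2]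

variable {ν : Measure (ℝ × ℝ)} [IsProbabilityMeasure ν]

lemma toReal_tsum_killed {ρ : Measure ℝ} {D A : Set ℝ} (hA : MeasurableSet A)
    (hfin : green ρ D A ≠ ⊤) :
    (green ρ D A).toReal = (killed ρ D 0 A).toReal + ∑' k, (killed ρ D (k + 1) A).toReal := by
  rw [green, Measure.sum_apply _ hA] at hfin ⊢
  rw [ENNReal.tsum_toReal_eq fun n => ENNReal.ne_top_of_tsum_ne_top hfin n]
  exact (ENNReal.summable_toReal hfin).tsum_eq_zero_add

lemma uFun_eq [IsProbabilityMeasure μ] {κ : ℝ} (h : KilledAsymp (ν.map Prod.fst) κ)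
    (hQ : ∀ i, Measurable (Q i)) (hν : μ.map (envMap Q) = pathLaw ν) {x : ℝ} (hx : 0 ≤ x) :
    uFun μ (Xenv Q) x = (uE (ν.map Prod.fst) x).toReal := by
  have := (uE_lt_top h x).ne
  rw [uE] at this ⊢
  rw [toReal_tsum_killed measurableSet_Ici this, uFun, if_pos hx]
  congr 1
  · simp [killed, hx]
  · refine tsum_congr fun k => ?_
    rw [killed_eq_map hQ hν measurableSet_Iio measurableSet_Ici]
    simp only [Mwalk_neg_iff, mem_Ici, neg_le]

lemma vFun_eq [IsProbabilityMeasure μ] {κ : ℝ} (h : KilledAsymp (ν.map Prod.fst) κ)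
    (hQ : ∀ i, Measurable (Q i)) (hν : μ.map (envMap Q) = pathLaw ν) {y : ℝ} (hy : 0 < y) :
    vFun μ (Xenv Q) (-y) = (vE (ν.map Prod.fst) y).toReal := by
  have := (vE_lt_top h y).ne
  rw [vE] at this ⊢
  rw [toReal_tsum_killed measurableSet_Iio this, vFun, if_pos (by linarith)]
  congr 1
  · simp [killed, hy]
  · refine tsum_congr fun k => ?_
    rw [killed_eq_map hQ hν measurableSet_Ici measurableSet_Iio]
    simp only [Lwalk_nonneg_iff, mem_Iio, neg_lt_neg_iff]

lemma vFun_zero : vFun μ (Xenv Q) 0 = 1 := by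
  rw [vFun, if_pos le_rfl]
  have : ∀ k, {ω | 0 < -walk (Xenv Q) (k + 1) ω ∧ 0 ≤ Lwalk (Xenv Q) (k + 1) ω} = ∅ := by
    intro k
    ext ω
    simp only [mem_ofPred_eq, mem_empty_iff_false, iff_false, not_and, Lwalk_nonneg_iff]
    intro h1 h2
    have := h2 (k + 1) (by omega) le_rfl
    rw [pS_envMap, mem_Ici] at this
    linarith
  simp only [this]
  simp

lemma lintegral_htransform {P : Measure Ω} [IsProbabilityMeasure P] {A : Set Ω}
    (hA : MeasurableSet A) {c : ℝ} (hc : 0 < c) {w g : Ω → ℝ} (hw : ∀ ω ∈ A, 0 ≤ w ω)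
    (hg : Measurable g) (hg0 : ∀ ω, 0 ≤ g ω) {C : ℝ} (hgC : ∀ ω, g ω ≤ C)
    (h1 : ∫ _, (1 : ℝ) ∂P = c⁻¹ * ∫ ω in A, 1 * w ω ∂μ)
    (hP : ∫ ω, g ω ∂P = c⁻¹ * ∫ ω in A, g ω * w ω ∂μ) :
    ENNReal.ofReal c * ∫⁻ ω, ENNReal.ofReal (g ω) ∂P =
      ∫⁻ ω in A, ENNReal.ofReal (g ω * w ω) ∂μ := by
  have hbd : ∀ ω, ‖g ω‖ ≤ C := fun ω => by rw [Real.norm_of_nonneg (hg0 ω)]; exact hgC ω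
  have hInt : IntegrableOn w A μ := by
    by_contra hcon
    simp only [one_mul] at h1
    rw [integral_undef hcon] at h1
    simp at h1
  have hInt' : IntegrableOn (fun ω => g ω * w ω) A μ :=
    Integrable.bdd_mul hInt hg.aestronglyMeasurable (.of_forall hbd)
  rw [← ofReal_integral_eq_lintegral_ofReal (Integrable.of_bound hg.aestronglyMeasurable C
      (.of_forall hbd)) (.of_forall hg0), ← ofReal_integral_eq_lintegral_ofReal hInt',
    hP, ← ENNReal.ofReal_mul hc.le, mul_inv_cancel_left₀ hc.ne']
  filter_upwards [ae_restrict_mem hA] with ω hω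
  exact mul_nonneg (hg0 ω) (hw ω hω)

lemma isHPlus_of_isPplus [IsProbabilityMeasure μ] {κ : ℝ} (h : KilledAsymp (ν.map Prod.fst) κ)
    (hQ : ∀ i, Measurable (Q i)) (hν : μ.map (envMap Q) = pathLaw ν) {Pp : ℝ → Measure Ω}
    (hPp : ∀ x : ℝ, 0 ≤ x → IsPplus μ (Xenv Q) (envFiltration Q) x (Pp x)) :
    IsHPlus ν fun z => (Pp z).map (envMap Q) := by
  intro z hz
  have hE := measurable_envMap hQ
  have := (hPp z hz).1
  refine ⟨Measure.isProbabilityMeasure_map hE.aemeasurable, fun k φ hφ hφ2 hloc => ?_⟩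
  have hfin : ∀ x, φ x ≠ ⊤ := fun x => ne_top_of_le_ne_top (by simp) (hφ2 x)
  have hA : MeasurableSet {x : Path | posP k z x} :=
    (measurableSet_posP k).preimage (measurable_const.prodMk measurable_id)
  have hA' : MeasurableSet {ω | posP k z (envMap Q ω)} := hE hA
  have hg : Measurable fun ω => (φ (envMap Q ω)).toReal := (hφ.comp hE).ennreal_toReal
  have hg2 : ∀ ω, (φ (envMap Q ω)).toReal ≤ 2 := fun ω =>
    ENNReal.toReal_le_of_le_ofReal (by norm_num) (by simpa using hφ2 _)
  have hu := (uE_lt_top h z).ne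
  have hu1 : 0 < uFun μ (Xenv Q) z := by
    rw [uFun_eq h hQ hν hz]
    exact ENNReal.toReal_pos (one_pos.trans_le (one_le_uE hz)).ne' hu
  have key := lintegral_htransform (P := Pp z) (A := posSet (Xenv Q) z k)
    (by rw [posSet_eq]; exact hE hA) hu1 (w := fun ω => uFun μ (Xenv Q) (z + walk (Xenv Q) k ω))
    (fun ω _ => by
      unfold uFun; split_ifs
      · exact add_nonneg zero_le_one (tsum_nonneg fun _ => ENNReal.toReal_nonneg)
      · exact le_rfl)
    hg (fun ω => ENNReal.toReal_nonneg) hg2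
    ((hPp z hz).2 k (fun _ => 1) measurable_const ⟨1, by simp⟩)
    ((hPp z hz).2 k _ (measurable_envFiltration hφ hloc).ennreal_toReal
      ⟨2, fun ω => by rw [abs_of_nonneg ENNReal.toReal_nonneg]; exact hg2 ω⟩)
  have e1 : ∀ ω, ENNReal.ofReal (φ (envMap Q ω)).toReal = φ (envMap Q ω) := fun ω =>
    ENNReal.ofReal_toReal (hfin _)
  simp_rw [ENNReal.ofReal_mul ENNReal.toReal_nonneg, e1] at key
  rw [uFun_eq h hQ hν hz, ENNReal.ofReal_toReal hu] at key
  have mS : Measurable fun x : Path => z + pS x k := by fun_prop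
  have mF : Measurable fun x : Path =>
      ind (posP k z x) * (φ x * uE (ν.map Prod.fst) (z + pS x k)) :=
    (measurable_ind hA).mul (hφ.mul (measurable_uE.comp mS))
  rw [lintegral_map hφ hE, key, ← hν, lintegral_map mF hE, posSet_eq, ← lintegral_ind_mul μ hA']
  refine lintegral_congr fun ω => ?_
  by_cases hω : posP k z (envMap Q ω)
  · have h0 : 0 ≤ z + walk (Xenv Q) k ω := by
      rcases Nat.eq_zero_or_pos k with rfl | hk
      · simpa [walk] using hz
      · simpa [pS_envMap] using hω k hk le_rfl
    rw [uFun_eq h hQ hν h0, ENNReal.ofReal_toReal (uE_lt_top h _).ne, pS_envMap]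
  · rw [ind_neg hω, zero_mul, zero_mul]

lemma isHMinus_of_isPminus [IsProbabilityMeasure μ] {κ : ℝ} (h : KilledAsymp (ν.map Prod.fst) κ)
    (hQ : ∀ i, Measurable (Q i)) (hν : μ.map (envMap Q) = pathLaw ν) {Pm : Measure Ω}
    (hPm : IsPminus μ (Xenv Q) (envFiltration Q) 0 Pm) :
    IsHMinus ν (Pm.map (envMap Q)) := by
  have hE := measurable_envMap hQ
  have := hPm.1
  refine ⟨Measure.isProbabilityMeasure_map hE.aemeasurable, fun k hk φ hφ hφ2 hloc => ?_⟩
  have hfin : ∀ x, φ x ≠ ⊤ := fun x => ne_top_of_le_ne_top (by simp) (hφ2 x)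
  have hA : MeasurableSet {x : Path | stay (Iio 0) k x} := measurableSet_stay measurableSet_Iio k
  have hA' : MeasurableSet {ω | stay (Iio 0) k (envMap Q ω)} := hE hA
  have hg : Measurable fun ω => (φ (envMap Q ω)).toReal := (hφ.comp hE).ennreal_toReal
  have hg2 : ∀ ω, (φ (envMap Q ω)).toReal ≤ 2 := fun ω =>
    ENNReal.toReal_le_of_le_ofReal (by norm_num) (by simpa using hφ2 _)
  have key := lintegral_htransform (P := Pm) (A := negSet (Xenv Q) 0 k)
    (by rw [negSet_eq]; exact hE hA) one_pos
    (w := fun ω => vFun μ (Xenv Q) (0 + walk (Xenv Q) k ω))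
    (fun ω _ => by
      unfold vFun; split_ifs
      · exact add_nonneg zero_le_one (tsum_nonneg fun _ => ENNReal.toReal_nonneg)
      · exact le_rfl)
    hg (fun ω => ENNReal.toReal_nonneg) hg2
    (by rw [← vFun_zero (μ := μ) (Q := Q)]
        exact hPm.2 k (fun _ => vFun μ (Xenv Q) 0) measurable_const ⟨1, by simp [vFun_zero]⟩)
    (by rw [← vFun_zero (μ := μ) (Q := Q)]
        exact hPm.2 k _ (measurable_envFiltration hφ hloc).ennreal_toReal
          ⟨2, fun ω => by rw [abs_of_nonneg ENNReal.toReal_nonneg]; exact hg2 ω⟩)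
  have e1 : ∀ ω, ENNReal.ofReal (φ (envMap Q ω)).toReal = φ (envMap Q ω) := fun ω =>
    ENNReal.ofReal_toReal (hfin _)
  simp_rw [ENNReal.ofReal_mul ENNReal.toReal_nonneg, e1] at key
  rw [ENNReal.ofReal_one, one_mul] at key
  have mS : Measurable fun x : Path => -pS x k := by fun_prop
  have mF : Measurable fun x : Path =>
      ind (stay (Iio 0) k x) * (φ x * vE (ν.map Prod.fst) (-pS x k)) :=
    (measurable_ind hA).mul (hφ.mul (measurable_vE.comp mS))
  rw [lintegral_map hφ hE, key, ← hν, lintegral_map mF hE, negSet_eq, ← lintegral_ind_mul μ hA']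
  refine lintegral_congr fun ω => ?_
  by_cases hω : stay (Iio 0) k (envMap Q ω)
  · have h0 : 0 < -walk (Xenv Q) k ω := by
      have := hω k hk le_rfl
      rw [pS_envMap, mem_Iio] at this; linarith
    have := vFun_eq h hQ hν h0
    rw [neg_neg] at this
    rw [zero_add, this, ENNReal.ofReal_toReal (vE_lt_top h _).ne, pS_envMap]
  · rw [ind_neg hω, zero_mul, zero_mul]

end renewalid

section transfer

variable {μ : Measure Ω} {Q : ℕ → Ω → Measure ℕ}

omit [MeasurableSpace Ω] in
lemma tauWalk_eq_iff (X : ℕ → Ω → ℝ) (n : ℕ) (ω : Ω) :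
    tauWalk X n ω = n ↔ ∀ i < n, walk X n ω < walk X i ω := by
  have hle : ∀ i ≤ n, minWalk X n ω ≤ walk X i ω := fun i hi =>
    Finset.inf'_le _ (Finset.mem_range.mpr (by omega))
  obtain ⟨j, hj, hje⟩ := Finset.exists_mem_eq_inf' (s := Finset.range (n + 1)) (by simp)
    fun i => walk X i ω
  have hne : {i : ℕ | walk X i ω = minWalk X n ω}.Nonempty := ⟨j, hje.symm⟩
  have hj' : j ≤ n := by have := Finset.mem_range.mp hj; omega
  constructor
  · intro h i hi
    have h1 : walk X n ω = minWalk X n ω := by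
      have := Nat.sInf_mem hne
      rwa [show sInf {i : ℕ | walk X i ω = minWalk X n ω} = n from h] at this
    have h2 : walk X i ω ≠ minWalk X n ω := fun e =>
      absurd (Nat.sInf_le (show i ∈ {i : ℕ | walk X i ω = minWalk X n ω} from e))
        (by rw [show sInf {i : ℕ | walk X i ω = minWalk X n ω} = n from h]; omega)
    rw [h1]
    exact lt_of_le_of_ne (hle i hi.le) h2.symm
  · intro h
    have hjn : j = n := by
      by_contra hcon
      have h1 := h j (by omega)
      have h2 := hle n le_rfl
      have h3 : minWalk X n ω = walk X j ω := hje
      linarith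
    subst hjn
    have h3 : minWalk X j ω = walk X j ω := hje
    refine le_antisymm (Nat.sInf_le h3.symm) (le_csInf hne fun i hi => ?_)
    by_contra hcon
    have h1 := h i (by omega)
    have h2 : walk X i ω = minWalk X j ω := hi
    linarith

omit [MeasurableSpace Ω] in
lemma tauWalk_envMap_iff (n : ℕ) (ω : Ω) : tauWalk (Xenv Q) n ω = n ↔
    ∀ i < n, pS (envMap Q ω) n - pS (envMap Q ω) i ∈ Iio 0 := by
  simp only [tauWalk_eq_iff, pS_envMap, mem_Iio, sub_neg]

lemma prev_prev (n : ℕ) (x : Path) : prev n (prev n x) = x := by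
  funext i
  have : revIdx n (revIdx n i) = i := by unfold revIdx; split_ifs <;> omega
  simp only [prev, this]

omit [MeasurableSpace Ω] in
lemma pgf_nonneg (n : ℕ) (ω : Ω) {s : ℝ} (hs : 0 ≤ s) : 0 ≤ pgf Q n ω s :=
  tsum_nonneg fun i => mul_nonneg ENNReal.toReal_nonneg (pow_nonneg hs i)

omit [MeasurableSpace Ω] in
lemma pgf_lt_one (hf : FracLinear Q) {n : ℕ} (hn : 1 ≤ n) {ω : Ω} (hη : 0 ≤ etaEnv Q n ω) {s : ℝ}
    (hs : 0 ≤ s) (hs1 : s < 1) : pgf Q n ω s < 1 := by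
  have h := hf n hn ω s hs hs1
  have h1 : 0 < (1 - pgf Q n ω s)⁻¹ := by
    rw [h]; have : 0 < 1 - s := by linarith
    positivity
  linarith [inv_pos.mp h1]

omit [MeasurableSpace Ω] in
lemma pgfComp_self (m : ℕ) (ω : Ω) (s : ℝ) : pgfComp Q m m ω s = s := by
  cases m with
  | zero => rfl
  | succ m => exact if_pos le_rfl

omit [MeasurableSpace Ω] in
lemma inv_one_sub_pgfComp (hf : FracLinear Q) {ω : Ω} (hη : ∀ i, 0 ≤ (envMap Q ω i).2)
    (m k : ℕ) {s : ℝ} (hs : 0 ≤ s) (hs1 : s < 1) :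
    (1 - pgfComp Q m (m + k) ω s)⁻¹ =
      Real.exp (pS (envMap Q ω) m - pS (envMap Q ω) (m + k)) / (1 - s) +
        ∑ j ∈ Finset.range k, (envMap Q ω (m + j)).2 *
          Real.exp (pS (envMap Q ω) m - pS (envMap Q ω) (m + j)) := by
  induction k generalizing s with
  | zero => simp [pgfComp_self]
  | succ k ih =>
    have e : pgfComp Q m (m + (k + 1)) ω s = pgfComp Q m (m + k) ω (pgf Q (m + k + 1) ω s) :=
      if_neg (show ¬ m + k + 1 ≤ m by omega)
    rw [e, ih (pgf_nonneg _ _ hs) (pgf_lt_one hf (by omega) (hη (m + k)) hs hs1),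
      Finset.sum_range_succ, div_eq_mul_inv, hf _ (by omega) ω s hs hs1, ← add_assoc m k 1, pS_succ]
    have e2 : Real.exp (pS (envMap Q ω) m - (pS (envMap Q ω) (m + k) + (envMap Q ω (m + k)).1)) =
        Real.exp (pS (envMap Q ω) m - pS (envMap Q ω) (m + k)) *
          Real.exp (-(Xenv Q (m + k + 1) ω)) := by
      rw [← Real.exp_add]; congr 1; simp only [envMap]; ring
    rw [e2]
    simp only [envMap]
    ring

lemma pd_prev {K : ℝ} {x : Path} (hx : ∀ i, 0 ≤ (x i).2 ∧ (x i).2 ≤ K) (m k : ℕ) :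
    pd K k (prev (m + k) x) =
      ∑ j ∈ Finset.range k, (x (m + j)).2 * Real.exp (pS x (m + k) - pS x (m + j)) := by
  rw [← Finset.sum_range_reflect, pd]
  refine Finset.sum_congr rfl fun i hi => ?_
  have hi' := Finset.mem_range.mp hi
  have e : prev (m + k) x i = x (m + (k - 1 - i)) := by
    simp only [prev, revIdx]
    rw [if_pos (by omega)]; congr 1; omega
  rw [e, cl_eq (hx _).1 (hx _).2, pS_prev x (by omega)]
  congr 4; omega

omit [MeasurableSpace Ω] in
lemma bEnv_eq {K : ℝ} {ω : Ω} (hx : ∀ i, 0 ≤ (envMap Q ω i).2 ∧ (envMap Q ω i).2 ≤ K) (m : ℕ) :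
    bEnv Q m ω = pb K m (envMap Q ω) := by
  refine Finset.sum_congr rfl fun i _ => ?_
  rw [cl_eq (hx _).1 (hx _).2, pS_envMap]; rfl

lemma Vtil_eq (hf : FracLinear Q) {K : ℝ} {ω : Ω}
    (hx : ∀ i, 0 ≤ (envMap Q ω i).2 ∧ (envMap Q ω i).2 ≤ K) {m n : ℕ} (hmn : m ≤ n) {r : ℝ}
    (hr : 0 ≤ r) (hr1 : r < 1) :
    Vtil Q m n r ω = rV r (pd K (n - m) (prev n (envMap Q ω))) := by
  obtain ⟨k, rfl⟩ := Nat.exists_eq_add_of_le hmn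
  rw [Nat.add_sub_cancel_left, pd_prev hx, rV, Vtil, ← inv_inv (1 - pgfComp _ _ _ _ _),
    inv_one_sub_pgfComp hf (fun i => (hx i).1) m k hr hr1, Senv, ← pS_envMap, ← pS_envMap]
  set y := envMap Q ω
  rw [← neg_sub (pS y (m + k)) (pS y m), Real.exp_neg, ← mul_inv]
  congr 1
  rw [add_mul, add_comm, Finset.sum_mul]
  congr 1
  · refine Finset.sum_congr rfl fun j _ => ?_
    rw [mul_assoc, ← Real.exp_add]; congr 2; ring
  · have := Real.exp_pos (pS y (m + k) - pS y m)
    have : 0 < 1 - r := by linarith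
    field_simp

lemma lfun_eq {y : ℝ} (h0 : 0 ≤ y) (h1 : y ≤ 1) : lfun y = y := by
  rw [lfun, if_neg (not_lt.mpr h0), if_pos h1]

lemma kappa_eq {y : ℝ} (h0 : 0 ≤ y) : kappa y = y := by
  rcases h0.eq_or_lt with rfl | h
  · simp [kappa]
  · exact if_pos h

lemma omegaFun_eq {lam u₁ u₂ b V x : ℝ} (h1 : 0 ≤ u₁) (h1' : u₁ ≤ 1) (h2 : 0 ≤ u₂) (h2' : u₂ ≤ 1)
    (hb : 0 ≤ b) (hV : 0 ≤ V) (hV' : V ≤ 1) :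
    omegaFun lam (u₁, u₂, b) V x = om lam u₁ u₂ b V (Real.exp x) := by
  rw [omegaFun, lfun_eq hV hV', lfun_eq h1 h1', lfun_eq h2 h2', kappa_eq hb, om]

lemma omegaStar_eq {lam b V x : ℝ} (hb : 0 ≤ b) (hV : 0 ≤ V) (hV' : V ≤ 1) :
    omegaStar lam b V x = om lam 1 1 b V (Real.exp x) := by
  rw [omegaStar, lfun_eq hV hV', kappa_eq hb, om, mul_one, one_mul]

lemma omegaFun_mul_eq_Gfull (hf : FracLinear Q) {K : ℝ} {ω : Ω}
    (hx : ∀ i, 0 ≤ (envMap Q ω i).2 ∧ (envMap Q ω i).2 ≤ K) {m n : ℕ} (hmn : m ≤ n)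
    {lam r₁ r₂ : ℝ} (hl : 0 < lam) (h₁ : 0 ≤ r₁) (h₁' : r₁ < 1) (h₂ : 0 ≤ r₂) (h₂' : r₂ < 1) :
    omegaFun lam (Uvec Q 1 lam m ω) (Vtil Q m n r₁ ω) (Senv Q n ω) *
      omegaFun lam (Uvec Q 1 lam m ω) (Vtil Q m n r₂ ω) (Senv Q n ω) =
      Gfull K lam r₁ r₂ m n (prev n (envMap Q ω)) := by
  have hy : 0 < lam * Real.exp (-pS (envMap Q ω) m) := mul_pos hl (Real.exp_pos _)
  have hS : pS (prev n (envMap Q ω)) n = Senv Q n ω := by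
    rw [pS_prev _ le_rfl, Nat.sub_self, pS_zero, sub_zero, pS_envMap]; rfl
  have hU : Uvec Q 1 lam m ω = (phiOne (lam * Real.exp (-pS (envMap Q ω) m)),
      Real.exp (-(lam * Real.exp (-pS (envMap Q ω) m))), pb K m (envMap Q ω)) := by
    rw [Uvec, bEnv_eq hx, mul_one, Senv, ← pS_envMap]; rfl
  have key : ∀ r, 0 ≤ r → r < 1 →
      omegaFun lam (Uvec Q 1 lam m ω) (Vtil Q m n r ω) (Senv Q n ω) =
      om lam (phiOne (lam * Real.exp (-pS (envMap Q ω) m)))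
        (Real.exp (-(lam * Real.exp (-pS (envMap Q ω) m)))) (pb K m (envMap Q ω))
        (rV r (pd K (n - m) (prev n (envMap Q ω)))) (Real.exp (pS (prev n (envMap Q ω)) n)) := by
    intro r h h'
    rw [hU, Vtil_eq hf hx hmn h h', hS]
    exact omegaFun_eq (phiOne_nonneg hy) (phiOne_le_one hy) (Real.exp_pos _).le
      (Real.exp_le_one_iff.mpr (by linarith)) (pb_nonneg _ _ _)
      (rV_pos h h' (pd_nonneg _ _ _)).le (rV_le_one h h' (pd_nonneg _ _ _))
  rw [key r₁ h₁ h₁', key r₂ h₂ h₂', Gfull, prev_prev]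

end transfer

section assembly

variable {μ : Measure Ω} {Q : ℕ → Ω → Measure ℕ}
  {ν : Measure (ℝ × ℝ)} [IsProbabilityMeasure ν] {K : ℝ}

/-- All the marks of the path lie in `[0, K]`. -/
def MarksIn (K : ℝ) (x : Path) : Prop := ∀ i, 0 ≤ (x i).2 ∧ (x i).2 ≤ K

lemma measurableSet_mark (K : ℝ) (i : ℕ) :
    MeasurableSet {x : Path | 0 ≤ (x i).2 ∧ (x i).2 ≤ K} :=
  (show Measurable fun x : Path => (x i).2 by fun_prop) measurableSet_Icc

lemma measurableSet_marksIn (K : ℝ) : MeasurableSet {x : Path | MarksIn K x} := by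
  unfold MarksIn
  simp only [ofPred_forall]
  exact MeasurableSet.iInter fun i => measurableSet_mark K i

lemma exists_ae_marksIn (hf : FracLinear Q) (hA : AssumptionA1 μ Q) :
    ∃ K : ℝ, 0 ≤ K ∧ ∀ᵐ ω ∂μ, MarksIn K (envMap Q ω) := by
  obtain ⟨χ, h0, -, h⟩ := hA
  refine ⟨χ⁻¹, by positivity, ae_all_iff.mpr fun i => ?_⟩
  filter_upwards [h (i + 1) (by omega)] with ω hω
  obtain ⟨-, h2, h3⟩ := hω
  refine ⟨h0.le.trans h3, ?_⟩
  have e := hf (i + 1) (by omega) ω 0 le_rfl one_pos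
  have h4 : (1 - pgf Q (i + 1) ω 0)⁻¹ ≤ χ⁻¹ := inv_anti₀ h0 (by linarith)
  have h5 := Real.exp_pos (-(Xenv Q (i + 1) ω))
  simp only [sub_zero, div_one] at e
  change etaEnv Q (i + 1) ω ≤ χ⁻¹
  linarith

lemma ae_marksIn_of_ind {P : Measure Path}
    (h : ∀ i, ∫⁻ x, ind (¬(0 ≤ (x i).2 ∧ (x i).2 ≤ K)) ∂P = 0) : ∀ᵐ x ∂P, MarksIn K x := by
  refine ae_all_iff.mpr fun i => ?_
  have := (lintegral_eq_zero_iff (measurable_ind (measurableSet_mark K i).compl)).mp (h i)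
  filter_upwards [this] with x hx
  by_contra hcon
  have hx' : ind (¬(0 ≤ (x i).2 ∧ (x i).2 ≤ K)) = 0 := hx
  rw [ind_pos hcon] at hx'
  exact one_ne_zero hx'

lemma ind_mark_local (K : ℝ) (i : ℕ) (a a' : Path) (h : ∀ j < i + 1, a j = a' j) :
    ind (¬(0 ≤ (a i).2 ∧ (a i).2 ≤ K)) = ind (¬(0 ≤ (a' i).2 ∧ (a' i).2 ≤ K)) := by
  rw [h i (by omega)]

omit [IsProbabilityMeasure ν] in
lemma IsHMinus.ae_marksIn {P : Measure Path} (h : IsHMinus ν P)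
    (hν : ∀ᵐ x ∂(pathLaw ν), MarksIn K x) : ∀ᵐ x ∂P, MarksIn K x := by
  refine ae_marksIn_of_ind fun i => ?_
  rw [h.2 (i + 1) (by omega) (fun x => ind (¬(0 ≤ (x i).2 ∧ (x i).2 ≤ K)))
    (measurable_ind (measurableSet_mark K i).compl)
    (fun x => (ind_le_one _).trans one_le_two) (ind_mark_local K i)]
  refine (lintegral_congr_ae ?_).trans lintegral_zero
  filter_upwards [hν] with x hx
  rw [ind_neg (p := ¬_) (not_not.mpr (hx i)), zero_mul, mul_zero]

lemma IsHPlus.ae_marksIn {P : ℝ → Measure Path} (h : IsHPlus ν P)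
    (hν : ∀ᵐ x ∂(pathLaw ν), MarksIn K x) {z : ℝ} (hz : 0 ≤ z) : ∀ᵐ x ∂(P z), MarksIn K x := by
  have : IsProbabilityMeasure (ν.map Prod.fst) :=
    Measure.isProbabilityMeasure_map measurable_fst.aemeasurable
  refine ae_marksIn_of_ind fun i => ?_
  have h1 := (h z hz).2 (i + 1) (fun x => ind (¬(0 ≤ (x i).2 ∧ (x i).2 ≤ K)))
    (measurable_ind (measurableSet_mark K i).compl)
    (fun x => (ind_le_one _).trans one_le_two) (ind_mark_local K i)
  have h2 : ∫⁻ x, ind (posP (i + 1) z x) * (ind (¬(0 ≤ (x i).2 ∧ (x i).2 ≤ K)) *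
      uE (ν.map Prod.fst) (z + pS x (i + 1))) ∂(pathLaw ν) = 0 := by
    refine (lintegral_congr_ae ?_).trans lintegral_zero
    filter_upwards [hν] with x hx
    rw [ind_neg (p := ¬_) (not_not.mpr (hx i)), zero_mul, mul_zero]
  rw [h2] at h1
  exact (mul_eq_zero.mp h1).resolve_left (one_pos.trans_le (one_le_uE hz)).ne'

lemma measurableSet_tau (hQ : ∀ i, Measurable (Q i)) (n : ℕ) :
    MeasurableSet {ω | tauWalk (Xenv Q) n ω = n} := by
  simp only [tauWalk_envMap_iff]
  exact measurable_envMap hQ (measurableSet_left measurableSet_Iio n)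

lemma setLIntegral_tau (hQ : ∀ i, Measurable (Q i)) (hν : μ.map (envMap Q) = pathLaw ν)
    {F : Path → ENNReal} (hF : Measurable F) (n : ℕ) :
    ∫⁻ ω in {ω | tauWalk (Xenv Q) n ω = n}, F (envMap Q ω) ∂μ =
      ∫⁻ x, ind (stay (Iio 0) n x) * F (prev n x) ∂(pathLaw ν) := by
  have mG : Measurable fun x : Path => ind (∀ i < n, pS x n - pS x i ∈ Iio 0) * F x :=
    (measurable_ind (measurableSet_left measurableSet_Iio n)).mul hF
  rw [← lintegral_ind_mul μ (measurableSet_tau hQ n)]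
  simp only [tauWalk_envMap_iff]
  rw [← lintegral_map mG (measurable_envMap hQ), hν, ← lintegral_prev n mG]
  simp only [stay_prev]

lemma setIntegral_tau (hQ : ∀ i, Measurable (Q i)) (hν : μ.map (envMap Q) = pathLaw ν)
    {f : Ω → ℝ} {g : Path → ℝ} (hg : Measurable g) (hg0 : ∀ x, 0 ≤ g x)
    (hfg : ∀ᵐ ω ∂μ, f ω = g (envMap Q ω)) (n : ℕ) :
    ∫ ω in {ω | tauWalk (Xenv Q) n ω = n}, f ω ∂μ =
      (∫⁻ x, ind (stay (Iio 0) n x) * ENNReal.ofReal (g (prev n x)) ∂(pathLaw ν)).toReal := by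
  rw [integral_congr_ae (ae_restrict_of_ae hfg), integral_eq_lintegral_of_nonneg_ae
    (.of_forall fun ω => hg0 _) (hg.comp (measurable_envMap hQ)).aestronglyMeasurable,
    ← setLIntegral_tau hQ hν hg.ennreal_ofReal]

lemma setIntegral_exp_tau (hQ : ∀ i, Measurable (Q i)) (hν : μ.map (envMap Q) = pathLaw ν)
    (n : ℕ) : ∫ ω in {ω | tauWalk (Xenv Q) n ω = n}, Real.exp (Senv Q n ω) ∂μ =
      kmgf (ν.map Prod.fst) (Iio 0) 1 n := by
  have mg : Measurable fun x : Path => Real.exp (pS x n) := by fun_prop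
  rw [setIntegral_tau hQ hν (g := fun x => Real.exp (pS x n)) mg (fun x => (Real.exp_pos _).le)
    (.of_forall fun ω => by rw [pS_envMap]; rfl), ← ENNReal.toReal_ofReal (kmgf_nonneg 1 n),
    ← lintegral_stay_exp one_pos]
  simp only [pS_prev _ le_rfl, Nat.sub_self, pS_zero, sub_zero, one_mul]

lemma setIntegral_omega_tau (hf : FracLinear Q) (hQ : ∀ i, Measurable (Q i))
    (hν : μ.map (envMap Q) = pathLaw ν) (hμ : ∀ᵐ ω ∂μ, MarksIn K (envMap Q ω)) {m n : ℕ}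
    (hmn : m ≤ n) {lam r₁ r₂ : ℝ} (hl : 0 < lam) (h₁ : 0 ≤ r₁) (h₁' : r₁ < 1) (h₂ : 0 ≤ r₂)
    (h₂' : r₂ < 1) :
    ∫ ω in {ω | tauWalk (Xenv Q) n ω = n},
      (omegaFun lam (Uvec Q 1 lam m ω) (Vtil Q m n r₁ ω) (Senv Q n ω) *
        omegaFun lam (Uvec Q 1 lam m ω) (Vtil Q m n r₂ ω) (Senv Q n ω)) *
        Real.exp (Senv Q n ω) ∂μ =
      (∫⁻ x, ind (stay (Iio 0) n x) *
        ENNReal.ofReal (Real.exp (pS x n) * Gfull K lam r₁ r₂ m n x) ∂(pathLaw ν)).toReal := by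
  have mg : Measurable fun x : Path =>
      Real.exp (pS x n) * Gfull K lam r₁ r₂ m n (prev n x) :=
    (Real.measurable_exp.comp (measurable_pS n)).mul
      ((measurable_Gfull K lam r₁ r₂ m n).comp (measurable_prev n))
  rw [setIntegral_tau hQ hν mg
    (fun x => mul_nonneg (Real.exp_pos _).le (Gfull_mem hl h₁ h₁' h₂ h₂' m n _).1)]
  · simp only [pS_prev _ le_rfl, Nat.sub_self, pS_zero, sub_zero, prev_prev]
  · filter_upwards [hμ] with ω hω
    rw [omegaFun_mul_eq_Gfull hf hω hmn hl h₁ h₁' h₂ h₂', pS_envMap, mul_comm]; rfl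

omit [MeasurableSpace Ω] in
lemma Bplus_eq {ω : Ω} (hx : MarksIn K (envMap Q ω)) : Bplus Q ω = pbInf K (envMap Q ω) := by
  refine tsum_congr fun i => ?_
  rw [cl_eq (hx i).1 (hx i).2, pS_envMap]; rfl

omit [MeasurableSpace Ω] in
lemma Vinf_eq {ω : Ω} (hx : MarksIn K (envMap Q ω)) (r : ℝ) :
    Vinf Q r ω = rV r (pdInf K (envMap Q ω)) := by
  have : Bminus Q ω = pdInf K (envMap Q ω) := by
    refine tsum_congr fun i => ?_
    rw [cl_eq (hx i).1 (hx i).2, pS_envMap]; rfl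
  rw [Vinf, this, rV]

omit [MeasurableSpace Ω] in
lemma omegaStar_mul_eq_PsiInf {ω₁ ω₂ : Ω} (hx₁ : MarksIn K (envMap Q ω₁))
    (hx₂ : MarksIn K (envMap Q ω₂)) {lam r₁ r₂ : ℝ} (h₁ : 0 ≤ r₁) (h₁' : r₁ < 1) (h₂ : 0 ≤ r₂)
    (h₂' : r₂ < 1) (z : ℝ) :
    omegaStar lam (Bplus Q ω₁) (Vinf Q r₁ ω₂) (-z) *
      omegaStar lam (Bplus Q ω₁) (Vinf Q r₂ ω₂) (-z) =
      PsiInf K lam r₁ r₂ (envMap Q ω₂) (envMap Q ω₁) z := by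
  have key : ∀ r, 0 ≤ r → r < 1 → omegaStar lam (Bplus Q ω₁) (Vinf Q r ω₂) (-z) =
      om lam 1 1 (pbInf K (envMap Q ω₁)) (rV r (pdInf K (envMap Q ω₂))) (Real.exp (-z)) := by
    intro r h h'
    rw [Bplus_eq hx₁, Vinf_eq hx₂]
    exact omegaStar_eq (pbInf_nonneg _ _) (rV_pos h h' (pdInf_nonneg _ _)).le
      (rV_le_one h h' (pdInf_nonneg _ _))
  rw [key r₁ h₁ h₁', key r₂ h₂ h₂', PsiInf]

lemma measurable_PsiInf_swap (K lam r₁ r₂ z : ℝ) :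
    Measurable fun p : Path × Path => PsiInf K lam r₁ r₂ p.2 p.1 z := by
  have m1 : Measurable fun p : Path × Path => pbInf K p.1 :=
    (measurable_pbInf K).comp measurable_fst
  have m2 : Measurable fun p : Path × Path => pdInf K p.2 :=
    (measurable_pdInf K).comp measurable_snd
  unfold PsiInf om rV
  fun_prop

lemma measurable_ofReal_PsiInf (K lam r₁ r₂ z : ℝ) :
    Measurable fun p : Path × Path => ENNReal.ofReal (PsiInf K lam r₁ r₂ p.2 p.1 z) :=
  (measurable_PsiInf_swap K lam r₁ r₂ z).ennreal_ofReal

lemma measurable_PsiInf_left (K lam r₁ r₂ z : ℝ) (b : Path) :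
    Measurable fun a : Path => PsiInf K lam r₁ r₂ a b z := by
  unfold PsiInf om rV
  fun_prop

lemma integral_integral_omegaStar (hQ : ∀ i, Measurable (Q i)) {P₁ P₂ : Measure Ω}
    [IsProbabilityMeasure P₁] [IsProbabilityMeasure P₂]
    (hx₁ : ∀ᵐ ω ∂P₁, MarksIn K (envMap Q ω)) (hx₂ : ∀ᵐ ω ∂P₂, MarksIn K (envMap Q ω))
    {lam r₁ r₂ : ℝ} (hl : 0 ≤ lam) (h₁ : 0 ≤ r₁) (h₁' : r₁ < 1) (h₂ : 0 ≤ r₂) (h₂' : r₂ < 1)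
    (z : ℝ) :
    ∫ ω₁, (∫ ω₂, omegaStar lam (Bplus Q ω₁) (Vinf Q r₁ ω₂) (-z) *
      omegaStar lam (Bplus Q ω₁) (Vinf Q r₂ ω₂) (-z) ∂P₂) ∂P₁ =
      (∫⁻ b, ∫⁻ a, ENNReal.ofReal (PsiInf K lam r₁ r₂ a b z) ∂(P₂.map (envMap Q))
        ∂(P₁.map (envMap Q))).toReal := by
  have hE := measurable_envMap hQ
  have : IsProbabilityMeasure (P₂.map (envMap Q)) :=
    Measure.isProbabilityMeasure_map hE.aemeasurable
  have mJ : Measurable fun b => ∫⁻ a, ENNReal.ofReal (PsiInf K lam r₁ r₂ a b z)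
      ∂(P₂.map (envMap Q)) := (measurable_ofReal_PsiInf K lam r₁ r₂ z).lintegral_prod_right'
  have mΨ' := fun b => measurable_PsiInf_left K lam r₁ r₂ z b
  have mΨ := fun b => (mΨ' b).ennreal_ofReal
  have hfin : ∀ b, ∫⁻ a, ENNReal.ofReal (PsiInf K lam r₁ r₂ a b z) ∂(P₂.map (envMap Q)) ≠ ⊤ :=
    fun b => ne_top_of_le_ne_top ENNReal.one_ne_top (lintegral_le_one_of_le fun a => by
      simpa using ENNReal.ofReal_le_ofReal (PsiInf_le_one (K := K) hl h₁ h₁' h₂ h₂' a b z))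
  have inner : ∀ᵐ ω₁ ∂P₁, (∫ ω₂, omegaStar lam (Bplus Q ω₁) (Vinf Q r₁ ω₂) (-z) *
      omegaStar lam (Bplus Q ω₁) (Vinf Q r₂ ω₂) (-z) ∂P₂) =
      (∫⁻ a, ENNReal.ofReal (PsiInf K lam r₁ r₂ a (envMap Q ω₁) z)
        ∂(P₂.map (envMap Q))).toReal := by
    filter_upwards [hx₁] with ω₁ hω₁
    rw [lintegral_map (mΨ _) hE, ← integral_eq_lintegral_of_nonneg_ae
      (.of_forall fun ω => PsiInf_nonneg hl h₁ h₁' h₂ h₂' _ _ _)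
      ((mΨ' _).comp hE).aestronglyMeasurable]
    refine integral_congr_ae ?_
    filter_upwards [hx₂] with ω₂ hω₂
    exact omegaStar_mul_eq_PsiInf hω₁ hω₂ h₁ h₁' h₂ h₂' z
  rw [integral_congr_ae inner, lintegral_map mJ hE, integral_toReal]
  · exact (mJ.comp hE).aemeasurable
  · exact .of_forall fun ω => (hfin _).lt_top

end assembly

section conclusion

variable {μ : Measure Ω} {Q : ℕ → Ω → Measure ℕ}
  {ν : Measure (ℝ × ℝ)} [IsProbabilityMeasure ν] {K κ : ℝ}

lemma integral_exp_mul_uFun [IsProbabilityMeasure μ] (h : KilledAsymp (ν.map Prod.fst) κ)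
    (hQ : ∀ i, Measurable (Q i)) (hν : μ.map (envMap Q) = pathLaw ν) :
    ∫ z in Ioi (0 : ℝ), Real.exp (-z) * uFun μ (Xenv Q) z =
      ∑' j, kmgf (ν.map Prod.fst) (Iio 0) 1 j := by
  have : IsProbabilityMeasure (ν.map Prod.fst) :=
    Measure.isProbabilityMeasure_map measurable_fst.aemeasurable
  have mF : Measurable fun z : ℝ => ENNReal.ofReal (Real.exp (-1 * z)) * uE (ν.map Prod.fst) z :=
    (show Measurable fun z : ℝ => ENNReal.ofReal (Real.exp (-1 * z)) by fun_prop).mul measurable_uE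
  rw [setIntegral_congr_fun (g := fun z => (ENNReal.ofReal (Real.exp (-1 * z)) *
      uE (ν.map Prod.fst) z).toReal) measurableSet_Ioi, integral_toReal mF.aemeasurable,
    lintegral_exp_mul_uE h one_pos, inv_one, one_mul, ENNReal.toReal_ofReal]
  · exact tsum_nonneg fun n => kmgf_nonneg _ _
  · exact .of_forall fun z => ENNReal.mul_lt_top ENNReal.ofReal_lt_top (uE_lt_top h z)
  · intro z (hz : 0 < z)
    simp only [uFun_eq h hQ hν hz.le, ENNReal.toReal_mul, neg_one_mul,
      ENNReal.toReal_ofReal (Real.exp_pos (-z)).le]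

lemma integral_limU [IsProbabilityMeasure μ] (h : KilledAsymp (ν.map Prod.fst) κ)
    (hQ : ∀ i, Measurable (Q i)) (hν : μ.map (envMap Q) = pathLaw ν) {Pp : ℝ → Measure Path}
    {Pm : Measure Path} (hp : IsHPlus ν Pp) (hm : IsHMinus ν Pm) (hK : 0 ≤ K)
    {lam r₁ r₂ : ℝ} (hl : 0 ≤ lam) (h₁ : 0 ≤ r₁) (h₁' : r₁ < 1) (h₂ : 0 ≤ r₂) (h₂' : r₂ < 1)
    (c : ℝ) {J : ℝ → ℝ} (hJ : ∀ z, 0 ≤ z → J z =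
      (∫⁻ b, ∫⁻ a, ENNReal.ofReal (PsiInf K lam r₁ r₂ a b z) ∂Pm ∂(Pp z)).toReal) :
    ∫ z in Ici (0 : ℝ), (c * Real.exp (-z) * uFun μ (Xenv Q) z) * J z =
      c * (∫⁻ z in Ioi 0, ENNReal.ofReal (Real.exp (-z)) *
        limU ν K lam r₁ r₂ Pp Pm z).toReal := by
  have : IsProbabilityMeasure (ν.map Prod.fst) :=
    Measure.isProbabilityMeasure_map measurable_fst.aemeasurable
  have mF : AEMeasurable (fun z : ℝ => ENNReal.ofReal (Real.exp (-z)) *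
      limU ν K lam r₁ r₂ Pp Pm z) (volume.restrict (Ioi 0)) :=
    (show Measurable fun z : ℝ => ENNReal.ofReal (Real.exp (-z)) by fun_prop).aemeasurable.mul
      (aemeasurable_limU h hp hm hK hl h₁ h₁' h₂ h₂')
  rw [integral_Ici_eq_integral_Ioi, setIntegral_congr_fun (g := fun z =>
      c * (ENNReal.ofReal (Real.exp (-z)) * limU ν K lam r₁ r₂ Pp Pm z).toReal) measurableSet_Ioi,
    integral_const_mul, integral_toReal mF]
  · filter_upwards [ae_restrict_mem measurableSet_Ioi] with z hz
    exact ENNReal.mul_lt_top ENNReal.ofReal_lt_top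
      ((limU_le (fun z hz => (hp z hz).1) hm.1 hl h₁ h₁' h₂ h₂' (mem_Ioi.mp hz).le).trans_lt
        (uE_lt_top h z))
  · intro z (hz : 0 < z)
    simp only [uFun_eq h hQ hν hz.le, hJ z hz.le, ENNReal.toReal_mul, limU,
      ENNReal.toReal_ofReal (Real.exp_pos (-z)).le]
    ring

lemma lintegral_limU_ne_top (h : KilledAsymp (ν.map Prod.fst) κ) {Pp : ℝ → Measure Path}
    {Pm : Measure Path} (hp : IsHPlus ν Pp) (hm : IsHMinus ν Pm)
    {lam r₁ r₂ : ℝ} (hl : 0 ≤ lam) (h₁ : 0 ≤ r₁) (h₁' : r₁ < 1) (h₂ : 0 ≤ r₂) (h₂' : r₂ < 1) :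
    ∫⁻ z in Ioi 0, ENNReal.ofReal (Real.exp (-z)) * limU ν K lam r₁ r₂ Pp Pm z ≠ ⊤ := by
  have : IsProbabilityMeasure (ν.map Prod.fst) :=
    Measure.isProbabilityMeasure_map measurable_fst.aemeasurable
  refine ne_top_of_le_ne_top (ENNReal.ofReal_ne_top
    (r := (1 : ℝ)⁻¹ * ∑' j, kmgf (ν.map Prod.fst) (Iio 0) 1 j)) ?_
  rw [← lintegral_exp_mul_uE h one_pos]
  refine setLIntegral_mono' measurableSet_Ioi fun z hz => ?_
  rw [neg_one_mul]
  gcongr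
  exact limU_le (fun z hz => (hp z hz).1) hm.1 hl h₁ h₁' h₂ h₂' (mem_Ioi.mp hz).le

lemma tendsto_floor_mul {t : ℝ} (ht : 0 < t) :
    Tendsto (fun n : ℕ => ⌊(n : ℝ) * t⌋₊) atTop atTop :=
  tendsto_nat_floor_atTop.comp (tendsto_natCast_atTop_atTop.atTop_mul_const ht)

lemma floor_mul_le {t : ℝ} (ht : t ≤ 1) (n : ℕ) : ⌊(n : ℝ) * t⌋₊ ≤ n :=
  Nat.floor_le_of_le (mul_le_of_le_one_right n.cast_nonneg ht)

lemma tendsto_sub_floor_mul {t : ℝ} (ht0 : 0 ≤ t) (ht : t < 1) :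
    Tendsto (fun n : ℕ => n - ⌊(n : ℝ) * t⌋₊) atTop atTop := by
  refine tendsto_natCast_atTop_iff (R := ℝ).mp ?_
  refine tendsto_atTop_mono (f := fun n : ℕ => (n : ℝ) * (1 - t)) (fun n => ?_)
    (tendsto_natCast_atTop_atTop.atTop_mul_const (by linarith))
  rw [Nat.cast_sub (floor_mul_le ht.le n)]
  have := Nat.floor_le (mul_nonneg (Nat.cast_nonneg (α := ℝ) n) ht0)
  linarith

/-- The data of the limit theorem for the conditioned walk carried by an environment. -/
lemma exists_killedAsymp_env [IsProbabilityMeasure μ] (hQ : ∀ i, Measurable (Q i))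
    (hA2 : AssumptionA2 μ Q) :
    ∃ κ, KilledAsymp ((μ.map fun ω => lawPair (Q 1 ω)).map Prod.fst) κ := by
  have mL : Measurable fun ω => lawPair (Q 1 ω) := measurable_lawPair.comp (hQ 1)
  have mX : Measurable (Xenv Q 1) := measurable_fst.comp mL
  have e : (μ.map fun ω => lawPair (Q 1 ω)).map Prod.fst = μ.map (Xenv Q 1) :=
    Measure.map_map measurable_fst mL
  rw [e]
  have := Measure.isProbabilityMeasure_map (μ := μ) mX.aemeasurable
  obtain ⟨-, h0, -, hv, hnl⟩ := hA2
  refine exists_killedAsymp ?_ ?_ hnl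
  · rwa [integral_map mX.aemeasurable (by fun_prop)]
  · rwa [integral_map mX.aemeasurable (by fun_prop)]

end conclusion

/-- **Lemma `LLright`.** Under A1–A4, for `t ∈ (0,1)`, `0 ≤ r₂ < r₁ < 1` and `λ > 0`:
`E[Ω(λ; U_{⌊nt⌋}, Ṽ_{⌊nt⌋}(r₁,r₂), S_n) e^{S_n}; τ(n) = n] / E[e^{S_n}; τ(n) = n]
  → ⨌ Ω*(λ; u, v, -z) P_z⁺(B⁺ ∈ du) P⁻(V_∞(r₁,r₂) ∈ dv) μ₁(dz)`. -/
theorem statement16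
    {Ω : Type*} [MeasurableSpace Ω] (μ : Measure Ω) [IsProbabilityMeasure μ]
    (Q : ℕ → Ω → Measure ℕ) (hQprob : ∀ n ω, IsProbabilityMeasure (Q n ω))
    (hiid : IIDseq μ Q) (hfrac : FracLinear Q)
    (hA1 : AssumptionA1 μ Q) (hA2 : AssumptionA2 μ Q) (hA3 : AssumptionA3 μ Q)
    (c : ℕ → ℝ) (hA4 : AssumptionA4 μ (Xenv Q) c)
    (Pp : ℝ → Measure Ω)
    (hPp : ∀ x : ℝ, 0 ≤ x → IsPplus μ (Xenv Q) (envFiltration Q) x (Pp x))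
    (Pm0 : Measure Ω) (hPm0 : IsPminus μ (Xenv Q) (envFiltration Q) 0 Pm0)
    (t : ℝ) (ht0 : 0 < t) (ht1 : t < 1)
    (r₁ r₂ : ℝ) (hr2 : 0 ≤ r₂) (hr21 : r₂ < r₁) (hr1 : r₁ < 1)
    (lam : ℝ) (hlam : 0 < lam) :
    Tendsto (fun n : ℕ =>
        (∫ ω in {ω | tauWalk (Xenv Q) n ω = n},
            (omegaFun lam (Uvec Q 1 lam ⌊(n : ℝ) * t⌋₊ ω)
                (Vtil Q ⌊(n : ℝ) * t⌋₊ n r₁ ω) (Senv Q n ω) *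
              omegaFun lam (Uvec Q 1 lam ⌊(n : ℝ) * t⌋₊ ω)
                (Vtil Q ⌊(n : ℝ) * t⌋₊ n r₂ ω) (Senv Q n ω)) *
              Real.exp (Senv Q n ω) ∂μ) /
          ∫ ω in {ω | tauWalk (Xenv Q) n ω = n}, Real.exp (Senv Q n ω) ∂μ)
      atTop (𝓝 (∫ z in Set.Ici (0 : ℝ),
        ((∫ z' in Set.Ioi (0 : ℝ), Real.exp (-z') * uFun μ (Xenv Q) z')⁻¹ *
            Real.exp (-z) * uFun μ (Xenv Q) z) *
          ∫ ω₁, (∫ ω₂,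
              omegaStar lam (Bplus Q ω₁) (Vinf Q r₁ ω₂) (-z) *
                omegaStar lam (Bplus Q ω₁) (Vinf Q r₂ ω₂) (-z)
            ∂Pm0) ∂(Pp z))) := by
  have hQ : ∀ i, Measurable (Q i) := hiid.1
  obtain ⟨κ, h⟩ := exists_killedAsymp_env hQ hA2
  have hν := map_envMap hiid
  have mL : Measurable fun ω => lawPair (Q 1 ω) := measurable_lawPair.comp (hQ 1)
  have := Measure.isProbabilityMeasure_map (μ := μ) mL.aemeasurable
  set ν := μ.map fun ω => lawPair (Q 1 ω)
  have hE := measurable_envMap hQ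
  have h₁ : 0 ≤ r₁ := hr2.trans hr21.le
  have h₂' : r₂ < 1 := hr21.trans hr1
  have hp := isHPlus_of_isPplus h hQ hν hPp
  have hm := isHMinus_of_isPminus h hQ hν hPm0
  obtain ⟨K, hK, hμ⟩ := exists_ae_marksIn hfrac hA1
  have hpath : ∀ᵐ x ∂(pathLaw ν), MarksIn K x := by
    rw [← hν]
    exact (ae_map_iff hE.aemeasurable (measurableSet_marksIn K)).mpr hμ
  have hxm : ∀ᵐ ω ∂Pm0, MarksIn K (envMap Q ω) :=
    ae_of_ae_map hE.aemeasurable (hm.ae_marksIn hpath)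
  have hxp : ∀ z, 0 ≤ z → ∀ᵐ ω ∂(Pp z), MarksIn K (envMap Q ω) := fun z hz =>
    ae_of_ae_map hE.aemeasurable (hp.ae_marksIn hpath hz)
  have := hPm0.1
  rw [integral_limU h hQ hν hp hm hK hlam.le h₁ hr1 hr2 h₂' _ fun z hz =>
    have := (hPp z hz).1
    integral_integral_omegaStar hQ (hxp z hz) hxm hlam.le h₁ hr1 hr2 h₂' z,
    integral_exp_mul_uFun h hQ hν]
  simp_rw [setIntegral_exp_tau hQ hν,
    fun n : ℕ => setIntegral_omega_tau hfrac hQ hν hμ (floor_mul_le ht1.le n) hlam h₁ hr1 hr2 h₂']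
  have hI := lintegral_limU_ne_top (K := K) h hp hm hlam.le h₁ hr1 hr2 h₂'
  have hnum := (ENNReal.tendsto_toReal (ENNReal.mul_ne_top ENNReal.ofReal_ne_top hI)).comp
    (tendsto_Gfull h hp hm hK hlam h₁ hr1 hr2 h₂' (tendsto_floor_mul ht0)
      (tendsto_sub_floor_mul ht0.le ht1))
  have hden := ((h.2 1 one_pos).1).2
  have : IsProbabilityMeasure (ν.map Prod.fst) :=
    Measure.isProbabilityMeasure_map measurable_fst.aemeasurable
  have hD : 0 < ∑' j, kmgf (ν.map Prod.fst) (Iio 0) 1 j :=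
    ((h.2 1 one_pos).1).1.tsum_pos (fun n => kmgf_nonneg _ _) 0 (by rw [kmgf_zero]; exact one_pos)
  have hκ := h.1
  have hlim := hnum.div hden (by positivity)
  rw [ENNReal.toReal_mul, ENNReal.toReal_ofReal hκ.le, div_one, mul_div_mul_left _ _ hκ.ne'] at hlim
  rw [inv_mul_eq_div]
  refine hlim.congr' ?_
  filter_upwards [eventually_ge_atTop 1] with n hn
  simp only [Pi.div_apply, Function.comp_apply, ENNReal.toReal_mul,
    ENNReal.toReal_ofReal (wt_nonneg n)]
  rw [mul_div_mul_left _ _ (wt_pos hn).ne']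

end BPREpaper
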